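/- Let K be a number field of degree at least 3. Then there are at most finitely many three times monogenic orders in K. -/

import Mathlib

open NumberField

/-- An order in a number field `K`: a subring of the ring of integers `𝓞 K`
whose quotient field equals `K`. -/
def IsOrder (K : Type*) [Field K] [NumberField K] (O : Subring (𝓞 K)) : Prop :=
  ∀ x : K, ∃ a ∈ O, ∃ b ∈ O, b ≠ 0 ∧
    x = algebraMap (𝓞 K) K a / algebraMap (𝓞 K) K b

/-- Two elements `α, β` of `𝓞 K` are ℤ-equivalent if `β = u * α + a` for some
`u ∈ {1, -1}` and `a ∈ ℤ`. -/
def ZEquiv (K : Type*) [Field K] [NumberField K] (α β : 𝓞 K) : Prop :=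
  ∃ u a : ℤ, (u = 1 ∨ u = -1) ∧ β = (u : 𝓞 K) * α + (a : 𝓞 K)

/-- An order `O` is `k` times monogenic if there are at least `k` pairwise
ℤ-inequivalent elements `α ∈ O` with `ℤ[α] = O`. -/
def TimesMonogenic (K : Type*) [Field K] [NumberField K] (k : ℕ) (O : Subring (𝓞 K)) : Prop :=
  ∃ f : Fin k → 𝓞 K, (∀ i j, i ≠ j → ¬ ZEquiv K (f i) (f j)) ∧
    ∀ i, Subring.closure {f i} = O

namespace TM
open MvPolynomial

/-- product of binomials -/
noncomputable def bin {σ : Type*} [Fintype σ] (n a : σ →₀ ℕ) : ℕ := ∏ i, (n i + a i).choose (a i)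

/-- Hasse derivative -/
noncomputable def hd {σ : Type*} [Fintype σ] {R : Type*} [CommRing R] (a : σ →₀ ℕ) :
    MvPolynomial σ R →ₗ[R] MvPolynomial σ R :=
  (basisMonomials σ R).constr R (fun s => if a ≤ s then monomial (s - a) ((bin (s - a) a : ℕ) : R) else 0)

lemma coeff_hd {σ : Type*} [Fintype σ] {R : Type*} [CommRing R] (a n : σ →₀ ℕ)
    (P : MvPolynomial σ R) : coeff n (hd a P) = (bin n a : ℕ) * coeff (n + a) P := by
  classical
  induction P using MvPolynomial.induction_on' with
  | monomial u c =>
    have h1 : (monomial u c : MvPolynomial σ R) = c • (basisMonomials σ R u) := by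
      simp [smul_monomial]
    rw [h1, map_smul, hd, Module.Basis.constr_basis]
    simp only [coeff_smul, coe_basisMonomials, coeff_monomial, smul_eq_mul]
    by_cases h : a ≤ u
    · simp only [h, if_true, coeff_monomial]
      have : u - a = n ↔ u = n + a := by
        constructor
        · intro h2; rw [← h2, tsub_add_cancel_of_le h]
        · intro h2; rw [h2]; simp
      by_cases h3 : u = n + a
      · subst h3; simp [mul_comm]
      · simp [this, h3]
    · have h3 : u ≠ n + a := by rintro rfl; exact h (by simp)
      simp [h, h3]
  | add p q hp hq => simp [hp, hq, mul_add]

lemma bin_zero {σ : Type*} [Fintype σ] (n : σ →₀ ℕ) : bin n 0 = 1 := by simp [bin]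


lemma bin_pascal {σ : Type*} [Fintype σ] [DecidableEq σ] (n a : σ →₀ ℕ) (i : σ) :
    bin (n + Finsupp.single i 1) (a + Finsupp.single i 1) =
      bin (n + Finsupp.single i 1) a + bin n (a + Finsupp.single i 1) := by
  unfold bin
  rw [← Finset.mul_prod_erase _ _ (Finset.mem_univ i), ← Finset.mul_prod_erase _ _ (Finset.mem_univ i),
    ← Finset.mul_prod_erase _ (fun x => _) (Finset.mem_univ i)]
  have e : ∀ j ∈ Finset.univ.erase i, (Finsupp.single i 1 : σ →₀ ℕ) j = 0 := by
    intro j hj; simp at hj; simp [Finsupp.single_apply, Ne.symm hj]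
  have h1 : ∀ (f g : σ →₀ ℕ), ∏ x ∈ Finset.univ.erase i, ((f + Finsupp.single i 1 : σ →₀ ℕ) x + (g + Finsupp.single i 1 : σ →₀ ℕ) x).choose ((g + Finsupp.single i 1 : σ →₀ ℕ) x) = ∏ x ∈ Finset.univ.erase i, (f x + g x).choose (g x) := by
    intro f g; exact Finset.prod_congr rfl (fun j hj => by simp [e j hj])
  have h2 : ∀ (f g : σ →₀ ℕ), ∏ x ∈ Finset.univ.erase i, ((f + Finsupp.single i 1 : σ →₀ ℕ) x + g x).choose (g x) = ∏ x ∈ Finset.univ.erase i, (f x + g x).choose (g x) := by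
    intro f g; exact Finset.prod_congr rfl (fun j hj => by simp [e j hj])
  have h3 : ∀ (f g : σ →₀ ℕ), ∏ x ∈ Finset.univ.erase i, (f x + (g + Finsupp.single i 1 : σ →₀ ℕ) x).choose ((g + Finsupp.single i 1 : σ →₀ ℕ) x) = ∏ x ∈ Finset.univ.erase i, (f x + g x).choose (g x) := by
    intro f g; exact Finset.prod_congr rfl (fun j hj => by simp [e j hj])
  rw [h1, h2, h3, ← add_mul]
  congr 1
  simp only [Finsupp.add_apply, Finsupp.single_eq_same]
  rw [show n i + 1 + (a i + 1) = (n i + 1 + a i) + 1 by ring, Nat.choose_succ_succ]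
  congr 2
  ring

lemma hd_mul_X_succ {σ : Type*} [Fintype σ] [DecidableEq σ] {R : Type*} [CommRing R] (a : σ →₀ ℕ) (i : σ)
    (P : MvPolynomial σ R) : hd (a + Finsupp.single i 1) (P * X i) =
      hd a P + hd (a + Finsupp.single i 1) P * X i := by
  ext n
  rw [coeff_hd, coeff_add, coeff_hd, ← add_assoc, coeff_mul_X, coeff_mul_X']
  by_cases h : i ∈ n.support
  · rw [if_pos h, coeff_hd]
    obtain ⟨n', rfl⟩ : ∃ n', n = n' + Finsupp.single i 1 := by
      refine ⟨n - Finsupp.single i 1, ?_⟩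
      rw [tsub_add_cancel_of_le]
      simp at h ⊢; omega
    rw [bin_pascal]
    simp
    rw [show n' + Finsupp.single i 1 + a = n' + (a + Finsupp.single i 1) by abel]
    ring
  · rw [if_neg h, add_zero]
    congr 2
    unfold bin
    apply Finset.prod_congr rfl
    intro j _
    simp at h
    by_cases hj : j = i
    · subst hj; simp [h]
    · simp [Finsupp.single_apply, Ne.symm hj]

lemma hd_mul_X_zero {σ : Type*} [Fintype σ] [DecidableEq σ] {R : Type*} [CommRing R] (a : σ →₀ ℕ) (i : σ)
    (ha : a i = 0) (P : MvPolynomial σ R) : hd a (P * X i) = hd a P * X i := by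
  ext n
  rw [coeff_hd, coeff_mul_X', coeff_mul_X']
  by_cases h : i ∈ n.support
  · rw [if_pos h, coeff_hd, if_pos (by simp at h ⊢; omega)]
    obtain ⟨n', rfl⟩ : ∃ n', n = n' + Finsupp.single i 1 := by
      refine ⟨n - Finsupp.single i 1, ?_⟩
      rw [tsub_add_cancel_of_le]
      simp at h ⊢; omega
    rw [show n' + Finsupp.single i 1 + a = (n' + a) + Finsupp.single i 1 by abel]
    simp only [add_tsub_cancel_right]
    congr 2
    unfold bin
    apply Finset.prod_congr rfl
    intro j _
    by_cases hj : j = i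
    · subst hj; simp [ha]
    · simp [Finsupp.single_apply, Ne.symm hj]
  · rw [if_neg h, if_neg (by simp at h ⊢; omega), mul_zero]

/-- Taylor expansion -/
noncomputable def tay {σ : Type*} {R : Type*} [CommRing R] :
    MvPolynomial σ R →ₐ[R] MvPolynomial σ (MvPolynomial σ R) :=
  aeval (fun i => X i + C (X i))

lemma coeff_tay {σ : Type*} [Fintype σ] {R : Type*} [CommRing R] (a : σ →₀ ℕ)
    (P : MvPolynomial σ R) : coeff a (tay P) = hd a P := by
  classical
  induction P using MvPolynomial.induction_on generalizing a with
  | C c =>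
    ext n
    rw [coeff_hd]
    have : tay (C c : MvPolynomial σ R) = C (C c) := by
      simp [tay, MvPolynomial.algebraMap_eq]
    rw [this, coeff_C, coeff_C]
    by_cases ha : a = 0
    · subst ha; simp [bin_zero, coeff_C]
    · have : (0 : σ →₀ ℕ) ≠ n + a := fun h => ha (by
        ext i; have := DFunLike.congr_fun h i; simp at this ⊢; omega)
      simp [Ne.symm ha, this]
  | add p q hp hq => simp [hp, hq]
  | mul_X p i hp =>
    rw [map_mul, show tay (X i : MvPolynomial σ R) = X i + C (X i) by simp [tay], mul_add, coeff_add,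
      mul_comm (tay p) (C _), coeff_C_mul, hp]
    by_cases ha : a i = 0
    · rw [coeff_mul_X', if_neg (by simp [ha]), hd_mul_X_zero _ _ ha, zero_add, mul_comm]
    · obtain ⟨a', rfl⟩ : ∃ n', a = n' + Finsupp.single i 1 := by
        refine ⟨a - Finsupp.single i 1, ?_⟩
        rw [tsub_add_cancel_of_le]
        simp; omega
      rw [coeff_mul_X, hp, hd_mul_X_succ, mul_comm (X i)]

/-- translation -/
noncomputable def tr {σ : Type*} {R : Type*} [CommRing R] (β : σ → R) :
    MvPolynomial σ R →ₐ[R] MvPolynomial σ R := aeval (fun i => X i + C (β i))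

lemma tr_hd {σ : Type*} [Fintype σ] {R : Type*} [CommRing R] (β : σ → R) (a : σ →₀ ℕ)
    (P : MvPolynomial σ R) : tr β (hd a P) = hd a (tr β P) := by
  rw [← coeff_tay, ← coeff_tay]
  have : (tay (R := R)).comp (tr β) = (mapAlgHom (tr β)).comp tay := by
    apply MvPolynomial.algHom_ext
    intro i
    simp [tay, tr, MvPolynomial.algebraMap_eq, add_assoc]
  have h2 := DFunLike.congr_fun this P
  simp only [AlgHom.comp_apply] at h2
  rw [h2]
  simp [coeff_map]

lemma eval_hd {σ : Type*} [Fintype σ] {R : Type*} [CommRing R] (β : σ → R) (a : σ →₀ ℕ)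
    (P : MvPolynomial σ R) : eval β (hd a P) = coeff a (tr β P) := by
  rw [← coeff_tay]
  have : ((mapAlgHom (aeval β : MvPolynomial σ R →ₐ[R] R)).comp tay) = tr β := by
    apply MvPolynomial.algHom_ext
    intro i
    simp [tay, tr]
  rw [← this]
  simp [coeff_map, coe_aeval_eq_eval]

lemma tr_neg_tr {σ : Type*} {R : Type*} [CommRing R] (β : σ → R) (P : MvPolynomial σ R) :
    tr (fun i => - β i) (tr β P) = P := by
  have : (tr (fun i => - β i)).comp (tr β) = AlgHom.id R _ := by
    apply MvPolynomial.algHom_ext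
    intro i
    simp [tr, MvPolynomial.algebraMap_eq]
  exact DFunLike.congr_fun this P

lemma tr_injective {σ : Type*} {R : Type*} [CommRing R] (β : σ → R) :
    Function.Injective (tr β) := Function.LeftInverse.injective (tr_neg_tr β)

lemma pderiv_hd {σ : Type*} [Fintype σ] {R : Type*} [CommRing R] (i : σ) (a : σ →₀ ℕ)
    (P : MvPolynomial σ R) : pderiv i (hd a P) = ((a i + 1 : ℕ) : R) • hd (a + Finsupp.single i 1) P := by
  classical
  ext n
  rw [coeff_pderiv, coeff_hd, coeff_smul, coeff_hd, smul_eq_mul]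
  rw [show n + Finsupp.single i 1 + a = n + (a + Finsupp.single i 1) by abel]
  have : bin (n + Finsupp.single i 1) a * (n i + 1) = (a i + 1) * bin n (a + Finsupp.single i 1) := by
    unfold bin
    rw [← Finset.mul_prod_erase _ _ (Finset.mem_univ i), ← Finset.mul_prod_erase _ (fun x => (n x + _).choose _) (Finset.mem_univ i)]
    have : ∏ x ∈ Finset.univ.erase i, ((n + Finsupp.single i 1 : σ →₀ ℕ) x + a x).choose (a x) = ∏ x ∈ Finset.univ.erase i, (n x + (a + Finsupp.single i 1 : σ →₀ ℕ) x).choose ((a + Finsupp.single i 1 : σ →₀ ℕ) x) := by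
      apply Finset.prod_congr rfl
      intro j hj
      simp at hj
      simp [Finsupp.single_apply, Ne.symm hj]
    rw [this, mul_right_comm, ← mul_assoc]
    congr 1
    simp only [Finsupp.add_apply, Finsupp.single_eq_same]
    have := Nat.choose_succ_right_eq (n i + (a i + 1)) (a i)
    rw [mul_comm (a i + 1), this, show n i + (a i + 1) = n i + 1 + a i by ring]
    congr 1
    omega
  have h2 : ((bin (n + Finsupp.single i 1) a * (n i + 1) : ℕ) : R) = ((a i + 1) * bin n (a + Finsupp.single i 1) : ℕ) := by rw [this]
  push_cast at h2 ⊢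
  linear_combination coeff (n + (a + Finsupp.single i 1)) P * h2

end TM

namespace TM
open MvPolynomial

lemma exists_det_ne_zero_of_span {K : Type*} [Field K] {k : ℕ} {A : Type*} (w : A → Fin k → K) (S : Set A)
    (h : ∀ g : Fin k → K, (∀ a ∈ S, ∑ j, g j * w a j = 0) → g = 0) :
    ∃ a : Fin k → A, (∀ i, a i ∈ S) ∧ Matrix.det (Matrix.of (fun i j => w (a i) j)) ≠ 0 := by
  classical
  have hspan : Submodule.span K (w '' S) = ⊤ := by
    by_contra hne
    obtain ⟨f, hf0, hf⟩ := Submodule.exists_le_ker_of_lt_top _ (lt_top_iff_ne_top.2 hne)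
    apply hf0
    have hfe : ∀ x, f x = ∑ j, f (Pi.single j 1) * x j := by
      intro x
      conv_lhs => rw [← Finset.univ_sum_single x]
      rw [map_sum]
      refine Finset.sum_congr rfl (fun j _ => ?_)
      have : (Pi.single j (x j) : Fin k → K) = x j • Pi.single j 1 := by
        rw [← Pi.single_smul]; simp
      simp [this, mul_comm]
    have := h (fun j => f (Pi.single j 1)) (fun a ha => by
      rw [← hfe]
      exact hf (Submodule.subset_span ⟨a, ha, rfl⟩))
    ext x
    have h2 : f (Pi.single x 1) = 0 := congrFun this x
    simpa using h2
  obtain ⟨b, hb, hbs, hli⟩ := exists_linearIndependent K (w '' S)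
  rw [hspan] at hbs
  let B := Module.Basis.mk hli (by rw [Subtype.range_coe, hbs])
  haveI : Fintype b := FiniteDimensional.fintypeBasisIndex B
  have hc : Fintype.card b = k := by
    rw [← Module.finrank_eq_card_basis B]; simp
  let e : Fin k ≃ b := (Fintype.equivFinOfCardEq hc).symm
  choose a ha hwa using fun i => hb (e i).2
  refine ⟨a, ha, ?_⟩
  have hl2 : LinearIndependent K (fun i => w (a i)) := by
    have := hli.comp e e.injective
    have e3 : (fun i => w (a i)) = (Subtype.val ∘ e) := by ext i; simp [hwa]
    rw [e3]; exact this
  have := (Matrix.linearIndependent_rows_iff_isUnit (A := Matrix.of (fun i j => w (a i) j))).1 hl2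
  rw [Matrix.isUnit_iff_isUnit_det] at this
  exact this.ne_zero

lemma wronskian_abs {R : Type*} [CommRing R] [IsDomain R] [CharZero R] {k : ℕ} {A ι : Type*}
    (v : A → Fin k → R) (lev : A → ℕ) (D : ι → R →+ R)
    (hL : ∀ i x y, D i (x * y) = x * D i y + y * D i x)
    (h1 : ∀ a i, ∃ a', lev a' = lev a + 1 ∧ ∃ c : ℕ, ∀ j, D i (v a j) = (c : R) * v a' j)
    (h2 : ∀ a', 0 < lev a' → ∃ a i, lev a + 1 = lev a' ∧ ∃ c : ℕ, c ≠ 0 ∧ ∀ j, D i (v a j) = (c : R) * v a' j)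
    (h3 : ∀ g : Fin k → R, (∀ a, ∑ j, g j * v a j = 0) → g = 0) :
    ∃ a : Fin k → A, (∀ i, lev (a i) < k) ∧ Matrix.det (Matrix.of (fun i j => v (a i) j)) ≠ 0 := by
  classical
  let K := FractionRing R
  let Us : ℕ → (Fin k → R) → Prop := fun s g => ∀ a, lev a < s → ∑ j, g j * v a j = 0
  let Cl : ℕ → Prop := fun s => ∀ g, Us s g → Us (s+1) g
  have hCl : ∀ s, Cl s → Cl (s+1) := by
    intro s hs g hg
    have hD : ∀ i, Us (s+1) (fun j => D i (g j)) := by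
      intro i
      apply hs
      intro a ha
      obtain ⟨a', ha', c, hc⟩ := h1 a i
      have e1 := congrArg (D i) (hg a (by omega))
      have e2 := hg a' (by omega)
      simp only [map_sum, hL, map_zero, hc, Finset.sum_add_distrib] at e1
      have e3 : ∑ x, g x * ((c:R) * v a' x) = c * ∑ x, g x * v a' x := by
        rw [Finset.mul_sum]; exact Finset.sum_congr rfl (fun _ _ => by ring)
      rw [e3, e2, mul_zero, zero_add] at e1
      rw [← e1]
      exact Finset.sum_congr rfl (fun _ _ => by ring)
    intro a' ha'
    by_cases hl : lev a' < s + 1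
    · exact hg a' hl
    obtain ⟨a, i, hla, c, hc0, hc⟩ := h2 a' (by omega)
    have e1 := congrArg (D i) (hg a (by omega))
    have e2 := hD i a (by omega)
    simp only [map_sum, hL, map_zero, hc, Finset.sum_add_distrib] at e1
    have e3 : ∑ x, g x * ((c:R) * v a' x) = c * ∑ x, g x * v a' x := by
      rw [Finset.mul_sum]; exact Finset.sum_congr rfl (fun _ _ => by ring)
    have e4 : ∑ x, v a x * D i (g x) = 0 := by
      rw [← e2]; exact Finset.sum_congr rfl (fun _ _ => by ring)
    rw [e3, e4, add_zero] at e1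
    exact (mul_eq_zero.1 e1).resolve_left (by exact_mod_cast hc0)
  have hClz : ∀ s, Cl s → ∀ g, Us s g → g = 0 := by
    intro s hs g hg
    apply h3
    have : ∀ t, Cl (s+t) ∧ Us (s+t) g := by
      intro t
      induction t with
      | zero => exact ⟨hs, hg⟩
      | succ t ih => exact ⟨hCl _ ih.1, ih.1 g ih.2⟩
    intro a
    exact (this (lev a + 1)).2 a (by omega)
  let V : ℕ → Submodule K (Fin k → K) := fun s =>
    { carrier := {g | ∀ a, lev a < s → ∑ j, g j * algebraMap R K (v a j) = 0}
      add_mem' := by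
        intro x y hx hy a ha
        simp [add_mul, Finset.sum_add_distrib, hx a ha, hy a ha]
      zero_mem' := by intro a _; simp
      smul_mem' := by
        intro c x hx a ha
        simp [mul_assoc, ← Finset.mul_sum, hx a ha] }
  have hclear : ∀ g : Fin k → K, ∃ d : R, d ≠ 0 ∧ ∃ g' : Fin k → R, ∀ j, algebraMap R K d * g j = algebraMap R K (g' j) := by
    intro g
    obtain ⟨b, hb⟩ := IsLocalization.exist_integer_multiples_of_finite (nonZeroDivisors R) g
    choose g' hg' using hb
    exact ⟨b, nonZeroDivisors.coe_ne_zero b, g', fun j => by rw [hg' j]; simp [Submonoid.smul_def, Algebra.smul_def]⟩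
  have hVU : ∀ s (g : Fin k → K) (d : R) (g' : Fin k → R), d ≠ 0 → (∀ j, algebraMap R K d * g j = algebraMap R K (g' j)) → (g ∈ V s ↔ Us s g') := by
    intro s g d g' hd hg
    have hd' : algebraMap R K d ≠ 0 := by simpa using hd
    have : ∀ a, algebraMap R K d * ∑ j, g j * algebraMap R K (v a j) = algebraMap R K (∑ j, g' j * v a j) := by
      intro a
      rw [map_sum, Finset.mul_sum]
      refine Finset.sum_congr rfl (fun j _ => ?_)
      rw [← mul_assoc, hg, map_mul]
    constructor
    · intro h a ha
      have h5 := this a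
      rw [h a ha, mul_zero] at h5
      exact (FaithfulSMul.algebraMap_injective R K) (by rw [← h5, map_zero])
    · intro h a ha
      have h5 := this a
      rw [h a ha, map_zero] at h5
      exact (mul_eq_zero.1 h5).resolve_left hd'
  have hVle : ∀ s, V (s+1) ≤ V s := fun s g hg a ha => hg a (by omega)
  have hVstep : ∀ s, V s = ⊥ ∨ V (s+1) < V s := by
    intro s
    by_cases hs : V (s+1) = V s
    · left
      have hcl : Cl s := by
        intro g hg
        rw [← hVU (s+1) (fun j => algebraMap R K (g j)) 1 g one_ne_zero (by simp), hs]
        rw [hVU s (fun j => algebraMap R K (g j)) 1 g one_ne_zero (by simp)]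
        exact hg
      rw [eq_bot_iff]
      intro g hg
      obtain ⟨d, hd, g', hg'⟩ := hclear g
      rw [hVU s g d g' hd hg'] at hg
      have := hClz s hcl g' hg
      have hd' : algebraMap R K d ≠ 0 := by simpa using hd
      rw [Submodule.mem_bot]
      ext j
      have h6 := hg' j
      rw [this] at h6
      simp at h6
      simpa using h6.resolve_left hd
    · right; exact lt_of_le_of_ne (hVle s) hs
  have hVrank : ∀ s, Module.finrank K (V s) ≤ k - s := by
    intro s
    induction s with
    | zero => simpa using Submodule.finrank_le (V 0)
    | succ s ih =>
      rcases hVstep s with h | h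
      · have : V (s+1) = ⊥ := eq_bot_iff.2 (h ▸ hVle s)
        rw [this]; simp
      · have := Submodule.finrank_lt_finrank_of_lt h
        omega
  have hVk : V k = ⊥ := by
    have := hVrank k
    simp at this
    exact this
  obtain ⟨a, ha, hdet⟩ := exists_det_ne_zero_of_span (fun a j => algebraMap R K (v a j)) {a | lev a < k} (by
    intro g hg
    have : g ∈ V k := hg
    rw [hVk] at this
    exact this)
  refine ⟨a, ha, fun h0 => hdet ?_⟩
  have : Matrix.of (fun i j => algebraMap R K (v (a i) j)) = (algebraMap R K).mapMatrix (Matrix.of (fun i j => v (a i) j)) := by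
    ext; simp
  rw [this, ← RingHom.map_det, h0, map_zero]


lemma wronskian_mv {m k : ℕ} (φ : Fin k → MvPolynomial (Fin m) ℚ) (hφ : LinearIndependent ℚ φ) :
    ∃ a : Fin k → (Fin m →₀ ℕ), (∀ i, (a i).degree < k) ∧
      Matrix.det (Matrix.of (fun i j => hd (a i) (φ j))) ≠ 0 := by
  classical
  refine wronskian_abs (fun a j => hd a (φ j)) Finsupp.degree
    (fun i : Fin m => (pderiv i : Derivation ℚ _ _).toLinearMap.toAddMonoidHom)
    (fun i x y => by simp [Derivation.leibniz]) ?_ ?_ ?_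
  · intro a i
    refine ⟨a + Finsupp.single i 1, by simp, a i + 1, fun j => ?_⟩
    change pderiv i (hd a (φ j)) = _
    rw [pderiv_hd]
    simp [smul_eq_C_mul]
  · intro a' ha'
    have : ∃ i, a' i ≠ 0 := by
      by_contra h
      push Not at h
      have : a' = 0 := by ext i; simp [h i]
      simp [this] at ha'
    obtain ⟨i, hi⟩ := this
    refine ⟨a' - Finsupp.single i 1, i, ?_, a' i, hi, fun j => ?_⟩
    · have h2 : a' - Finsupp.single i 1 + Finsupp.single i 1 = a' :=
        tsub_add_cancel_of_le (by simp; omega)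
      conv_rhs => rw [← h2]
      simp
    · have h2 : a' - Finsupp.single i 1 + Finsupp.single i 1 = a' :=
        tsub_add_cancel_of_le (by simp; omega)
      change pderiv i (hd _ (φ j)) = _
      rw [pderiv_hd, h2]
      have : (a' - Finsupp.single i 1 : Fin m →₀ ℕ) i + 1 = a' i := by simp; omega
      rw [this]
      simp [smul_eq_C_mul]
  · intro g hg
    by_contra hne
    obtain ⟨j0, hj0⟩ := Function.ne_iff.1 hne
    have : ∃ x, eval x (g j0) ≠ 0 := by
      by_contra h
      push Not at h
      exact hj0 (MvPolynomial.funext (fun x => by simp [h x]))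
    obtain ⟨x, hx⟩ := this
    have h2 : ∑ j, eval x (g j) • φ j = 0 := by
      apply tr_injective x
      rw [map_zero, map_sum]
      ext a
      have := congrArg (eval x) (hg a)
      simp only [map_sum, map_mul, eval_hd, map_zero] at this
      simp only [map_smul, coeff_sum, coeff_smul, smul_eq_mul, coeff_zero]
      exact this
    exact hx (Fintype.linearIndependent_iff.1 hφ _ h2 j0)

lemma wronskian_uni {k : ℕ} (ψ : Fin k → Polynomial ℚ) (hψ : LinearIndependent ℚ ψ) :
    ∃ a : Fin k → ℕ, (∀ i, a i < k) ∧
      Matrix.det (Matrix.of (fun i j => Polynomial.hasseDeriv (a i) (ψ j))) ≠ 0 := by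
  classical
  have hder : ∀ a (f : Polynomial ℚ), Polynomial.derivative (Polynomial.hasseDeriv a f) = ((a + 1 : ℕ) : Polynomial ℚ) * Polynomial.hasseDeriv (a+1) f := by
    intro a f
    rw [← Polynomial.hasseDeriv_one, ← LinearMap.comp_apply, Polynomial.hasseDeriv_comp]
    rw [add_comm 1 a]
    simp
    ring
  refine wronskian_abs (fun a j => Polynomial.hasseDeriv a (ψ j)) id
    (fun i : Unit => (Polynomial.derivative (R := ℚ)).toAddMonoidHom)
    (fun i x y => by simp [Polynomial.derivative_mul]; ring) ?_ ?_ ?_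
  · intro a i
    exact ⟨a + 1, rfl, a + 1, fun j => hder a (ψ j)⟩
  · intro a' ha'
    obtain ⟨a, rfl⟩ : ∃ a, a' = a + 1 := ⟨a' - 1, by simp at ha'; omega⟩
    exact ⟨a, (), rfl, a + 1, by omega, fun j => hder a (ψ j)⟩
  · intro g hg
    by_contra hne
    obtain ⟨j0, hj0⟩ := Function.ne_iff.1 hne
    have : ∃ x, Polynomial.eval x (g j0) ≠ 0 := by
      by_contra h
      push Not at h
      exact hj0 (Polynomial.funext (fun x => by simp [h x]))
    obtain ⟨x, hx⟩ := this
    have h2 : ∑ j, Polynomial.eval x (g j) • ψ j = 0 := by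
      apply Polynomial.taylor_injective x
      rw [map_zero, map_sum]
      ext a
      have := congrArg (Polynomial.eval x) (hg a)
      simp only [Polynomial.eval_finset_sum, Polynomial.eval_mul, Polynomial.eval_zero] at this
      simp only [map_smul, Polynomial.finset_sum_coeff, Polynomial.coeff_smul, smul_eq_mul, Polynomial.coeff_zero, Polynomial.taylor_coeff]
      exact this
    exact hx (Fintype.linearIndependent_iff.1 hψ _ h2 j0)

/-- embedding of last variables -/
noncomputable def emi (m : ℕ) : MvPolynomial (Fin m) ℚ →+* MvPolynomial (Fin (m+1)) ℚ :=
  ((MvPolynomial.finSuccEquiv ℚ m).symm.toRingEquiv.toRingHom).comp Polynomial.C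
/-- embedding of the first variable -/
noncomputable def emk (m : ℕ) : Polynomial ℚ →+* MvPolynomial (Fin (m+1)) ℚ :=
  ((MvPolynomial.finSuccEquiv ℚ m).symm.toRingEquiv.toRingHom).comp (Polynomial.mapRingHom C)

lemma coeff_emi_emk {m : ℕ} (φ : MvPolynomial (Fin m) ℚ) (ψ : Polynomial ℚ) (b : ℕ) (a : Fin m →₀ ℕ) :
    coeff (Finsupp.cons b a) (emi m φ * emk m ψ) = coeff a φ * ψ.coeff b := by
  rw [← finSuccEquiv_coeff_coeff, emi, emk]
  simp
  rw [mul_comm φ, coeff_C_mul, mul_comm]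

lemma cons_add_cons {m : ℕ} (b j : ℕ) (t a : Fin m →₀ ℕ) :
    Finsupp.cons b t + Finsupp.cons j a = Finsupp.cons (b + j) (t + a) := by
  ext i
  refine Fin.cases ?_ (fun i => ?_) i <;> simp

lemma ext_cons {m : ℕ} {R : Type*} [CommRing R] {P Q : MvPolynomial (Fin (m+1)) R}
    (h : ∀ b a, coeff (Finsupp.cons b a) P = coeff (Finsupp.cons b a) Q) : P = Q := by
  ext n
  rw [← Finsupp.cons_tail n]
  exact h _ _

lemma bin_cons {m : ℕ} (b j : ℕ) (t a : Fin m →₀ ℕ) :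
    bin (Finsupp.cons b t) (Finsupp.cons j a) = (b + j).choose j * bin t a := by
  simp [bin, Fin.prod_univ_succ]

lemma hd_sep {m : ℕ} (φ : MvPolynomial (Fin m) ℚ) (ψ : Polynomial ℚ) (j : ℕ) (a : Fin m →₀ ℕ) :
    hd (Finsupp.cons j a) (emi m φ * emk m ψ) = emi m (hd a φ) * emk m (Polynomial.hasseDeriv j ψ) := by
  apply ext_cons
  intro b t
  rw [coeff_hd, cons_add_cons, coeff_emi_emk, coeff_emi_emk, coeff_hd, Polynomial.hasseDeriv_coeff, bin_cons]
  push_cast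
  ring

lemma tr_sep {m : ℕ} (φ : MvPolynomial (Fin m) ℚ) (ψ : Polynomial ℚ) (β : Fin (m+1) → ℚ) :
    tr β (emi m φ * emk m ψ) = emi m (tr (fun i => β i.succ) φ) * emk m (ψ.comp (Polynomial.X + Polynomial.C (β 0))) := by
  rw [map_mul]
  congr 1
  · have : ((tr β : _ →ₐ[ℚ] _) : _ →+* _).comp (emi m) = (emi m).comp ((tr (fun i : Fin m => β i.succ) : _ →ₐ[ℚ] _) : _ →+* _) := by
      apply MvPolynomial.ringHom_ext
      · intro r; simp [emi, tr, MvPolynomial.finSuccEquiv, optionEquivLeft]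
      · intro i; simp [emi, tr, MvPolynomial.finSuccEquiv, optionEquivLeft]
    exact DFunLike.congr_fun this φ
  · have : ((tr β : _ →ₐ[ℚ] _) : _ →+* _).comp (emk m) = (emk m).comp (Polynomial.compRingHom (Polynomial.X + Polynomial.C (β 0))) := by
      apply Polynomial.ringHom_ext
      · intro r; simp [emk, tr, MvPolynomial.finSuccEquiv, optionEquivLeft]
      · simp [emk, tr, MvPolynomial.finSuccEquiv, optionEquivLeft]
    exact DFunLike.congr_fun this ψ

lemma exists_sep {m r : ℕ} (P : MvPolynomial (Fin (m+1)) ℚ) (hP : P ≠ 0) (hr : P.degreeOf 0 ≤ r) :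
    ∃ k : ℕ, 0 < k ∧ k ≤ r + 1 ∧ ∃ (φ : Fin k → MvPolynomial (Fin m) ℚ) (ψ : Fin k → Polynomial ℚ),
      LinearIndependent ℚ φ ∧ LinearIndependent ℚ ψ ∧ P = ∑ s, emi m (φ s) * emk m (ψ s) := by
  classical
  let p : Fin (r+1) → MvPolynomial (Fin m) ℚ := fun b => (finSuccEquiv ℚ m P).coeff b
  let S := Submodule.span ℚ (Set.range p)
  haveI : FiniteDimensional ℚ S := FiniteDimensional.span_of_finite ℚ (Set.finite_range p)
  let k := Module.finrank ℚ S
  let φ := Module.finBasis ℚ S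
  have hpS : ∀ b, p b ∈ S := fun b => Submodule.subset_span ⟨b, rfl⟩
  let ψ : Fin k → Polynomial ℚ := fun s => ∑ b : Fin (r+1), Polynomial.monomial (b:ℕ) (φ.repr ⟨p b, hpS b⟩ s)
  have hψc : ∀ s (b : Fin (r+1)), (ψ s).coeff b = φ.repr ⟨p b, hpS b⟩ s := by
    intro s b
    simp only [ψ, Polynomial.finset_sum_coeff, Polynomial.coeff_monomial]
    rw [Finset.sum_eq_single b]
    · simp
    · intro c _ hc
      rw [if_neg]; intro h; exact hc (Fin.ext h)
    · simp
  have hψc' : ∀ s (b : ℕ), r < b → (ψ s).coeff b = 0 := by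
    intro s b hb
    simp only [ψ, Polynomial.finset_sum_coeff, Polynomial.coeff_monomial]
    apply Finset.sum_eq_zero
    intro c _
    rw [if_neg]; have := c.2; omega
  have hPb : ∀ b : ℕ, r < b → (finSuccEquiv ℚ m P).coeff b = 0 := by
    intro b hb
    apply Polynomial.coeff_eq_zero_of_natDegree_lt
    rw [natDegree_finSuccEquiv]; omega
  have hPeq : P = ∑ s, emi m (φ s) * emk m (ψ s) := by
    apply ext_cons
    intro b a
    rw [coeff_sum, ← finSuccEquiv_coeff_coeff]
    simp only [coeff_emi_emk]
    by_cases hb : r < b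
    · rw [hPb b hb]; simp [hψc' _ b hb]
    · have hb' : b < r + 1 := by omega
      have h1 := φ.sum_repr ⟨p ⟨b, hb'⟩, hpS _⟩
      have h2 := congrArg (fun x : S => coeff a (x : MvPolynomial (Fin m) ℚ)) h1
      simp only [Submodule.coe_sum, Submodule.coe_smul, coeff_sum, coeff_smul, smul_eq_mul] at h2
      rw [show (finSuccEquiv ℚ m P).coeff b = p ⟨b, hb'⟩ from rfl, ← h2]
      refine Finset.sum_congr rfl (fun s _ => ?_)
      rw [← hψc s ⟨b, hb'⟩]; ring
  refine ⟨k, ?_, ?_, fun s => φ s, ψ, ?_, ?_, hPeq⟩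
  · by_contra h
    have hk0 : k = 0 := by omega
    haveI : IsEmpty (Fin k) := by rw [hk0]; infer_instance
    apply hP
    rw [hPeq]
    exact Finset.sum_of_isEmpty _
  · have := finrank_range_le_card (R := ℚ) p
    simpa [Set.finrank] using this
  · exact φ.linearIndependent.map' S.subtype (by simp)
  · rw [Fintype.linearIndependent_iff]
    intro t ht
    -- functional
    let f : S →ₗ[ℚ] ℚ := φ.constr ℚ t
    have hf : ∀ x : S, f x = ∑ s, t s * φ.repr x s := by
      intro x
      rw [Module.Basis.constr_apply_fintype]
      simp [Module.Basis.equivFun, mul_comm]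
      rfl
    have hf0 : ∀ b, f ⟨p b, hpS b⟩ = 0 := by
      intro b
      rw [hf]
      have := congrArg (fun q => Polynomial.coeff q (b:ℕ)) ht
      simp only [Polynomial.finset_sum_coeff, Polynomial.coeff_smul, hψc, smul_eq_mul, Polynomial.coeff_zero] at this
      exact this
    have hker : ∀ x (hx : x ∈ S), f ⟨x, hx⟩ = 0 := by
      intro x hx
      induction hx using Submodule.span_induction with
      | mem x h => obtain ⟨b, rfl⟩ := h; exact hf0 b
      | zero => exact map_zero f
      | add x y hx hy h1 h2 =>
        have : (⟨x + y, Submodule.add_mem _ hx hy⟩ : S) = ⟨x, hx⟩ + ⟨y, hy⟩ := rfl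
        rw [this, map_add, h1, h2, add_zero]
      | smul c x hx h1 =>
        have : (⟨c • x, Submodule.smul_mem _ c hx⟩ : S) = c • ⟨x, hx⟩ := rfl
        rw [this, map_smul, h1, smul_zero]
    intro s
    have := hker (φ s) (φ s).2
    simpa [f] using this

lemma gauss_bound (V : Polynomial ℤ) (hV : V ≠ 0) (β : ℚ) (B : ℝ) (hB : ∀ b, |(V.coeff b : ℝ)| ≤ B) :
    ((max β.num.natAbs β.den : ℕ) : ℝ) ^ ((V.map (Int.castRingHom ℚ)).rootMultiplicity β) ≤ B := by
  set e := (V.map (Int.castRingHom ℚ)).rootMultiplicity β with he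
  let L : Polynomial ℤ := Polynomial.C (β.den : ℤ) * Polynomial.X + Polynomial.C (-β.num)
  have hden : (β.den : ℤ) ≠ 0 := by exact_mod_cast β.den_nz
  have hLp : L.IsPrimitive := by
    intro c hc
    rw [Polynomial.C_dvd_iff_dvd_coeff] at hc
    have h1 := hc 1
    have h0 := hc 0
    simp only [L, Polynomial.coeff_add, Polynomial.coeff_C_mul, Polynomial.coeff_X_one, Polynomial.coeff_X_zero, Polynomial.coeff_C, mul_zero, mul_one, zero_add, if_true, one_ne_zero, if_false, add_zero, dvd_neg] at h1 h0
    have := β.reduced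
    have hco : IsCoprime β.num (β.den : ℤ) := Int.isCoprime_iff_gcd_eq_one.2 (by simpa [Int.gcd] using this)
    exact hco.isUnit_of_dvd' h0 h1
  have hLe : (L ^ e).IsPrimitive := by
    have : ∀ n : ℕ, (L ^ n).IsPrimitive := by
      intro n
      induction n with
      | zero => simp
      | succ n ih => rw [pow_succ]; exact ih.mul hLp
    exact this e
  have hdvd : (L^e) ∣ V := by
    rw [Polynomial.IsPrimitive.Int.dvd_iff_map_cast_dvd_map_cast _ _ hLe]
    have hmapL : (L^e).map (Int.castRingHom ℚ) = Polynomial.C ((β.den:ℚ)^e) * (Polynomial.X - Polynomial.C β)^e := by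
      rw [Polynomial.map_pow, map_pow, ← mul_pow]
      congr 1
      have hb : β.num = (β.den : ℚ) * β := by rw [mul_comm]; exact (Rat.mul_den_eq_num β).symm
      simp only [L, Polynomial.map_add, Polynomial.map_mul, Polynomial.map_C, Polynomial.map_X]
      rw [mul_sub, ← Polynomial.C_mul, ← hb]
      simp [sub_eq_add_neg]
    rw [hmapL]
    have hq : ((β.den:ℚ)^e) ≠ 0 := by positivity
    have h1 : (Polynomial.X - Polynomial.C β)^e ∣ V.map (Int.castRingHom ℚ) := Polynomial.pow_rootMultiplicity_dvd _ _
    rw [(Polynomial.isUnit_C.2 hq.isUnit).mul_left_dvd]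
    exact h1
  obtain ⟨G, hG⟩ := hdvd
  have hG0 : G ≠ 0 := by rintro rfl; simp at hG; exact hV hG
  have hdeg : L.natDegree = 1 := Polynomial.natDegree_linear hden
  have hlc : L.leadingCoeff = β.den := Polynomial.leadingCoeff_linear hden
  have key : ∀ x y : ℤ, y ≠ 0 → |(x:ℝ)| ≤ |((x * y : ℤ):ℝ)| := by
    intro x y hy
    have : 1 ≤ |y| := Int.one_le_abs hy
    rw [Int.cast_mul, abs_mul]
    have h2 : (1:ℝ) ≤ |(y:ℝ)| := by exact_mod_cast this
    nlinarith [abs_nonneg (x:ℝ)]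
  have h1 : ((β.den : ℕ):ℝ)^e ≤ B := by
    have h2 := hB V.natDegree
    have h3 : V.coeff V.natDegree = (β.den:ℤ)^e * G.leadingCoeff := by
      change V.leadingCoeff = _
      rw [hG, Polynomial.leadingCoeff_mul, Polynomial.leadingCoeff_pow, hlc]
    rw [h3] at h2
    refine le_trans ?_ h2
    refine le_trans ?_ (key _ _ (by simpa using hG0))
    push_cast
    exact le_abs_self _
  have h2 : ((β.num.natAbs : ℕ):ℝ)^e ≤ B := by
    by_cases hp : β.num = 0
    · rw [hp]
      simp only [Int.natAbs_zero, Nat.cast_zero]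
      refine le_trans ?_ h1
      apply pow_le_pow_left₀ le_rfl; positivity
    have h2 := hB V.natTrailingDegree
    have htL : L.trailingCoeff = -β.num := by
      rw [Polynomial.trailingCoeff, Polynomial.natTrailingDegree_eq_zero.2]
      · simp [L]
      · right; simp [L, hp]
    have h3 : V.coeff V.natTrailingDegree = (-β.num)^e * G.trailingCoeff := by
      change V.trailingCoeff = _
      rw [hG, Polynomial.trailingCoeff_mul]
      congr 1
      have : ∀ n : ℕ, (L^n).trailingCoeff = (-β.num)^n := by
        intro n
        induction n with
        | zero => simp [Polynomial.trailingCoeff]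
        | succ n ih => rw [pow_succ, Polynomial.trailingCoeff_mul, ih, htL, pow_succ]
      exact this e
    rw [h3] at h2
    refine le_trans ?_ h2
    refine le_trans ?_ (key _ _ (by simpa [Polynomial.trailingCoeff_eq_zero] using hG0))
    push_cast
    rw [abs_pow, abs_neg, Nat.cast_natAbs]
    simp
  rcases le_total β.num.natAbs β.den with h | h
  · rw [max_eq_right h]; exact h1
  · rw [max_eq_left h]; exact h2


/-- ℓ¹ norm -/
noncomputable def l1 {σ : Type*} (P : MvPolynomial σ ℤ) : ℝ := ∑ n ∈ P.support, |((coeff n P : ℤ) : ℝ)|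

lemma l1_nonneg {σ : Type*} (P : MvPolynomial σ ℤ) : 0 ≤ l1 P := Finset.sum_nonneg (fun _ _ => abs_nonneg _)

lemma l1_eq {σ : Type*} (P : MvPolynomial σ ℤ) (s : Finset (σ →₀ ℕ)) (h : P.support ⊆ s) :
    l1 P = ∑ n ∈ s, |((coeff n P : ℤ) : ℝ)| := by
  refine Finset.sum_subset h (fun n _ hn => ?_)
  simp at hn; simp [hn]

lemma l1_add {σ : Type*} (P Q : MvPolynomial σ ℤ) : l1 (P + Q) ≤ l1 P + l1 Q := by
  classical
  rw [l1_eq (P+Q) (P.support ∪ Q.support) support_add, l1_eq P (P.support ∪ Q.support) Finset.subset_union_left,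
    l1_eq Q (P.support ∪ Q.support) Finset.subset_union_right, ← Finset.sum_add_distrib]
  refine Finset.sum_le_sum (fun n _ => ?_)
  simp only [coeff_add, Int.cast_add]
  exact abs_add_le _ _

@[simp] lemma l1_zero {σ : Type*} : l1 (0 : MvPolynomial σ ℤ) = 0 := by simp [l1]

lemma l1_sum {σ ι : Type*} (s : Finset ι) (f : ι → MvPolynomial σ ℤ) : l1 (∑ i ∈ s, f i) ≤ ∑ i ∈ s, l1 (f i) := by
  classical
  induction s using Finset.induction_on with
  | empty => simp
  | insert a s ha ih => rw [Finset.sum_insert ha, Finset.sum_insert ha]; exact (l1_add _ _).trans (by linarith)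

lemma l1_monomial {σ : Type*} (n : σ →₀ ℕ) (c : ℤ) : l1 (monomial n c) = |(c:ℝ)| := by
  classical
  rw [l1_eq _ {n} support_monomial_subset]; simp

lemma l1_mul {σ : Type*} (P Q : MvPolynomial σ ℤ) : l1 (P * Q) ≤ l1 P * l1 Q := by
  conv_lhs => rw [P.as_sum, Q.as_sum, Finset.sum_mul_sum]
  refine (l1_sum _ _).trans ?_
  rw [l1, l1, Finset.sum_mul_sum]
  refine Finset.sum_le_sum (fun i _ => (l1_sum _ _).trans (Finset.sum_le_sum (fun j _ => ?_)))
  rw [monomial_mul, l1_monomial]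
  simp [abs_mul]

lemma l1_one {σ : Type*} : l1 (1 : MvPolynomial σ ℤ) = 1 := by
  have : (1 : MvPolynomial σ ℤ) = monomial 0 1 := rfl
  rw [this, l1_monomial]; simp

lemma l1_prod {σ ι : Type*} (s : Finset ι) (f : ι → MvPolynomial σ ℤ) : l1 (∏ i ∈ s, f i) ≤ ∏ i ∈ s, l1 (f i) := by
  classical
  induction s using Finset.induction_on with
  | empty => simp [l1_one]
  | insert a s ha ih =>
    rw [Finset.prod_insert ha, Finset.prod_insert ha]
    exact (l1_mul _ _).trans (mul_le_mul_of_nonneg_left ih (l1_nonneg _))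

lemma l1_smul_unit {σ : Type*} (u : ℤˣ) (P : MvPolynomial σ ℤ) : l1 (u • P) ≤ l1 P := by
  rcases Int.units_eq_one_or u with rfl | rfl
  · simp
  · simp [l1, Units.smul_def]

lemma l1_det {σ : Type*} {k : ℕ} (M : Matrix (Fin k) (Fin k) (MvPolynomial σ ℤ)) (B : ℝ)
    (h : ∀ i j, l1 (M i j) ≤ B) : l1 M.det ≤ k.factorial * B ^ k := by
  rw [Matrix.det_apply]
  refine (l1_sum _ _).trans ?_
  have : ∀ s ∈ (Finset.univ : Finset (Equiv.Perm (Fin k))), l1 (Equiv.Perm.sign s • ∏ i, M (s i) i) ≤ B ^ k := by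
    intro s _
    refine (l1_smul_unit _ _).trans ((l1_prod _ _).trans ?_)
    refine (Finset.prod_le_prod (fun _ _ => l1_nonneg _) (fun i _ => h (s i) i)).trans ?_
    simp
  refine (Finset.sum_le_sum this).trans ?_
  simp [Finset.card_univ, Fintype.card_perm]

lemma coeff_le_l1 {σ : Type*} (P : MvPolynomial σ ℤ) (n : σ →₀ ℕ) : |((coeff n P : ℤ) : ℝ)| ≤ l1 P := by
  classical
  rw [l1_eq P (insert n P.support) (Finset.subset_insert _ _)]
  exact Finset.single_le_sum (f := fun n => |((coeff n P : ℤ) : ℝ)|) (fun _ _ => abs_nonneg _) (Finset.mem_insert_self _ _)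


/-- comparison through an injection of exponents -/
lemma l1_le_of_inj {σ τ : Type*} (P : MvPolynomial σ ℤ) (Q : MvPolynomial τ ℤ) (B : ℝ) (hB : 0 ≤ B)
    (f : (σ →₀ ℕ) → (τ →₀ ℕ)) (hf : Function.Injective f)
    (h : ∀ n ∈ P.support, |((coeff n P : ℤ) : ℝ)| ≤ B * |((coeff (f n) Q : ℤ) : ℝ)|) : l1 P ≤ B * l1 Q := by
  classical
  rw [l1_eq Q (Q.support ∪ P.support.image f) Finset.subset_union_left, l1]
  refine (Finset.sum_le_sum h).trans ?_
  rw [← Finset.mul_sum]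
  apply mul_le_mul_of_nonneg_left _ hB
  rw [← Finset.sum_image (f := fun n => |((coeff n Q : ℤ) : ℝ)|) (hf.injOn)]
  exact Finset.sum_le_sum_of_subset_of_nonneg Finset.subset_union_right (fun _ _ _ => abs_nonneg _)

lemma degreeOf_hd {σ : Type*} [Fintype σ] {R : Type*} [CommRing R] (a : σ →₀ ℕ) (P : MvPolynomial σ R) (i : σ) :
    degreeOf i (hd a P) ≤ degreeOf i P := by
  rw [degreeOf_le_iff]
  intro n hn
  rw [mem_support_iff, coeff_hd] at hn
  have h2 : coeff (n + a) P ≠ 0 := fun h => hn (by rw [h, mul_zero])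
  have := monomial_le_degreeOf i (mem_support_iff.2 h2)
  simp at this; omega

lemma l1_hd {m : ℕ} (a : Fin m →₀ ℕ) (P : MvPolynomial (Fin m) ℤ) (r : Fin m → ℕ)
    (hr : ∀ i, degreeOf i P ≤ r i) : l1 (hd a P) ≤ 2 ^ (∑ i, r i) * l1 P := by
  refine l1_le_of_inj _ _ _ (by positivity) (fun n => n + a) (add_left_injective a) (fun n hn => ?_)
  rw [mem_support_iff, coeff_hd] at hn
  have h2 : coeff (n + a) P ≠ 0 := fun h => hn (by rw [h, mul_zero])
  rw [coeff_hd]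
  push_cast
  rw [abs_mul]
  apply mul_le_mul_of_nonneg_right _ (abs_nonneg _)
  rw [abs_of_nonneg (by positivity)]
  have : bin n a ≤ 2 ^ (∑ i, r i) := by
    rw [bin, ← Finset.prod_pow_eq_pow_sum]
    refine Finset.prod_le_prod' (fun i _ => ?_)
    refine (Nat.choose_le_two_pow _ _).trans ?_
    apply Nat.pow_le_pow_right (by norm_num)
    have := monomial_le_degreeOf i (mem_support_iff.2 h2)
    have := hr i
    simp at *; omega
  exact_mod_cast this

lemma map_hd {σ : Type*} [Fintype σ] {R S : Type*} [CommRing R] [CommRing S] (f : R →+* S) (a : σ →₀ ℕ)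
    (P : MvPolynomial σ R) : map f (hd a P) = hd a (map f P) := by
  ext n; simp [coeff_hd, coeff_map]

lemma degreeOf_det {σ : Type*} {R : Type*} [CommRing R] {k : ℕ} (M : Matrix (Fin k) (Fin k) (MvPolynomial σ R))
    (i : σ) (d : ℕ) (h : ∀ a b, degreeOf i (M a b) ≤ d) : degreeOf i M.det ≤ k * d := by
  classical
  rw [Matrix.det_apply]
  refine (degreeOf_sum_le _ _ _).trans (Finset.sup_le (fun s _ => ?_))
  have h1 : degreeOf i (∏ j, M (s j) j) ≤ k * d := by
    refine (degreeOf_prod_le _ _ _).trans ?_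
    refine (Finset.sum_le_sum (fun j _ => h (s j) j)).trans ?_
    simp
  rcases Int.units_eq_one_or (Equiv.Perm.sign s) with h2 | h2
  · rw [h2]; simpa using h1
  · rw [h2]; simpa [Units.smul_def, degreeOf_neg] using h1

/-- weighted order at the origin is at least θ -/
def Idx {σ : Type*} [Fintype σ] {R : Type*} [CommRing R] (w : σ → ℝ) (θ : ℝ) (P : MvPolynomial σ R) : Prop :=
  ∀ n, coeff n P ≠ 0 → θ ≤ ∑ i, w i * n i

lemma Idx.sum {σ ι : Type*} [Fintype σ] {R : Type*} [CommRing R] {w : σ → ℝ} {θ : ℝ} (s : Finset ι) (f : ι → MvPolynomial σ R)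
    (h : ∀ i ∈ s, Idx w θ (f i)) : Idx w θ (∑ i ∈ s, f i) := by
  intro n hn
  rw [coeff_sum] at hn
  obtain ⟨i, hi, h2⟩ := Finset.exists_ne_zero_of_sum_ne_zero hn
  exact h i hi n h2

lemma Idx.mul {σ : Type*} [Fintype σ] {R : Type*} [CommRing R] {w : σ → ℝ} {θ η : ℝ} {P Q : MvPolynomial σ R}
    (hP : Idx w θ P) (hQ : Idx w η Q) : Idx w (θ + η) (P * Q) := by
  classical
  intro n hn
  rw [coeff_mul] at hn
  obtain ⟨⟨a, b⟩, hi, h2⟩ := Finset.exists_ne_zero_of_sum_ne_zero hn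
  rw [Finset.HasAntidiagonal.mem_antidiagonal] at hi
  have h3 := hP a (left_ne_zero_of_mul h2)
  have h4 := hQ b (right_ne_zero_of_mul h2)
  simp only at hi
  rw [← hi]
  simp only [Finsupp.add_apply, Nat.cast_add, mul_add, Finset.sum_add_distrib]
  linarith

lemma Idx.prod {σ ι : Type*} [Fintype σ] {R : Type*} [CommRing R] {w : σ → ℝ} {θ : ι → ℝ} (s : Finset ι) (f : ι → MvPolynomial σ R)
    (h : ∀ i ∈ s, Idx w (θ i) (f i)) : Idx w (∑ i ∈ s, θ i) (∏ i ∈ s, f i) := by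
  classical
  induction s using Finset.induction_on with
  | empty =>
    intro n hn
    have : n = 0 := by
      by_contra h0
      apply hn
      rw [Finset.prod_empty, coeff_one, if_neg (Ne.symm h0)]
    simp [this]
  | insert a s ha ih =>
    rw [Finset.prod_insert ha, Finset.sum_insert ha]
    exact (h a (Finset.mem_insert_self _ _)).mul (ih (fun i hi => h i (Finset.mem_insert_of_mem hi)))

lemma Idx.det {σ : Type*} [Fintype σ] {R : Type*} [CommRing R] {w : σ → ℝ} {k : ℕ} {θ : Fin k → ℝ}
    (M : Matrix (Fin k) (Fin k) (MvPolynomial σ R)) (h : ∀ i j, Idx w (θ j) (M i j)) : Idx w (∑ j, θ j) M.det := by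
  rw [Matrix.det_apply]
  refine Idx.sum _ _ (fun s _ => ?_)
  have h1 := Idx.prod Finset.univ (fun j => M (s j) j) (fun j _ => h (s j) j)
  rcases Int.units_eq_one_or (Equiv.Perm.sign s) with h2 | h2
  · rw [h2]; simpa using h1
  · rw [h2]
    intro n hn
    refine h1 n (fun h0 => hn ?_)
    simp [Units.smul_def, h0]

lemma Idx.hd {σ : Type*} [Fintype σ] {R : Type*} [CommRing R] {w : σ → ℝ} {θ : ℝ} {P : MvPolynomial σ R}
    (hP : Idx w θ P) (a : σ →₀ ℕ) : Idx w (θ - ∑ i, w i * a i) (hd a P) := by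
  intro n hn
  rw [coeff_hd] at hn
  have := hP (n + a) (right_ne_zero_of_mul hn)
  simp only [Finsupp.add_apply, Nat.cast_add, mul_add, Finset.sum_add_distrib] at this
  linarith

lemma Idx.nonneg {σ : Type*} [Fintype σ] {R : Type*} [CommRing R] {w : σ → ℝ} (hw : ∀ i, 0 ≤ w i) {P : MvPolynomial σ R} :
    Idx w 0 P := fun n _ => Finset.sum_nonneg (fun i _ => mul_nonneg (hw i) (by positivity))

lemma Idx.max {σ : Type*} [Fintype σ] {R : Type*} [CommRing R] {w : σ → ℝ} {θ η : ℝ} {P : MvPolynomial σ R}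
    (hP : Idx w θ P) (hQ : Idx w η P) : Idx w (max θ η) P := fun n hn => max_le (hP n hn) (hQ n hn)


/-- height of a rational -/
def rH (β : ℚ) : ℕ := max β.num.natAbs β.den

lemma count_lower (k r : ℕ) (hk : 0 < k) (hkr : k ≤ r + 1) (hr : 0 < r) (θ : ℝ) (h0 : 0 < θ) (h1 : θ ≤ 1) :
    k * (θ ^ 2 / 8) ≤ ∑ j : Fin k, max 0 (θ - (j : ℕ) / (r:ℝ)) := by
  rw [Fin.sum_univ_eq_sum_range (fun j : ℕ => max 0 (θ - (j:ℝ) / (r:ℝ))) k]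
  set N := ⌊θ * k / 4⌋₊ with hN
  have hk' : (0:ℝ) < k := by exact_mod_cast hk
  have hr' : (1:ℝ) ≤ r := by exact_mod_cast hr
  have hNle : (N:ℝ) ≤ θ * k / 4 := Nat.floor_le (by positivity)
  have hNlt : θ * k / 4 < N + 1 := Nat.lt_floor_add_one _
  have hNk : N + 1 ≤ k := by
    have : (N:ℝ) < k := by nlinarith
    have : N < k := by exact_mod_cast this
    omega
  have hsub : Finset.range (N+1) ⊆ Finset.range k := Finset.range_subset_range.2 hNk
  refine le_trans ?_ (Finset.sum_le_sum_of_subset_of_nonneg hsub (fun _ _ _ => le_max_left _ _))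
  have : ∀ j ∈ Finset.range (N+1), θ / 2 ≤ max 0 (θ - (j:ℝ) / (r:ℝ)) := by
    intro j hj
    refine le_trans ?_ (le_max_right _ _)
    have hj2 : (j:ℝ) ≤ N := by exact_mod_cast (by simpa using hj : j < N + 1) |> Nat.lt_succ_iff.1
    have hkr' : (k:ℝ) ≤ r + 1 := by exact_mod_cast hkr
    have : (j:ℝ) / r ≤ θ / 2 := by
      rw [div_le_iff₀ (by linarith)]
      nlinarith
    linarith
  have h2 := Finset.card_nsmul_le_sum _ _ _ this
  simp only [Finset.card_range, nsmul_eq_mul] at h2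
  push_cast at h2
  refine le_trans ?_ h2
  nlinarith

theorem roth (m : ℕ) : ∀ ε : ℝ, 0 < ε → ∃ ω : ℝ, 0 < ω ∧ ω < 1 ∧
    ∀ (r : Fin m → ℕ) (β : Fin m → ℚ) (T : ℝ) (P : MvPolynomial (Fin m) ℤ), P ≠ 0 →
    (∀ i, 0 < r i) → (∀ i j, i < j → (r i : ℝ) ≤ ω * r j) → (∀ i, degreeOf i P ≤ r i) →
    l1 P ≤ Real.exp T → (∀ i, (r i : ℝ) ≤ T) → (∀ i, T ≤ ω * r i * Real.log (rH (β i))) →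
    ∃ n, coeff n (tr β (map (Int.castRingHom ℚ) P)) ≠ 0 ∧ ∑ i, (1 / (r i : ℝ)) * n i < ε := by
  induction m with
  | zero =>
    intro ε hε
    refine ⟨1/2, by norm_num, by norm_num, ?_⟩
    intro r β T P hP _ _ _ _ _ _
    have h0 : tr β (map (Int.castRingHom ℚ) P) ≠ 0 := by
      rw [Ne, map_eq_zero_iff _ (tr_injective β), map_eq_zero_iff _ (map_injective _ (RingHom.injective_int _))]
      exact hP
    obtain ⟨n, hn⟩ := MvPolynomial.ne_zero_iff.1 h0
    exact ⟨n, hn, by simpa using hε⟩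
  | succ m ih =>
    intro ε0 hε0
    set ε := min ε0 1 with hεdef
    have hε : 0 < ε := lt_min hε0 one_pos
    have hε1 : ε ≤ 1 := min_le_right _ _
    obtain ⟨ω', hω'0, hω'1, hω'⟩ := ih (ε ^ 2 / 100) (by positivity)
    set ω := min ω' (ε ^ 2 / 100) / (m + 3) with hω
    have hm3 : (0:ℝ) < m + 3 := by positivity
    have hω0 : 0 < ω := by
      apply div_pos (lt_min hω'0 (by positivity)) hm3
    have hωa : (m + 3) * ω ≤ ω' := by
      rw [hω, mul_div_cancel₀ _ hm3.ne']; exact min_le_left _ _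
    have hωb : (m + 3) * ω ≤ ε ^ 2 / 100 := by
      rw [hω, mul_div_cancel₀ _ hm3.ne']; exact min_le_right _ _
    have hωω' : ω ≤ ω' := by nlinarith [(Nat.cast_nonneg m : (0:ℝ) ≤ m)]
    have hωε : ω ≤ ε / 2 := by nlinarith [(Nat.cast_nonneg m : (0:ℝ) ≤ m)]
    refine ⟨ω, hω0, by nlinarith, ?_⟩
    intro r β T P hP hr hrr hdeg hl1 hrT hTH
    by_contra hcon
    push Not at hcon
    have hIdx : Idx (fun i => 1 / (r i : ℝ)) ε (tr β (map (Int.castRingHom ℚ) P)) := fun n hn =>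
      le_trans (min_le_left _ _) (hcon n hn)
    have hr0 : (1:ℝ) ≤ r 0 := by exact_mod_cast hr 0
    have hT0 : 0 < T := lt_of_lt_of_le (by linarith) (hrT 0)
    set PQ := map (Int.castRingHom ℚ) P with hPQ
    have hPQ0 : PQ ≠ 0 := by
      rw [hPQ, Ne, map_eq_zero_iff _ (map_injective _ (RingHom.injective_int _))]; exact hP
    have hdegQ : degreeOf 0 PQ ≤ r 0 := by
      rw [degreeOf_le_iff]
      intro n hn
      have h1 : n ∈ P.support := support_map_subset _ _ hn
      exact (monomial_le_degreeOf 0 h1).trans (hdeg 0)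
    obtain ⟨k, hk0, hkr, φ, ψ, hφ, hψ, hsep⟩ := exists_sep PQ hPQ0 hdegQ
    obtain ⟨a, ha, hdetA⟩ := wronskian_mv φ hφ
    obtain ⟨b, hb, hdetB⟩ := wronskian_uni ψ hψ
    set U := Matrix.det (Matrix.of (fun i j => hd (a i) (φ j))) with hU
    set V := Matrix.det (Matrix.of (fun i j => Polynomial.hasseDeriv (b i) (ψ j))) with hV
    have hk0' : (0:ℝ) < k := by exact_mod_cast hk0
    -- b is a bijection
    have hbinj : Function.Injective b := by
      intro i j hij
      by_contra hne
      exact hdetB (Matrix.det_zero_of_row_eq hne (by ext s; simp [hij]))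
    let b' : Fin k → Fin k := fun i => ⟨b i, hb i⟩
    have hb'bij : Function.Bijective b' := by
      apply Finite.injective_iff_bijective.1
      intro i j hij
      exact hbinj (by simpa [b'] using hij)
    set M : Matrix (Fin k) (Fin k) (MvPolynomial (Fin (m+1)) ℤ) :=
      Matrix.of (fun i j => hd (Finsupp.cons (b j) (a i)) P) with hM
    set W := M.det with hW
    have hMQ : M.map (map (Int.castRingHom ℚ)) = ((Matrix.of (fun i j => hd (a i) (φ j))).map (emi m)) *
        ((Matrix.of (fun i j => Polynomial.hasseDeriv (b i) (ψ j))).transpose.map (emk m)) := by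
      ext1 i j
      simp only [hM, Matrix.map_apply, Matrix.of_apply, Matrix.mul_apply, Matrix.transpose_apply]
      rw [map_hd, ← hPQ, hsep, map_sum]
      exact Finset.sum_congr rfl (fun s _ => hd_sep _ _ _ _)
    have hWQ : map (Int.castRingHom ℚ) W = emi m U * emk m V := by
      rw [hW, RingHom.map_det, RingHom.mapMatrix_apply, hMQ, Matrix.det_mul]
      rw [← RingHom.mapMatrix_apply, ← RingHom.map_det, ← RingHom.mapMatrix_apply, ← RingHom.map_det, Matrix.det_transpose]
    have hWc : ∀ c d, ((coeff (Finsupp.cons c d) W : ℤ) : ℚ) = coeff d U * V.coeff c := by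
      intro c d
      rw [← coeff_emi_emk, ← hWQ, coeff_map]; simp
    -- bounds
    have hWl1 : l1 W ≤ Real.exp (k * (m + 3) * T) := by
      have h1 : ∀ i j, l1 (M i j) ≤ Real.exp ((m + 2) * T) := by
        intro i j
        refine (l1_hd _ P r hdeg).trans ?_
        have h2 : (2:ℝ) ^ (∑ i, r i) ≤ Real.exp ((m+1) * T) := by
          calc (2:ℝ) ^ (∑ i, r i) ≤ (Real.exp 1) ^ (∑ i, r i) := by
                apply pow_le_pow_left₀ (by norm_num)
                linarith [Real.add_one_le_exp (1:ℝ)]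
            _ = Real.exp (∑ i, (r i : ℝ)) := by rw [← Real.exp_nat_mul]; simp
            _ ≤ _ := by
                apply Real.exp_le_exp.2
                refine (Finset.sum_le_sum (fun i _ => hrT i)).trans ?_
                simp
        calc _ ≤ Real.exp ((m+1) * T) * Real.exp T := by
              apply mul_le_mul h2 hl1 (l1_nonneg _) (Real.exp_pos _).le
          _ = _ := by rw [← Real.exp_add]; ring_nf
      refine (l1_det M _ h1).trans ?_
      have h3 : (k.factorial : ℝ) ≤ Real.exp (k * T) := by
        have h4 : k.factorial ≤ k ^ k := Nat.factorial_le_pow k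
        have h5 : (k:ℝ) ≤ Real.exp T := by
          have : (k:ℝ) ≤ r 0 + 1 := by exact_mod_cast hkr
          have := hrT 0
          linarith [Real.add_one_le_exp T]
        calc (k.factorial : ℝ) ≤ (k:ℝ) ^ k := by exact_mod_cast h4
          _ ≤ (Real.exp T)^k := pow_le_pow_left₀ hk0'.le h5 _
          _ = _ := by rw [← Real.exp_nat_mul]
      rw [← Real.exp_nat_mul]
      calc _ ≤ Real.exp (k * T) * Real.exp (k * ((m + 2) * T)) := by
            apply mul_le_mul_of_nonneg_right h3 (Real.exp_pos _).le
        _ = _ := by rw [← Real.exp_add]; ring_nf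
    -- choose a0, b0
    obtain ⟨a0, ha0⟩ := MvPolynomial.ne_zero_iff.1 hdetA
    obtain ⟨b0, hb0⟩ : ∃ b0, V.coeff b0 ≠ 0 := by
      by_contra h
      push Not at h
      exact hdetB (Polynomial.ext (by simpa using h))
    -- U part
    let U' : MvPolynomial (Fin m) ℤ := (MvPolynomial.finSuccEquiv ℤ m W).coeff b0
    have hU'c : ∀ n, coeff n U' = coeff (Finsupp.cons b0 n) W := fun n => finSuccEquiv_coeff_coeff _ _ _
    have hU'Q : map (Int.castRingHom ℚ) U' = V.coeff b0 • U := by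
      ext n
      rw [coeff_map, hU'c, coeff_smul]
      simp [hWc, mul_comm]
    have hU'0 : U' ≠ 0 := by
      intro h
      rw [h, map_zero] at hU'Q
      exact (smul_ne_zero hb0 hdetA) hU'Q.symm
    obtain ⟨n1, hn1, hn1w⟩ := hω' (fun i => k * r i.succ) (fun i => β i.succ) (k * (m+3) * T) U' hU'0
      (fun i => Nat.mul_pos hk0 (hr _))
      (fun i j hij => by
        have h1 := hrr i.succ j.succ (Fin.succ_lt_succ_iff.2 hij)
        have h2 : (0:ℝ) ≤ r j.succ := by positivity
        push_cast
        have : (r i.succ:ℝ) ≤ ω' * r j.succ := h1.trans (by gcongr)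
        nlinarith)
      (fun i => by
        have hdW : degreeOf i.succ W ≤ k * r i.succ :=
          degreeOf_det M _ _ (fun x y => (degreeOf_hd _ _ _).trans (hdeg _))
        rw [degreeOf_le_iff]
        intro n hn
        rw [mem_support_iff, hU'c] at hn
        have := monomial_le_degreeOf i.succ (mem_support_iff.2 hn)
        simp only [Finsupp.cons_succ] at this
        omega)
      (by
        refine le_trans ?_ hWl1
        have := l1_le_of_inj U' W 1 zero_le_one (fun n => Finsupp.cons b0 n) (Finsupp.cons_right_injective b0) (fun n _ => by rw [hU'c]; simp)
        simpa using this)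
      (fun i => by
        have h1 := hrT i.succ
        push_cast
        nlinarith [(Nat.cast_nonneg m : (0:ℝ) ≤ m), mul_nonneg (mul_nonneg hk0'.le (Nat.cast_nonneg m : (0:ℝ) ≤ m)) hT0.le, mul_pos hk0' hT0, mul_le_mul_of_nonneg_left h1 hk0'.le])
      (fun i => by
        have h1 := hTH i.succ
        have h2 : (0:ℝ) < r i.succ := by exact_mod_cast hr i.succ
        have hlog : 0 ≤ Real.log (rH (β i.succ)) := Real.log_natCast_nonneg _
        push_cast
        calc k * (m+3) * T ≤ k * (m+3) * (ω * r i.succ * Real.log (rH (β i.succ))) := by gcongr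
          _ = ((m+3) * ω) * (k * r i.succ * Real.log (rH (β i.succ))) := by ring
          _ ≤ ω' * (k * r i.succ * Real.log (rH (β i.succ))) := by gcongr
          _ = _ := by ring)
    rw [hU'Q, map_smul, coeff_smul, smul_eq_mul] at hn1
    have hn1' := right_ne_zero_of_mul hn1
    have hn1w' : ∑ i : Fin m, (1 / (r i.succ : ℝ)) * n1 i < k * (ε^2/100) := by
      have h1 : ∑ i : Fin m, (1 / (r i.succ : ℝ)) * n1 i = k * ∑ i : Fin m, (1 / ((k * r i.succ : ℕ) : ℝ)) * n1 i := by
        rw [Finset.mul_sum]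
        refine Finset.sum_congr rfl (fun i _ => ?_)
        have h2 : (0:ℝ) < r i.succ := by exact_mod_cast hr i.succ
        push_cast
        field_simp
      rw [h1]
      exact mul_lt_mul_of_pos_left hn1w hk0'
    -- V part
    let V' : Polynomial ℤ := ∑ c ∈ (MvPolynomial.finSuccEquiv ℤ m W).support, Polynomial.monomial c (coeff a0 ((MvPolynomial.finSuccEquiv ℤ m W).coeff c))
    have hV'c : ∀ c, V'.coeff c = coeff (Finsupp.cons c a0) W := by
      intro c
      rw [← finSuccEquiv_coeff_coeff]
      simp only [V', Polynomial.finset_sum_coeff, Polynomial.coeff_monomial]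
      rw [Finset.sum_ite_eq' ]
      split_ifs with h
      · rfl
      · simp at h; simp [h]
    have hV'Q : V'.map (Int.castRingHom ℚ) = Polynomial.C (coeff a0 U) * V := by
      ext c
      rw [Polynomial.coeff_map, hV'c, Polynomial.coeff_C_mul]
      simp [hWc]
    have hV'0 : V' ≠ 0 := by
      intro h
      rw [h, Polynomial.map_zero] at hV'Q
      exact (mul_ne_zero (Polynomial.C_ne_zero.2 ha0) hdetB) hV'Q.symm
    have hg := gauss_bound V' hV'0 (β 0) (Real.exp (k * (m+3) * T)) (fun c => by
      rw [hV'c]; exact (coeff_le_l1 _ _).trans hWl1)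
    set e := (V'.map (Int.castRingHom ℚ)).rootMultiplicity (β 0) with he
    have he2 : (V.comp (Polynomial.X + Polynomial.C (β 0))).coeff e ≠ 0 := by
      have h1 : (Polynomial.C (coeff a0 U) * V.comp (Polynomial.X + Polynomial.C (β 0))).coeff e ≠ 0 := by
        have h2 : Polynomial.C (coeff a0 U) * V.comp (Polynomial.X + Polynomial.C (β 0)) = (V'.map (Int.castRingHom ℚ)).comp (Polynomial.X + Polynomial.C (β 0)) := by
          rw [hV'Q]; simp
        rw [h2, he, Polynomial.rootMultiplicity_eq_natTrailingDegree]
        change Polynomial.trailingCoeff _ ≠ 0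
        rw [Ne, Polynomial.trailingCoeff_eq_zero, ← h2]
        intro h3
        rcases mul_eq_zero.1 h3 with h4 | h4
        · exact ha0 (Polynomial.C_eq_zero.1 h4)
        · apply hdetB
          apply Polynomial.taylor_injective (β 0)
          rw [map_zero, Polynomial.taylor_apply]; exact h4
      rw [Polynomial.coeff_C_mul] at h1
      exact right_ne_zero_of_mul h1
    have hlogpos : 0 < Real.log (rH (β 0)) := by
      have h1 := hTH 0
      by_contra h
      push Not at h
      have : ω * r 0 * Real.log (rH (β 0)) ≤ 0 := mul_nonpos_of_nonneg_of_nonpos (by positivity) h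
      linarith
    have he3 : (e:ℝ) / r 0 ≤ k * (ε^2/100) := by
      have hHpos : (0:ℝ) < rH (β 0) := by
        have : 0 < rH (β 0) := lt_of_lt_of_le (β 0).den_pos (le_max_right _ _)
        exact_mod_cast this
      have h1 : (e:ℝ) * Real.log (rH (β 0)) ≤ k * (m+3) * T := by
        have := Real.log_le_log (by positivity) hg
        rw [Real.log_exp, Real.log_pow] at this
        exact this
      have h2 := hTH 0
      have h3 : (e:ℝ) * Real.log (rH (β 0)) ≤ (k * ((m+3) * ω) * r 0) * Real.log (rH (β 0)) := by
        refine h1.trans ?_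
        calc k * (m+3) * T ≤ k * (m+3) * (ω * r 0 * Real.log (rH (β 0))) := by gcongr
          _ = _ := by ring
      have h4 := le_of_mul_le_mul_right h3 hlogpos
      rw [div_le_iff₀ (by linarith)]
      refine h4.trans ?_
      gcongr
    -- upper index
    have hup : coeff (Finsupp.cons e n1) (tr β (map (Int.castRingHom ℚ) W)) ≠ 0 := by
      rw [hWQ, tr_sep, coeff_emi_emk]
      exact mul_ne_zero hn1' he2
    -- lower index
    have hlow : Idx (fun i => 1 / (r i : ℝ)) (∑ j : Fin k, max 0 ((ε - ω) - (b j : ℕ) / (r 0:ℝ))) (tr β (map (Int.castRingHom ℚ) W)) := by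
      have h1 : tr β (map (Int.castRingHom ℚ) W) = Matrix.det (Matrix.of (fun i j => hd (Finsupp.cons (b j) (a i)) (tr β PQ))) := by
        rw [hW, RingHom.map_det, AlgHom.map_det]
        congr 1
        ext1 i j
        simp only [hM, AlgHom.mapMatrix_apply, RingHom.mapMatrix_apply, Matrix.map_apply, Matrix.of_apply]
        rw [map_hd, tr_hd]
      rw [h1]
      refine Idx.det _ (fun i j => Idx.max (Idx.nonneg (fun i => by positivity)) ?_)
      have h2 := hIdx.hd (Finsupp.cons (b j) (a i))
      intro n hn
      refine le_trans ?_ (h2 n hn)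
      rw [Fin.sum_univ_succ]
      simp only [Finsupp.cons_zero, Finsupp.cons_succ]
      have h3 : ∑ x : Fin m, 1 / (r x.succ : ℝ) * (a i x : ℝ) ≤ ω := by
        calc ∑ x : Fin m, 1 / (r x.succ : ℝ) * (a i x : ℝ) ≤ ∑ x : Fin m, (ω / r 0) * (a i x : ℝ) := by
              refine Finset.sum_le_sum (fun x _ => ?_)
              apply mul_le_mul_of_nonneg_right _ (by positivity)
              have h4 := hrr 0 x.succ (Fin.succ_pos x)
              have h5 : (0:ℝ) < r x.succ := by exact_mod_cast hr x.succ
              rw [div_le_div_iff₀ h5 (by linarith)]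
              linarith
          _ = (ω / r 0) * ((a i).degree : ℕ) := by
              rw [← Finset.mul_sum, Finsupp.degree_eq_sum]; push_cast; rfl
          _ ≤ (ω / r 0) * r 0 := by
              apply mul_le_mul_of_nonneg_left _ (by positivity)
              have := ha i
              exact_mod_cast (by omega : (a i).degree ≤ r 0)
          _ = ω := by field_simp
      have h6 : 1 / (r 0 : ℝ) * (b j : ℝ) = (b j : ℝ) / r 0 := by ring
      rw [h6]
      linarith
    have h1 := hlow _ hup
    rw [Fin.sum_univ_succ] at h1
    simp only [Finsupp.cons_zero, Finsupp.cons_succ] at h1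
    have h2 := count_lower k (r 0) hk0 hkr (hr 0) (ε - ω) (by linarith) (by linarith)
    have h3 : ∑ j : Fin k, max 0 ((ε - ω) - (b j : ℕ) / (r 0:ℝ)) = ∑ j : Fin k, max 0 ((ε - ω) - (j : ℕ) / (r 0:ℝ)) := by
      exact (Function.Bijective.sum_comp hb'bij (fun j : Fin k => max 0 ((ε - ω) - (j : ℕ) / (r 0:ℝ))))
    rw [h3] at h1
    have h6 : 1 / (r 0 : ℝ) * (e : ℝ) = (e : ℝ) / r 0 := by ring
    rw [h6] at h1
    have h7 : (k:ℝ) * ((ε - ω)^2/8) < k * (ε^2/100) + k * (ε^2/100) := by linarith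
    have h8 : (ε/2)^2 ≤ (ε - ω)^2 := by
      apply pow_le_pow_left₀ (by linarith); linarith
    have h9 : (ε - ω)^2/8 < ε^2/100 + ε^2/100 := by
      rw [← mul_add] at h7
      exact lt_of_mul_lt_mul_left h7 hk0'.le
    nlinarith [sq_nonneg ε, pow_pos hε 2]


/-- submultiplicative seminorm data -/
structure IsV {R : Type*} [CommRing R] (ν : R → ℝ) : Prop where
  nonneg : ∀ x, 0 ≤ ν x
  zero : ν 0 = 0
  add : ∀ x y, ν (x + y) ≤ ν x + ν y
  mul : ∀ x y, ν (x * y) ≤ ν x * ν y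
  one : ν 1 ≤ 1

noncomputable def l1v {σ R : Type*} [CommRing R] (ν : R → ℝ) (P : MvPolynomial σ R) : ℝ :=
  ∑ n ∈ P.support, ν (coeff n P)

section
variable {σ R : Type*} [CommRing R] {ν : R → ℝ}

lemma l1v_nonneg (hν : IsV ν) (P : MvPolynomial σ R) : 0 ≤ l1v ν P :=
  Finset.sum_nonneg fun _ _ => hν.nonneg _

lemma l1v_eq (hν : IsV ν) (P : MvPolynomial σ R) (s : Finset (σ →₀ ℕ)) (h : P.support ⊆ s) :
    l1v ν P = ∑ n ∈ s, ν (coeff n P) := by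
  apply Finset.sum_subset h
  intro n _ hn
  rw [notMem_support_iff.mp hn, hν.zero]

lemma coeff_le_l1v (hν : IsV ν) (P : MvPolynomial σ R) (n) : ν (coeff n P) ≤ l1v ν P := by
  by_cases h : n ∈ P.support
  · exact Finset.single_le_sum (f := fun n => ν (coeff n P)) (fun _ _ => hν.nonneg _) h
  · rw [notMem_support_iff.mp h, hν.zero]; exact l1v_nonneg hν P

lemma l1v_zero : l1v ν (0 : MvPolynomial σ R) = 0 := by simp [l1v]

lemma l1v_add (hν : IsV ν) (P Q : MvPolynomial σ R) : l1v ν (P + Q) ≤ l1v ν P + l1v ν Q := by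
  classical
  rw [l1v_eq hν (P + Q) (P.support ∪ Q.support) support_add,
    l1v_eq hν P (P.support ∪ Q.support) Finset.subset_union_left,
    l1v_eq hν Q (P.support ∪ Q.support) Finset.subset_union_right, ← Finset.sum_add_distrib]
  apply Finset.sum_le_sum
  intro n _
  rw [coeff_add]; exact hν.add _ _

lemma l1v_sum (hν : IsV ν) {ι : Type*} (s : Finset ι) (f : ι → MvPolynomial σ R) :
    l1v ν (∑ i ∈ s, f i) ≤ ∑ i ∈ s, l1v ν (f i) := by
  classical
  induction s using Finset.induction_on with
  | empty => simp [l1v_zero]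
  | insert a s ha ih =>
    rw [Finset.sum_insert ha, Finset.sum_insert ha]
    exact (l1v_add hν _ _).trans (by gcongr)

lemma l1v_monomial (hν : IsV ν) (n : σ →₀ ℕ) (c : R) : l1v ν (monomial n c) = ν c := by
  classical
  rw [l1v_eq hν _ {n} support_monomial_subset]
  simp

lemma l1v_mul (hν : IsV ν) (P Q : MvPolynomial σ R) : l1v ν (P * Q) ≤ l1v ν P * l1v ν Q := by
  classical
  have h : P * Q = ∑ n ∈ P.support, ∑ k ∈ Q.support,
      monomial (n + k) (coeff n P * coeff k Q) := by
    conv_lhs => rw [P.as_sum, Q.as_sum]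
    rw [Finset.sum_mul_sum]
    simp [monomial_mul]
  rw [h]
  refine (l1v_sum hν _ _).trans ?_
  rw [l1v, l1v, Finset.sum_mul_sum]
  apply Finset.sum_le_sum
  intro n _
  refine (l1v_sum hν _ _).trans ?_
  apply Finset.sum_le_sum
  intro k _
  rw [l1v_monomial hν]
  exact hν.mul _ _

lemma l1v_one (hν : IsV ν) : l1v ν (1 : MvPolynomial σ R) ≤ 1 := by
  have : (1 : MvPolynomial σ R) = monomial 0 1 := rfl
  rw [this, l1v_monomial hν]
  exact hν.one

lemma l1v_C (hν : IsV ν) (c : R) : l1v ν (C c : MvPolynomial σ R) = ν c :=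
  l1v_monomial hν 0 c


lemma l1v_CX (hν : IsV ν) (c : R) (i : σ) : l1v ν (C c * X i : MvPolynomial σ R) ≤ ν c := by
  have : (C c * X i : MvPolynomial σ R) = monomial (Finsupp.single i 1) c := by
    rw [C_mul_X_eq_monomial]
  rw [this, l1v_monomial hν]

lemma l1v_pow (hν : IsV ν) (P : MvPolynomial σ R) (k : ℕ) : l1v ν (P ^ k) ≤ l1v ν P ^ k := by
  induction k with
  | zero => simpa using l1v_one hν
  | succ k ih =>
    rw [pow_succ, pow_succ]
    exact (l1v_mul hν _ _).trans (mul_le_mul_of_nonneg_right ih (l1v_nonneg hν P))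

lemma l1v_prod (hν : IsV ν) {ι : Type*} (s : Finset ι) (f : ι → MvPolynomial σ R) :
    l1v ν (∏ i ∈ s, f i) ≤ ∏ i ∈ s, l1v ν (f i) := by
  classical
  induction s using Finset.induction_on with
  | empty => simpa using l1v_one hν
  | insert a s ha ih =>
    rw [Finset.prod_insert ha, Finset.prod_insert ha]
    exact (l1v_mul hν _ _).trans (mul_le_mul_of_nonneg_left ih (l1v_nonneg hν _))

lemma isV_abs : IsV (fun x : ℝ => |x|) where
  nonneg := abs_nonneg
  zero := abs_zero
  add := abs_add_le
  mul x y := (abs_mul x y).le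
  one := by simp

section
attribute [local instance] Matrix.linftyOpNormedRing

/-- the seminorm coming from an integral matrix representation: max row sum -/
noncomputable def nrho {D : ℕ} (ρ : R →+* Matrix (Fin D) (Fin D) ℤ) (x : R) : ℝ :=
  ‖((Int.castRingHom ℝ).mapMatrix) (ρ x)‖

lemma isV_nrho {D : ℕ} (ρ : R →+* Matrix (Fin D) (Fin D) ℤ) : IsV (nrho ρ) where
  nonneg _ := norm_nonneg _
  zero := by simp [nrho]
  add x y := by
    simp only [nrho, map_add]; exact norm_add_le _ _
  mul x y := by
    simp only [nrho, map_mul]; exact norm_mul_le _ _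
  one := by
    simp only [nrho, map_one]
    rcases isEmpty_or_nonempty (Fin D) with h | h
    · rw [Subsingleton.elim (1 : Matrix (Fin D) (Fin D) ℝ) 0, norm_zero]; norm_num
    · rw [Matrix.linfty_opNorm_def]
      norm_cast
      apply Finset.sup_le
      intro i _
      rw [Finset.sum_eq_single i]
      · simp
      · intro b _ hb; simp [Matrix.one_apply_ne (Ne.symm hb)]
      · simp

lemma entry_le_nrho {D : ℕ} (ρ : R →+* Matrix (Fin D) (Fin D) ℤ) (x : R) (k l) :
    |((ρ x k l : ℤ) : ℝ)| ≤ nrho ρ x := by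
  rw [nrho, Matrix.linfty_opNorm_def]
  have h1 : ‖(((Int.castRingHom ℝ).mapMatrix) (ρ x)) k l‖₊ ≤
      Finset.univ.sup fun i => ∑ j, ‖(((Int.castRingHom ℝ).mapMatrix) (ρ x)) i j‖₊ :=
    (Finset.single_le_sum (f := fun j => ‖(((Int.castRingHom ℝ).mapMatrix) (ρ x)) k j‖₊)
      (fun _ _ => zero_le) (Finset.mem_univ l)).trans
      (Finset.le_sup (f := fun i => ∑ j, ‖(((Int.castRingHom ℝ).mapMatrix) (ρ x)) i j‖₊)
        (Finset.mem_univ k))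
  have h2 : (‖(((Int.castRingHom ℝ).mapMatrix) (ρ x)) k l‖₊ : ℝ) ≤ _ := NNReal.coe_le_coe.mpr h1
  simpa using h2
end

end

/-! counting -/
section
variable {N : ℕ}

def EE {m N : ℕ} (d : Fin m → ℕ) : Finset (Fin m → Fin N → ℕ) :=
  Fintype.piFinset (fun h => Finset.piAntidiag Finset.univ (d h))

lemma mem_EE {m N : ℕ} {d : Fin m → ℕ} {e : Fin m → Fin N → ℕ} :
    e ∈ EE d ↔ ∀ h, ∑ i, e h i = d h := by
  simp [EE, Fintype.mem_piFinset, Finset.mem_piAntidiag]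

lemma card_piAntidiag_le (d : ℕ) :
    (Finset.piAntidiag (Finset.univ : Finset (Fin N)) d).card ≤ 2 ^ (N * d) := by
  classical
  have h : Finset.piAntidiag (Finset.univ : Finset (Fin N)) d ⊆
      Fintype.piFinset (fun _ : Fin N => Finset.range (d + 1)) := by
    intro e he
    rw [Finset.mem_piAntidiag] at he
    rw [Fintype.mem_piFinset]
    intro i
    rw [Finset.mem_range, Nat.lt_succ_iff, ← he.1]
    exact Finset.single_le_sum (f := e) (fun _ _ => Nat.zero_le _) (Finset.mem_univ i)
  refine (Finset.card_le_card h).trans ?_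
  rw [Fintype.card_piFinset]
  simp only [Finset.card_range, Finset.prod_const, Finset.card_univ, Fintype.card_fin]
  rw [mul_comm, pow_mul]
  exact Nat.pow_le_pow_left (Nat.lt_two_pow_self) _

lemma card_EE_le {m : ℕ} (d : Fin m → ℕ) : (EE (N := N) d).card ≤ 2 ^ (N * ∑ h, d h) := by
  rw [EE, Fintype.card_piFinset, Finset.mul_sum, ← Finset.prod_pow_eq_pow_sum]
  exact Finset.prod_le_prod' fun h _ => card_piAntidiag_le _

lemma EE_nonempty {m : ℕ} (hN : 0 < N) (d : Fin m → ℕ) : (EE (N := N) d).Nonempty := by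
  refine ⟨fun h i => if i = ⟨0, hN⟩ then d h else 0, ?_⟩
  rw [mem_EE]
  intro h
  simp

lemma sum_coord_swap (d : ℕ) (i j : Fin N) :
    ∑ x ∈ Finset.piAntidiag (Finset.univ : Finset (Fin N)) d, ((x i : ℕ) : ℝ) =
      ∑ x ∈ Finset.piAntidiag (Finset.univ : Finset (Fin N)) d, ((x j : ℕ) : ℝ) := by
  classical
  refine Finset.sum_nbij' (fun x => x ∘ Equiv.swap i j) (fun x => x ∘ Equiv.swap i j) ?_ ?_ ?_ ?_ ?_
  · intro x hx
    simp only [Finset.mem_piAntidiag, Finset.mem_univ, implies_true, and_true] at hx ⊢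
    rw [← hx]
    exact Equiv.sum_comp (Equiv.swap i j) x
  · intro x hx
    simp only [Finset.mem_piAntidiag, Finset.mem_univ, implies_true, and_true] at hx ⊢
    rw [← hx]
    exact Equiv.sum_comp (Equiv.swap i j) x
  · intro x _; funext k; simp
  · intro x _; funext k; simp
  · intro x _; simp

lemma sum_lin_zero (d : ℕ) (c : Fin N → ℝ) (hc : ∑ i, c i = 0) :
    ∑ x ∈ Finset.piAntidiag (Finset.univ : Finset (Fin N)) d, ∑ i, c i * ((x i : ℕ) : ℝ) = 0 := by
  rcases Nat.eq_zero_or_pos N with hN | hN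
  · subst hN; simp
  rw [Finset.sum_comm]
  simp_rw [← Finset.mul_sum]
  have : ∀ i, c i * ∑ x ∈ Finset.piAntidiag (Finset.univ : Finset (Fin N)) d, ((x i : ℕ) : ℝ) =
      c i * ∑ x ∈ Finset.piAntidiag (Finset.univ : Finset (Fin N)) d,
        ((x ⟨0, hN⟩ : ℕ) : ℝ) := by
    intro i; rw [sum_coord_swap d i ⟨0, hN⟩]
  simp_rw [this]
  rw [← Finset.sum_mul, hc, zero_mul]

/-- second moment bound -/
lemma second_moment {m : ℕ} (d : Fin m → ℕ) (c : Fin N → ℝ) (hc : ∑ i, c i = 0) (c0 : ℝ)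
    (hc0 : ∀ i, |c i| ≤ c0) (hd : ∀ h, 0 < d h) :
    ∑ e ∈ EE d, (∑ h, (∑ i, c i * ((e h i : ℕ) : ℝ)) / d h) ^ 2 ≤
      (EE (N := N) d).card * (m * c0 ^ 2) := by
  classical
  set Y : Fin m → (Fin N → ℕ) → ℝ := fun h x => (∑ i, c i * ((x i : ℕ) : ℝ)) / d h with hY
  have hY0 : ∀ h, ∑ x ∈ Finset.piAntidiag (Finset.univ : Finset (Fin N)) (d h), Y h x = 0 := by
    intro h
    rw [hY]
    simp only
    rw [← Finset.sum_div, sum_lin_zero _ c hc, zero_div]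
  have hYb : ∀ e ∈ EE (N := N) d, ∀ h, Y h (e h) ^ 2 ≤ c0 ^ 2 := by
    intro e he h
    have h1 : (∑ i, ((e h i : ℕ) : ℝ)) = d h := by
      have := (mem_EE.mp he) h
      exact_mod_cast this
    have hdh : (0 : ℝ) < d h := by exact_mod_cast hd h
    have h2 : |Y h (e h)| ≤ c0 := by
      rw [hY]
      simp only
      rw [abs_div, abs_of_pos hdh, div_le_iff₀ hdh]
      refine (Finset.abs_sum_le_sum_abs _ _).trans ?_
      rw [← h1, Finset.mul_sum]
      apply Finset.sum_le_sum
      intro i _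
      rw [abs_mul, abs_of_nonneg (a := ((e h i : ℕ) : ℝ)) (Nat.cast_nonneg (e h i))]
      exact mul_le_mul_of_nonneg_right (hc0 i) (Nat.cast_nonneg _)
    exact sq_le_sq' (by linarith [abs_le.mp h2]) (abs_le.mp h2).2
  have hoff : ∀ h h', h ≠ h' → ∑ e ∈ EE (N := N) d, Y h (e h) * Y h' (e h') = 0 := by
    intro h h' hne
    have key := Finset.prod_univ_sum (fun h => Finset.piAntidiag (Finset.univ : Finset (Fin N)) (d h))
      (fun k x => (if k = h then Y h x else 1) * (if k = h' then Y h' x else 1))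
    have h0 : ∏ k, ∑ x ∈ Finset.piAntidiag (Finset.univ : Finset (Fin N)) (d k),
        ((if k = h then Y h x else 1) * (if k = h' then Y h' x else 1)) = 0 := by
      apply Finset.prod_eq_zero (Finset.mem_univ h)
      simp [hne, hY0]
    rw [h0] at key
    rw [EE, key]
    apply Finset.sum_congr rfl
    intro e _
    rw [Finset.prod_mul_distrib]
    simp
  calc ∑ e ∈ EE d, (∑ h, Y h (e h)) ^ 2
      = ∑ h, ∑ h', ∑ e ∈ EE (N := N) d, Y h (e h) * Y h' (e h') := by
        simp_rw [sq, Finset.sum_mul_sum]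
        rw [Finset.sum_comm]
        apply Finset.sum_congr rfl
        intro h _
        rw [Finset.sum_comm]
    _ = ∑ h, ∑ e ∈ EE (N := N) d, Y h (e h) ^ 2 := by
        apply Finset.sum_congr rfl
        intro h _
        rw [Finset.sum_eq_single h]
        · simp_rw [sq]
        · intro b _ hb; exact hoff h b (Ne.symm hb)
        · simp
    _ ≤ ∑ h : Fin m, ∑ e ∈ EE (N := N) d, c0 ^ 2 := by
        apply Finset.sum_le_sum; intro h _
        apply Finset.sum_le_sum; intro e he
        exact hYb e he h
    _ = _ := by simp; ring

lemma bad_card {m : ℕ} (d : Fin m → ℕ) (c : Fin N → ℝ) (hc : ∑ i, c i = 0) (c0 : ℝ)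
    (hc0 : ∀ i, |c i| ≤ c0) (hd : ∀ h, 0 < d h) (ε : ℝ) (hε : 0 < ε) (q : ℝ) (hm : 0 < m)
    (hq : 0 ≤ q) (hmq : q * c0 ^ 2 ≤ ε ^ 2 * m) :
    q * (((EE (N := N) d).filter (fun e => ε * m < ∑ h, (∑ i, c i * ((e h i : ℕ) : ℝ)) / d h)).card : ℝ)
      ≤ (EE (N := N) d).card := by
  classical
  set B := (EE (N := N) d).filter (fun e => ε * m < ∑ h, (∑ i, c i * ((e h i : ℕ) : ℝ)) / d h)
  have h1 : (B.card : ℝ) * (ε * m) ^ 2 ≤ (EE (N := N) d).card * (m * c0 ^ 2) := by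
    refine le_trans ?_ (second_moment d c hc c0 hc0 hd)
    refine le_trans ?_ (Finset.sum_le_sum_of_subset_of_nonneg (Finset.filter_subset _ _)
      (fun _ _ _ => sq_nonneg _) : ∑ e ∈ B, _ ≤ _)
    rw [← nsmul_eq_mul]
    apply Finset.card_nsmul_le_sum
    intro e he
    have := (Finset.mem_filter.mp he).2
    have hm' : (0 : ℝ) < m := by exact_mod_cast hm
    exact pow_le_pow_left₀ (by positivity) this.le 2
  have hm' : (0 : ℝ) < m := by exact_mod_cast hm
  have h2 : (B.card : ℝ) * (ε ^ 2 * m) ≤ (EE (N := N) d).card * c0 ^ 2 := by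
    have : ((B.card : ℝ) * (ε ^ 2 * m)) * m ≤ ((EE (N := N) d).card * c0 ^ 2) * m := by
      nlinarith [h1]
    exact le_of_mul_le_mul_right this hm'
  have h3 : (q * (B.card : ℝ)) * (ε ^ 2 * m) ≤ ((EE (N := N) d).card : ℝ) * (ε ^ 2 * m) := by
    calc (q * (B.card : ℝ)) * (ε ^ 2 * m) = q * ((B.card : ℝ) * (ε ^ 2 * m)) := by ring
      _ ≤ q * ((EE (N := N) d).card * c0 ^ 2) := by gcongr
      _ = (EE (N := N) d).card * (q * c0 ^ 2) := by ring
      _ ≤ _ := by gcongr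
  exact le_of_mul_le_mul_right h3 (by positivity)

end

noncomputable def fs {m N : ℕ} (e : Fin m → Fin N → ℕ) : (Fin m × Fin N) →₀ ℕ :=
  Finsupp.equivFunOnFinite.symm (fun p => e p.1 p.2)

lemma fs_apply {m N : ℕ} (e : Fin m → Fin N → ℕ) (p) : fs e p = e p.1 p.2 := rfl

lemma fs_inj {m N : ℕ} {e e' : Fin m → Fin N → ℕ} (h : fs e = fs e') : e = e' := by
  funext i j
  have := DFunLike.congr_fun h (i, j)
  simpa [fs_apply] using this

lemma fs_surj {m N : ℕ} (n : (Fin m × Fin N) →₀ ℕ) : fs (fun h i => n (h, i)) = n := by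
  ext p; simp [fs_apply]

section
variable {m N : ℕ} {R : Type*} [CommRing R]

noncomputable def Lf (m : ℕ) (a : Matrix (Fin N) (Fin N) R) (p : Fin m × Fin N) :
    MvPolynomial (Fin m × Fin N) R := ∑ i, C (a p.2 i) * X (p.1, i)

noncomputable def ph (m : ℕ) (a : Matrix (Fin N) (Fin N) R) :
    MvPolynomial (Fin m × Fin N) ℤ →+* MvPolynomial (Fin m × Fin N) R :=
  eval₂Hom (Int.castRingHom _) (Lf m a)

lemma ph_X (a : Matrix (Fin N) (Fin N) R) (p) : ph m a (X p) = Lf m a p := by simp [ph]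

lemma map_ph {S : Type*} [CommRing S] (τ : R →+* S) (a : Matrix (Fin N) (Fin N) R) (P) :
    map τ (ph m a P) = ph m (a.map τ) P := by
  have : (map τ).comp (ph m a) = ph m (a.map τ) := by
    apply MvPolynomial.ringHom_ext
    · intro r; simp
    · intro p; simp [ph_X, Lf]
  exact RingHom.congr_fun this P

noncomputable def kap (a : Matrix (Fin N) (Fin N) R) (e : Fin m → Fin N → ℕ) :
    MvPolynomial (Fin m × Fin N) R := ∏ p, Lf m a p ^ (e p.1 p.2)

lemma ph_monomial (a : Matrix (Fin N) (Fin N) R) (e : Fin m → Fin N → ℕ) (t : ℤ) :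
    ph m a (monomial (fs e) t) = C (t : R) * kap a e := by
  rw [ph, coe_eval₂Hom, eval₂_monomial, Finsupp.prod_fintype _ _ (by simp)]
  simp [kap, fs_apply]

lemma kap_hom (a : Matrix (Fin N) (Fin N) R) (e : Fin m → Fin N → ℕ) (j) 
    (hj : coeff j (kap a e) ≠ 0) (h : Fin m) : ∑ i, j (h, i) = ∑ i, e h i := by
  classical
  set w : Fin m × Fin N → (Fin m → ℕ) := fun p => Pi.single p.1 1 with hw
  have h1 : IsWeightedHomogeneous w (kap a e) (∑ p : Fin m × Fin N, e p.1 p.2 • w p) := by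
    unfold kap
    apply IsWeightedHomogeneous.prod
    intro p _
    apply IsWeightedHomogeneous.pow
    unfold Lf
    apply IsWeightedHomogeneous.sum
    intro i _
    have := (isWeightedHomogeneous_C w (a p.2 i)).mul (isWeightedHomogeneous_X R w (p.1, i))
    rw [zero_add] at this
    exact this
  have h2 := h1 hj
  have h3 := congrFun h2 h
  rw [Finsupp.weight_apply, Finsupp.sum_fintype _ _ (by simp)] at h3
  simp [Finset.sum_apply, hw, Pi.single_apply, Fintype.sum_prod_type] at h3
  rw [Finset.sum_comm] at h3
  simpa using h3

lemma l1v_kap {ν : R → ℝ} (hν : IsV ν) (a : Matrix (Fin N) (Fin N) R) (K : ℝ)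
    (hK : ∀ l, ∑ i, ν (a l i) ≤ K) (e : Fin m → Fin N → ℕ) :
    l1v ν (kap a e) ≤ K ^ (∑ h, ∑ i, e h i) := by
  refine (l1v_prod hν _ _).trans ?_
  rw [← Fintype.sum_prod_type' (f := fun h i => e h i), ← Finset.prod_pow_eq_pow_sum]
  apply Finset.prod_le_prod
  · intro p _; exact l1v_nonneg hν _
  intro p _
  refine (l1v_pow hν _ _).trans ?_
  apply pow_le_pow_left₀ (l1v_nonneg hν _)
  refine le_trans ?_ (hK p.2)
  refine (l1v_sum hν _ _).trans ?_
  exact Finset.sum_le_sum fun i _ => l1v_CX hν _ _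

end

attribute [local instance] Matrix.normedAddCommGroup in
/-- Siegel's lemma in a convenient form -/
lemma siegel {α β : Type*} [Fintype α] [Fintype β] [DecidableEq β] (A : Matrix α β ℤ) (K : ℝ)
    (hK : 1 ≤ K) (hA : ∀ i j, |((A i j : ℤ) : ℝ)| ≤ K) (h0 : 0 < Fintype.card β)
    (hc : 2 * Fintype.card α ≤ Fintype.card β) :
    ∃ t : β → ℤ, t ≠ 0 ∧ A.mulVec t = 0 ∧ ∀ j, |((t j : ℤ) : ℝ)| ≤ Fintype.card β * K := by
  have hb1 : (1 : ℝ) ≤ Fintype.card β := by exact_mod_cast h0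
  rcases Nat.eq_zero_or_pos (Fintype.card α) with h | h
  · haveI : IsEmpty α := Fintype.card_eq_zero_iff.mp h
    haveI : Nonempty β := Fintype.card_pos_iff.mp h0
    refine ⟨fun _ => 1, ?_, ?_, ?_⟩
    · intro h; simpa using congrFun h (Classical.arbitrary β)
    · funext i; exact isEmptyElim i
    · intro j; simp; nlinarith
  · obtain ⟨t, ht, hm, hn⟩ := Int.Matrix.exists_ne_zero_int_vec_norm_le A (by omega) h
    refine ⟨t, ht, hm, fun j => ?_⟩
    have h1 : |((t j : ℤ) : ℝ)| ≤ ‖t‖ := by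
      have := norm_le_pi_norm t j
      rwa [Int.norm_eq_abs] at this
    refine h1.trans (hn.trans ?_)
    have h2 : max 1 ‖A‖ ≤ K := by
      apply max_le hK
      rw [Matrix.norm_le_iff (by linarith)]
      intro i j
      rw [Int.norm_eq_abs]; exact hA i j
    have h3 : 1 ≤ (Fintype.card β : ℝ) * max 1 ‖A‖ := by
      nlinarith [le_max_left 1 ‖A‖]
    have hc' : 2 * (Fintype.card α : ℝ) ≤ Fintype.card β := by exact_mod_cast hc
    have ha : (0 : ℝ) < Fintype.card α := by exact_mod_cast h
    calc _ ≤ ((Fintype.card β : ℝ) * max 1 ‖A‖) ^ (1 : ℝ) := by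
          apply Real.rpow_le_rpow_of_exponent_le h3
          rw [div_le_one (by linarith)]
          linarith
      _ ≤ _ := by rw [Real.rpow_one]; gcongr

theorem aux_poly {N D : ℕ} (hN : 0 < N) {S : Type*} [CommRing S] (τ : S →+* ℝ)
    (ρ : S →+* Matrix (Fin D) (Fin D) ℤ) (hρ : Function.Injective ρ)
    (a : Matrix (Fin N) (Fin N) S) :
    ∃ K : ℝ, 1 ≤ K ∧ ∀ c : Fin N → ℝ, ∑ i, c i = 0 → ∀ ε : ℝ, 0 < ε → ∃ m0 : ℕ, ∀ m, m0 ≤ m →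
      ∀ d : Fin m → ℕ, (∀ h, 0 < d h) → ∃ P : MvPolynomial (Fin m × Fin N) ℤ, P ≠ 0 ∧
        (∀ e ∈ P.support, ∀ h, ∑ i, e (h, i) = d h) ∧
        l1 P ≤ K ^ (∑ h, d h) ∧
        (∀ j ∈ (ph m (a.map τ) P).support, (∀ h, ∑ i, j (h, i) = d h) ∧
          ∑ h, (∑ i, c i * ((j (h, i) : ℕ) : ℝ)) / d h ≤ ε * m) ∧
        l1v (fun x : ℝ => |x|) (ph m (a.map τ) P) ≤ K ^ (∑ h, d h) := by
  classical
  set ν := nrho ρ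
  have hν : IsV ν := isV_nrho ρ
  set K0 : ℝ := 1 + ∑ l, (∑ i, ν (a l i) + ∑ i, |τ (a l i)|) with hK0
  have hpos : ∀ l, 0 ≤ (∑ i, ν (a l i) + ∑ i, |τ (a l i)|) := fun l =>
    add_nonneg (Finset.sum_nonneg fun _ _ => hν.nonneg _) (Finset.sum_nonneg fun _ _ => abs_nonneg _)
  have hle : ∀ l, (∑ i, ν (a l i) + ∑ i, |τ (a l i)|) ≤ K0 := fun l => by
    have := Finset.single_le_sum (f := fun l => (∑ i, ν (a l i) + ∑ i, |τ (a l i)|))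
      (fun l _ => hpos l) (Finset.mem_univ l)
    beta_reduce at this
    linarith
  have hK1 : 1 ≤ K0 := by
    have := Finset.sum_nonneg (s := Finset.univ) fun l _ => hpos l
    linarith
  have hKν : ∀ l, ∑ i, ν (a l i) ≤ K0 := fun l => by
    have := Finset.sum_nonneg (s := Finset.univ) fun i _ => abs_nonneg (τ (a l i))
    linarith [hle l]
  have hKτ : ∀ l, ∑ i, |(a.map τ) l i| ≤ K0 := fun l => by
    have := Finset.sum_nonneg (s := Finset.univ) fun i _ => hν.nonneg (a l i)
    change (∑ i, |τ (a l i)|) ≤ K0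
    linarith [hle l]
  refine ⟨4 ^ N * K0 ^ 2, ?_, ?_⟩
  · have : (1 : ℝ) ≤ 4 ^ N := one_le_pow₀ (by norm_num)
    nlinarith [one_le_pow₀ (n := 2) hK1]
  intro c hc ε hε
  set c0 : ℝ := ∑ i, |c i|
  have hc0 : ∀ i, |c i| ≤ c0 := fun i =>
    Finset.single_le_sum (f := fun i => |c i|) (fun _ _ => abs_nonneg _) (Finset.mem_univ i)
  obtain ⟨m0, hm0⟩ := exists_nat_ge (2 * (D : ℝ) ^ 2 * c0 ^ 2 / ε ^ 2)
  refine ⟨m0 + 1, ?_⟩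
  intro m hm d hd
  set E := EE (N := N) d with hE
  set B := E.filter (fun e => ε * m < ∑ h, (∑ i, c i * ((e h i : ℕ) : ℝ)) / d h) with hB
  have hBc := bad_card (N := N) d c hc c0 hc0 hd ε hε (2 * (D : ℝ) ^ 2) (by omega) (by positivity) (by
    rw [div_le_iff₀ (by positivity)] at hm0
    have : (m0 : ℝ) ≤ m := by exact_mod_cast (by omega : m0 ≤ m)
    nlinarith [sq_nonneg ε])
  set A : Matrix (B × Fin D × Fin D) E ℤ :=
    fun x e => ρ (coeff (fs x.1.1) (kap a e.1)) x.2.1 x.2.2 with hA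
  set s := ∑ h, d h with hs
  have hsum : ∀ e ∈ E, ∑ h, ∑ i, e h i = s := by
    intro e he
    rw [hs]
    exact Finset.sum_congr rfl fun h _ => mem_EE.mp he h
  obtain ⟨t, ht0, htm, htb⟩ := siegel A (K0 ^ s) (one_le_pow₀ hK1) (by
    intro x e
    refine (entry_le_nrho ρ _ _ _).trans ?_
    refine (coeff_le_l1v hν _ _).trans ?_
    have := l1v_kap hν a K0 hKν e.1
    rwa [hsum e.1 e.2] at this) (by
      rw [Fintype.card_coe]; exact Finset.card_pos.mpr (EE_nonempty hN d)) (by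
      simp only [Fintype.card_prod, Fintype.card_coe, Fintype.card_fin]
      have : 2 * ((B.card : ℝ) * (D * D)) ≤ E.card := by
        rw [hB, hE]; nlinarith [hBc]
      exact_mod_cast this)
  rw [Fintype.card_coe] at htb
  set P : MvPolynomial (Fin m × Fin N) ℤ := ∑ e : E, monomial (fs e.1) (t e) with hP
  have hcP : ∀ e : E, coeff (fs e.1) P = t e := by
    intro e
    rw [hP, coeff_sum, Finset.sum_eq_single e]
    · simp
    · intro b _ hb
      rw [coeff_monomial, if_neg]
      intro h; exact hb (Subtype.ext (fs_inj h))
    · simp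
  have hphat : ∀ {R : Type _} [CommRing R] (b : Matrix (Fin N) (Fin N) R),
      ph m b P = ∑ e : E, C ((t e : ℤ) : R) * kap b e.1 := by
    intro R _ b
    rw [hP, map_sum]
    exact Finset.sum_congr rfl fun e _ => ph_monomial b e.1 (t e)
  have hphR : ph m (a.map τ) P = ∑ e : E, C ((t e : ℤ) : ℝ) * kap (a.map τ) e.1 := by
    rw [hP, map_sum]
    exact Finset.sum_congr rfl fun e _ => ph_monomial _ e.1 (t e)
  have hEc : (E.card : ℝ) ≤ (2 ^ N) ^ s := by
    rw [← pow_mul]; exact_mod_cast card_EE_le d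
  have hEc0 : (0 : ℝ) ≤ E.card := Nat.cast_nonneg _
  have hsumt : ∑ e : E, |((t e : ℤ) : ℝ)| ≤ (4 ^ N * K0) ^ s := by
    calc ∑ e : E, |((t e : ℤ) : ℝ)| ≤ ∑ e : E, (E.card * K0 ^ s) := Finset.sum_le_sum fun e _ => htb e
      _ = E.card * (E.card * K0 ^ s) := by simp
      _ ≤ (2 ^ N) ^ s * ((2 ^ N) ^ s * K0 ^ s) := by gcongr
      _ = _ := by
        have h4 : (4 : ℝ) ^ N = 2 ^ N * 2 ^ N := by rw [← mul_pow]; norm_num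
        rw [h4, mul_pow, mul_pow, mul_assoc]
  have hK2 : (4 ^ N * K0) ^ s ≤ (4 ^ N * K0 ^ 2) ^ s := by
    gcongr; nlinarith
  refine ⟨P, ?_, ?_, ?_, ?_, ?_⟩
  · intro h
    apply ht0
    funext e
    rw [← hcP e, h]; simp
  · intro e he h
    have : e ∈ (Finset.univ.biUnion fun e : E => (monomial (fs e.1) (t e)).support) :=
      support_sum he
    rw [Finset.mem_biUnion] at this
    obtain ⟨e', _, he'⟩ := this
    have h2 := support_monomial_subset he'
    rw [Finset.mem_singleton] at h2
    rw [h2]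
    exact mem_EE.mp e'.2 h
  · refine le_trans ?_ (hsumt.trans hK2)
    rw [hP]
    refine (l1_sum _ _).trans ?_
    apply Finset.sum_le_sum
    intro e _
    rw [l1_monomial]
  · intro j hj
    have hj' : coeff j (ph m (a.map τ) P) ≠ 0 := mem_support_iff.mp hj
    have h1 : ∀ h, ∑ i, j (h, i) = d h := by
      intro h
      by_contra hcon
      apply hj'
      rw [hphR, coeff_sum]
      apply Finset.sum_eq_zero
      intro e _
      rw [coeff_C_mul]
      by_contra h0
      have := kap_hom (a.map τ) e.1 j (right_ne_zero_of_mul h0) h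
      rw [mem_EE.mp e.2 h] at this
      exact hcon this
    refine ⟨h1, ?_⟩
    by_contra hcon
    push Not at hcon
    apply hj'
    rw [← map_ph, coeff_map]
    have : coeff j (ph m a P) = 0 := by
      apply hρ
      rw [map_zero]
      have hjB : (fun h i => j (h, i)) ∈ B := by
        rw [hB, Finset.mem_filter]
        exact ⟨mem_EE.mpr h1, hcon⟩
      ext k l
      have h2 := congrFun htm (⟨_, hjB⟩, k, l)
      rw [Matrix.mulVec, dotProduct] at h2
      simp only [hA, fs_surj] at h2
      rw [hphat a, coeff_sum]
      simp only [coeff_C_mul]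
      simp only [map_sum, map_mul, map_intCast]
      rw [Matrix.sum_apply]
      simp only [Matrix.zero_apply]
      rw [Pi.zero_apply] at h2
      rw [← h2]
      apply Finset.sum_congr rfl
      intro e _
      rw [← zsmul_eq_mul, Matrix.smul_apply, smul_eq_mul, mul_comm]
    rw [this, map_zero]
  · rw [hphR]
    refine (l1v_sum isV_abs _ _).trans ?_
    calc _ ≤ ∑ e : E, |((t e : ℤ) : ℝ)| * K0 ^ s := by
          apply Finset.sum_le_sum
          intro e _
          refine (l1v_mul isV_abs _ _).trans ?_
          rw [l1v_C isV_abs]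
          gcongr
          have := l1v_kap isV_abs (a.map τ) K0 hKτ e.1
          rwa [hsum e.1 e.2] at this
      _ = (∑ e : E, |((t e : ℤ) : ℝ)|) * K0 ^ s := by rw [Finset.sum_mul]
      _ ≤ (4 ^ N * K0) ^ s * K0 ^ s := by gcongr
      _ = _ := by rw [← mul_pow]; ring_nf

section
variable {m n N : ℕ}

noncomputable def gpt (x : Fin m → Fin n → Fin N → ℤ) (l0 : Fin N) (p : Fin m × Fin N) :
    MvPolynomial ((Fin m × Fin n) ⊕ Fin m) ℤ :=
  ∑ k, C (x p.1 k p.2) * X (Sum.inl (p.1, k)) + if p.2 = l0 then X (Sum.inr p.1) else 0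

/-- the auxiliary variables -/
noncomputable def VV (m : ℕ) (l0 s : Fin N) (p : Fin m × Fin N) :
    MvPolynomial (Fin m × Fin N) (MvPolynomial (Fin m) ℚ) :=
  if p.2 = s then 1 else if p.2 = l0 then 0 else X p

noncomputable def pt (hv : Fin m → Fin N → ℤ) (l0 s : Fin N) (p : Fin m × Fin N) :
    MvPolynomial (Fin m × Fin N) (MvPolynomial (Fin m) ℚ) :=
  if p.2 = l0 then C (X p.1) - ∑ l, C (C ((hv p.1 l : ℚ) / hv p.1 l0)) * VV m l0 s (p.1, l)
  else VV m l0 s p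

noncomputable def PhiT (hv : Fin m → Fin N → ℤ) (l0 s : Fin N) :
    MvPolynomial (Fin m × Fin N) ℤ →+* MvPolynomial (Fin m × Fin N) (MvPolynomial (Fin m) ℚ) :=
  eval₂Hom (Int.castRingHom _) (pt hv l0 s)

noncomputable def rest (l0 s : Fin N) (e : Fin m × Fin N →₀ ℕ) : Fin m × Fin N →₀ ℕ :=
  e.filter (fun p => p.2 ≠ l0 ∧ p.2 ≠ s)

noncomputable def nn (l0 : Fin N) (e : Fin m × Fin N →₀ ℕ) : Fin m →₀ ℕ :=
  Finsupp.equivFunOnFinite.symm (fun h => e (h, l0))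

lemma rest_nn_inj {l0 s : Fin N} (hls : l0 ≠ s) {d : Fin m → ℕ} {e e' : Fin m × Fin N →₀ ℕ}
    (he : ∀ h, ∑ i, e (h, i) = d h) (he' : ∀ h, ∑ i, e' (h, i) = d h)
    (h1 : rest l0 s e = rest l0 s e') (h2 : nn l0 e = nn l0 e') : e = e' := by
  classical
  have hl0 : ∀ h, e (h, l0) = e' (h, l0) := fun h => DFunLike.congr_fun h2 h
  have hr : ∀ h l, l ≠ l0 → l ≠ s → e (h, l) = e' (h, l) := by
    intro h l a b
    have := DFunLike.congr_fun h1 (h, l)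
    simpa [rest, Finsupp.filter_apply, a, b] using this
  have hs : ∀ h, e (h, s) = e' (h, s) := by
    intro h
    have a := he h
    have b := he' h
    rw [← Finset.add_sum_erase _ _ (Finset.mem_univ s)] at a b
    have : ∑ x ∈ Finset.univ.erase s, e (h, x) = ∑ x ∈ Finset.univ.erase s, e' (h, x) := by
      apply Finset.sum_congr rfl
      intro l hl
      by_cases hh : l = l0
      · rw [hh]; exact hl0 h
      · exact hr h l hh (Finset.ne_of_mem_erase hl)
    omega
  ext ⟨h, l⟩
  by_cases a : l = l0
  · rw [a]; exact hl0 h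
  by_cases b : l = s
  · rw [b]; exact hs h
  exact hr h l a b

lemma PhiT_monomial (hv : Fin m → Fin N → ℤ) {l0 s : Fin N} (hls : l0 ≠ s)
    (e : Fin m × Fin N →₀ ℕ) (t : ℤ) :
    ∃ F : MvPolynomial (Fin m × Fin N) (MvPolynomial (Fin m) ℚ),
      PhiT hv l0 s (monomial e t) = monomial (rest l0 s e) 1 * F ∧
      constantCoeff F = tr (fun h => - ((hv h s : ℚ) / hv h l0))
        (monomial (nn l0 e) (t : ℚ)) := by
  classical
  refine ⟨C (C (t : ℚ)) * ∏ h, (pt hv l0 s (h, l0)) ^ e (h, l0), ?_, ?_⟩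
  · rw [PhiT, coe_eval₂Hom, eval₂_monomial, Finsupp.prod_fintype _ _ (by simp)]
    have h1 : ∀ p : Fin m × Fin N, pt hv l0 s p ^ e p =
        (if p.2 = l0 then pt hv l0 s p ^ e p else 1) * X p ^ (rest l0 s e p) := by
      intro p
      by_cases hp : p.2 = l0
      · simp [hp, rest]
      · by_cases hps : p.2 = s
        · have h0 : pt hv l0 s p = 1 := by rw [pt, if_neg hp, VV, if_pos hps]
          have h1 : rest l0 s e p = 0 := by
            rw [rest, Finsupp.filter_apply, if_neg]; exact fun h => h.2 hps
          rw [h0, h1, if_neg hp]; simp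
        · have h0 : pt hv l0 s p = X p := by rw [pt, if_neg hp, VV, if_neg hps, if_neg hp]
          have h1 : rest l0 s e p = e p := by
            rw [rest, Finsupp.filter_apply, if_pos ⟨hp, hps⟩]
          rw [h0, h1, if_neg hp, one_mul]
    rw [Finset.prod_congr rfl fun p _ => h1 p, Finset.prod_mul_distrib]
    have h2 : ∏ p : Fin m × Fin N, (X p : MvPolynomial (Fin m × Fin N) (MvPolynomial (Fin m) ℚ)) ^
        (rest l0 s e p) = monomial (rest l0 s e) 1 := by
      rw [monomial_eq, Finsupp.prod_fintype _ _ (by simp)]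
      simp
    have h3 : ∏ p : Fin m × Fin N, (if p.2 = l0 then pt hv l0 s p ^ e p else 1) =
        ∏ h, (pt hv l0 s (h, l0)) ^ e (h, l0) := by
      rw [Fintype.prod_prod_type]
      simp
    rw [h2, h3]
    have h4 : (Int.castRingHom (MvPolynomial (Fin m × Fin N) (MvPolynomial (Fin m) ℚ))) t
        = C (C (t : ℚ)) := by simp
    rw [h4]
    ring
  · have h0 : ∀ h, constantCoeff (pt hv l0 s (h, l0)) =
        X h + C (- ((hv h s : ℚ) / hv h l0)) := by
      intro h
      simp only [pt, if_true, map_sub, map_sum, map_mul, constantCoeff_C]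
      rw [Finset.sum_eq_single s]
      · simp [VV, sub_eq_add_neg]
      · intro l _ hl
        by_cases hl0 : l = l0
        · subst hl0; simp [VV, hl]
        · simp [VV, hl, hl0]
      · simp
    rw [map_mul, map_prod]
    simp only [map_pow, h0, constantCoeff_C]
    rw [monomial_eq, Finsupp.prod_fintype _ _ (by simp)]
    simp [tr, nn]

lemma coeff_PhiT (hv : Fin m → Fin N → ℤ) {l0 s : Fin N} (hls : l0 ≠ s)
    (e : Fin m × Fin N →₀ ℕ) (t : ℤ) (μ : Fin m × Fin N →₀ ℕ)
    (hμ : μ.degree ≤ (rest l0 s e).degree) :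
    coeff μ (PhiT hv l0 s (monomial e t)) = if rest l0 s e = μ then
      tr (fun h => - ((hv h s : ℚ) / hv h l0)) (monomial (nn l0 e) (t : ℚ)) else 0 := by
  classical
  obtain ⟨F, h1, h2⟩ := PhiT_monomial hv hls e t
  rw [h1, coeff_monomial_mul', one_mul]
  by_cases h : rest l0 s e = μ
  · rw [if_pos h, if_pos h.le, h, tsub_self, ← h2]; rfl
  · rw [if_neg h, if_neg]
    intro hle
    apply h
    obtain ⟨ν, rfl⟩ := exists_add_of_le hle
    rw [map_add] at hμ
    have : ν.degree = 0 := by omega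
    rw [Finsupp.degree_eq_zero_iff] at this
    simp [this]

/-- the algebraic core -/
theorem index_core (hv : Fin m → Fin N → ℤ) (x : Fin m → Fin n → Fin N → ℤ) {l0 s : Fin N}
    (hls : l0 ≠ s)
    (hspan : ∀ h l, ∃ u : Fin n → ℚ, ∀ l', (if l' = l then (1 : ℚ) else 0) -
      (if l' = l0 then (hv h l : ℚ) / hv h l0 else 0) = ∑ k, u k * x h k l')
    (hl0 : ∀ h, hv h l0 ≠ 0)
    (d : Fin m → ℕ) (P : MvPolynomial (Fin m × Fin N) ℤ) (hP : P ≠ 0)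
    (hhom : ∀ e ∈ P.support, ∀ h, ∑ i, e (h, i) = d h) (W : (Fin m →₀ ℕ) → Prop)
    (hW : ∀ j : ((Fin m × Fin n) ⊕ Fin m) →₀ ℕ, coeff j (bind₁ (gpt x l0) P) ≠ 0 →
      W (Finsupp.equivFunOnFinite.symm (fun h => j (Sum.inr h)))) :
    ∃ p : MvPolynomial (Fin m) ℤ, p ≠ 0 ∧ l1 p ≤ l1 P ∧ (∀ h, degreeOf h p ≤ d h) ∧
      ∀ i, coeff i (tr (fun h => - ((hv h s : ℚ) / hv h l0)) (map (Int.castRingHom ℚ) p)) ≠ 0 →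
        W i := by
  classical
  choose u hu using hspan
  obtain ⟨e0, he0, hmin⟩ := Finset.exists_min_image P.support (fun e => (rest l0 s e).degree)
    (support_nonempty.mpr hP)
  set μ := rest l0 s e0 with hμ
  set A := P.support.filter (fun e => rest l0 s e = μ) with hA
  set p : MvPolynomial (Fin m) ℤ := ∑ e ∈ A, monomial (nn l0 e) (coeff e P) with hp
  have hinj : ∀ e ∈ A, ∀ e' ∈ A, nn l0 e = nn l0 e' → e = e' := by
    intro e he e' he' h
    rw [hA, Finset.mem_filter] at he he'
    exact rest_nn_inj hls (hhom e he.1) (hhom e' he'.1) (he.2.trans he'.2.symm) h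
  have hco : coeff μ (PhiT hv l0 s P) =
      tr (fun h => - ((hv h s : ℚ) / hv h l0)) (map (Int.castRingHom ℚ) p) := by
    conv_lhs => rw [P.as_sum]
    rw [map_sum, coeff_sum, hp, map_sum, map_sum, hA, Finset.sum_filter]
    apply Finset.sum_congr rfl
    intro e he
    rw [coeff_PhiT hv hls e _ μ (hmin e he), map_monomial]
    rfl
  -- Φ_T factors through G
  set U : Fin m × Fin n → MvPolynomial (Fin m × Fin N) ℚ := fun q =>
    ∑ l, C (u q.1 l q.2) * (if l = s then 1 else if l = l0 then 0 else X (q.1, l)) with hU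
  set ψ : MvPolynomial ((Fin m × Fin n) ⊕ Fin m) ℤ →+*
      MvPolynomial (Fin m × Fin N) (MvPolynomial (Fin m) ℚ) :=
    eval₂Hom (Int.castRingHom _) (Sum.elim (fun q => map C (U q)) (fun h => C (X h))) with hψ
  have hfac : PhiT hv l0 s P = ψ (bind₁ (gpt x l0) P) := by
    have : PhiT hv l0 s = ψ.comp (bind₁ (gpt x l0)).toRingHom := by
      apply MvPolynomial.ringHom_ext
      · intro r; simp
      · rintro ⟨h, l'⟩
        have e1 : ψ (bind₁ (gpt x l0) (X (h, l'))) =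
            (∑ k, C (C (x h k l' : ℚ)) * map C (U (h, k))) + if l' = l0 then C (X h) else 0 := by
          rw [bind₁_X_right, gpt, hψ, map_add, map_sum]
          congr 1
          · apply Finset.sum_congr rfl
            intro k _
            rw [map_mul]
            simp only [coe_eval₂Hom, eval₂_C, eval₂_X, Sum.elim_inl]
            simp
          · by_cases hh : l' = l0 <;> simp [hh]
        have e2 : ∀ q, map C (U q) = ∑ l, C (C (u q.1 l q.2)) * VV m l0 s (q.1, l) := by
          intro q
          rw [hU]
          simp only [map_sum, map_mul, map_C]
          apply Finset.sum_congr rfl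
          intro l _
          congr 1
          unfold VV
          split_ifs <;> simp
        have e3 : (∑ k, C (C (x h k l' : ℚ)) * map C (U (h, k))) =
            ∑ l, C (C ((if l' = l then (1 : ℚ) else 0) -
              (if l' = l0 then (hv h l : ℚ) / hv h l0 else 0))) * VV m l0 s (h, l) := by
          simp_rw [e2, Finset.mul_sum]
          rw [Finset.sum_comm]
          apply Finset.sum_congr rfl
          intro l _
          rw [hu h l l', map_sum, map_sum, Finset.sum_mul]
          apply Finset.sum_congr rfl
          intro k _
          rw [map_mul, map_mul]; ring
        have e4 : (PhiT hv l0 s) (X (h, l')) = pt hv l0 s (h, l') := by simp [PhiT]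
        have e5 : (ψ.comp (bind₁ (gpt x l0)).toRingHom) (X (h, l')) =
          ψ (bind₁ (gpt x l0) (X (h, l'))) := rfl
        rw [e4, e5, e1, e3]
        by_cases hh : l' = l0
        · subst hh
          simp only [pt, if_true, map_sub, sub_mul, Finset.sum_sub_distrib]
          have h9 : ∑ l, C (C (if l' = l then (1 : ℚ) else 0)) * VV m l' s (h, l) = 0 := by
            rw [Finset.sum_eq_single l']
            · have : VV m l' s (h, l') = 0 := by simp [VV, hls]
              rw [this]; ring
            · intro b _ hb; simp [hb.symm]
            · simp
          rw [h9]; ring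
        · simp only [pt, hh, if_false, sub_zero, add_zero]
          rw [Finset.sum_eq_single l']
          · simp
          · intro b _ hb; simp [hb.symm]
          · simp
    rw [this]; rfl
  refine ⟨p, ?_, ?_, ?_, ?_⟩
  · have hc : coeff (nn l0 e0) p = coeff e0 P := by
      have he0A : e0 ∈ A := by rw [hA, Finset.mem_filter]; exact ⟨he0, rfl⟩
      rw [hp, coeff_sum, Finset.sum_eq_single e0]
      · simp
      · intro b hb hne
        rw [coeff_monomial, if_neg]
        intro h; exact hne (hinj b hb e0 he0A h)
      · intro h; exact absurd he0A h
    intro h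
    rw [h, coeff_zero] at hc
    exact (mem_support_iff.mp he0) hc.symm
  · rw [hp]
    refine (l1_sum _ _).trans ?_
    simp_rw [l1_monomial]
    rw [l1, hA]
    exact Finset.sum_le_sum_of_subset_of_nonneg (Finset.filter_subset _ _) (fun _ _ _ => abs_nonneg _)
  · intro h
    rw [degreeOf_le_iff]
    intro i hi
    have : i ∈ A.biUnion fun e => (monomial (nn l0 e) (coeff e P)).support := support_sum hi
    rw [Finset.mem_biUnion] at this
    obtain ⟨e', he', hi'⟩ := this
    have h2 := support_monomial_subset hi'
    rw [Finset.mem_singleton] at h2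
    rw [h2, ← hhom e' (Finset.mem_filter.mp he').1 h]
    exact Finset.single_le_sum (f := fun i => e' (h, i)) (fun _ _ => Nat.zero_le _) (Finset.mem_univ l0)
  · intro i hi
    rw [← hco, hfac] at hi
    set G := bind₁ (gpt x l0) P with hG
    rw [G.as_sum, map_sum, coeff_sum, coeff_sum] at hi
    obtain ⟨j, hj, hji⟩ := Finset.exists_ne_zero_of_sum_ne_zero hi
    have e1 : ψ (monomial j (coeff j G)) = map C (C ((coeff j G : ℤ) : ℚ) * ∏ q, U q ^ j (Sum.inl q)) *
        C (monomial (Finsupp.equivFunOnFinite.symm (fun h => j (Sum.inr h))) 1) := by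
      rw [hψ, coe_eval₂Hom, eval₂_monomial, Finsupp.prod_fintype _ _ (by simp), Fintype.prod_sum_type]
      rw [monomial_eq, Finsupp.prod_fintype _ _ (by simp)]
      simp [mul_assoc]
    rw [e1, mul_comm, coeff_C_mul, coeff_map, mul_comm, coeff_C_mul, coeff_monomial] at hji
    have h3 : (Finsupp.equivFunOnFinite.symm (fun h => j (Sum.inr h))) = i := by
      by_contra hne
      rw [if_neg hne, mul_zero] at hji
      exact hji rfl
    rw [← h3]
    exact hW j (mem_support_iff.mp hj)

end

lemma coeff_scale {σ : Type*} [Fintype σ] (w : σ → ℝ) (F : MvPolynomial σ ℝ) (j : σ →₀ ℕ) :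
    coeff j (aeval (fun i => C (w i) * X i) F) = (∏ i, w i ^ j i) * coeff j F := by
  classical
  induction F using MvPolynomial.induction_on' with
  | monomial u a =>
    have : aeval (fun i => C (w i) * X i) (monomial u a) = monomial u ((∏ i, w i ^ u i) * a) := by
      rw [aeval_monomial, Finsupp.prod_fintype _ _ (by simp)]
      simp_rw [mul_pow]
      rw [Finset.prod_mul_distrib]
      rw [monomial_eq, Finsupp.prod_fintype _ _ (by simp)]
      simp only [map_mul, map_prod, map_pow, algebraMap_eq]
      ring
    rw [this, coeff_monomial, coeff_monomial]
    split_ifs with h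
    · rw [h]
    · simp
  | add p q hp hq => rw [map_add, coeff_add, hp, hq, coeff_add, mul_add]

lemma l1v_eval {σ σ' : Type*} [Fintype σ] (g : σ → MvPolynomial σ' ℝ) (F : MvPolynomial σ ℝ) (M : ℝ)
    (hM : ∀ e ∈ F.support, ∏ p, l1v (fun x : ℝ => |x|) (g p) ^ e p ≤ M) :
    l1v (fun x : ℝ => |x|) (aeval g F) ≤ l1v (fun x : ℝ => |x|) F * M := by
  conv_lhs => rw [F.as_sum]
  rw [map_sum]
  refine (l1v_sum isV_abs _ _).trans ?_
  rw [l1v, Finset.sum_mul]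
  apply Finset.sum_le_sum
  intro e he
  rw [aeval_monomial, Finsupp.prod_fintype _ _ (by simp)]
  refine (l1v_mul isV_abs _ _).trans ?_
  rw [algebraMap_eq, l1v_C isV_abs]
  apply mul_le_mul_of_nonneg_left _ (abs_nonneg _)
  refine le_trans ?_ (hM e he)
  refine (l1v_prod isV_abs _ _).trans ?_
  apply Finset.prod_le_prod
  · intro p _; exact l1v_nonneg isV_abs _
  · intro p _; exact l1v_pow isV_abs _ _

theorem vanish {m n N : ℕ} (A L : Matrix (Fin N) (Fin N) ℝ) (hAL : A * L = 1)
    (d : Fin m → ℕ) (hd : ∀ h, 0 < d h) (P : MvPolynomial (Fin m × Fin N) ℤ)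
    (K Λ : ℝ) (hK : 1 ≤ K) (c : Fin N → ℝ) (c0 ε δ θ R : ℝ) (hc0 : ∀ i, |c i| ≤ c0)
    (hδ : 0 < δ) (hθ : θ ≤ 1) (hR : 0 ≤ R) (hc00 : 0 ≤ c0)
    (l0 : Fin N) (hΛ1 : 1 ≤ Λ) (hΛ : ∀ i, |L i l0| ≤ Λ)
    (hl1 : l1v (fun x : ℝ => |x|) (ph m A P) ≤ K ^ (∑ h, d h))
    (hsup : ∀ j ∈ (ph m A P).support, (∀ h, ∑ i, j (h, i) = d h) ∧
          ∑ h, (∑ i, c i * ((j (h, i) : ℕ) : ℝ)) / d h ≤ ε * m)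
    (q : Fin m → ℝ) (hq : ∀ h, 0 ≤ q h) (x : Fin m → Fin n → Fin N → ℤ)
    (hx : ∀ h k i, |∑ l, L i l * (x h k l : ℝ)| ≤ Real.exp (q h * (c i - δ)))
    (hdq1 : ∀ h, R ≤ d h * q h) (hdq2 : ∀ h, d h * q h ≤ R + q h)
    (hfin : (∑ h, (d h : ℝ)) * Real.log (K * (n + Λ)) + R * ε * m + c0 * ∑ h, q h - δ * R * m
      + (c0 + δ) * (R * θ + ∑ h, q h) < 0)
    (j : ((Fin m × Fin n) ⊕ Fin m) →₀ ℕ) (hj : ∑ h, (j (Sum.inr h) : ℝ) / d h < θ) :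
    coeff j (bind₁ (gpt x l0) P) = 0 := by
  classical
  have hdp : ∀ h, (0 : ℝ) < d h := fun h => by exact_mod_cast hd h
  set b : Fin m → ℝ := fun h => Real.exp (- (q h * (c0 + δ))) with hb
  set w : ((Fin m × Fin n) ⊕ Fin m) → ℝ := Sum.elim (fun _ => 1) b with hw
  set g : Fin m × Fin N → MvPolynomial ((Fin m × Fin n) ⊕ Fin m) ℝ := fun p =>
    ∑ k, C (∑ l, L p.2 l * (x p.1 k l : ℝ)) * X (Sum.inl (p.1, k)) +
      C (L p.2 l0 * b p.1) * X (Sum.inr p.1) with hg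
  have hcomp : aeval (fun i => C (w i) * X i) (map (Int.castRingHom ℝ) (bind₁ (gpt x l0) P)) =
      aeval g (ph m A P) := by
    have : ((aeval (fun i => C (w i) * X i) :
        MvPolynomial ((Fin m × Fin n) ⊕ Fin m) ℝ →ₐ[ℝ] _).toRingHom.comp
        (map (Int.castRingHom ℝ))).comp (bind₁ (gpt x l0)).toRingHom =
        (aeval g).toRingHom.comp (ph m A) := by
      apply MvPolynomial.ringHom_ext
      · intro r; simp
      · rintro ⟨h, l⟩
        have e1 : (aeval (fun i => C (w i) * X i) (map (Int.castRingHom ℝ)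
            (bind₁ (gpt x l0) (X (h, l)))) : MvPolynomial ((Fin m × Fin n) ⊕ Fin m) ℝ) =
            ∑ k, C (x h k l : ℝ) * X (Sum.inl (h, k)) +
              if l = l0 then C (b h) * X (Sum.inr h) else 0 := by
          rw [bind₁_X_right, gpt]
          simp only [map_add, map_sum, map_mul, map_C, map_X, aeval_C, aeval_X, algebraMap_eq]
          congr 1
          · simp [hw]
          · split_ifs <;> simp [hw]
        have e2 : (aeval g (ph m A (X (h, l))) : MvPolynomial ((Fin m × Fin n) ⊕ Fin m) ℝ) =
            ∑ k, C (∑ i, A l i * ∑ l', L i l' * (x h k l' : ℝ)) * X (Sum.inl (h, k)) +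
              C ((∑ i, A l i * L i l0) * b h) * X (Sum.inr h) := by
          rw [ph_X, Lf, map_sum, hg]
          simp only [map_mul, aeval_C, aeval_X, algebraMap_eq, mul_add, Finset.sum_add_distrib,
            map_sum]
          congr 1
          · simp only [Finset.mul_sum, Finset.sum_mul]
            rw [Finset.sum_comm]
            apply Finset.sum_congr rfl; intro k _
            apply Finset.sum_congr rfl; intro i _
            apply Finset.sum_congr rfl; intro i _
            ring
          · rw [Finset.sum_mul, Finset.sum_mul]
            apply Finset.sum_congr rfl; intro i _
            ring
        have e3 : ∀ l', ∑ i, A l i * L i l' = if l = l' then 1 else 0 := by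
          intro l'
          have := congrFun (congrFun hAL l) l'
          rw [Matrix.mul_apply, Matrix.one_apply] at this
          exact this
        have e4 : ∀ k, ∑ i, A l i * ∑ l', L i l' * (x h k l' : ℝ) = x h k l := by
          intro k
          simp_rw [Finset.mul_sum]
          rw [Finset.sum_comm]
          simp_rw [← mul_assoc, ← Finset.sum_mul, e3]
          simp
        change (aeval (fun i => C (w i) * X i) (map (Int.castRingHom ℝ)
            (bind₁ (gpt x l0) (X (h, l)))) : MvPolynomial ((Fin m × Fin n) ⊕ Fin m) ℝ) =
            aeval g (ph m A (X (h, l)))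
        rw [e1, e2, e3]
        simp_rw [e4]
        congr 1
        split_ifs <;> simp
    exact RingHom.congr_fun this P
  -- sizes
  set κ : ℝ := n + Λ with hκ
  have hκ1 : 1 ≤ κ := by
    have : (0 : ℝ) ≤ n := Nat.cast_nonneg _
    linarith
  have hgb : ∀ p, l1v (fun x : ℝ => |x|) (g p) ≤ κ * Real.exp (q p.1 * (c p.2 - δ)) := by
    intro p
    rw [hg]
    refine (l1v_add isV_abs _ _).trans ?_
    rw [hκ, add_mul]
    apply add_le_add
    · refine (l1v_sum isV_abs _ _).trans ?_
      calc _ ≤ ∑ k : Fin n, Real.exp (q p.1 * (c p.2 - δ)) :=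
            Finset.sum_le_sum fun k _ => (l1v_CX isV_abs _ _).trans (hx p.1 k p.2)
        _ = _ := by simp
    · refine (l1v_CX isV_abs _ _).trans ?_
      rw [abs_mul, hb, Real.abs_exp]
      apply mul_le_mul (hΛ _) _ (Real.exp_pos _).le (by linarith)
      apply Real.exp_le_exp.mpr
      have h1 := (abs_le.mp (hc0 p.2)).1
      nlinarith [hq p.1]
  set s := ∑ h, d h with hs
  set E1 : ℝ := R * ε * m + c0 * ∑ h, q h - δ * R * m with hE1
  have hM : ∀ e ∈ (ph m A P).support, ∏ p, l1v (fun x : ℝ => |x|) (g p) ^ e p ≤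
      κ ^ s * Real.exp E1 := by
    intro e he
    obtain ⟨he1, he2⟩ := hsup e he
    have he1' : ∀ h, ∑ i, ((e (h, i) : ℕ) : ℝ) = d h := fun h => by exact_mod_cast he1 h
    calc ∏ p, l1v (fun x : ℝ => |x|) (g p) ^ e p
        ≤ ∏ p : Fin m × Fin N, (κ ^ e p * Real.exp (e p * (q p.1 * (c p.2 - δ)))) := by
          apply Finset.prod_le_prod
          · intro p _; exact pow_nonneg (l1v_nonneg isV_abs _) _
          · intro p _
            refine (pow_le_pow_left₀ (l1v_nonneg isV_abs _) (hgb p) _).trans ?_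
            rw [mul_pow, Real.exp_nat_mul]
      _ = κ ^ s * Real.exp (∑ p : Fin m × Fin N, e p * (q p.1 * (c p.2 - δ))) := by
          rw [Finset.prod_mul_distrib, Finset.prod_pow_eq_pow_sum, ← Real.exp_sum,
            Fintype.sum_prod_type]
          simp_rw [he1]
          rfl
      _ ≤ _ := by
          apply mul_le_mul_of_nonneg_left _ (by positivity)
          apply Real.exp_le_exp.mpr
          rw [Fintype.sum_prod_type]
          have h1 : ∀ h, ∑ i, (e (h, i) : ℝ) * (q h * (c i - δ)) ≤
              R * ((∑ i, c i * ((e (h, i) : ℕ) : ℝ)) / d h) + c0 * q h - δ * R := by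
            intro h
            set S := (∑ i, c i * ((e (h, i) : ℕ) : ℝ)) with hS
            have h2 : ∑ i, (e (h, i) : ℝ) * (q h * (c i - δ)) = q h * S - δ * (d h * q h) := by
              rw [hS, ← he1' h, Finset.mul_sum, Finset.sum_mul, Finset.mul_sum,
                ← Finset.sum_sub_distrib]
              apply Finset.sum_congr rfl; intro i _; ring
            have h3 : S ≤ c0 * d h := by
              rw [hS, ← he1' h, Finset.mul_sum]
              apply Finset.sum_le_sum; intro i _
              exact mul_le_mul_of_nonneg_right (abs_le.mp (hc0 i)).2 (Nat.cast_nonneg _)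
            have h4 : S / d h ≤ c0 := by rw [div_le_iff₀ (hdp h)]; exact h3
            have h5 : q h * S = (d h * q h) * (S / d h) := by
              field_simp [(hdp h).ne']
            rw [h2, h5]
            have h6 : (d h * q h - R) * (S / d h) ≤ q h * c0 := by
              calc _ ≤ (d h * q h - R) * c0 :=
                    mul_le_mul_of_nonneg_left h4 (by linarith [hdq1 h])
                _ ≤ q h * c0 := mul_le_mul_of_nonneg_right (by linarith [hdq2 h]) hc00
            nlinarith [hdq1 h]
          calc _ ≤ ∑ h, (R * ((∑ i, c i * ((e (h, i) : ℕ) : ℝ)) / d h) + c0 * q h - δ * R) :=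
                Finset.sum_le_sum fun h _ => h1 h
            _ = R * ∑ h, ((∑ i, c i * ((e (h, i) : ℕ) : ℝ)) / d h) + c0 * ∑ h, q h - δ * R * m := by
                rw [Finset.sum_sub_distrib, Finset.sum_add_distrib, Finset.mul_sum, Finset.mul_sum]
                simp; ring
            _ ≤ R * (ε * m) + c0 * ∑ h, q h - δ * R * m := by gcongr
            _ = E1 := by rw [hE1]; ring
  have hbound := l1v_eval g (ph m A P) _ hM
  rw [← hcomp] at hbound
  have hcf := (coeff_le_l1v isV_abs (aeval (fun i => C (w i) * X i)
    (map (Int.castRingHom ℝ) (bind₁ (gpt x l0) P))) j).trans hbound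
  rw [coeff_scale, coeff_map] at hcf
  set z : ℤ := coeff j (bind₁ (gpt x l0) P) with hz
  have hwprod : ∏ i, w i ^ j i = Real.exp (- ((c0 + δ) * ∑ h, (j (Sum.inr h) : ℝ) * q h)) := by
    rw [Fintype.prod_sum_type, hw]
    simp only [Sum.elim_inl, one_pow, Finset.prod_const_one, one_mul, Sum.elim_inr, hb]
    rw [Finset.mul_sum, ← Finset.sum_neg_distrib, Real.exp_sum]
    apply Finset.prod_congr rfl
    intro h _
    rw [← Real.exp_nat_mul]; congr 1; ring
  have hjq : ∑ h, (j (Sum.inr h) : ℝ) * q h ≤ R * θ + ∑ h, q h := by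
    have h1 : ∀ h, (j (Sum.inr h) : ℝ) * q h ≤ R * ((j (Sum.inr h) : ℝ) / d h) + q h := by
      intro h
      have h0 : (0 : ℝ) ≤ (j (Sum.inr h) : ℝ) / d h := by positivity
      have h2 : (j (Sum.inr h) : ℝ) / d h ≤ 1 := by
        have := Finset.single_le_sum (f := fun h => (j (Sum.inr h) : ℝ) / d h)
          (fun h _ => by positivity) (Finset.mem_univ h)
        beta_reduce at this
        linarith
      have h5 : (j (Sum.inr h) : ℝ) * q h = (d h * q h) * ((j (Sum.inr h) : ℝ) / d h) := by
        field_simp [(hdp h).ne']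
      rw [h5]
      calc _ ≤ (R + q h) * ((j (Sum.inr h) : ℝ) / d h) := mul_le_mul_of_nonneg_right (hdq2 h) h0
        _ ≤ _ := by nlinarith [hq h]
    calc _ ≤ ∑ h, (R * ((j (Sum.inr h) : ℝ) / d h) + q h) := Finset.sum_le_sum fun h _ => h1 h
      _ = R * ∑ h, ((j (Sum.inr h) : ℝ) / d h) + ∑ h, q h := by
          rw [Finset.sum_add_distrib, Finset.mul_sum]
      _ ≤ _ := by gcongr
  have hKκ : (K ^ s) * (κ ^ s * Real.exp E1) =
      Real.exp ((∑ h, (d h : ℝ)) * Real.log (K * κ) + E1) := by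
    rw [Real.exp_add, ← mul_assoc, ← mul_pow]
    congr 1
    have : (∑ h, (d h : ℝ)) = ((s : ℕ) : ℝ) := by rw [hs]; push_cast; rfl
    rw [this, Real.exp_nat_mul, Real.exp_log (by positivity)]
  have h1 : |(z : ℝ)| < 1 := by
    have h2 : Real.exp (- ((c0 + δ) * ∑ h, (j (Sum.inr h) : ℝ) * q h)) * |(z : ℝ)| ≤
        Real.exp ((∑ h, (d h : ℝ)) * Real.log (K * κ) + E1) := by
      rw [← hKκ]
      refine le_trans ?_ (mul_le_mul_of_nonneg_right hl1 (by positivity))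
      refine le_trans (le_of_eq ?_) hcf
      rw [abs_mul, hwprod, Real.abs_exp]; rfl
    rw [Real.exp_neg, inv_mul_le_iff₀ (Real.exp_pos _), ← Real.exp_add] at h2
    refine lt_of_le_of_lt h2 ?_
    rw [Real.exp_lt_one_iff]
    have h3 : (c0 + δ) * ∑ h, (j (Sum.inr h) : ℝ) * q h ≤ (c0 + δ) * (R * θ + ∑ h, q h) :=
      mul_le_mul_of_nonneg_left hjq (by linarith)
    rw [hE1]
    linarith
  have : |z| < 1 := by exact_mod_cast h1
  exact Int.abs_lt_one_iff.mp this

lemma seq_growth {α : Type*} (f : α → ℝ) (p : α → Prop) (hf : ∀ B : ℝ, ∃ y, p y ∧ B ≤ f y) (B0 t : ℝ)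
    : ∃ y : ℕ → α, (∀ k, p (y k) ∧ B0 ≤ f (y k)) ∧ ∀ k k', k < k' → t * f (y k) ≤ f (y k') := by
  classical
  obtain ⟨y, h1, h2⟩ := exists_seq_of_forall_finset_exists (fun y => p y ∧ B0 ≤ f y)
    (fun y y' => t * f y ≤ f y') (by
      intro s _
      obtain ⟨y, hy, hB⟩ := hf (max B0 (∑ z ∈ s, |t * f z|))
      refine ⟨y, ⟨hy, (le_max_left _ _).trans hB⟩, fun z hz => ?_⟩
      refine (le_abs_self _).trans (le_trans ?_ ((le_max_right _ _).trans hB))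
      exact Finset.single_le_sum (f := fun z => |t * f z|) (fun _ _ => abs_nonneg _) hz)
  exact ⟨y, h1, h2⟩

lemma hfin_aux {sd m R B0 K2 δ c0 θ Sq : ℝ} (hB0pos : 0 < B0) (hsd : sd ≤ m * (R / B0 + 1))
    (hK2 : 0 ≤ K2) (hδ : 0 < δ) (hm1 : 1 ≤ m) (hRpos : 0 < R) (hθ2 : (c0 + δ) * θ ≤ δ / 4)
    (hB : 8 * K2 / δ ≤ B0) (hR : 8 / δ * (m * K2 + (2 * c0 + δ) * Sq) < R) :
    sd * K2 + R * (δ / 4) * m + c0 * Sq - δ * R * m + (c0 + δ) * (R * θ + Sq) < 0 := by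
  have h1 : sd * K2 ≤ m * (R * (δ / 8) + K2) := by
    calc _ ≤ m * (R / B0 + 1) * K2 := mul_le_mul_of_nonneg_right hsd hK2
      _ = m * (R * (K2 / B0) + K2) := by ring
      _ ≤ _ := by
        have : K2 / B0 ≤ δ / 8 := by
          rw [div_le_iff₀ hB0pos]
          rw [div_le_iff₀ hδ] at hB
          linarith
        gcongr
  have h2 : (c0 + δ) * (R * θ) ≤ R * (δ / 4) * m := by
    calc (c0 + δ) * (R * θ) = R * ((c0 + δ) * θ) := by ring
      _ ≤ R * (δ / 4) := by gcongr
      _ ≤ R * (δ / 4) * m := le_mul_of_one_le_right (by positivity) hm1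
  have h5 : 8 * (m * K2 + (2 * c0 + δ) * Sq) < δ * R := by
    have := mul_lt_mul_of_pos_left hR hδ
    have h6 : δ * (8 / δ * (m * K2 + (2 * c0 + δ) * Sq)) = 8 * (m * K2 + (2 * c0 + δ) * Sq) := by field_simp
    linarith
  have h7 : δ * R ≤ δ * R * m := le_mul_of_one_le_right (by positivity) hm1
  have h8 : 0 < δ * R := mul_pos hδ hRpos
  nlinarith

set_option maxHeartbeats 1000000 in
theorem core_ls {N D n : ℕ} (hN : 0 < N) {S : Type*} [CommRing S] (τ : S →+* ℝ)
    (ρ : S →+* Matrix (Fin D) (Fin D) ℤ) (hρ : Function.Injective ρ)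
    (a : Matrix (Fin N) (Fin N) S) (L : Matrix (Fin N) (Fin N) ℝ) (hAL : a.map τ * L = 1)
    (c : Fin N → ℝ) (hc : ∑ i, c i = 0) (δ η : ℝ) (hδ : 0 < δ) (hη : 0 < η) (l0 s : Fin N)
    (hls : l0 ≠ s) :
    ¬ ∀ B : ℝ, ∃ y : ℝ × (Fin n → Fin N → ℤ) × (Fin N → ℤ),
      (y.2.2 l0 ≠ 0 ∧ η * y.1 ≤ Real.log (rH (- ((y.2.2 s : ℚ) / y.2.2 l0))) ∧
      (∀ l, ∃ u : Fin n → ℚ, ∀ l', (if l' = l then (1 : ℚ) else 0) -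
        (if l' = l0 then (y.2.2 l : ℚ) / y.2.2 l0 else 0) = ∑ k, u k * y.2.1 k l') ∧
      ∀ k i, |∑ l, L i l * (y.2.1 k l : ℝ)| ≤ Real.exp (y.1 * (c i - δ))) ∧ B ≤ y.1 := by
  classical
  intro hall
  obtain ⟨K, hK, haux⟩ := aux_poly hN τ ρ hρ a
  set c0 : ℝ := ∑ i, |c i| with hc0d
  have hc0 : ∀ i, |c i| ≤ c0 := fun i =>
    Finset.single_le_sum (f := fun i => |c i|) (fun _ _ => abs_nonneg _) (Finset.mem_univ i)
  have hc00 : 0 ≤ c0 := Finset.sum_nonneg fun _ _ => abs_nonneg _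
  set Λ : ℝ := 1 + ∑ i, |L i l0| with hΛd
  have hΛ1 : 1 ≤ Λ := by
    have := Finset.sum_nonneg (s := Finset.univ) fun i _ => abs_nonneg (L i l0)
    linarith
  have hΛ : ∀ i, |L i l0| ≤ Λ := fun i => by
    have := Finset.single_le_sum (f := fun i => |L i l0|) (fun _ _ => abs_nonneg _) (Finset.mem_univ i)
    beta_reduce at this
    linarith
  set θ : ℝ := min 1 (δ / (4 * (c0 + δ))) with hθd
  have hθ1 : θ ≤ 1 := min_le_left _ _
  have hθ0 : 0 < θ := lt_min one_pos (by positivity)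
  have hθ2 : (c0 + δ) * θ ≤ δ / 4 := by
    have : θ ≤ δ / (4 * (c0 + δ)) := min_le_right _ _
    rw [le_div_iff₀ (by positivity)] at this
    linarith
  obtain ⟨m0, hm0⟩ := haux c hc (δ / 4) (by positivity)
  set m := m0 + 1 with hm
  obtain ⟨ω, hω0, hω1, hroth⟩ := roth m θ hθ0
  have hm1 : (1 : ℝ) ≤ m := by rw [hm]; push_cast; linarith [(Nat.cast_nonneg m0 : (0 : ℝ) ≤ m0)]
  set K1 : ℝ := 1 + Real.log K with hK1d
  have hlogK : 0 ≤ Real.log K := Real.log_nonneg hK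
  set K2 : ℝ := Real.log (K * (n + Λ)) with hK2d
  have hK2 : 0 ≤ K2 := Real.log_nonneg (by
    have : (0 : ℝ) ≤ n := Nat.cast_nonneg _
    nlinarith)
  set B0 : ℝ := 1 + 8 * K2 / δ + 2 * K1 * m / (ω * η) with hB0
  have hB1 : 0 ≤ 8 * K2 / δ := by positivity
  have hB2 : 0 ≤ 2 * K1 * m / (ω * η) := by positivity
  obtain ⟨y, hy, hgrow⟩ := seq_growth (fun y : ℝ × (Fin n → Fin N → ℤ) × (Fin N → ℤ) => y.1) _ hall B0 (2 / ω)
  set z : Fin m → ℝ × (Fin n → Fin N → ℤ) × (Fin N → ℤ) := fun h => y (Fin.rev h) with hz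
  set q : Fin m → ℝ := fun h => (z h).1 with hq
  have hqB : ∀ h, B0 ≤ q h := fun h => (hy _).2
  have hq0 : ∀ h, 0 < q h := fun h => by linarith [hqB h]
  have hqg : ∀ i j, i < j → 2 / ω * q j ≤ q i := by
    intro i j hij
    apply hgrow
    exact_mod_cast Fin.rev_lt_rev.mpr hij
  set Sq := ∑ h, q h with hSq
  have hSq0 : 0 ≤ Sq := Finset.sum_nonneg fun h _ => (hq0 h).le
  have hqS : ∀ h, q h ≤ Sq := fun h => Finset.single_le_sum (f := q) (fun h _ => (hq0 h).le) (Finset.mem_univ h)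
  set cst : ℝ := m * K2 + (2 * c0 + δ) * Sq with hcst
  have hcst0 : 0 ≤ cst := by positivity
  set R : ℝ := 1 + 8 / δ * cst + 2 * Sq / ω + 2 * K1 * m / (ω * η) with hR
  have hR1 : 0 ≤ 8 / δ * cst := by positivity
  have hR2 : 0 ≤ 2 * Sq / ω := by positivity
  have hRpos : 0 < R := by linarith
  set d : Fin m → ℕ := fun h => ⌈R / q h⌉₊ with hd
  have hdpos : ∀ h, 0 < d h := fun h => Nat.ceil_pos.mpr (div_pos hRpos (hq0 h))
  have hd1 : ∀ h, R / q h ≤ d h := fun h => Nat.le_ceil _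
  have hd2 : ∀ h, (d h : ℝ) ≤ R / q h + 1 := fun h => (Nat.ceil_lt_add_one (div_pos hRpos (hq0 h)).le).le
  have hdq1 : ∀ h, R ≤ d h * q h := fun h => by
    have := hd1 h
    rwa [div_le_iff₀ (hq0 h)] at this
  have hdq2 : ∀ h, d h * q h ≤ R + q h := fun h => by
    have := mul_le_mul_of_nonneg_right (hd2 h) (hq0 h).le
    rwa [add_mul, div_mul_cancel₀ _ (hq0 h).ne', one_mul] at this
  have hdB : ∀ h, (d h : ℝ) ≤ R / B0 + 1 := fun h => by
    refine (hd2 h).trans ?_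
    have : R / q h ≤ R / B0 := div_le_div_of_nonneg_left hRpos.le (by linarith) (hqB h)
    linarith
  have hsd : (∑ h, (d h : ℝ)) ≤ m * (R / B0 + 1) := by
    calc _ ≤ ∑ h : Fin m, (R / B0 + 1) := Finset.sum_le_sum fun h _ => hdB h
      _ = _ := by simp; ring
  obtain ⟨P, hP0, hPhom, hPl1, hPsup, hPl1v⟩ := hm0 m (by omega) d hdpos
  have hB0pos : 0 < B0 := by linarith
  have hfin : (∑ h, (d h : ℝ)) * K2 + R * (δ / 4) * m + c0 * ∑ h, q h - δ * R * m
      + (c0 + δ) * (R * θ + ∑ h, q h) < 0 :=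
    hfin_aux hB0pos hsd hK2 hδ hm1 hRpos hθ2 (by linarith) (by linarith)
  have hidx := vanish (n := n) (a.map τ) L hAL d hdpos P K Λ hK c c0 (δ / 4) δ θ R hc0 hδ hθ1 hRpos.le hc00
    l0 hΛ1 hΛ hPl1v hPsup q (fun h => (hq0 h).le) (fun h => (z h).2.1)
    (fun h k i => (hy _).1.2.2.2 k i) hdq1 hdq2 hfin
  obtain ⟨p, hp0, hpl1, hpdeg, hpW⟩ := index_core (fun h => (z h).2.2) (fun h => (z h).2.1) hls
    (fun h l => (hy _).1.2.2.1 l) (fun h => (hy _).1.1) d P hP0 hPhom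
    (fun i => θ ≤ ∑ h, (1 / (d h : ℝ)) * i h) (by
      intro j hj
      by_contra hcon
      push Not at hcon
      apply hj
      apply hidx j
      refine lt_of_eq_of_lt ?_ hcon
      apply Finset.sum_congr rfl
      intro h _
      simp
      ring)
  set T : ℝ := K1 * ∑ h, (d h : ℝ) with hT
  have hK1' : 1 ≤ K1 := by linarith
  have hTle : T ≤ ω * η * R := by
    have h1 : T ≤ K1 * (m * (R / B0 + 1)) := mul_le_mul_of_nonneg_left hsd (by linarith)
    have hωη : 0 < ω * η := by positivity
    have h2 : K1 * m * (R / B0) ≤ ω * η * R / 2 := by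
      have : 2 * K1 * m / (ω * η) ≤ B0 := by linarith
      rw [div_le_iff₀ hωη] at this
      rw [mul_div_assoc', div_le_iff₀ hB0pos]
      nlinarith
    have h3 : K1 * m ≤ ω * η * R / 2 := by
      have : 2 * K1 * m / (ω * η) ≤ R := by linarith
      rw [div_le_iff₀ hωη] at this
      linarith
    linarith
  obtain ⟨i, hi, hiθ⟩ := hroth d (fun h => - (((z h).2.2 s : ℚ) / (z h).2.2 l0)) T p hp0 hdpos (by
      intro i j hij
      have h1 := hqg i j hij
      have h2 : R / q i ≤ ω * R / (2 * q j) := by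
        rw [div_le_div_iff₀ (hq0 i) (by linarith [hq0 j])]
        have : 2 * q j ≤ ω * q i := by
          have := mul_le_mul_of_nonneg_left h1 hω0.le
          have h6 : ω * (2 / ω * q j) = 2 * q j := by field_simp
          linarith
        nlinarith
      have h3 : 1 ≤ ω * R / (2 * q j) := by
        rw [le_div_iff₀ (by linarith [hq0 j])]
        have : 2 * Sq / ω ≤ R := by linarith
        rw [div_le_iff₀ hω0] at this
        linarith [hqS j]
      have h4 : ω * R / (2 * q j) + ω * R / (2 * q j) = ω * (R / q j) := by
        have := (hq0 j).ne'
        field_simp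
        ring
      have h5 : ω * (R / q j) ≤ ω * d j := mul_le_mul_of_nonneg_left (hd1 j) hω0.le
      linarith [hd2 i]) hpdeg (by
      refine hpl1.trans (hPl1.trans ?_)
      have : (∑ h, (d h : ℝ)) = ((∑ h, d h : ℕ) : ℝ) := by push_cast; rfl
      rw [hT, this, mul_comm, Real.exp_nat_mul]
      apply pow_le_pow_left₀ (by linarith)
      calc K = Real.exp (Real.log K) := (Real.exp_log (by linarith)).symm
        _ ≤ _ := Real.exp_le_exp.mpr (by linarith)) (by
      intro h
      have h1 : (d h : ℝ) ≤ ∑ h, (d h : ℝ) :=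
        Finset.single_le_sum (f := fun h => (d h : ℝ)) (fun _ _ => Nat.cast_nonneg _) (Finset.mem_univ h)
      have h2 : 0 ≤ ∑ h, (d h : ℝ) := Finset.sum_nonneg fun _ _ => Nat.cast_nonneg _
      rw [hT]; nlinarith) (by
      intro h
      refine hTle.trans ?_
      have h1 := (hy (Fin.rev h)).1.2.1
      have h2 := hdq1 h
      calc ω * η * R ≤ ω * η * (d h * q h) := by gcongr
        _ = ω * d h * (η * q h) := by ring
        _ ≤ _ := mul_le_mul_of_nonneg_left h1 (by positivity))
  have := hpW i hi
  linarith
end TM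

namespace TM

/-- the values of `f` on `p` are unbounded -/
def Unb {α : Type*} (f : α → ℝ) (p : α → Prop) : Prop := ∀ B : ℝ, ∃ y, p y ∧ B ≤ f y

lemma Unb.mono {α : Type*} {f : α → ℝ} {p q : α → Prop} (h : Unb f p) (hpq : ∃ B0, ∀ y, B0 ≤ f y → p y → q y) :
    Unb f q := by
  obtain ⟨B0, hB⟩ := hpq
  intro B
  obtain ⟨y, hy, h1⟩ := h (max B0 B)
  exact ⟨y, hB y ((le_max_left _ _).trans h1) hy, (le_max_right _ _).trans h1⟩

lemma Unb.pigeon {α T : Type*} [Finite T] {f : α → ℝ} {p : α → Prop} {q : T → α → Prop} (h : Unb f p)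
    (hpq : ∃ B0, ∀ y, B0 ≤ f y → p y → ∃ t, q t y) : ∃ t, Unb f (q t) := by
  classical
  obtain ⟨B0, hB⟩ := hpq
  by_contra hcon
  simp only [Unb, not_exists, not_forall] at hcon
  choose Bt hBt using hcon
  haveI := Fintype.ofFinite T
  obtain ⟨y, hy, h1⟩ := h (max B0 (∑ t, |Bt t|))
  obtain ⟨t, ht⟩ := hB y ((le_max_left _ _).trans h1) hy
  apply hBt t y ⟨ht, ?_⟩
  refine (le_abs_self _).trans (le_trans ?_ ((le_max_right _ _).trans h1))
  exact Finset.single_le_sum (f := fun t => |Bt t|) (fun _ _ => abs_nonneg _) (Finset.mem_univ t)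

lemma Unb.map {α β : Type*} {f : α → ℝ} {p : α → Prop} {g : β → ℝ} {q : β → Prop} (h : Unb f p)
    (hpq : ∃ B0, ∀ y, B0 ≤ f y → p y → ∃ z, q z ∧ f y ≤ g z) : Unb g q := by
  obtain ⟨B0, hB⟩ := hpq
  intro B
  obtain ⟨y, hy, h1⟩ := h (max B0 B)
  obtain ⟨z, hz, h2⟩ := hB y ((le_max_left _ _).trans h1) hy
  exact ⟨z, hz, ((le_max_right _ _).trans h1).trans h2⟩

lemma rH_one_le (β : ℚ) : 1 ≤ rH β := le_max_of_le_right β.den_pos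

lemma rH_neg (β : ℚ) : rH (-β) = rH β := by simp [rH]

lemma rH_prod {N : ℕ} (h : Fin N → ℤ) (hp : ∃ a : Fin N → ℤ, ∑ l, a l * h l = 1) (l0 : Fin N)
    (h0 : h l0 ≠ 0) (l : Fin N) :
    (h l).natAbs ≤ ∏ s ∈ Finset.univ.erase l0, rH ((h s : ℚ) / h l0) := by
  classical
  set β : Fin N → ℚ := fun s => (h s : ℚ) / h l0 with hβ
  set v : ℕ := ∏ s ∈ Finset.univ.erase l0, (β s).den with hv
  have hvpos : 0 < v := Finset.prod_pos fun s _ => (β s).den_pos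
  have h0' : (h l0 : ℚ) ≠ 0 := by exact_mod_cast h0
  have key : ∀ s, h s * (β s).den = (β s).num * h l0 := by
    intro s
    have h1 : (h s : ℚ) = β s * h l0 := by rw [hβ]; field_simp
    have h2 : β s * (β s).den = (β s).num := Rat.mul_den_eq_num _
    have : (h s : ℚ) * (β s).den = (β s).num * h l0 := by rw [h1, ← h2]; ring
    exact_mod_cast this
  have hdvd : ∀ s, h l0 ∣ v * h s := by
    intro s
    by_cases hs : s = l0
    · rw [hs]; exact dvd_mul_left _ _
    · have : (β s).den ∣ v := Finset.dvd_prod_of_mem _ (Finset.mem_erase.mpr ⟨hs, Finset.mem_univ _⟩)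
      obtain ⟨w, hw⟩ := this
      refine ⟨w * (β s).num, ?_⟩
      rw [hw]; push_cast
      linear_combination (w : ℤ) * key s
  have hdv : h l0 ∣ v := by
    obtain ⟨a, ha⟩ := hp
    have : (v : ℤ) = ∑ s, a s * (v * h s) := by
      calc (v : ℤ) = v * ∑ l, a l * h l := by rw [ha, mul_one]
        _ = _ := by rw [Finset.mul_sum]; exact Finset.sum_congr rfl fun _ _ => by ring
    rw [this]
    exact Finset.dvd_sum fun s _ => (hdvd s).mul_left _
  have hle : (h l0).natAbs ≤ v := by
    have := Int.natAbs_dvd_natAbs.mpr hdv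
    exact Nat.le_of_dvd hvpos (by simpa using this)
  by_cases hl : l = l0
  · rw [hl]
    exact hle.trans (Finset.prod_le_prod' fun s _ => le_max_right _ _)
  · have hmem : l ∈ Finset.univ.erase l0 := Finset.mem_erase.mpr ⟨hl, Finset.mem_univ _⟩
    have h1 : (h l).natAbs * (β l).den = (β l).num.natAbs * (h l0).natAbs := by
      have := congrArg Int.natAbs (key l)
      simpa [Int.natAbs_mul] using this
    rw [← Finset.mul_prod_erase _ _ hmem]
    rw [hv, ← Finset.mul_prod_erase _ _ hmem] at hle
    have h2 : (h l).natAbs * (β l).den ≤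
        ((β l).num.natAbs * ∏ s ∈ (Finset.univ.erase l0).erase l, (β s).den) * (β l).den := by
      rw [h1, mul_assoc]
      refine Nat.mul_le_mul_left _ (hle.trans (le_of_eq (mul_comm _ _)))
    refine (Nat.le_of_mul_le_mul_right h2 (β l).den_pos).trans ?_
    exact Nat.mul_le_mul (le_max_left _ _) (Finset.prod_le_prod' fun s _ => le_max_right _ _)

lemma int_mult {ι F : Type*} [Finite ι] [Field F] [NumberField F] (f : ι → F) :
    ∃ d : ℤ, d ≠ 0 ∧ ∃ g : ι → 𝓞 F, ∀ i, (g i : F) = d * f i := by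
  classical
  haveI := Fintype.ofFinite ι
  obtain ⟨d, hd, h⟩ := exists_integral_multiples ℤ ℚ (Finset.univ.image f)
  refine ⟨d, hd, fun i => ⟨d • f i, h _ (Finset.mem_image_of_mem _ (Finset.mem_univ i))⟩, fun i => ?_⟩
  simp

/-- hyperplanes spanned by small vectors -/
theorem core_hyp {N n : ℕ} {F : Type*} [Field F] [NumberField F] (τ : F →+* ℝ)
    (L : Matrix (Fin N) (Fin N) F) (hL : IsUnit L.det)
    (c : Fin N → ℝ) (hc : ∑ i, c i = 0) (δ η : ℝ) (hδ : 0 < δ) (hη : 0 < η) :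
    ¬ Unb (fun y : ℝ × (Fin n → Fin N → ℤ) × (Fin N → ℤ) => y.1) (fun y =>
      (∃ a : Fin N → ℤ, ∑ l, a l * y.2.2 l = 1) ∧ (∃ l, Real.exp (η * y.1) ≤ |(y.2.2 l : ℝ)|) ∧
      (∀ v : Fin N → ℚ, ∑ l, (y.2.2 l : ℚ) * v l = 0 → ∃ u : Fin n → ℚ, ∀ l', v l' = ∑ k, u k * y.2.1 k l') ∧
      ∀ k i, |∑ l, τ (L i l) * (y.2.1 k l : ℝ)| ≤ Real.exp (y.1 * (c i - δ))) := by
  classical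
  intro hU
  -- choose the pair of coordinates
  obtain ⟨⟨⟨l0, s⟩, hls⟩, hU2⟩ := hU.pigeon (T := {p : Fin N × Fin N // p.1 ≠ p.2}) (q := fun t y =>
      y.2.2 t.1.1 ≠ 0 ∧ η / N * y.1 ≤ Real.log (rH (- ((y.2.2 t.1.2 : ℚ) / y.2.2 t.1.1))) ∧
      (∀ v : Fin N → ℚ, ∑ l, (y.2.2 l : ℚ) * v l = 0 → ∃ u : Fin n → ℚ, ∀ l', v l' = ∑ k, u k * y.2.1 k l') ∧
      ∀ k i, |∑ l, τ (L i l) * (y.2.1 k l : ℝ)| ≤ Real.exp (y.1 * (c i - δ))) (by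
    refine ⟨1, ?_⟩
    rintro ⟨q, x, h⟩ hq ⟨hp, ⟨l, hl⟩, hsp, hx⟩
    simp only at hq hp hl hsp hx ⊢
    obtain ⟨l0, h0⟩ : ∃ l0, h l0 ≠ 0 := by
      by_contra hcon
      push Not at hcon
      obtain ⟨a, ha⟩ := hp
      simp [hcon] at ha
    have hN : (0 : ℝ) < N := by exact_mod_cast (Fin.pos l)
    have h1 := rH_prod h hp l0 h0 l
    have h2 : η * q ≤ ∑ s ∈ Finset.univ.erase l0, Real.log (rH ((h s : ℚ) / h l0)) := by
      rw [← Real.log_prod (fun s _ => by have := rH_one_le ((h s : ℚ) / h l0); positivity)]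
      rw [Real.le_log_iff_exp_le (Finset.prod_pos fun s _ => by
        have := rH_one_le ((h s : ℚ) / h l0); positivity)]
      refine hl.trans ?_
      rw [← Int.cast_abs, Int.abs_eq_natAbs]
      exact_mod_cast h1
    obtain ⟨s, hs, hs2⟩ : ∃ s ∈ Finset.univ.erase l0, η / N * q ≤ Real.log (rH ((h s : ℚ) / h l0)) := by
      by_contra hcon
      push Not at hcon
      have h3 : ∑ s ∈ Finset.univ.erase l0, Real.log (rH ((h s : ℚ) / h l0)) ≤
          ∑ s ∈ Finset.univ.erase l0, η / N * q := Finset.sum_le_sum fun s hs => (hcon s hs).le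
      rw [Finset.sum_const, Finset.card_erase_of_mem (Finset.mem_univ _), Finset.card_univ, Fintype.card_fin,
        nsmul_eq_mul, Nat.cast_sub (Fin.pos l)] at h3
      have h4 : ((N : ℝ) - (1 : ℕ)) * (η / N * q) = η * q - η / N * q := by push_cast; field_simp
      have h5 : 0 < η / N * q := by positivity
      linarith
    exact ⟨⟨(l0, s), (Finset.ne_of_mem_erase hs).symm⟩, h0, by rwa [rH_neg], hsp, hx⟩)
  have hN : 0 < N := Fin.pos l0
  -- integral inverse
  obtain ⟨d, hd0, g, hg⟩ := int_mult (fun p : Fin N × Fin N => L⁻¹ p.1 p.2)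
  set bas := RingOfIntegers.basis F
  have hd1 : (1 : ℝ) ≤ |(d : ℝ)| := by
    rw [← Int.cast_abs]; exact_mod_cast Int.one_le_abs hd0
  have hd0' : (d : ℝ) ≠ 0 := by exact_mod_cast hd0
  have hLL : L⁻¹ * L = 1 := Matrix.nonsing_inv_mul _ hL
  set e := Fintype.equivFin (Module.Free.ChooseBasisIndex ℤ (𝓞 F))
  apply core_ls hN (τ.comp (algebraMap (𝓞 F) F)) (Algebra.leftMulMatrix (bas.reindex e)).toRingHom
    (Algebra.leftMulMatrix_injective _) (Matrix.of fun i j => g (i, j))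
    (Matrix.of fun i j => τ (L i j) / d) ?_ c hc δ (η / N) hδ (by positivity) l0 s hls
  · intro B
    obtain ⟨⟨q, x, h⟩, ⟨h1, h2, h3, h4⟩, h5⟩ := hU2 B
    refine ⟨⟨q, x, h⟩, ⟨h1, h2, ?_, ?_⟩, h5⟩
    · intro l
      have h1' : (h l0 : ℚ) ≠ 0 := by exact_mod_cast h1
      apply h3 (fun l' => (if l' = l then (1 : ℚ) else 0) - (if l' = l0 then (h l : ℚ) / h l0 else 0))
      change ∑ l', (h l' : ℚ) * ((if l' = l then (1 : ℚ) else 0) - (if l' = l0 then (h l : ℚ) / h l0 else 0)) = 0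
      simp only [mul_sub, Finset.sum_sub_distrib, mul_ite, mul_one, mul_zero, Finset.sum_ite_eq',
        Finset.mem_univ, if_true]
      rw [mul_div_cancel₀ _ h1', sub_self]
    · intro k i
      have : ∑ l, (Matrix.of fun i j => τ (L i j) / (d : ℝ)) i l * ((x k l : ℤ) : ℝ)
          = (∑ l, τ (L i l) * ((x k l : ℤ) : ℝ)) / d := by
        rw [Finset.sum_div]
        exact Finset.sum_congr rfl fun l _ => by simp only [Matrix.of_apply]; ring
      change |∑ l, (Matrix.of fun i j => τ (L i j) / (d : ℝ)) i l * ((x k l : ℤ) : ℝ)| ≤ _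
      rw [this, abs_div]
      exact (div_le_self (abs_nonneg _) hd1).trans (h4 k i)
  · ext i j
    have h1 := congrArg τ (congrFun (congrFun hLL i) j)
    rw [Matrix.mul_apply, map_sum] at h1
    rw [Matrix.mul_apply]
    have h2 : ∀ k, ((Matrix.of fun i j => g (i, j)).map (τ.comp (algebraMap (𝓞 F) F))) i k *
        (Matrix.of fun i j => τ (L i j) / (d : ℝ)) k j = τ (L⁻¹ i k * L k j) := by
      intro k
      change τ (g (i, k) : F) * (τ (L k j) / d) = _
      rw [hg, map_mul, map_mul, map_intCast]
      field_simp
    rw [Finset.sum_congr rfl fun k _ => h2 k, h1]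
    rw [Matrix.one_apply, Matrix.one_apply, apply_ite τ, map_one, map_zero]

end TM

namespace TM

lemma chain_step {N j : ℕ} (U : Submodule ℝ (Fin N → ℝ)) (hU : Module.finrank ℝ U ≤ j)
    (I : Finset (Fin N)) (hI : I.card = j + 1) :
    ∃ i ∈ I, ∀ u ∈ U, |u i| ≤ ∑ k ∈ I.erase i, |u k| := by
  classical
  let φ : (I → ℝ) →ₗ[ℝ] (Module.Dual ℝ U) :=
    { toFun := fun a => ∑ i : I, a i • ((LinearMap.proj i.1).comp U.subtype)
      map_add' := by intro a b; simp [add_smul, Finset.sum_add_distrib]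
      map_smul' := by intro a b; simp [Finset.smul_sum, smul_smul] }
  have hk : LinearMap.ker φ ≠ ⊥ := by
    apply LinearMap.ker_ne_bot_of_finrank_lt
    rw [Subspace.dual_finrank_eq]
    simp [hI]; omega
  obtain ⟨a, ha, ha0⟩ := Submodule.exists_mem_ne_zero_of_ne_bot hk
  have hrel : ∀ u ∈ U, ∑ i : I, a i * u i = 0 := by
    intro u hu
    have := congrArg (fun f => f ⟨u, hu⟩) (LinearMap.mem_ker.mp ha)
    simpa [φ] using this
  haveI : Nonempty I := by
    obtain ⟨i, hi⟩ := Finset.card_pos.mp (by rw [hI]; omega : 0 < I.card)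
    exact ⟨⟨i, hi⟩⟩
  obtain ⟨i0, hi0⟩ := Finite.exists_max (fun i : I => |a i|)
  have hpos : 0 < |a i0| := by
    by_contra hcon
    apply ha0
    ext i
    have h1 := hi0 i
    have h2 := abs_nonneg (a i)
    have h3 : |a i| = 0 := by linarith [not_lt.mp hcon]
    simpa using h3
  refine ⟨i0.1, i0.2, fun u hu => ?_⟩
  have h1 := hrel u hu
  rw [← Finset.add_sum_erase _ _ (Finset.mem_univ i0)] at h1
  have h2 : |a i0| * |u i0| ≤ |a i0| * ∑ k ∈ I.erase i0.1, |u k| := by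
    rw [← abs_mul, eq_neg_of_add_eq_zero_left h1, abs_neg]
    refine (Finset.abs_sum_le_sum_abs _ _).trans ?_
    rw [Finset.mul_sum]
    have : ∑ k ∈ I.erase i0.1, |a i0| * |u k| = ∑ k ∈ Finset.univ.erase i0, |a i0| * |u (k : I)| := by
      refine (Finset.sum_bij (fun (k : I) _ => k.1) ?_ ?_ ?_ ?_).symm
      · intro k hk
        simp only [Finset.mem_erase, Finset.mem_univ, and_true] at hk ⊢
        exact ⟨fun h => hk (Subtype.ext h), k.2⟩
      · intro k _ k' _ h; exact Subtype.ext h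
      · intro k hk
        rw [Finset.mem_erase] at hk
        exact ⟨⟨k, hk.2⟩, by simp only [Finset.mem_erase, Finset.mem_univ, and_true]; exact fun h => hk.1 (congrArg Subtype.val h), rfl⟩
      · intro k _; rfl
    rw [this]
    refine Finset.sum_le_sum fun k _ => ?_
    rw [abs_mul]
    exact mul_le_mul_of_nonneg_right (hi0 k) (abs_nonneg _)
  exact le_of_mul_le_mul_left h2 hpos

/-- Davenport's ordering of the coordinates -/
theorem chain {N : ℕ} (U : ℕ → Submodule ℝ (Fin N → ℝ)) (hU : ∀ j, Module.finrank ℝ (U j) ≤ j)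
    (hm : Monotone U) :
    ∃ σ : Equiv.Perm (Fin N), ∀ j : Fin N, ∀ u ∈ U (j + 1), ∃ i, σ i ≤ j ∧ ‖u‖ ≤ N * 2 ^ N * |u i| := by
  classical
  let Good : ℕ → Finset (Fin N) → Prop := fun j I => I.card = j ∧
    ∀ u ∈ U j, ∑ i, |u i| ≤ 2 ^ (N - j) * ∑ i ∈ I, |u i|
  have step : ∀ k (I : Finset (Fin N)), k < N → Good (N - k) I →
      ∃ i ∈ I, Good (N - (k + 1)) (I.erase i) := by
    rintro k I hk ⟨h1, h2⟩
    obtain ⟨i, hi, h3⟩ := chain_step (U (N - (k + 1))) (hU _) I (by omega)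
    refine ⟨i, hi, ?_⟩
    refine ⟨by rw [Finset.card_erase_of_mem hi]; omega, fun u hu => ?_⟩
    have h4 := h2 u (hm (by omega : N - (k + 1) ≤ N - k) hu)
    have h5 := h3 u hu
    rw [← Finset.add_sum_erase _ _ hi] at h4
    have e1 : N - (N - (k + 1)) = (N - (N - k)) + 1 := by omega
    rw [e1, pow_succ]
    refine h4.trans ?_
    rw [mul_assoc]
    apply mul_le_mul_of_nonneg_left _ (by positivity)
    linarith
  let nx : ℕ → Finset (Fin N) → Finset (Fin N) := fun k I =>
    if h : k < N ∧ Good (N - k) I then I.erase (Classical.choose (step k I h.1 h.2)) else I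
  let J : ℕ → Finset (Fin N) := fun k => Nat.rec Finset.univ (fun k I => nx k I) k
  have hJs : ∀ k, J (k + 1) = nx k (J k) := fun k => rfl
  have hJ : ∀ k, k ≤ N → Good (N - k) (J k) := by
    intro k
    induction k with
    | zero => intro _; exact ⟨by simp [J], fun u _ => by simp [J]⟩
    | succ k ih =>
      intro hk
      have h := ih (by omega)
      rw [hJs]
      simp only [nx, dif_pos (show k < N ∧ Good (N - k) (J k) from ⟨hk, h⟩)]
      exact (Classical.choose_spec (step k (J k) hk h)).2
  have hJe : ∀ k, k < N → ∃ i ∈ J k, J (k + 1) = (J k).erase i := by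
    intro k hk
    refine ⟨_, (Classical.choose_spec (step k (J k) hk (hJ k hk.le))).1, ?_⟩
    rw [hJs]
    simp only [nx, dif_pos (show k < N ∧ Good (N - k) (J k) from ⟨hk, hJ k hk.le⟩)]
  have hJm : ∀ k k', k ≤ k' → J k' ⊆ J k := by
    intro k k' h
    induction k', h using Nat.le_induction with
    | base => exact Finset.Subset.refl _
    | succ k' h ih =>
      refine Finset.Subset.trans ?_ ih
      rw [hJs]; simp only [nx]; split_ifs
      · exact Finset.erase_subset _ _
      · exact Finset.Subset.refl _
  have hf : ∀ j : Fin N, ∃ i, i ∈ J (N - (j + 1)) ∧ i ∉ J (N - j) := by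
    intro j
    have hj := j.2
    obtain ⟨i, hi, he⟩ := hJe (N - (j + 1)) (by omega)
    refine ⟨i, hi, ?_⟩
    rw [show N - (j : ℕ) = N - (j + 1) + 1 by omega, he]
    simp
  choose f hf1 hf2 using hf
  have hfi : Function.Injective f := by
    have : ∀ j j' : Fin N, j < j' → f j ≠ f j' := by
      intro j j' h he
      apply hf2 j'
      rw [← he]
      exact hJm _ _ (by omega) (hf1 j)
    intro j j' he
    rcases lt_trichotomy j j' with h | h | h
    · exact absurd he (this _ _ h)
    · exact h
    · exact absurd he.symm (this _ _ h)
  let e : Equiv.Perm (Fin N) := Equiv.ofBijective f (Finite.injective_iff_bijective.mp hfi)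
  have hmem : ∀ (j : Fin N) (i : Fin N), i ∈ J (N - (j + 1)) → e.symm i ≤ j := by
    intro j i hi
    by_contra hcon
    push Not at hcon
    have h1 : f (e.symm i) = i := e.apply_symm_apply i
    apply hf2 (e.symm i)
    rw [h1]
    exact hJm _ _ (by omega) hi
  refine ⟨e.symm, fun j u hu => ?_⟩
  have hj := j.2
  obtain ⟨h1, h2⟩ := hJ (N - (j + 1)) (by omega)
  rw [show N - (N - ((j : ℕ) + 1)) = j + 1 by omega] at h1 h2
  have h3 := h2 u hu
  obtain ⟨i, hi, hi2⟩ : ∃ i ∈ J (N - (j + 1)), ∀ i' ∈ J (N - (j + 1)), |u i'| ≤ |u i| :=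
    Finset.exists_max_image _ _ (Finset.card_pos.mp (by omega))
  refine ⟨i, hmem j i hi, ?_⟩
  have h4 : ∑ i ∈ J (N - (j + 1)), |u i| ≤ N * |u i| := by
    refine (Finset.sum_le_card_nsmul _ _ _ hi2).trans ?_
    rw [nsmul_eq_mul]
    apply mul_le_mul_of_nonneg_right _ (abs_nonneg _)
    rw [h1]; exact_mod_cast hj
  have h5 : (2 : ℝ) ^ (N - (j + 1)) ≤ 2 ^ N := pow_le_pow_right₀ (by norm_num) (by omega)
  have h6 : ∑ i, |u i| ≤ N * 2 ^ N * |u i| := by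
    refine h3.trans ?_
    calc _ ≤ (2 : ℝ) ^ N * (N * |u i|) := by
          apply mul_le_mul h5 h4 (Finset.sum_nonneg fun _ _ => abs_nonneg _) (by positivity)
      _ = _ := by ring
  rw [pi_norm_le_iff_of_nonneg (by positivity)]
  intro i'
  refine le_trans ?_ h6
  exact Finset.single_le_sum (f := fun i => |u i|) (fun _ _ => abs_nonneg _) (Finset.mem_univ i')

lemma det_le_rows {N : ℕ} (A : Matrix (Fin N) (Fin N) ℝ) (r : Fin N → ℝ) (h : ∀ i j, |A i j| ≤ r i) :
    |A.det| ≤ N.factorial * ∏ i, r i := by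
  rw [← Matrix.det_transpose, Matrix.det_apply]
  refine (Finset.abs_sum_le_sum_abs _ _).trans ?_
  have : ∀ σ ∈ (Finset.univ : Finset (Equiv.Perm (Fin N))), |Equiv.Perm.sign σ • ∏ i, A.transpose (σ i) i| ≤ ∏ i, r i := by
    intro σ _
    rw [Units.smul_def, zsmul_eq_mul, abs_mul, Finset.abs_prod]
    have : |(((Equiv.Perm.sign σ : ℤˣ) : ℤ) : ℝ)| = 1 := by
      rcases Int.units_eq_one_or (Equiv.Perm.sign σ) with h | h <;> simp [h]
    rw [this, one_mul]
    exact Finset.prod_le_prod (fun _ _ => abs_nonneg _) fun i _ => h _ _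
  refine (Finset.sum_le_card_nsmul _ _ _ this).trans ?_
  rw [nsmul_eq_mul, Finset.card_univ, Fintype.card_perm, Fintype.card_fin]
end TM

namespace TM
open Matrix

/-- real vector of an integer vector -/
def cv {N : ℕ} (x : Fin N → ℤ) : Fin N → ℝ := fun l => (x l : ℝ)

/-- the norm `max |B_i x|` -/
noncomputable def nm {N : ℕ} (B : Matrix (Fin N) (Fin N) ℝ) (x : Fin N → ℤ) : ℝ := ‖B *ᵥ cv x‖

lemma nm_nonneg {N : ℕ} (B : Matrix (Fin N) (Fin N) ℝ) (x : Fin N → ℤ) : 0 ≤ nm B x := norm_nonneg _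

lemma cv_ne {N : ℕ} {x : Fin N → ℤ} (hx : x ≠ 0) : cv x ≠ 0 := by
  intro h
  apply hx
  ext l
  have := congrFun h l
  simpa [cv] using this

lemma nm_pos {N : ℕ} {B : Matrix (Fin N) (Fin N) ℝ} (hB : B.det ≠ 0) {x : Fin N → ℤ} (hx : x ≠ 0) :
    0 < nm B x := by
  rw [nm, norm_pos_iff]
  intro h
  exact cv_ne hx (Matrix.eq_zero_of_mulVec_eq_zero hB h)

lemma nm_finite {N : ℕ} {B : Matrix (Fin N) (Fin N) ℝ} (hB : B.det ≠ 0) (R : ℝ) :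
    {x : Fin N → ℤ | nm B x ≤ R}.Finite := by
  classical
  set C : ℝ := (∑ l, ∑ i, |B⁻¹ l i|) * R
  have : {x : Fin N → ℤ | nm B x ≤ R} ⊆ Set.Icc (fun _ => -⌈C⌉) (fun _ => ⌈C⌉) := by
    intro x hx
    have hx' : ‖B *ᵥ cv x‖ ≤ R := hx
    have hR : 0 ≤ R := (norm_nonneg _).trans hx'
    have key : ∀ l, |(x l : ℝ)| ≤ C := by
      intro l
      have h1 : cv x = B⁻¹ *ᵥ (B *ᵥ cv x) := by
        rw [Matrix.mulVec_mulVec, Matrix.nonsing_inv_mul _ (isUnit_iff_ne_zero.mpr hB), Matrix.one_mulVec]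
      have h2 : (x l : ℝ) = ∑ i, B⁻¹ l i * (B *ᵥ cv x) i := congrFun h1 l
      rw [h2]
      refine (Finset.abs_sum_le_sum_abs _ _).trans ?_
      have h3 : ∑ i, |B⁻¹ l i * (B *ᵥ cv x) i| ≤ (∑ i, |B⁻¹ l i|) * R := by
        rw [Finset.sum_mul]
        refine Finset.sum_le_sum fun i _ => ?_
        rw [abs_mul]
        exact mul_le_mul_of_nonneg_left ((norm_le_pi_norm (B *ᵥ cv x) i).trans hx') (abs_nonneg _)
      refine h3.trans (mul_le_mul_of_nonneg_right ?_ hR)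
      exact Finset.single_le_sum (f := fun l => ∑ i, |B⁻¹ l i|)
        (fun _ _ => Finset.sum_nonneg fun _ _ => abs_nonneg _) (Finset.mem_univ l)
    constructor
    · intro l
      have := (neg_le_of_abs_le (key l))
      have h2 := Int.le_ceil C
      have : -(⌈C⌉ : ℝ) ≤ x l := by linarith
      exact_mod_cast this
    · intro l
      have := (le_of_abs_le (key l))
      have h2 := Int.le_ceil C
      have : (x l : ℝ) ≤ ⌈C⌉ := by linarith
      exact_mod_cast this
  exact (Set.finite_Icc _ _).subset this

lemma nm_exists_min {N : ℕ} {B : Matrix (Fin N) (Fin N) ℝ} (hB : B.det ≠ 0) (p : (Fin N → ℤ) → Prop)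
    (hp : ∃ x, p x) : ∃ x, p x ∧ ∀ y, p y → nm B x ≤ nm B y := by
  obtain ⟨x0, h0⟩ := hp
  have hf : {x | p x ∧ nm B x ≤ nm B x0}.Finite := (nm_finite hB (nm B x0)).subset fun x hx => hx.2
  obtain ⟨x, hx, hm⟩ := Set.exists_min_image _ (nm B) hf ⟨x0, h0, le_refl _⟩
  refine ⟨x, hx.1, fun y hy => ?_⟩
  by_cases h : nm B y ≤ nm B x0
  · exact hm y ⟨hy, h⟩
  · exact hx.2.trans (not_le.mp h).le

/-- the flag spanned by the first vectors -/
def flag {N : ℕ} (x : Fin N → Fin N → ℤ) (j : ℕ) : Submodule ℝ (Fin N → ℝ) :=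
  Submodule.span ℝ ((fun i => cv (x i)) '' {i | (i : ℕ) < j})

lemma flag_mono {N : ℕ} (x : Fin N → Fin N → ℤ) : Monotone (flag x) := fun j j' h =>
  Submodule.span_mono (Set.image_mono fun i hi => lt_of_lt_of_le hi h)

lemma flag_rank {N : ℕ} (x : Fin N → Fin N → ℤ) (j : ℕ) : Module.finrank ℝ (flag x j) ≤ j := by
  classical
  have : ((fun i => cv (x i)) '' {i | (i : ℕ) < j}) =
      (((Finset.univ.filter fun i : Fin N => (i : ℕ) < j).image fun i => cv (x i) : Finset _) : Set (Fin N → ℝ)) := by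
    ext v; simp
  rw [flag, this]
  refine (finrank_span_finset_le_card _).trans (Finset.card_image_le.trans ?_)
  calc _ = ((Finset.univ.filter fun i : Fin N => (i : ℕ) < j).image (fun i : Fin N => (i : ℕ))).card :=
        (Finset.card_image_of_injective _ Fin.val_injective).symm
    _ ≤ (Finset.range j).card := Finset.card_le_card (by intro k; simp; intro a h1 h2; omega)
    _ = j := Finset.card_range j

structure IsMin {N : ℕ} (B : Matrix (Fin N) (Fin N) ℝ) (x : Fin N → Fin N → ℤ) : Prop where
  li : LinearIndependent ℝ fun j => cv (x j)
  mono : ∀ i j, i ≤ j → nm B (x i) ≤ nm B (x j)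
  min : ∀ (j : Fin N) y, cv y ∉ flag x j → nm B (x j) ≤ nm B y

theorem exists_min {N : ℕ} {B : Matrix (Fin N) (Fin N) ℝ} (hB : B.det ≠ 0) : ∃ x, IsMin B x := by
  classical
  have hg : ∀ V : Submodule ℝ (Fin N → ℝ), ∃ x : Fin N → ℤ, V ≠ ⊤ → (cv x ∉ V ∧ ∀ y, cv y ∉ V → nm B x ≤ nm B y) := by
    intro V
    by_cases hV : V = ⊤
    · exact ⟨0, fun h => absurd hV h⟩
    · obtain ⟨x, h1, h2⟩ := nm_exists_min hB (fun x => cv x ∉ V) (by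
        by_contra hcon
        push Not at hcon
        apply hV
        rw [eq_top_iff, ← (Pi.basisFun ℝ (Fin N)).span_eq, Submodule.span_le]
        rintro _ ⟨i, rfl⟩
        have h1 : Pi.basisFun ℝ (Fin N) i = cv (Pi.single i 1) := by
          ext l
          by_cases h : l = i
          · subst h; simp [cv]
          · simp [cv, h]
        rw [h1]
        exact hcon (Pi.single i 1))
      exact ⟨x, fun _ => ⟨h1, h2⟩⟩
  choose g hg using hg
  let V : ℕ → Submodule ℝ (Fin N → ℝ) := fun k => Nat.rec ⊥ (fun _ W => W ⊔ Submodule.span ℝ {cv (g W)}) k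
  have hVs : ∀ k, V (k + 1) = V k ⊔ Submodule.span ℝ {cv (g (V k))} := fun _ => rfl
  let x : Fin N → Fin N → ℤ := fun j => g (V j)
  have hfl : ∀ k, k ≤ N → V k = flag x k := by
    intro k
    induction k with
    | zero => intro _; simp [V, flag]
    | succ k ih =>
      intro hk
      rw [hVs, ih (by omega), flag, flag, ← Submodule.span_union]
      congr 1
      ext v
      simp only [Set.mem_union, Set.mem_image, Set.mem_setOf_eq, Set.mem_singleton_iff]
      constructor
      · rintro (⟨i, hi, rfl⟩ | rfl)
        · exact ⟨i, by omega, rfl⟩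
        · refine ⟨⟨k, hk⟩, by simp, ?_⟩
          change cv (g (V k)) = _
          rw [ih (by omega)]; rfl
      · rintro ⟨i, hi, rfl⟩
        rcases Nat.lt_succ_iff_lt_or_eq.mp hi with h | h
        · exact Or.inl ⟨i, h, rfl⟩
        · right
          change cv (g (V i)) = _
          rw [h, ih (by omega)]; rfl
  have hne : ∀ k, k < N → V k ≠ ⊤ := by
    intro k hk h
    have h1 := flag_rank x k
    rw [← hfl k hk.le, h, finrank_top] at h1
    simp at h1; omega
  have hx1 : ∀ j : Fin N, cv (x j) ∉ flag x j := fun j => by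
    rw [← hfl j j.2.le]; exact (hg _ (hne j j.2)).1
  have hx2 : ∀ (j : Fin N) y, cv y ∉ flag x j → nm B (x j) ≤ nm B y := fun j y hy => by
    rw [← hfl j j.2.le] at hy; exact (hg _ (hne j j.2)).2 y hy
  refine ⟨x, ?_, fun i j hij => hx2 i _ (fun h => hx1 j (flag_mono x hij h)), hx2⟩
  have hfr : ∀ k : ℕ, k ≤ N → k ≤ Module.finrank ℝ (flag x k) := by
    intro k
    induction k with
    | zero => intro _; omega
    | succ k ih =>
      intro hk
      have h1 := ih (by omega)
      have : flag x k < flag x (k + 1) := by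
        refine lt_of_le_of_ne (flag_mono x (Nat.le_succ k)) fun h => ?_
        apply hx1 ⟨k, hk⟩
        change _ ∈ flag x k
        rw [h]
        exact Submodule.subset_span ⟨⟨k, hk⟩, by simp, rfl⟩
      have := Submodule.finrank_lt_finrank_of_lt this
      omega
  have htop : flag x N = ⊤ := by
    apply Submodule.eq_top_of_finrank_eq
    have := hfr N le_rfl
    have h2 := flag_rank x N
    simp; omega
  apply linearIndependent_of_top_le_span_of_card_eq_finrank
  · rw [← htop]
    exact Submodule.span_mono (by rintro _ ⟨i, _, rfl⟩; exact ⟨i, rfl⟩)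
  · simp
end TM

namespace TM
open Matrix MeasureTheory

/-- Minkowski's linear forms theorem, weak form -/
lemma minkowski {N : ℕ} {B : Matrix (Fin N) (Fin N) ℝ} (hB : B.det ≠ 0) (r : Fin N → ℝ) (hr : ∀ i, 0 < r i)
    (h : |B.det| < ∏ i, r i) : ∃ x : Fin N → ℤ, x ≠ 0 ∧ ∀ i, |(B *ᵥ cv x) i| < r i := by
  classical
  set s : Set (Fin N → ℝ) := (Matrix.toLin' B) ⁻¹' (Set.pi Set.univ fun i => Set.Ioo (- r i) (r i)) with hs
  have hmem : ∀ v, v ∈ s ↔ ∀ i, |(B *ᵥ v) i| < r i := by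
    intro v
    simp [hs, abs_lt]
  have hvol : volume s = ENNReal.ofReal |(B.det)⁻¹| * ∏ i, ENNReal.ofReal (2 * r i) := by
    rw [hs, Measure.addHaar_preimage_linearMap _ (by rwa [LinearMap.det_toLin']), LinearMap.det_toLin',
      Real.volume_pi_Ioo]
    congr 1
    refine Finset.prod_congr rfl fun i _ => ?_
    congr 1; ring
  haveI : Countable (Submodule.span ℤ (Set.range ⇑(Pi.basisFun ℝ (Fin N)))).toAddSubgroup :=
    inferInstanceAs (Countable (Submodule.span ℤ (Set.range ⇑(Pi.basisFun ℝ (Fin N)))))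
  obtain ⟨⟨v, hv⟩, hv0, hvs⟩ := exists_ne_zero_mem_lattice_of_measure_mul_two_pow_lt_measure
    (μ := volume) (s := s) (ZSpan.isAddFundamentalDomain' (Pi.basisFun ℝ (Fin N)) volume)
    (by
      intro v hv
      rw [hmem] at hv ⊢
      intro i
      rw [Matrix.mulVec_neg, Pi.neg_apply, abs_neg]
      exact hv i)
    (by
      apply Convex.linear_preimage
      apply convex_pi
      intro i _
      exact convex_Ioo _ _)
    (by
      rw [hvol, ZSpan.volume_fundamentalDomain]
      rw [← ENNReal.ofReal_prod_of_nonneg (fun i _ => by have := hr i; positivity),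
        ← ENNReal.ofReal_mul (abs_nonneg _), Finset.prod_mul_distrib]
      have h1 : (Matrix.of (Pi.basisFun ℝ (Fin N))).det = 1 := by
        have : Matrix.of (Pi.basisFun ℝ (Fin N)) = 1 := by
          ext i j
          simp [Matrix.one_apply, Pi.single_apply, eq_comm]
        rw [this, Matrix.det_one]
      rw [h1]
      simp only [abs_one, ENNReal.ofReal_one, one_mul, Module.finrank_fin_fun, Finset.prod_const, Finset.card_univ,
        Fintype.card_fin]
      rw [show (2 : ENNReal) ^ N = ENNReal.ofReal (2 ^ N) by
        rw [ENNReal.ofReal_pow (by norm_num)]; norm_num]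
      rw [ENNReal.ofReal_lt_ofReal_iff_of_nonneg (by positivity), abs_inv]
      have hd : 0 < |B.det| := abs_pos.mpr hB
      have : 1 < |B.det|⁻¹ * ∏ i, r i := by
        rw [inv_mul_eq_div, lt_div_iff₀ hd, one_mul]; exact h
      have h2 : (0 : ℝ) < 2 ^ N := by positivity
      nlinarith)
  rw [Submodule.mem_toAddSubgroup] at hv
  replace hv := ((Pi.basisFun ℝ (Fin N)).mem_span_iff_repr_mem ℤ v).mp hv
  choose x hx using hv
  have hxv : cv x = v := by
    ext l
    have := hx l
    simpa [cv] using this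
  refine ⟨x, ?_, ?_⟩
  · rintro rfl
    apply hv0
    apply Subtype.ext
    change v = 0
    rw [← hxv]; ext l; simp [cv]
  · rw [hxv]; exact (hmem v).mp hvs

lemma IsMin.pos {N : ℕ} {B : Matrix (Fin N) (Fin N) ℝ} (hB : B.det ≠ 0) {x : Fin N → Fin N → ℤ} (hx : IsMin B x)
    (j : Fin N) : 0 < nm B (x j) := by
  apply nm_pos hB
  intro h
  apply hx.li.ne_zero j
  simp only [h]
  ext l; simp [cv]

lemma IsMin.flag_top {N : ℕ} {B : Matrix (Fin N) (Fin N) ℝ} {x : Fin N → Fin N → ℤ} (hx : IsMin B x) :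
    flag x N = ⊤ := by
  have h1 := hx.li.span_eq_top_of_card_eq_finrank' (by simp)
  rw [flag, ← h1]
  congr 1
  ext v; simp

/-- every nonzero integer vector is in exactly one layer of the flag -/
lemma IsMin.layer {N : ℕ} {B : Matrix (Fin N) (Fin N) ℝ} {x : Fin N → Fin N → ℤ} (hx : IsMin B x)
    {y : Fin N → ℤ} (hy : y ≠ 0) : ∃ j : Fin N, cv y ∈ flag x (j + 1) ∧ cv y ∉ flag x j := by
  classical
  have hex : ∃ k, cv y ∈ flag x k := ⟨N, by rw [hx.flag_top]; trivial⟩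
  have h0 : Nat.find hex ≠ 0 := by
    intro h
    have := Nat.find_spec hex
    rw [h] at this
    simp [flag] at this
    exact cv_ne hy this
  have hN : Nat.find hex ≤ N := Nat.find_min' hex (by rw [hx.flag_top]; trivial)
  refine ⟨⟨Nat.find hex - 1, by omega⟩, ?_, ?_⟩
  · simp only
    rw [Nat.sub_add_cancel (by omega)]
    exact Nat.find_spec hex
  · exact Nat.find_min hex (by simp only; omega)

/-- the constant in Davenport's ordering -/
noncomputable def dK (N : ℕ) : ℝ := N * 2 ^ N

lemma dK_pos {N : ℕ} (i : Fin N) : 0 < dK N := by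
  have : (0 : ℝ) < N := by exact_mod_cast Fin.pos i
  unfold dK; positivity

/-- Davenport's ordering of the forms -/
theorem IsMin.davenport {N : ℕ} {B : Matrix (Fin N) (Fin N) ℝ} {x : Fin N → Fin N → ℤ} (_hx : IsMin B x) :
    ∃ σ : Equiv.Perm (Fin N), ∀ j : Fin N, ∀ y : Fin N → ℤ, cv y ∈ flag x (j + 1) →
      ∃ i, σ i ≤ j ∧ nm B y ≤ dK N * |(B *ᵥ cv y) i| := by
  obtain ⟨σ, hσ⟩ := chain (fun j => (flag x j).map (Matrix.toLin' B))
    (fun j => (Submodule.finrank_map_le _ _).trans (flag_rank x j)) (fun j j' h => Submodule.map_mono (flag_mono x h))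
  refine ⟨σ, fun j y hy => ?_⟩
  obtain ⟨i, h1, h2⟩ := hσ j (B *ᵥ cv y) ⟨cv y, hy, by simp⟩
  exact ⟨i, h1, h2⟩

theorem IsMin.prod_le {N : ℕ} {B : Matrix (Fin N) (Fin N) ℝ} (hB : B.det ≠ 0) {x : Fin N → Fin N → ℤ}
    (hx : IsMin B x) : ∏ j, nm B (x j) ≤ dK N ^ N * |B.det| := by
  obtain ⟨σ, hσ⟩ := hx.davenport
  by_contra hcon
  push Not at hcon
  obtain ⟨y, hy0, hy⟩ := minkowski hB (fun i => nm B (x (σ i)) / dK N)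
    (fun i => div_pos (hx.pos hB _) (dK_pos i)) (by
      rw [Finset.prod_div_distrib, Finset.prod_const, Finset.card_univ, Fintype.card_fin,
        Equiv.prod_comp σ (fun j => nm B (x j))]
      rcases Nat.eq_zero_or_pos N with h0 | h0
      · subst h0; simp at hcon
      · rw [lt_div_iff₀ (pow_pos (dK_pos ⟨0, h0⟩) _)]; linarith)
  obtain ⟨j, hj1, hj2⟩ := hx.layer hy0
  obtain ⟨i, hi1, hi2⟩ := hσ j y hj1
  have h1 := hx.min j y hj2
  have h2 := hx.mono _ _ hi1
  have h3 := hy i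
  rw [lt_div_iff₀ (dK_pos i)] at h3
  linarith

/-- the integer matrix of the minima -/
lemma IsMin.det_ne {N : ℕ} {B : Matrix (Fin N) (Fin N) ℝ} {x : Fin N → Fin N → ℤ}
    (hx : IsMin B x) : (Matrix.of x).det ≠ 0 := by
  intro h
  have h1 : ((Matrix.of x).map (Int.castRingHom ℝ)).det = 0 := by
    rw [← RingHom.mapMatrix_apply, ← RingHom.map_det, h, map_zero]
  have h2 := (Matrix.linearIndependent_rows_iff_isUnit (A := (Matrix.of x).map (Int.castRingHom ℝ))).mp hx.li
  rw [Matrix.isUnit_iff_isUnit_det, h1] at h2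
  exact not_isUnit_zero h2

theorem det_le_prod {N : ℕ} {B : Matrix (Fin N) (Fin N) ℝ} {x : Fin N → Fin N → ℤ}
    (hx : (Matrix.of x).det ≠ 0) : |B.det| ≤ N.factorial * ∏ j, nm B (x j) := by
  have h1 : |(((Matrix.of x).map (Int.castRingHom ℝ)) * Bᵀ).det| ≤ N.factorial * ∏ j, nm B (x j) := by
    apply det_le_rows
    intro i j
    have : (((Matrix.of x).map (Int.castRingHom ℝ)) * Bᵀ) i j = (B *ᵥ cv (x i)) j := by
      simp [Matrix.mul_apply, Matrix.mulVec, dotProduct, cv, mul_comm]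
    rw [this]
    exact norm_le_pi_norm (B *ᵥ cv (x i)) j
  rw [Matrix.det_mul, Matrix.det_transpose, ← RingHom.mapMatrix_apply, ← RingHom.map_det, abs_mul] at h1
  refine le_trans ?_ h1
  apply le_mul_of_one_le_left (abs_nonneg _)
  simp only [eq_intCast, ← Int.cast_abs]
  exact_mod_cast Int.one_le_abs hx

/-- dual vectors -/
theorem IsMin.dual {N : ℕ} {B : Matrix (Fin N) (Fin N) ℝ} (hB : B.det ≠ 0) {x : Fin N → Fin N → ℤ}
    (hx : IsMin B x) : ∃ (h : Fin N → Fin N → ℤ) (d : ℤ), d ≠ 0 ∧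
      (∀ b c, ∑ l, h b l * x c l = if b = c then d else 0) ∧
      ∀ b i, |∑ l, (h b l : ℝ) * B⁻¹ l i| * nm B (x b) ≤ N.factorial * dK N ^ N := by
  classical
  set X := Matrix.of x with hX
  set XR := X.map (Int.castRingHom ℝ) with hXR
  refine ⟨fun b l => X.adjugate l b, X.det, hx.det_ne, ?_, ?_⟩
  · intro b c
    have := congrFun (congrFun (Matrix.mul_adjugate X) c) b
    rw [Matrix.mul_apply] at this
    simp only [hX, Matrix.smul_apply, Matrix.one_apply, smul_eq_mul] at this
    simp only [hX]
    rw [← Finset.sum_congr rfl fun l _ => mul_comm _ _]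
    simp only [Matrix.of_apply] at this ⊢
    rw [this]
    by_cases hbc : b = c
    · simp [hbc]
    · simp [hbc, Ne.symm hbc]
  · intro b i
    have hd : 0 < |B.det| := abs_pos.mpr hB
    have e1 : (XR * Bᵀ).adjugate = B.adjugateᵀ * XR.adjugate := by
      rw [Matrix.adjugate_mul_distrib, Matrix.adjugate_transpose]
    have e2 : B⁻¹ = (B.det)⁻¹ • B.adjugate := by
      rw [Matrix.inv_def, Ring.inverse_eq_inv']
    have e3 : ∑ l, ((X.adjugate l b : ℤ) : ℝ) * B⁻¹ l i = (B.det)⁻¹ * (XR * Bᵀ).adjugate i b := by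
      rw [e1, Matrix.mul_apply, Finset.mul_sum]
      refine Finset.sum_congr rfl fun l _ => ?_
      have : XR.adjugate l b = ((X.adjugate l b : ℤ) : ℝ) := by
        rw [hXR]
        have := congrFun (congrFun (RingHom.map_adjugate (Int.castRingHom ℝ) X) l) b
        exact this.symm
      rw [this, e2, Matrix.smul_apply, Matrix.transpose_apply, smul_eq_mul]
      ring
    rw [e3, abs_mul, abs_inv, Matrix.adjugate_apply]
    have h1 : |((XR * Bᵀ).updateRow b (Pi.single i 1)).det| ≤
        N.factorial * ∏ c, (if c = b then 1 else nm B (x c)) := by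
      apply det_le_rows
      intro c j
      by_cases hc : c = b
      · subst hc
        rw [Matrix.updateRow_self, if_pos rfl]
        by_cases hj : j = i
        · subst hj; simp
        · simp [hj]
      · rw [Matrix.updateRow_ne hc, if_neg hc]
        have : (XR * Bᵀ) c j = (B *ᵥ cv (x c)) j := by
          simp [hXR, hX, Matrix.mul_apply, Matrix.mulVec, dotProduct, cv, mul_comm]
        rw [this]
        exact norm_le_pi_norm (B *ᵥ cv (x c)) j
    have h2 : (∏ c, (if c = b then 1 else nm B (x c))) * nm B (x b) = ∏ c, nm B (x c) := by
      rw [← Finset.mul_prod_erase _ _ (Finset.mem_univ b), if_pos rfl, one_mul,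
        ← Finset.mul_prod_erase _ (fun c => nm B (x c)) (Finset.mem_univ b), mul_comm]
      congr 1
      exact Finset.prod_congr rfl fun c hc => if_neg (Finset.ne_of_mem_erase hc)
    have h3 := hx.prod_le hB
    calc _ ≤ |B.det|⁻¹ * (N.factorial * ∏ c, (if c = b then 1 else nm B (x c))) * nm B (x b) := by
          gcongr
          exact nm_nonneg _ _
      _ = N.factorial * (|B.det|⁻¹ * ∏ c, nm B (x c)) := by rw [← h2]; ring
      _ ≤ N.factorial * (|B.det|⁻¹ * (dK N ^ N * |B.det|)) := by gcongr
      _ = _ := by field_simp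
end TM

namespace TM
open Matrix

/-- sub-basis lemma -/
theorem subbasis {N : ℕ} {ι : Type*} [Fintype ι] (M : Matrix ι (Fin N) ℝ) (G : Matrix (Fin N) ι ℝ) (hG : G * M = 1)
    (A : ι → ℝ) (hA : ∀ i, 0 < A i) : ∃ e : Fin N → ι, (M.submatrix e id).det ≠ 0 ∧
      ∀ (i : ι) (v : Fin N → ℝ), A i * |∑ l, M i l * v l| ≤ ∑ a, A (e a) * |∑ l, M (e a) l * v l| := by
  classical
  have hspan : Submodule.span ℝ (Set.range fun i => M i) = ⊤ := by
    rw [eq_top_iff]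
    intro v _
    have h1 : v = (v ᵥ* G) ᵥ* M := by rw [Matrix.vecMul_vecMul, hG, Matrix.vecMul_one]
    have h2 : v = ∑ i, (v ᵥ* G) i • M i := by
      conv_lhs => rw [h1]
      ext l
      simp [Matrix.vecMul, dotProduct]
    rw [h2]
    exact Submodule.sum_mem _ fun i _ => Submodule.smul_mem _ _ (Submodule.subset_span ⟨i, rfl⟩)
  have hex : ∃ e : Fin N → ι, (M.submatrix e id).det ≠ 0 := by
    obtain ⟨f, h1, h2, h3⟩ := Submodule.exists_fun_fin_finrank_span_eq ℝ (Set.range fun i => M i)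
    have hN : Module.finrank ℝ (Submodule.span ℝ (Set.range fun i => M i)) = N := by rw [hspan]; simp
    choose e he using fun a => h1 (Fin.cast hN.symm a)
    refine ⟨e, ?_⟩
    have h4 : LinearIndependent ℝ (fun a : Fin N => M (e a)) := by
      have : (fun a : Fin N => M (e a)) = f ∘ (Fin.cast hN.symm) := by ext a; simp [← he]
      rw [this]
      exact h3.comp _ (Fin.cast_injective _)
    have h5 := (Matrix.linearIndependent_rows_iff_isUnit (A := M.submatrix e id)).mp h4
    exact ((Matrix.isUnit_iff_isUnit_det _).mp h5).ne_zero
  obtain ⟨e0, he0⟩ := hex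
  haveI : Nonempty (Fin N → ι) := ⟨e0⟩
  obtain ⟨e, he⟩ := Finite.exists_max (fun e : Fin N → ι => |(M.submatrix e id).det| * ∏ a, A (e a))
  have hpos : 0 < |(M.submatrix e id).det| := by
    have h1 := he e0
    have h2 : 0 < |(M.submatrix e0 id).det| * ∏ a, A (e0 a) :=
      mul_pos (abs_pos.mpr he0) (Finset.prod_pos fun _ _ => hA _)
    by_contra hcon
    have : |(M.submatrix e id).det| = 0 := le_antisymm (not_lt.mp hcon) (abs_nonneg _)
    rw [this, zero_mul] at h1
    linarith
  set E := M.submatrix e id with hE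
  have hdet : E.det ≠ 0 := abs_pos.mp hpos
  refine ⟨e, hdet, fun i v => ?_⟩
  set t : Fin N → ℝ := M i ᵥ* E⁻¹ with ht
  have hMi : M i = t ᵥ* E := by
    rw [ht, Matrix.vecMul_vecMul, Matrix.nonsing_inv_mul _ (isUnit_iff_ne_zero.mpr hdet), Matrix.vecMul_one]
  have hMi' : ∀ l, M i l = ∑ a, t a * M (e a) l := fun l => congrFun hMi l
  have hta : ∀ a, A i * |t a| ≤ A (e a) := by
    intro a
    have h1 := he (Function.update e a i)
    have h2 : M.submatrix (Function.update e a i) id = E.updateRow a (M i) := by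
      ext b l
      by_cases hb : b = a
      · subst hb; simp
      · simp [hb, hE]
    have h3 : (E.updateRow a (M i)).det = t a * E.det := by
      have : M i = ∑ b, t b • E b := by
        ext l; rw [hMi' l]; simp [hE]
      rw [this, Matrix.det_updateRow_sum]
      simp
    rw [h2, h3, ← Finset.mul_prod_erase _ _ (Finset.mem_univ a), Function.update_self,
      ← Finset.mul_prod_erase _ (fun b => A (e b)) (Finset.mem_univ a)] at h1
    have h4 : ∏ b ∈ Finset.univ.erase a, A (Function.update e a i b) = ∏ b ∈ Finset.univ.erase a, A (e b) :=
      Finset.prod_congr rfl fun b hb => by rw [Function.update_of_ne (Finset.ne_of_mem_erase hb)]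
    rw [h4, abs_mul] at h1
    have h5 : 0 < ∏ b ∈ Finset.univ.erase a, A (e b) := Finset.prod_pos fun _ _ => hA _
    have h6 : (|E.det| * ∏ b ∈ Finset.univ.erase a, A (e b)) * (A i * |t a|) ≤
        (|E.det| * ∏ b ∈ Finset.univ.erase a, A (e b)) * A (e a) := by linarith
    exact le_of_mul_le_mul_left h6 (mul_pos hpos h5)
  have h1 : ∑ l, M i l * v l = ∑ a, t a * ∑ l, M (e a) l * v l := by
    simp_rw [Finset.mul_sum]
    rw [Finset.sum_comm]
    refine Finset.sum_congr rfl fun l _ => ?_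
    rw [hMi' l, Finset.sum_mul]
    exact Finset.sum_congr rfl fun a _ => by ring
  rw [h1]
  calc _ ≤ A i * ∑ a, |t a * ∑ l, M (e a) l * v l| :=
        mul_le_mul_of_nonneg_left (Finset.abs_sum_le_sum_abs _ _) (hA i).le
    _ = ∑ a, A i * |t a| * |∑ l, M (e a) l * v l| := by
        rw [Finset.mul_sum]
        exact Finset.sum_congr rfl fun a _ => by rw [abs_mul]; ring
    _ ≤ _ := Finset.sum_le_sum fun a _ => mul_le_mul_of_nonneg_right (hta a) (abs_nonneg _)

/-- Liouville's inequality -/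
theorem liouville {N : ℕ} {F : Type*} [Field F] [NumberField F] (τ : F →+* ℝ) (m : Fin N → F) :
    ∃ c : ℝ, 0 < c ∧ ∃ κ : ℕ, ∀ (h : Fin N → ℤ) (H : ℝ), 1 ≤ H → (∀ l, |(h l : ℝ)| ≤ H) →
      ∑ l, m l * h l ≠ 0 → c ≤ |τ (∑ l, m l * h l)| * H ^ κ := by
  classical
  obtain ⟨d, hd0, g, hg⟩ := int_mult m
  set C : ℝ := 1 + ∑ σ : F →ₐ[ℚ] ℂ, ∑ l, ‖σ (g l : F)‖ with hC
  have hC1 : 1 ≤ C := by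
    have : 0 ≤ ∑ σ : F →ₐ[ℚ] ℂ, ∑ l, ‖σ (g l : F)‖ :=
      Finset.sum_nonneg fun _ _ => Finset.sum_nonneg fun _ _ => norm_nonneg _
    linarith
  let τ' : F →ₐ[ℚ] ℂ := (Complex.ofRealHom.comp τ).toRatAlgHom
  set κ := (Finset.univ.erase τ').card with hκ
  have hd0' : (d : ℝ) ≠ 0 := by exact_mod_cast hd0
  refine ⟨1 / (|(d : ℝ)| * C ^ κ), by positivity, κ, fun h H hH hh h0 => ?_⟩
  set ξ : F := ∑ l, m l * h l with hξ
  set x : 𝓞 F := ∑ l, g l * (h l : 𝓞 F) with hx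
  have hxξ : (x : F) = d * ξ := by
    rw [hx, hξ, Finset.mul_sum]
    simp only [map_sum, map_mul, map_intCast]
    exact Finset.sum_congr rfl fun l _ => by linear_combination (h l : F) * hg l
  have hx0 : x ≠ 0 := by
    intro h
    rw [h] at hxξ
    apply h0
    have : (d : F) * ξ = 0 := by rw [← hxξ]; simp
    rcases mul_eq_zero.mp this with h | h
    · exact absurd (by exact_mod_cast h) hd0
    · exact h
  have hnorm : (1 : ℝ) ≤ ∏ σ : F →ₐ[ℚ] ℂ, ‖σ (x : F)‖ := by
    have h1 := Algebra.norm_eq_prod_embeddings ℚ ℂ (x : F)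
    have h2 : (Algebra.norm ℚ (x : F)) = (Algebra.norm ℤ x : ℤ) := (Algebra.coe_norm_int x).symm
    have h3 : Algebra.norm ℤ x ≠ 0 := Algebra.norm_ne_zero_iff.mpr hx0
    rw [← norm_prod, ← h1, h2]
    simp only [map_intCast]
    rw [Complex.norm_intCast, ← Int.cast_abs]
    exact_mod_cast Int.one_le_abs h3
  have hbd : ∀ σ : F →ₐ[ℚ] ℂ, ‖σ (x : F)‖ ≤ C * H := by
    intro σ
    have : σ (x : F) = ∑ l, σ (g l : F) * (h l : ℂ) := by
      rw [hx]; simp only [map_sum, map_mul, map_intCast]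
    rw [this]
    calc _ ≤ ∑ l, ‖σ (g l : F)‖ * H := by
          refine norm_sum_le_of_le _ fun l _ => ?_
          rw [norm_mul, Complex.norm_intCast]
          exact mul_le_mul_of_nonneg_left (hh l) (norm_nonneg _)
      _ = (∑ l, ‖σ (g l : F)‖) * H := by rw [Finset.sum_mul]
      _ ≤ C * H := by
          apply mul_le_mul_of_nonneg_right _ (by linarith)
          have := Finset.single_le_sum (f := fun σ : F →ₐ[ℚ] ℂ => ∑ l, ‖σ (g l : F)‖)
            (fun _ _ => Finset.sum_nonneg fun _ _ => norm_nonneg _) (Finset.mem_univ σ)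
          beta_reduce at this
          linarith
  rw [← Finset.mul_prod_erase _ _ (Finset.mem_univ τ')] at hnorm
  have h1 : ∏ σ ∈ Finset.univ.erase τ', ‖σ (x : F)‖ ≤ (C * H) ^ κ := by
    refine (Finset.prod_le_prod (fun _ _ => norm_nonneg _) fun σ _ => hbd σ).trans ?_
    rw [Finset.prod_const]
  have h2 : ‖τ' (x : F)‖ = |(d : ℝ)| * |τ ξ| := by
    rw [hxξ]
    change ‖((τ (d * ξ) : ℝ) : ℂ)‖ = _
    rw [Complex.norm_real, map_mul, map_intCast, norm_mul]; rfl
  rw [h2] at hnorm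
  have h3 : 1 ≤ |(d : ℝ)| * |τ ξ| * (C * H) ^ κ :=
    hnorm.trans (mul_le_mul_of_nonneg_left h1 (by positivity))
  rw [div_le_iff₀ (by positivity)]
  rw [mul_pow] at h3
  linarith
end TM

namespace TM
open Matrix

lemma bez_mul {N : ℕ} {h y : Fin N → ℤ} (hb : ∃ a : Fin N → ℤ, ∑ l, a l * h l = 1)
    (hy : cv y ∈ Submodule.span ℝ {cv h}) : ∃ r : ℤ, ∀ l, y l = r * h l := by
  obtain ⟨a, ha⟩ := hb
  obtain ⟨t, ht⟩ := Submodule.mem_span_singleton.mp hy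
  have h1 : ∀ l, t * (h l : ℝ) = y l := fun l => congrFun ht l
  refine ⟨∑ l, a l * y l, fun l => ?_⟩
  have h2 : t = ((∑ l, a l * y l : ℤ) : ℝ) := by
    have : (∑ l, (a l : ℝ) * h l) = 1 := by exact_mod_cast ha
    push_cast
    calc t = t * ∑ l, (a l : ℝ) * h l := by rw [this, mul_one]
      _ = _ := by rw [Finset.mul_sum]; exact Finset.sum_congr rfl fun l _ => by rw [← h1]; ring
  have h3 := h1 l
  rw [h2] at h3
  exact_mod_cast h3.symm

lemma nm_smul {N : ℕ} (B : Matrix (Fin N) (Fin N) ℝ) {h y : Fin N → ℤ} {r : ℤ} (hr : ∀ l, y l = r * h l) :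
    nm B y = |(r : ℝ)| * nm B h := by
  have : cv y = (r : ℝ) • cv h := by ext l; simp [cv, hr]
  rw [nm, this, Matrix.mulVec_smul, norm_smul]; rfl

lemma le_nm {N : ℕ} (B : Matrix (Fin N) (Fin N) ℝ) (x : Fin N → ℤ) (i : Fin N) : |(B *ᵥ cv x) i| ≤ nm B x :=
  norm_le_pi_norm (B *ᵥ cv x) i

lemma nm_le {N : ℕ} (B : Matrix (Fin N) (Fin N) ℝ) (x : Fin N → ℤ) {r : ℝ} (hr : 0 ≤ r)
    (h : ∀ i, |(B *ᵥ cv x) i| ≤ r) : nm B x ≤ r := (pi_norm_le_iff_of_nonneg hr).mpr h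

/-- the weighted matrix -/
def wm {N : ℕ} (A : Fin N → ℝ) (M : Matrix (Fin N) (Fin N) ℝ) : Matrix (Fin N) (Fin N) ℝ :=
  Matrix.diagonal A * M

lemma wm_mulVec {N : ℕ} (A : Fin N → ℝ) (M : Matrix (Fin N) (Fin N) ℝ) (v : Fin N → ℝ) (i : Fin N) :
    (wm A M *ᵥ v) i = A i * (M *ᵥ v) i := by
  rw [wm, ← Matrix.mulVec_mulVec, Matrix.mulVec_diagonal]

lemma wm_det {N : ℕ} (A : Fin N → ℝ) (M : Matrix (Fin N) (Fin N) ℝ) : (wm A M).det = (∏ i, A i) * M.det := by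
  rw [wm, Matrix.det_mul, Matrix.det_diagonal]

lemma wm_inv {N : ℕ} (A : Fin N → ℝ) (hA : ∀ i, A i ≠ 0) (M : Matrix (Fin N) (Fin N) ℝ) (l i : Fin N) :
    (wm A M)⁻¹ l i = M⁻¹ l i * (A i)⁻¹ := by
  have : (Matrix.diagonal A)⁻¹ = Matrix.diagonal fun i => (A i)⁻¹ := by
    apply Matrix.inv_eq_right_inv
    rw [Matrix.diagonal_mul_diagonal]
    simp [hA]
  rw [wm, Matrix.mul_inv_rev, this, Matrix.mul_diagonal]

lemma dK_ge {N : ℕ} (hN : 1 ≤ N) : 1 ≤ dK N := by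
  unfold dK
  have h1 : (1 : ℝ) ≤ N := by exact_mod_cast hN
  have h2 : (1 : ℝ) ≤ 2 ^ N := one_le_pow₀ (by norm_num)
  nlinarith

set_option maxHeartbeats 1000000 in
theorem isol_one {N : ℕ} (hN : 2 ≤ N) (M : Matrix (Fin N) (Fin N) ℝ) (hM : M.det ≠ 0) (A : Fin N → ℝ)
    (α β c2 C2 : ℝ) (hα : 0 < α) (hA1 : ∀ i, α ≤ A i) (hA2 : ∀ i, A i ≤ β)
    (hc2 : 0 < c2) (hc : ∀ x, x ≠ 0 → c2 ≤ nm M x) (hC : ∀ l, nm M (Pi.single l 1) ≤ C2)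
    (h : Fin N → ℤ) (hb : ∃ a : Fin N → ℤ, ∑ l, a l * h l = 1) (E : ℝ) (hE : dK N < E)
    (hiso : ∀ y, cv y ∉ Submodule.span ℝ {cv h} → E * nm (wm A M) h ≤ nm (wm A M) y) :
    ∃ (w : Fin N → ℝ) (z : Fin N → Fin N → ℤ) (q : ℝ), 0 < q ∧ q * E ≤ 1 ∧ (∀ i, 0 < w i) ∧
      (∀ v : Fin N → ℚ, ∑ l, (h l : ℚ) * v l = 0 → ∃ u : Fin N → ℚ, ∀ l', v l' = ∑ k, u k * z k l') ∧
      (∀ k i, |∑ l, (z k l : ℝ) * M⁻¹ l i| ≤ N.factorial * dK N ^ (N + 1) * w i) ∧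
      q ≤ dK N ^ N * ((∏ i, w i) * |M.det|) ∧ (∏ i, w i) * |M.det| ≤ N.factorial * q ∧
      (∀ i, w i * |(M *ᵥ cv h) i| ≤ q) ∧ (∀ i, α / (β * C2) ≤ w i) ∧ (∀ i, w i ≤ β / (α * c2)) := by
  classical
  have hA : ∀ i, 0 < A i := fun i => hα.trans_le (hA1 i)
  set B := wm A M with hBdef
  have hB : B.det ≠ 0 := by
    rw [hBdef, wm_det]; exact mul_ne_zero (Finset.prod_ne_zero_iff.mpr fun i _ => (hA i).ne') hM
  have hd1 : 1 ≤ dK N := dK_ge (by omega)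
  have hE1 : 1 < E := by linarith
  have hh0 : h ≠ 0 := by
    rintro rfl; obtain ⟨a, ha⟩ := hb; simp at ha
  have hnh : 0 < nm B h := nm_pos hB hh0
  obtain ⟨x, hx⟩ := exists_min hB
  set i0 : Fin N := ⟨0, by omega⟩ with hi0
  set i1 : Fin N := ⟨1, by omega⟩ with hi1
  have hpos : ∀ j, 0 < nm B (x j) := fun j => hx.pos hB j
  have hxne : ∀ {B' : Matrix (Fin N) (Fin N) ℝ} {x' : Fin N → Fin N → ℤ}, IsMin B' x' → ∀ j, x' j ≠ 0 := by
    intro B' x' hx' j h0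
    apply hx'.li.ne_zero j
    ext l; simp [cv, h0]
  have hmin0 : ∀ {B' : Matrix (Fin N) (Fin N) ℝ} {x' : Fin N → Fin N → ℤ}, IsMin B' x' →
      nm B' (x' i0) ≤ nm B' h := by
    intro B' x' hx'
    apply hx'.min i0
    have : flag x' (i0 : ℕ) = ⊥ := by simp [flag, hi0]
    rw [this, Submodule.mem_bot]
    exact cv_ne hh0
  have hmul : ∀ {B' : Matrix (Fin N) (Fin N) ℝ} {x' : Fin N → Fin N → ℤ}, IsMin B' x' →
      cv (x' i0) ∈ Submodule.span ℝ {cv h} → ∀ j, j ≠ i0 → cv (x' j) ∉ Submodule.span ℝ {cv h} := by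
    intro B' x' hx' h0 j hj h1
    obtain ⟨s, hs⟩ := Submodule.mem_span_singleton.mp h0
    obtain ⟨t, ht⟩ := Submodule.mem_span_singleton.mp h1
    have h2 : LinearIndependent ℝ ![cv (x' i0), cv (x' j)] := by
      have := hx'.li.comp ![i0, j] (by
        intro a b hab
        fin_cases a <;> fin_cases b <;> simp_all)
      convert this using 1
      ext a; fin_cases a <;> rfl
    have h3 := LinearIndependent.pair_iff.mp h2 t (-s) (by rw [← hs, ← ht, smul_smul, smul_smul, ← add_smul]; ring_nf; simp)
    have : s = 0 := by linarith [h3.2]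
    rw [this, zero_smul] at hs
    exact hx'.li.ne_zero i0 hs.symm
  have hx0 : cv (x i0) ∈ Submodule.span ℝ {cv h} := by
    by_contra hcon
    have h1 := hiso _ hcon
    have h2 := hmin0 hx
    nlinarith
  have hx0e : nm B (x i0) = nm B h := by
    apply le_antisymm (hmin0 hx)
    obtain ⟨r, hr⟩ := bez_mul hb hx0
    rw [nm_smul B hr]
    have : r ≠ 0 := by
      rintro rfl
      apply hxne hx i0; ext l; simp [hr]
    have : (1 : ℝ) ≤ |(r : ℝ)| := by rw [← Int.cast_abs]; exact_mod_cast Int.one_le_abs this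
    nlinarith
  have hi10 : i1 ≠ i0 := by simp [hi0, hi1]
  have hE2 : E * nm B h ≤ nm B (x i1) := hiso _ (hmul hx hx0 i1 hi10)
  have hfl : ∀ y, cv y ∈ flag x 1 → cv y ∈ Submodule.span ℝ {cv h} := by
    intro y hy
    refine (Submodule.span_le.mpr ?_) hy
    rintro _ ⟨j, hj, rfl⟩
    have : j = i0 := by ext; simp [hi0] at hj ⊢; omega
    rw [this]; exact hx0
  obtain ⟨σ, hσ⟩ := hx.davenport
  set ρ : Fin N → ℝ := fun i => (nm B (x (max (σ i) i1)))⁻¹ with hρ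
  have hρpos : ∀ i, 0 < ρ i := fun i => inv_pos.mpr (hpos _)
  set w : Fin N → ℝ := fun i => ρ i * A i with hw
  have hwpos : ∀ i, 0 < w i := fun i => mul_pos (hρpos i) (hA i)
  set q : ℝ := nm B h / nm B (x i1) with hq
  have hqpos : 0 < q := div_pos hnh (hpos _)
  have hqE : q * E ≤ 1 := by
    rw [hq, div_mul_eq_mul_div, div_le_one (hpos _)]; linarith
  set B' := wm w M with hB'def
  have hB' : B'.det ≠ 0 := by
    rw [hB'def, wm_det]; exact mul_ne_zero (Finset.prod_ne_zero_iff.mpr fun i _ => (hwpos i).ne') hM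
  have hB'B : ∀ v i, (B' *ᵥ v) i = ρ i * (B *ᵥ v) i := by
    intro v i
    rw [hB'def, hBdef, wm_mulVec, wm_mulVec, hw]; ring
  have hρ1 : ∀ i, ρ i ≤ (nm B (x i1))⁻¹ := fun i => inv_anti₀ (hpos _) (hx.mono _ _ (le_max_right _ _))
  have hB'h : ∀ i, |(B' *ᵥ cv h) i| ≤ q := by
    intro i
    rw [hB'B, abs_mul, abs_of_pos (hρpos i), hq, div_eq_inv_mul]
    exact mul_le_mul (hρ1 i) (le_nm _ _ _) (abs_nonneg _) (inv_pos.mpr (hpos _)).le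
  have hB'y : ∀ y, cv y ∉ Submodule.span ℝ {cv h} → 1 ≤ dK N * nm B' y := by
    intro y hy
    have hy0 : y ≠ 0 := by
      rintro rfl; apply hy
      have : cv (0 : Fin N → ℤ) = 0 := by ext l; simp [cv]
      rw [this]; exact zero_mem _
    obtain ⟨j, hj1, hj2⟩ := hx.layer hy0
    have hj : i1 ≤ j := by
      rw [Fin.le_def]
      by_contra hcon
      have : (j : ℕ) = 0 := by simp [hi1] at hcon; omega
      rw [this] at hj1
      exact hy (hfl _ hj1)
    obtain ⟨i, hi, hi2⟩ := hσ j y hj1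
    have h1 : nm B (x j) ≤ nm B y := hx.min j y hj2
    have h2 : (nm B (x j))⁻¹ ≤ ρ i := inv_anti₀ (hpos _) (hx.mono _ _ (max_le hi hj))
    have h3 : 1 ≤ ρ i * nm B y := by
      calc (1 : ℝ) = (nm B (x j))⁻¹ * nm B (x j) := by rw [inv_mul_cancel₀ (hpos j).ne']
        _ ≤ _ := mul_le_mul h2 h1 (hpos j).le (hρpos i).le
    have h4 := le_nm B' y i
    rw [hB'B, abs_mul, abs_of_pos (hρpos i)] at h4
    calc (1 : ℝ) ≤ ρ i * nm B y := h3
      _ ≤ ρ i * (dK N * |(B *ᵥ cv y) i|) := mul_le_mul_of_nonneg_left hi2 (hρpos i).le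
      _ = dK N * (ρ i * |(B *ᵥ cv y) i|) := by ring
      _ ≤ _ := mul_le_mul_of_nonneg_left h4 (by linarith)
  obtain ⟨x', hx'⟩ := exists_min hB'
  have hx'0 : cv (x' i0) ∈ Submodule.span ℝ {cv h} := by
    by_contra hcon
    have h1 := hB'y _ hcon
    have h2 : nm B' (x' i0) ≤ q := (hmin0 hx').trans (nm_le _ _ hqpos.le hB'h)
    have h3 : dK N * nm B' (x' i0) ≤ dK N * q := mul_le_mul_of_nonneg_left h2 (by linarith)
    have h4 : dK N * q < E * q := mul_lt_mul_of_pos_right hE hqpos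
    linarith
  obtain ⟨z, d, hd, hz1, hz2⟩ := hx'.dual hB'
  have hrprod : (∏ i, ρ i) * ∏ j, nm B (x j) = q := by
    have h1 : ∏ i, ρ i = ∏ j, (nm B (x (max j i1)))⁻¹ :=
      Equiv.prod_comp σ (fun j => (nm B (x (max j i1)))⁻¹)
    rw [h1, ← Finset.prod_mul_distrib, ← Finset.mul_prod_erase _ _ (Finset.mem_univ i0)]
    have h2 : max i0 i1 = i1 := max_eq_right (by simp [Fin.le_def, hi0])
    have h3 : ∏ j ∈ Finset.univ.erase i0, (nm B (x (max j i1)))⁻¹ * nm B (x j) = 1 := by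
      apply Finset.prod_eq_one
      intro j hj
      have : max j i1 = j := max_eq_left (by
        have := Finset.ne_of_mem_erase hj
        rw [Fin.le_def]
        have h5 : (j : ℕ) ≠ 0 := fun h => this (by ext; simp [hi0, h])
        simp [hi1]; omega)
      rw [this, inv_mul_cancel₀ (hpos j).ne']
    rw [h2, h3, mul_one, hx0e, hq, div_eq_inv_mul]
  have hdetw : (∏ i, w i) * |M.det| = (∏ i, ρ i) * |B.det| := by
    rw [hBdef, wm_det, abs_mul, abs_of_pos (Finset.prod_pos fun i _ => hA i), ← mul_assoc,
      ← Finset.prod_mul_distrib]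
  have hρprod : 0 < ∏ i, ρ i := Finset.prod_pos fun i _ => hρpos i
  refine ⟨w, fun k => if k = i0 then 0 else z k, q, hqpos, hqE, hwpos, ?_, ?_, ?_, ?_, ?_, ?_, ?_⟩
  · intro v hv
    obtain ⟨r, hr⟩ := bez_mul hb hx'0
    set Z : Matrix (Fin N) (Fin N) ℚ := of fun b l => (d : ℚ)⁻¹ * z b l with hZ
    set X : Matrix (Fin N) (Fin N) ℚ := of fun b l => (x' b l : ℚ) with hX
    have hdq : (d : ℚ) ≠ 0 := by exact_mod_cast hd
    have h1 : Z * Xᵀ = 1 := by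
      ext b c
      rw [Matrix.mul_apply, Matrix.one_apply]
      have h2 : (∑ l, (z b l : ℚ) * x' c l) = if b = c then (d : ℚ) else 0 := by
        have := hz1 b c
        have h3 : ((∑ l, z b l * x' c l : ℤ) : ℚ) = ((if b = c then d else 0 : ℤ) : ℚ) := by rw [this]
        push_cast at h3; exact h3
      have h3 : ∑ l, Z b l * Xᵀ l c = (d : ℚ)⁻¹ * ∑ l, (z b l : ℚ) * x' c l := by
        rw [Finset.mul_sum]; exact Finset.sum_congr rfl fun l _ => by simp [hZ, hX]; ring
      rw [h3, h2]; split_ifs <;> simp [hdq]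
    have h2 : Zᵀ * X = 1 := by
      have := mul_eq_one_comm.mp h1
      have h3 := congrArg Matrix.transpose this
      rwa [Matrix.transpose_mul, Matrix.transpose_transpose, Matrix.transpose_one] at h3
    refine ⟨fun k => (d : ℚ)⁻¹ * ∑ l, (x' k l : ℚ) * v l, fun l' => ?_⟩
    have h3 : v = Zᵀ *ᵥ (X *ᵥ v) := by rw [Matrix.mulVec_mulVec, h2, Matrix.one_mulVec]
    have h4 : v l' = ∑ k, ((d : ℚ)⁻¹ * z k l') * ∑ l, (x' k l : ℚ) * v l := by
      conv_lhs => rw [h3]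
      rfl
    rw [h4]
    refine Finset.sum_congr rfl fun k _ => ?_
    beta_reduce
    split_ifs with hk
    · have : ∑ l, (x' k l : ℚ) * v l = 0 := by
        rw [hk]
        have : ∑ l, (x' i0 l : ℚ) * v l = r * ∑ l, (h l : ℚ) * v l := by
          rw [Finset.mul_sum]; exact Finset.sum_congr rfl fun l _ => by rw [hr]; push_cast; ring
        rw [this, hv, mul_zero]
      rw [this]; simp
    · ring
  · intro k i
    have hC0 : (0 : ℝ) ≤ N.factorial * dK N ^ (N + 1) * w i := by
      have := hwpos i
      have : 0 < dK N := by linarith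
      positivity
    by_cases hk : k = i0
    · simp only [hk, if_true]; simpa using hC0
    · simp only [hk, if_false]
      have h1 := hz2 k i
      have h2 : ∑ l, (z k l : ℝ) * B'⁻¹ l i = (∑ l, (z k l : ℝ) * M⁻¹ l i) * (w i)⁻¹ := by
        rw [Finset.sum_mul]
        exact Finset.sum_congr rfl fun l _ => by rw [hB'def, wm_inv w (fun i => (hwpos i).ne')]; ring
      rw [h2, abs_mul, abs_of_pos (inv_pos.mpr (hwpos i))] at h1
      have h3 := hB'y _ (hmul hx' hx'0 k hk)
      set S := |∑ l, (z k l : ℝ) * M⁻¹ l i| with hS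
      have hS0 : 0 ≤ S := abs_nonneg _
      have h4 : S * (w i)⁻¹ ≤ N.factorial * dK N ^ (N + 1) := by
        calc S * (w i)⁻¹ ≤ S * (w i)⁻¹ * (dK N * nm B' (x' k)) :=
              le_mul_of_one_le_right (mul_nonneg hS0 (inv_pos.mpr (hwpos i)).le) h3
          _ = dK N * (S * (w i)⁻¹ * nm B' (x' k)) := by ring
          _ ≤ dK N * (N.factorial * dK N ^ N) := mul_le_mul_of_nonneg_left h1 (by linarith)
          _ = _ := by ring
      rwa [← div_eq_mul_inv, div_le_iff₀ (hwpos i)] at h4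
  · rw [hdetw, ← hrprod]
    have := mul_le_mul_of_nonneg_left (hx.prod_le hB) hρprod.le
    linarith
  · rw [hdetw, ← hrprod]
    have := mul_le_mul_of_nonneg_left (det_le_prod (B := B) hx.det_ne) hρprod.le
    linarith
  · intro i
    have := hB'h i
    rwa [hB'def, wm_mulVec, abs_mul, abs_of_pos (hwpos i)] at this
  · intro i
    obtain ⟨l, hl⟩ : ∃ l : Fin N, cv (Pi.single l 1) ∉ flag x (max (σ i) i1 : Fin N) := by
      by_contra hcon
      push Not at hcon
      have h1 : flag x (max (σ i) i1 : Fin N) = ⊤ := by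
        rw [eq_top_iff, ← (Pi.basisFun ℝ (Fin N)).span_eq, Submodule.span_le]
        rintro _ ⟨l, rfl⟩
        have : (Pi.basisFun ℝ (Fin N)) l = cv (Pi.single l 1) := by
          ext m; rw [Pi.basisFun_apply, cv]
          by_cases hm : m = l
          · subst hm; simp
          · simp [hm]
        rw [this]; exact hcon l
      have h2 := flag_rank x (max (σ i) i1 : Fin N)
      rw [h1, finrank_top, Module.finrank_fin_fun] at h2
      have := (max (σ i) i1).isLt
      omega
    have h1 := hx.min _ _ hl
    have hβ : 0 < β := (hA i).trans_le (hA2 i)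
    have h2 : nm B (Pi.single l 1) ≤ β * C2 := by
      have hC2 : 0 ≤ C2 := (nm_nonneg _ _).trans (hC l)
      apply nm_le _ _ (by positivity)
      intro i
      rw [hBdef, wm_mulVec, abs_mul, abs_of_pos (hA i)]
      exact mul_le_mul (hA2 i) ((le_nm _ _ _).trans (hC l)) (abs_nonneg _) hβ.le
    rw [hw]
    beta_reduce
    rw [div_eq_inv_mul]
    exact mul_le_mul (inv_anti₀ (hpos _) (h1.trans h2)) (hA1 i) hα.le (hρpos i).le
  · intro i
    have h2 : α * c2 ≤ nm B (x (max (σ i) i1)) := by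
      have h3 := hc _ (hxne hx (max (σ i) i1))
      obtain ⟨i', hi'⟩ : ∃ i', nm M (x (max (σ i) i1)) ≤ |(M *ᵥ cv (x (max (σ i) i1))) i'| := by
        by_contra hcon
        push Not at hcon
        have := (pi_norm_lt_iff (x := M *ᵥ cv (x (max (σ i) i1))) (hc2.trans_le h3)).mpr hcon
        exact lt_irrefl _ this
      refine le_trans ?_ (le_nm _ _ i')
      rw [hBdef, wm_mulVec, abs_mul, abs_of_pos (hA i')]
      exact mul_le_mul (hA1 i') (h3.trans hi') hc2.le (hA i').le
    rw [hw]
    beta_reduce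
    rw [div_eq_inv_mul]
    exact mul_le_mul (inv_anti₀ (by positivity) h2) (hA2 i) (hA i).le (by positivity)
end TM

namespace TM
open Matrix Filter

lemma ev_exp {a : ℝ} (ha : 0 < a) (K : ℝ) : ∀ᶠ q : ℝ in atTop, K ≤ Real.exp (a * q) :=
  (Real.tendsto_exp_atTop.comp (tendsto_id.const_mul_atTop ha)).eventually_ge_atTop K

/-- arithmetic for the size of `h` -/
lemma isol_size {N κ : ℕ} {c D2 δ q Q w m H κ' : ℝ} (hN : 2 ≤ N) (hQ : 0 < Q) (hQ1 : Q * Real.exp (δ * q) ≤ 1)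
    (hδ : 0 ≤ δ * q) (hw : 0 < w) (hc : 0 < c) (hD : 0 < D2)
    (h1 : Q ≤ D2 * w ^ N) (h2 : w * m ≤ Q) (hm : 0 ≤ m) (hH : 1 ≤ H) (h3 : c ≤ m * H ^ κ)
    (hbig : D2 / c ^ N ≤ Real.exp (δ / 2 * q)) (hκ0 : 0 < κ') (hκ : (κ * N : ℕ) ≤ κ') :
    Real.exp (δ / (2 * κ') * q) ≤ H := by
  have hQle : Q ≤ 1 := by
    have : 1 ≤ Real.exp (δ * q) := Real.one_le_exp hδ
    nlinarith
  have hmN : m ^ N ≤ D2 * Q := by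
    have a1 : w ^ N * m ^ N ≤ Q ^ N := by rw [← mul_pow]; exact pow_le_pow_left₀ (by positivity) h2 _
    have a2 : Q ^ N ≤ Q ^ 2 := pow_le_pow_of_le_one hQ.le hQle hN
    have a3 : m ^ N * Q ≤ m ^ N * (D2 * w ^ N) := mul_le_mul_of_nonneg_left h1 (by positivity)
    have a4 : m ^ N * Q ≤ (D2 * Q) * Q := by nlinarith
    exact le_of_mul_le_mul_right a4 hQ
  have hcN : c ^ N ≤ D2 * Q * H ^ (κ * N) := by
    calc c ^ N ≤ (m * H ^ κ) ^ N := pow_le_pow_left₀ hc.le h3 _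
      _ = m ^ N * H ^ (κ * N) := by rw [mul_pow, pow_mul]
      _ ≤ _ := mul_le_mul_of_nonneg_right hmN (by positivity)
  have hexp : Real.exp (δ * q) = Real.exp (δ / 2 * q) * Real.exp (δ / 2 * q) := by
    rw [← Real.exp_add]; ring_nf
  set e := Real.exp (δ / 2 * q) with he
  have hepos : 0 < e := Real.exp_pos _
  have hHe : e ≤ H ^ (κ * N) := by
    rw [div_le_iff₀ (by positivity)] at hbig
    have a1 : D2 ≤ e * (D2 * Q * H ^ (κ * N)) := hbig.trans (mul_le_mul_of_nonneg_left hcN hepos.le)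
    have a2 : 1 ≤ e * Q * H ^ (κ * N) := by
      have : D2 * 1 ≤ D2 * (e * Q * H ^ (κ * N)) := by linarith
      exact le_of_mul_le_mul_left this hD
    have a3 : 0 < H ^ (κ * N) := by positivity
    rw [hexp] at hQ1
    calc e = e * 1 := by ring
      _ ≤ e * (e * Q * H ^ (κ * N)) := mul_le_mul_of_nonneg_left a2 hepos.le
      _ = (Q * (e * e)) * H ^ (κ * N) := by ring
      _ ≤ 1 * H ^ (κ * N) := mul_le_mul_of_nonneg_right hQ1 a3.le
      _ = _ := one_mul _
  have hlog : δ / 2 * q ≤ κ' * Real.log H := by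
    have a1 := Real.log_le_log hepos hHe
    rw [he, Real.log_exp, Real.log_pow] at a1
    exact a1.trans (mul_le_mul_of_nonneg_right hκ (Real.log_nonneg hH))
  rw [← Real.le_log_iff_exp_le (by linarith)]
  have : δ / (2 * κ') * q = (δ / 2 * q) / κ' := by field_simp
  rw [this, div_le_iff₀ hκ0]
  linarith

set_option maxHeartbeats 1000000 in
theorem isol_core {N : ℕ} (hN : 2 ≤ N) {F : Type*} [Field F] [NumberField F] (τ : F →+* ℝ)
    (M : Matrix (Fin N) (Fin N) F) (hM : M.det ≠ 0) (δ C : ℝ) (hδ : 0 < δ) :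
    ¬ Unb (fun y : ℝ × (Fin N → ℝ) × (Fin N → ℤ) => y.1) (fun y =>
      (∀ i, Real.exp (-(C * y.1)) ≤ y.2.1 i ∧ y.2.1 i ≤ Real.exp (C * y.1)) ∧
      (∃ a : Fin N → ℤ, ∑ l, a l * y.2.2 l = 1) ∧ (∀ i, ∑ l, M i l * (y.2.2 l : F) ≠ 0) ∧
      ∀ x, cv x ∉ Submodule.span ℝ {cv y.2.2} →
        Real.exp (δ * y.1) * nm (wm y.2.1 (M.map τ)) y.2.2 ≤ nm (wm y.2.1 (M.map τ)) x) := by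
  classical
  intro hU
  set R := M.map τ with hR
  have hRdet : R.det ≠ 0 := by
    rw [hR, ← RingHom.mapMatrix_apply, ← RingHom.map_det]
    exact (map_ne_zero τ).mpr hM
  obtain ⟨c2, hc2, hc2'⟩ : ∃ c2 : ℝ, 0 < c2 ∧ ∀ x, x ≠ 0 → c2 ≤ nm R x := by
    have : (⊥ : Submodule ℝ (Fin N → ℝ)) ≠ ⊤ := by
      intro h
      have := congrArg (fun V : Submodule ℝ (Fin N → ℝ) => Module.finrank ℝ V) h
      simp at this
      omega
    obtain ⟨x0, hx0⟩ := exists_min hRdet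
    refine ⟨nm R (x0 ⟨0, by omega⟩), hx0.pos hRdet _, fun x hx => hx0.min _ _ ?_⟩
    have : flag x0 ((⟨0, by omega⟩ : Fin N) : ℕ) = ⊥ := by simp [flag]
    rw [this, Submodule.mem_bot]
    exact cv_ne hx
  set C2 : ℝ := 1 + ∑ l : Fin N, nm R (Pi.single l 1) with hC2
  have hC2' : ∀ l, nm R (Pi.single l 1) ≤ C2 := by
    intro l
    have := Finset.single_le_sum (f := fun l : Fin N => nm R (Pi.single l 1)) (fun _ _ => nm_nonneg _ _) (Finset.mem_univ l)
    beta_reduce at this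
    linarith
  have hC2pos : 0 < C2 := by
    have : 0 ≤ ∑ l : Fin N, nm R (Pi.single l 1) := Finset.sum_nonneg fun _ _ => nm_nonneg _ _
    linarith
  have hNpos : (0 : ℝ) < N := by exact_mod_cast (by omega : 0 < N)
  set ε : ℝ := δ / (4 * N) with hε
  have hεpos : 0 < ε := by positivity
  have hεN : ε * N = δ / 4 := by rw [hε]; field_simp
  set C' : ℝ := 2 * C + 1 with hC'
  set K : ℤ := ⌈|C'| / ε⌉ + 1 with hK
  set D1 : ℝ := N.factorial * dK N ^ (N + 1) with hD1
  have hd1 : 1 ≤ dK N := dK_ge (by omega)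
  have hdK : 0 < dK N := by linarith
  have hdet' : 0 < |R.det| := abs_pos.mpr hRdet
  set D2 : ℝ := dK N ^ N * |R.det| with hD2
  have hD2pos : 0 < D2 := by positivity
  choose cL hcL κ hL using fun i => liouville τ (M i)
  set κ' : ℝ := ∑ i, ((κ i * N : ℕ) : ℝ) + 1 with hκ'
  have hκ'pos : 0 < κ' := by
    have : 0 ≤ ∑ i, ((κ i * N : ℕ) : ℝ) := Finset.sum_nonneg fun _ _ => Nat.cast_nonneg _
    linarith
  set η : ℝ := δ / (2 * κ') with hη
  have hηpos : 0 < η := by positivity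
  set cc : (Fin N → Set.Icc (-K) K) → Fin N → ℝ := fun k i => ((k i : ℤ) + 1 : ℝ) * ε with hcc
  set L : Matrix (Fin N) (Fin N) F := (M⁻¹)ᵀ with hLdef
  have hLunit : IsUnit L.det := by
    rw [hLdef, Matrix.det_transpose]
    have : IsUnit M := (Matrix.isUnit_iff_isUnit_det _).mpr (isUnit_iff_ne_zero.mpr hM)
    exact (Matrix.isUnit_nonsing_inv_det_iff).mpr (isUnit_iff_ne_zero.mpr hM)
  have hLτ : ∀ i l, τ (L i l) = R⁻¹ l i := by
    intro i l
    have : R⁻¹ = (M⁻¹).map τ := by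
      apply Matrix.inv_eq_right_inv
      rw [hR, ← RingHom.mapMatrix_apply, ← RingHom.mapMatrix_apply, ← map_mul,
        Matrix.mul_nonsing_inv _ (isUnit_iff_ne_zero.mpr hM), map_one]
    rw [this]; rfl
  have key : ∃ B0 : ℝ, ∀ y : ℝ × (Fin N → ℝ) × (Fin N → ℤ), B0 ≤ y.1 →
      ((∀ i, Real.exp (-(C * y.1)) ≤ y.2.1 i ∧ y.2.1 i ≤ Real.exp (C * y.1)) ∧
      (∃ a : Fin N → ℤ, ∑ l, a l * y.2.2 l = 1) ∧ (∀ i, ∑ l, M i l * (y.2.2 l : F) ≠ 0) ∧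
      ∀ x, cv x ∉ Submodule.span ℝ {cv y.2.2} →
        Real.exp (δ * y.1) * nm (wm y.2.1 R) y.2.2 ≤ nm (wm y.2.1 R) x) →
      ∃ k : Fin N → Set.Icc (-K) K, (∑ i, cc k i ≤ -(δ / 2)) ∧
        (∃ a : Fin N → ℤ, ∑ l, a l * y.2.2 l = 1) ∧ (∃ l, Real.exp (η * y.1) ≤ |(y.2.2 l : ℝ)|) ∧
        ∃ z : Fin N → Fin N → ℤ,
      (∀ v : Fin N → ℚ, ∑ l, (y.2.2 l : ℚ) * v l = 0 → ∃ u : Fin N → ℚ, ∀ l', v l' = ∑ k, u k * z k l') ∧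
      ∀ b i, |∑ l, τ (L i l) * (z b l : ℝ)| ≤ Real.exp (y.1 * (cc k i - (∑ i, cc k i) / N - ε)) := by
    have hev : ∀ᶠ q : ℝ in atTop, 1 ≤ q ∧ dK N + 1 ≤ Real.exp (δ * q) ∧ C2 ≤ Real.exp (1 * q) ∧ 1 / c2 ≤ Real.exp (1 * q) ∧
        N.factorial / |R.det| ≤ Real.exp (δ / 4 * q) ∧ D1 ≤ Real.exp (ε * q) ∧
        ∀ i, D2 / cL i ^ N ≤ Real.exp (δ / 2 * q) := by
      refine (eventually_ge_atTop 1).and ((ev_exp hδ _).and ((ev_exp one_pos _).and ((ev_exp one_pos _).and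
        ((ev_exp (by positivity) _).and ((ev_exp hεpos _).and ?_)))))
      exact eventually_all.mpr fun i => ev_exp (by positivity) _
    obtain ⟨B0, hB0⟩ := eventually_atTop.mp hev
    refine ⟨B0, ?_⟩
    rintro ⟨q, A, h⟩ hq ⟨hA, hb, hne, hiso⟩
    dsimp only at hq hA hb hne hiso ⊢
    obtain ⟨hq1, e1, e2, e3, e4, e5, e6⟩ := hB0 q hq
    have hq0 : 0 < q := by linarith
    obtain ⟨w, z, Q, hQ, hQE, hw, hz1, hz2, hq2, hq3, hq4, hw1, hw2⟩ := isol_one hN R hRdet A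
      (Real.exp (-(C * q))) (Real.exp (C * q)) c2 C2 (Real.exp_pos _) (fun i => (hA i).1) (fun i => (hA i).2)
      hc2 hc2' hC2' h hb (Real.exp (δ * q)) (by linarith) hiso
    have hlw1 : ∀ i, -(C' * q) ≤ Real.log (w i) := by
      intro i
      rw [Real.le_log_iff_exp_le (hw i)]
      refine le_trans ?_ (hw1 i)
      rw [le_div_iff₀ (by positivity)]
      calc Real.exp (-(C' * q)) * (Real.exp (C * q) * C2) ≤
          Real.exp (-(C' * q)) * (Real.exp (C * q) * Real.exp (1 * q)) := by gcongr
        _ = Real.exp (-(C * q)) := by rw [← Real.exp_add, ← Real.exp_add, hC']; ring_nf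
    have hlw2 : ∀ i, Real.log (w i) ≤ C' * q := by
      intro i
      rw [Real.log_le_iff_le_exp (hw i)]
      refine (hw2 i).trans ?_
      calc Real.exp (C * q) / (Real.exp (-(C * q)) * c2) = Real.exp (C * q) * (Real.exp (C * q) * (1 / c2)) := by
            rw [Real.exp_neg]; field_simp
        _ ≤ Real.exp (C * q) * (Real.exp (C * q) * Real.exp (1 * q)) := by gcongr
        _ = Real.exp (C' * q) := by rw [← Real.exp_add, ← Real.exp_add, hC']; ring_nf
    have hqε : 0 < q * ε := by positivity
    set k : Fin N → ℤ := fun i => ⌊Real.log (w i) / (q * ε)⌋ with hk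
    have hkmem : ∀ i, k i ∈ Set.Icc (-K) K := by
      intro i
      have a1 : |C'| / ε ≤ ⌈|C'| / ε⌉ := Int.le_ceil _
      have a2 : |Real.log (w i) / (q * ε)| ≤ |C'| / ε := by
        have : |Real.log (w i)| ≤ |C'| * q := by
          have : C' * q ≤ |C'| * q := mul_le_mul_of_nonneg_right (le_abs_self _) hq0.le
          exact abs_le.mpr ⟨by linarith [hlw1 i], by linarith [hlw2 i]⟩
        rw [abs_div, abs_of_pos hqε, div_le_div_iff₀ hqε hεpos]
        nlinarith
      have a3 := abs_le.mp (a2.trans a1)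
      constructor
      · rw [Int.le_floor, hK]; push_cast; linarith
      · have : (k i : ℝ) ≤ ⌈|C'| / ε⌉ := (Int.floor_le _).trans a3.2
        have : k i ≤ ⌈|C'| / ε⌉ := by exact_mod_cast this
        omega
    refine ⟨fun i => ⟨k i, hkmem i⟩, ?_⟩
    set c : Fin N → ℝ := cc fun i => ⟨k i, hkmem i⟩ with hc
    have hc1 : ∀ i, c i = ((k i : ℝ) + 1) * ε := fun i => rfl
    have hlc : ∀ i, Real.log (w i) ≤ q * c i := by
      intro i
      have := (Int.lt_floor_add_one (Real.log (w i) / (q * ε))).le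
      rw [div_le_iff₀ hqε] at this
      rw [hc1]
      calc _ ≤ _ := this
        _ = _ := by ring
    have hlc2 : ∀ i, q * c i ≤ Real.log (w i) + q * ε := by
      intro i
      have := Int.floor_le (Real.log (w i) / (q * ε))
      rw [le_div_iff₀ hqε] at this
      have h2 : q * c i = (k i : ℝ) * (q * ε) + q * ε := by rw [hc1]; ring
      rw [h2]; linarith
    have hsum : ∑ i, c i ≤ -(δ / 2) := by
      have a1 : q * ∑ i, c i ≤ Real.log (∏ i, w i) + q * (δ / 4) := by
        rw [Real.log_prod (fun i _ => (hw i).ne'), Finset.mul_sum]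
        calc _ ≤ ∑ i, (Real.log (w i) + q * ε) := Finset.sum_le_sum fun i _ => hlc2 i
          _ = _ := by rw [Finset.sum_add_distrib]; simp; rw [← hεN]; ring
      have a2 : Real.log (∏ i, w i) ≤ δ / 4 * q - δ * q := by
        rw [Real.log_le_iff_le_exp (Finset.prod_pos fun i _ => hw i), Real.exp_sub, le_div_iff₀ (Real.exp_pos _)]
        have b1 : ∏ i, w i ≤ N.factorial / |R.det| * Q := by
          rw [div_mul_eq_mul_div, le_div_iff₀ hdet']; exact hq3
        calc (∏ i, w i) * Real.exp (δ * q) ≤ N.factorial / |R.det| * Q * Real.exp (δ * q) := by gcongr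
          _ = N.factorial / |R.det| * (Q * Real.exp (δ * q)) := by ring
          _ ≤ N.factorial / |R.det| * 1 := by gcongr
          _ ≤ _ := by linarith
      have a3 : q * ∑ i, c i ≤ q * (-(δ / 2)) := by linarith
      exact le_of_mul_le_mul_left a3 hq0
    refine ⟨hsum, hb, ?_, z, hz1, ?_⟩
    · -- size
      haveI : Nonempty (Fin N) := ⟨⟨0, by omega⟩⟩
      obtain ⟨i, hi⟩ := Finite.exists_max w
      obtain ⟨l, hl⟩ := Finite.exists_max fun l => |(h l : ℝ)|
      refine ⟨l, ?_⟩
      have hH1 : 1 ≤ |(h l : ℝ)| := by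
        obtain ⟨a, ha⟩ := hb
        obtain ⟨m, hm⟩ : ∃ m, h m ≠ 0 := by
          by_contra hcon; push Not at hcon; simp [hcon] at ha
        refine le_trans ?_ (hl m)
        rw [← Int.cast_abs]; exact_mod_cast Int.one_le_abs hm
      have hprod : ∏ j, w j ≤ w i ^ N := by
        calc _ ≤ ∏ j : Fin N, w i := Finset.prod_le_prod (fun j _ => (hw j).le) fun j _ => hi j
          _ = _ := by simp
      have hτ : τ (∑ l, M i l * (h l : F)) = (R *ᵥ cv h) i := by
        rw [map_sum]; simp [Matrix.mulVec, dotProduct, hR, cv]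
      have hLi := hL i h _ hH1 hl (hne i)
      rw [hτ] at hLi
      refine isol_size hN hQ hQE (by positivity) (hw i) (hcL i) hD2pos ?_ (hq4 i) (abs_nonneg _) hH1 hLi (e6 i) hκ'pos ?_
      · refine hq2.trans ?_
        calc _ ≤ dK N ^ N * (w i ^ N * |R.det|) := by gcongr
          _ = _ := by rw [hD2]; ring
      · have := Finset.single_le_sum (f := fun i => ((κ i * N : ℕ) : ℝ)) (fun _ _ => Nat.cast_nonneg _) (Finset.mem_univ i)
        beta_reduce at this
        rw [hκ']; linarith
    · intro b i
      have a1 : ∑ l, τ (L i l) * (z b l : ℝ) = ∑ l, (z b l : ℝ) * R⁻¹ l i :=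
        Finset.sum_congr rfl fun l _ => by rw [hLτ]; ring
      rw [a1]
      refine (hz2 b i).trans ?_
      have a2 : w i ≤ Real.exp (q * c i) := (Real.log_le_iff_le_exp (hw i)).mp (hlc i)
      have a3 : 2 * ε ≤ -((∑ i, c i) / N) := by
        rw [← neg_div, le_div_iff₀ hNpos]; linarith
      calc D1 * w i ≤ Real.exp (ε * q) * Real.exp (q * c i) := mul_le_mul e5 a2 (hw i).le (Real.exp_pos _).le
        _ = Real.exp (ε * q + q * c i) := by rw [Real.exp_add]
        _ ≤ _ := by
          apply Real.exp_le_exp.mpr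
          nlinarith
  obtain ⟨k, hk⟩ := hU.pigeon key
  have hc0 : ∑ i, (cc k i - (∑ i, cc k i) / N) = 0 := by
    rw [Finset.sum_sub_distrib]; simp; field_simp; ring
  refine core_hyp (n := N) τ L hLunit (fun i => cc k i - (∑ i, cc k i) / N) hc0 ε η hεpos hηpos ?_
  intro B
  obtain ⟨⟨q, A, h⟩, ⟨_, h1, h2, z, h3, h4⟩, hq⟩ := hk B
  exact ⟨(q, z, h), ⟨h1, h2, h3, h4⟩, hq⟩

/-- weighted sum norm attached to a family of linear forms -/
def gn {ι κ : Type*} [Fintype ι] [Fintype κ] (M : Matrix ι κ ℝ) (A : ι → ℝ) (x : κ → ℤ) : ℝ :=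
  ∑ i, A i * |∑ l, M i l * (x l : ℝ)|

/-- `x` is proportional to `h` -/
def Prp {κ : Type*} (x h : κ → ℤ) : Prop := ∃ r s : ℤ, r ≠ 0 ∧ ∀ l, r * x l = s * h l

/-- rational cast of an integral vector -/
def cq {κ : Type*} (x : κ → ℤ) : κ → ℚ := fun l => (x l : ℚ)

lemma gn_nonneg {ι κ : Type*} [Fintype ι] [Fintype κ] (M : Matrix ι κ ℝ) {A : ι → ℝ} (hA : ∀ i, 0 < A i) (x : κ → ℤ) :
    0 ≤ gn M A x := Finset.sum_nonneg fun i _ => mul_nonneg (hA i).le (abs_nonneg _)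

lemma prim {N : ℕ} (g : Fin N → ℤ) (hg : g ≠ 0) : ∃ d : ℤ, d ≠ 0 ∧ ∃ g' : Fin N → ℤ, (∀ l, g l = d * g' l) ∧
    ∃ a : Fin N → ℤ, ∑ l, a l * g' l = 1 := by
  obtain ⟨d, hd⟩ := (IsPrincipalIdealRing.principal (Ideal.span (Set.range g))).principal
  have hd' : d ∈ Ideal.span (Set.range g) := by rw [hd]; exact Submodule.mem_span_singleton_self d
  obtain ⟨a, ha⟩ := Ideal.mem_span_range_iff_exists_fun.mp hd'
  have h1 : ∀ l, ∃ c, g l = d * c := by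
    intro l
    have : g l ∈ Submodule.span ℤ {d} := by rw [← hd]; exact Ideal.subset_span ⟨l, rfl⟩
    obtain ⟨c, hc⟩ := Submodule.mem_span_singleton.mp this
    exact ⟨c, by rw [← hc, smul_eq_mul, mul_comm]⟩
  choose g' hg' using h1
  have hd0 : d ≠ 0 := by
    rintro rfl; apply hg; ext l; simp [hg']
  refine ⟨d, hd0, g', hg', a, ?_⟩
  have : d * ∑ l, a l * g' l = d * 1 := by
    rw [mul_one, Finset.mul_sum]
    conv_rhs => rw [← ha]
    exact Finset.sum_congr rfl fun l _ => by rw [hg' l]; ring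
  exact mul_left_cancel₀ hd0 this

/-- a `ℤ`-basis of the integral points of a rational subspace -/
lemma lat_basis {κ : Type*} [Fintype κ] (V : Submodule ℚ (κ → ℚ)) : ∃ (N : ℕ) (b : Fin N → κ → ℤ) (G : Matrix (Fin N) κ ℝ),
    (∀ g : Fin N → ℤ, cq (fun l => ∑ a, g a * b a l) ∈ V) ∧
    (∀ x : κ → ℤ, cq x ∈ V → ∃ g : Fin N → ℤ, ∀ l, x l = ∑ a, g a * b a l) ∧
    (∀ g : Fin N → ℤ, (∀ l, ∑ a, g a * b a l = 0) → g = 0) ∧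
    G * (Matrix.of fun l a => (b a l : ℝ)) = 1 := by
  classical
  let φ : (κ → ℤ) →ₗ[ℤ] (κ → ℚ) :=
    { toFun := cq
      map_add' := fun x y => by ext l; simp [cq]
      map_smul' := fun c x => by ext l; simp [cq] }
  let W : Submodule ℤ (κ → ℤ) := (V.restrictScalars ℤ).comap φ
  have hW : ∀ x, x ∈ W ↔ cq x ∈ V := fun x => Iff.rfl
  let B := Module.finBasis ℤ W
  set N := Module.finrank ℤ W
  have hsum : ∀ (g : Fin N → ℤ) l, (∑ a, g a * (B a : κ → ℤ) l) = ((∑ a, g a • B a : W) : κ → ℤ) l := by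
    intro g l
    simp
  have hli : ∀ g : Fin N → ℤ, (∀ l, ∑ a, g a * (B a : κ → ℤ) l = 0) → g = 0 := by
    intro g hg
    have h1 : ∑ a, g a • B a = 0 := by
      ext l; rw [← hsum]; exact hg l
    have h2 := Fintype.linearIndependent_iff.mp B.linearIndependent g h1
    exact funext h2
  have hGex : ∃ G : Matrix (Fin N) κ ℚ, G * (Matrix.of fun l a => ((B a : κ → ℤ) l : ℚ)) = 1 := by
    have h1 : LinearIndependent ℤ (fun a => cq (B a : κ → ℤ)) := by
      rw [Fintype.linearIndependent_iff]
      intro g hg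
      have : g = 0 := by
        apply hli
        intro l
        have := congrFun hg l
        simp [cq] at this
        exact_mod_cast this
      exact fun i => congrFun this i
    have h2 : LinearIndependent ℚ (fun a => cq (B a : κ → ℤ)) := (LinearIndependent.iff_fractionRing ℤ ℚ).mp h1
    set P : Matrix κ (Fin N) ℚ := Matrix.of fun l a => ((B a : κ → ℤ) l : ℚ) with hP
    have h3 : Function.Injective P.mulVecLin := by
      rw [← LinearMap.ker_eq_bot, Matrix.ker_mulVecLin_eq_bot_iff]
      intro v hv
      have := Fintype.linearIndependent_iff.mp h2 v (by
        ext l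
        have := congrFun hv l
        simp [Matrix.mulVec, dotProduct, hP] at this
        simp [cq]
        rw [← this]
        exact Finset.sum_congr rfl fun a _ => mul_comm _ _)
      exact funext this
    obtain ⟨G, hG⟩ := LinearMap.exists_leftInverse_of_injective P.mulVecLin (LinearMap.ker_eq_bot.mpr h3)
    refine ⟨LinearMap.toMatrix' G, ?_⟩
    have h4 := congrArg LinearMap.toMatrix' hG
    rw [LinearMap.toMatrix'_comp, LinearMap.toMatrix'_id] at h4
    rw [← h4]; congr 1
    exact (LinearMap.toMatrix'_toLin' P).symm
  obtain ⟨G, hG⟩ := hGex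
  refine ⟨N, fun a => B a, G.map (algebraMap ℚ ℝ), ?_, ?_, hli, ?_⟩
  · intro g
    have : (fun l => ∑ a, g a * (B a : κ → ℤ) l) = ((∑ a, g a • B a : W) : κ → ℤ) := by ext l; exact hsum g l
    rw [this]
    exact (hW _).mp (∑ a, g a • B a : W).2
  · intro x hx
    refine ⟨B.repr ⟨x, (hW x).mpr hx⟩, fun l => ?_⟩
    rw [hsum, B.sum_repr]
  · have h5 := congrArg (fun X : Matrix (Fin N) (Fin N) ℚ => X.map (algebraMap ℚ ℝ)) hG
    simp only [Matrix.map_mul] at h5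
    have h6 : (Matrix.of fun l a => ((B a : κ → ℤ) l : ℚ)).map (algebraMap ℚ ℝ) =
        (Matrix.of fun l a => ((B a : κ → ℤ) l : ℝ)) := by ext l a; simp
    rw [h6] at h5
    rw [h5, ← RingHom.mapMatrix_apply, map_one]

set_option maxHeartbeats 1000000 in
theorem isol {ι κ : Type*} [Fintype ι] [Fintype κ] [DecidableEq κ] {F : Type*} [Field F] [NumberField F] (τ : F →+* ℝ)
    (M : Matrix ι κ F) (G : Matrix κ ι ℝ) (hG : G * M.map τ = 1) (δ C : ℝ) (hδ : 0 < δ) {α : Type*} (f q : α → ℝ)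
    (A : α → ι → ℝ) (h : α → κ → ℤ) (r : ℕ) : ∀ (V : Submodule ℚ (κ → ℚ)), Module.finrank ℚ V ≤ r →
    ∀ p : α → Prop, Unb f p → (∀ y, p y → f y ≤ q y ∧
      (∀ i, Real.exp (-(C * q y)) ≤ A y i ∧ A y i ≤ Real.exp (C * q y)) ∧ h y ≠ 0 ∧ cq (h y) ∈ V ∧
      ∀ x, cq x ∈ V → ¬ Prp x (h y) → Real.exp (δ * q y) * gn (M.map τ) (A y) (h y) ≤ gn (M.map τ) (A y) x) →
    (∀ y, p y → ∃ B, ∀ y', p y' → Prp (h y') (h y) → f y' ≤ B) → False := by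
  classical
  induction r with
  | zero =>
    intro V hV p hU hp _
    obtain ⟨y, hy, -⟩ := hU 0
    obtain ⟨_, _, h1, h2, _⟩ := hp y hy
    have : V = ⊥ := Submodule.finrank_eq_zero.mp (by omega)
    rw [this, Submodule.mem_bot] at h2
    apply h1
    ext l
    have := congrFun h2 l
    simp only [cq, Pi.zero_apply, Int.cast_eq_zero] at this
    simpa using this
  | succ r ih =>
    intro V hV p hU hp hfin
    -- forms do not vanish
    have hnv : ∀ i, (∃ x ∈ V, ∑ l, M i l * ((x l : ℚ) : F) ≠ 0) → ¬ Unb f (fun y => p y ∧ ∑ l, M i l * (h y l : F) = 0) := by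
      rintro i ⟨x, hx, hx0⟩ hUi
      let ψ : (κ → ℚ) →ₗ[ℚ] F :=
        { toFun := fun x => ∑ l, M i l * ((x l : ℚ) : F)
          map_add' := fun x y => by simp [mul_add, Finset.sum_add_distrib]
          map_smul' := fun c x => by
            simp only [Pi.smul_apply, smul_eq_mul, Rat.cast_mul, RingHom.id_apply, Finset.smul_sum]
            exact Finset.sum_congr rfl fun l _ => by rw [Rat.smul_def]; ring }
      have hlt : V ⊓ LinearMap.ker ψ < V := by
        refine lt_of_le_of_ne inf_le_left fun he => hx0 ?_
        have : x ∈ V ⊓ LinearMap.ker ψ := by rw [he]; exact hx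
        exact this.2
      have hfr := Submodule.finrank_lt_finrank_of_lt hlt
      refine ih (V ⊓ LinearMap.ker ψ) (by omega) _ hUi ?_ ?_
      · rintro y ⟨hy, hy0⟩
        obtain ⟨h1, h2, h3, h4, h5⟩ := hp y hy
        refine ⟨h1, h2, h3, ⟨h4, ?_⟩, fun x hx hx' => h5 x hx.1 hx'⟩
        change ∑ l, M i l * (((h y l : ℤ) : ℚ) : F) = 0
        simpa using hy0
      · rintro y ⟨hy, _⟩
        obtain ⟨B, hB⟩ := hfin y hy
        exact ⟨B, fun y' hy' => hB y' hy'.1⟩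
    have hU2 : Unb f (fun y => p y ∧ ∀ i, (∃ x ∈ V, ∑ l, M i l * ((x l : ℚ) : F) ≠ 0) → ∑ l, M i l * (h y l : F) ≠ 0) := by
      obtain ⟨t, ht⟩ := hU.pigeon (T := Option ι) (q := fun t y => p y ∧ match t with
        | none => ∀ i, (∃ x ∈ V, ∑ l, M i l * ((x l : ℚ) : F) ≠ 0) → ∑ l, M i l * (h y l : F) ≠ 0
        | some i => (∃ x ∈ V, ∑ l, M i l * ((x l : ℚ) : F) ≠ 0) ∧ ∑ l, M i l * (h y l : F) = 0) ⟨0, by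
          intro y _ hy
          by_cases hc : ∀ i, (∃ x ∈ V, ∑ l, M i l * ((x l : ℚ) : F) ≠ 0) → ∑ l, M i l * (h y l : F) ≠ 0
          · exact ⟨none, hy, hc⟩
          · push Not at hc
            obtain ⟨i, h1, h2⟩ := hc
            exact ⟨some i, hy, h1, h2⟩⟩
      rcases t with _ | i
      · exact ht
      · exfalso
        obtain ⟨y, ⟨_, h1, _⟩, _⟩ := ht 0
        exact hnv i h1 (ht.mono ⟨0, fun y _ hy => ⟨hy.1, hy.2.2⟩⟩)
    obtain ⟨N, b, Gb, hb1, hb2, hb3, hGb⟩ := lat_basis V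
    have hN : 2 ≤ N := by
      by_contra hcon
      have hpr : ∀ y y', p y → p y' → Prp (h y') (h y) := by
        intro y y' hy hy'
        obtain ⟨_, _, h1, h2, _⟩ := hp y hy
        obtain ⟨_, _, h1', h2', _⟩ := hp y' hy'
        obtain ⟨g, hg⟩ := hb2 _ h2
        obtain ⟨g', hg'⟩ := hb2 _ h2'
        rcases (by omega : N = 0 ∨ N = 1) with rfl | rfl
        · exact absurd (by ext l; simp [hg]) h1
        · refine ⟨g 0, g' 0, ?_, fun l => ?_⟩
          · intro h0; apply h1; ext l; simp [hg, h0]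
          · rw [hg, hg']; simp; ring
      obtain ⟨y, hy, _⟩ := hU 0
      obtain ⟨B, hB⟩ := hfin y hy
      obtain ⟨y', hy', h1⟩ := hU (B + 1)
      have := hB y' hy' (hpr y y' hy hy')
      linarith
    -- the forms in coordinates
    set Mb : Matrix ι (Fin N) F := M * Matrix.of fun l a => (b a l : F) with hMb
    set Rb : Matrix ι (Fin N) ℝ := Mb.map τ with hRb
    have hRb' : Rb = M.map τ * Matrix.of fun l a => (b a l : ℝ) := by
      rw [hRb, hMb, Matrix.map_mul]
      congr 1
      ext l a; simp
    have hGR : (Gb * G) * Rb = 1 := by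
      rw [hRb', Matrix.mul_assoc, ← Matrix.mul_assoc G, hG, Matrix.one_mul, hGb]
    have hform : ∀ i (g : Fin N → ℤ), ∑ a, Rb i a * (g a : ℝ) = ∑ l, (M.map τ) i l * ((∑ a, g a * b a l : ℤ) : ℝ) := by
      intro i g
      rw [hRb']
      simp only [Matrix.mul_apply, Matrix.of_apply, Finset.sum_mul]
      push_cast
      simp only [Finset.mul_sum]
      rw [Finset.sum_comm]
      exact Finset.sum_congr rfl fun l _ => Finset.sum_congr rfl fun a _ => by ring
    have hformF : ∀ i (g : Fin N → ℤ), ∑ a, Mb i a * (g a : F) = ∑ l, M i l * ((∑ a, g a * b a l : ℤ) : F) := by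
      intro i g
      rw [hMb]
      simp only [Matrix.mul_apply, Matrix.of_apply, Finset.sum_mul]
      push_cast
      simp only [Finset.mul_sum]
      rw [Finset.sum_comm]
      exact Finset.sum_congr rfl fun l _ => Finset.sum_congr rfl fun a _ => by ring
    set Kc : ℝ := Fintype.card ι * N + 1 with hKc
    have hKpos : 0 < Kc := by positivity
    obtain ⟨e, he⟩ := hU2.pigeon (T := Fin N → ι) (q := fun e y => (Mb.submatrix e id).det ≠ 0 ∧
        ∃ g : Fin N → ℤ, (∃ a : Fin N → ℤ, ∑ l, a l * g l = 1) ∧ f y ≤ q y ∧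
        (∀ i, Real.exp (-(C * q y)) ≤ A y (e i) ∧ A y (e i) ≤ Real.exp (C * q y)) ∧
        (∀ i, ∑ l, Mb (e i) l * (g l : F) ≠ 0) ∧
        ∀ x, cv x ∉ Submodule.span ℝ {cv g} →
        Real.exp (δ / 2 * q y) * nm (wm (A y ∘ e) ((Mb.submatrix e id).map τ)) g ≤ nm (wm (A y ∘ e) ((Mb.submatrix e id).map τ)) x) (by
      obtain ⟨B0, hB0⟩ := eventually_atTop.mp (ev_exp (a := δ / 2) (by positivity) Kc)
      refine ⟨B0, fun y hy0 ⟨hy, hyn⟩ => ?_⟩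
      obtain ⟨h1, h2, h3, h4, h5⟩ := hp y hy
      have hApos : ∀ i, 0 < A y i := fun i => (Real.exp_pos _).trans_le (h2 i).1
      obtain ⟨e, he1, he2⟩ := subbasis Rb (Gb * G) hGR (A y) hApos
      have hdet : (Mb.submatrix e id).det ≠ 0 := by
        intro h0
        apply he1
        have : Rb.submatrix e id = (Mb.submatrix e id).map τ := by ext i l; rfl
        rw [this, ← RingHom.mapMatrix_apply, ← RingHom.map_det, h0, map_zero]
      obtain ⟨g0, hg0⟩ := hb2 _ h4
      have hg0ne : g0 ≠ 0 := by
        rintro rfl; apply h3; ext l; simp [hg0]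
      obtain ⟨d, hd, g, hg, hbez⟩ := prim g0 hg0ne
      have hhd : ∀ l, h y l = d * ∑ a, g a * b a l := by
        intro l; rw [hg0, Finset.mul_sum]; exact Finset.sum_congr rfl fun a _ => by rw [hg]; ring
      refine ⟨e, hdet, g, hbez, h1, fun i => h2 _, ?_, ?_⟩
      · intro i h0
        refine hyn (e i) ?_ ?_
        · -- the form is non zero on V
          by_contra hcon
          push Not at hcon
          apply hdet
          apply Matrix.det_eq_zero_of_row_eq_zero i
          intro a
          have := hcon _ (hb1 (Pi.single a 1))
          have h6 := hformF (e i) (Pi.single a 1)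
          rw [Matrix.submatrix_apply, id]
          have h7 : ∑ a', Mb (e i) a' * ((Pi.single a 1 : Fin N → ℤ) a' : F) = Mb (e i) a := by
            rw [Finset.sum_eq_single a]
            · simp
            · intro a' _ ha'; simp [ha']
            · simp
          rw [← h7, h6, ← this]
          exact Finset.sum_congr rfl fun l _ => by simp only [cq, Rat.cast_intCast]
        · have : ∑ l, M (e i) l * (h y l : F) = d * ∑ l, Mb (e i) l * (g l : F) := by
            rw [hformF, Finset.mul_sum]
            exact Finset.sum_congr rfl fun l _ => by rw [hhd]; push_cast; ring
          rw [this, h0, mul_zero]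
      · intro x hx
        set X : κ → ℤ := fun l => ∑ a, x a * b a l with hX
        set R := (Mb.submatrix e id).map τ with hR
        have hRv : ∀ (x : Fin N → ℤ) i, (wm (A y ∘ e) R *ᵥ cv x) i = A y (e i) * ∑ l, Rb (e i) l * (x l : ℝ) := by
          intro x i; rw [wm_mulVec]; rfl
        have hnp : ¬ Prp X (h y) := by
          rintro ⟨r, s, hr, hrs⟩
          apply hx
          have h6 : (fun a => r * x a - s * d * g a) = 0 := by
            apply hb3
            intro l
            have := hrs l
            rw [hhd, hX] at this
            simp only [sub_mul, Finset.sum_sub_distrib]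
            have h7 : ∑ a, r * x a * b a l = r * ∑ a, x a * b a l := by
              rw [Finset.mul_sum]; exact Finset.sum_congr rfl fun a _ => by ring
            have h8 : ∑ a, s * d * g a * b a l = s * (d * ∑ a, g a * b a l) := by
              rw [Finset.mul_sum, Finset.mul_sum]; exact Finset.sum_congr rfl fun a _ => by ring
            rw [h7, h8]; linarith
          rw [Submodule.mem_span_singleton]
          refine ⟨(s * d : ℝ) / r, ?_⟩
          ext a
          have h7 := congrFun h6 a
          simp only [Pi.zero_apply] at h7
          have h8 : (r : ℝ) * x a = s * d * g a := by
            have : r * x a = s * d * g a := by linarith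
            exact_mod_cast this
          have hr' : (r : ℝ) ≠ 0 := by exact_mod_cast hr
          simp only [Pi.smul_apply, smul_eq_mul, cv]
          field_simp
          linarith
        have hiso := h5 X (hb1 x) hnp
        -- compare
        have c1 : nm (wm (A y ∘ e) R) g ≤ gn (M.map τ) (A y) (h y) := by
          apply nm_le _ _ (gn_nonneg _ hApos _)
          intro i
          rw [hRv, hform, abs_mul, abs_of_pos (hApos _)]
          have h6 : ∑ l, (M.map τ) (e i) l * (h y l : ℝ) = d * ∑ l, (M.map τ) (e i) l * ((∑ a, g a * b a l : ℤ) : ℝ) := by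
            rw [Finset.mul_sum]; exact Finset.sum_congr rfl fun l _ => by rw [hhd]; push_cast; ring
          have hd1 : (1 : ℝ) ≤ |(d : ℝ)| := by rw [← Int.cast_abs]; exact_mod_cast Int.one_le_abs hd
          have h7 := Finset.single_le_sum (f := fun i => A y i * |∑ l, (M.map τ) i l * (h y l : ℝ)|)
            (fun i _ => mul_nonneg (hApos i).le (abs_nonneg _)) (Finset.mem_univ (e i))
          beta_reduce at h7
          refine le_trans ?_ h7
          rw [h6, abs_mul]
          exact mul_le_mul_of_nonneg_left (le_mul_of_one_le_left (abs_nonneg _) hd1) (hApos _).le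
        have c2 : gn (M.map τ) (A y) X ≤ Kc * nm (wm (A y ∘ e) R) x := by
          have h6 : ∀ i, A y i * |∑ l, (M.map τ) i l * (X l : ℝ)| ≤ N * nm (wm (A y ∘ e) R) x := by
            intro i
            have := he2 i (cv x)
            have h7 : ∑ l, Rb i l * cv x l = ∑ l, (M.map τ) i l * (X l : ℝ) := hform i x
            rw [h7] at this
            refine this.trans ?_
            calc _ ≤ ∑ a : Fin N, nm (wm (A y ∘ e) R) x := by
                  refine Finset.sum_le_sum fun a _ => ?_
                  have := le_nm (wm (A y ∘ e) R) x a
                  rwa [hRv, abs_mul, abs_of_pos (hApos _)] at this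
              _ = _ := by simp
          calc gn (M.map τ) (A y) X ≤ ∑ i : ι, N * nm (wm (A y ∘ e) R) x := Finset.sum_le_sum fun i _ => h6 i
            _ = Fintype.card ι * N * nm (wm (A y ∘ e) R) x := by simp; ring
            _ ≤ _ := mul_le_mul_of_nonneg_right (by rw [hKc]; linarith) (nm_nonneg _ _)
        have hK := hB0 (q y) (hy0.trans h1)
        have hexp : Real.exp (δ * q y) = Real.exp (δ / 2 * q y) * Real.exp (δ / 2 * q y) := by
          rw [← Real.exp_add]; ring_nf
        rw [hexp] at hiso
        have hepos := Real.exp_pos (δ / 2 * q y)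
        have c3 : Real.exp (δ / 2 * q y) * (Real.exp (δ / 2 * q y) * nm (wm (A y ∘ e) R) g) ≤
            Real.exp (δ / 2 * q y) * nm (wm (A y ∘ e) R) x := by
          calc _ = Real.exp (δ / 2 * q y) * Real.exp (δ / 2 * q y) * nm (wm (A y ∘ e) R) g := by ring
            _ ≤ Real.exp (δ / 2 * q y) * Real.exp (δ / 2 * q y) * gn (M.map τ) (A y) (h y) :=
              mul_le_mul_of_nonneg_left c1 (by positivity)
            _ ≤ _ := hiso
            _ ≤ _ := c2
            _ ≤ _ := mul_le_mul_of_nonneg_right hK (nm_nonneg _ _)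
        exact le_of_mul_le_mul_left c3 hepos)
    obtain ⟨y0, hy0, _⟩ := he 0
    refine isol_core hN τ (Mb.submatrix e id) hy0.1 (δ / 2) C (by positivity) ?_
    refine he.map ⟨0, ?_⟩
    rintro y _ ⟨_, g, h1, h2, h3, h4, h5⟩
    exact ⟨(q y, A y ∘ e, g), ⟨h3, h1, h4, h5⟩, h2⟩

lemma gap_one {N : ℕ} {B : Matrix (Fin N) (Fin N) ℝ} (hB : B.det ≠ 0) (S : Submodule ℚ (Fin N → ℚ)) (t E : ℝ) (ht : 0 < t)
    (hE : 1 < E) (hS1 : S ≤ Submodule.span ℚ (cq '' {x | nm B x ≤ t})) (hS2 : ∀ x, nm B x < t * E → cq x ∈ S)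
    (hS3 : S ≠ ⊥) (hS4 : S ≠ ⊤) : ∃ (k : ℕ) (x h : Fin N → Fin N → ℤ) (d : ℤ), 0 < k ∧ k < N ∧ d ≠ 0 ∧
      (∀ b c, ∑ l, h b l * x c l = if b = c then d else 0) ∧
      (∀ v, v ∈ S ↔ ∀ b : Fin N, k ≤ (b : ℕ) → ∑ l, (h b l : ℚ) * v l = 0) ∧
      (∀ j, 0 < nm B (x j)) ∧ (∀ j : Fin N, (j : ℕ) < k → nm B (x j) ≤ t) ∧ (∀ j : Fin N, k ≤ (j : ℕ) → t * E ≤ nm B (x j)) ∧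
      ∀ b i, |∑ l, (h b l : ℝ) * B⁻¹ l i| * nm B (x b) ≤ N.factorial * dK N ^ N := by
  classical
  obtain ⟨x, hx⟩ := exists_min hB
  obtain ⟨h, d, hd, hdual, hbd⟩ := hx.dual hB
  have hdq : (d : ℚ) ≠ 0 := by exact_mod_cast hd
  have htE : t < t * E := by nlinarith
  have hdualq : ∀ b c, ∑ l, (h b l : ℚ) * x c l = if b = c then (d : ℚ) else 0 := by
    intro b c
    have h3 : ((∑ l, h b l * x c l : ℤ) : ℚ) = ((if b = c then d else 0 : ℤ) : ℚ) := by rw [hdual]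
    push_cast at h3; exact h3
  -- expansion
  have hexp : ∀ v : Fin N → ℚ, v = ∑ b, ((d : ℚ)⁻¹ * ∑ l, (h b l : ℚ) * v l) • cq (x b) := by
    intro v
    set Z : Matrix (Fin N) (Fin N) ℚ := of fun b l => (d : ℚ)⁻¹ * h b l with hZ
    set X : Matrix (Fin N) (Fin N) ℚ := of fun b l => (x b l : ℚ) with hX
    have h1 : Z * Xᵀ = 1 := by
      ext b c
      rw [Matrix.mul_apply, Matrix.one_apply]
      have h3 : ∑ l, Z b l * Xᵀ l c = (d : ℚ)⁻¹ * ∑ l, (h b l : ℚ) * x c l := by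
        rw [Finset.mul_sum]; exact Finset.sum_congr rfl fun l _ => by simp [hZ, hX]; ring
      rw [h3, hdualq]; split_ifs <;> simp [hdq]
    have h2 : Xᵀ * Z = 1 := mul_eq_one_comm.mp h1
    have h3 : v = Xᵀ *ᵥ (Z *ᵥ v) := by rw [Matrix.mulVec_mulVec, h2, Matrix.one_mulVec]
    conv_lhs => rw [h3]
    ext l
    simp only [Matrix.mulVec, dotProduct, Finset.sum_apply, Pi.smul_apply, smul_eq_mul, cq]
    refine Finset.sum_congr rfl fun b _ => ?_
    rw [mul_comm, Finset.mul_sum]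
    congr 1
    exact Finset.sum_congr rfl fun m _ => by simp [hZ]; ring
  -- the index k
  have hkex : ∃ k, k ≤ N ∧ ∀ j : Fin N, (j : ℕ) < k ↔ nm B (x j) ≤ t := by
    by_cases hall : ∀ j, nm B (x j) ≤ t
    · exact ⟨N, le_refl _, fun j => ⟨fun _ => hall j, fun _ => j.2⟩⟩
    · push Not at hall
      let P : ℕ → Prop := fun n => ∃ hn : n < N, t < nm B (x ⟨n, hn⟩)
      have hP : ∃ n, P n := by obtain ⟨j, hj⟩ := hall; exact ⟨j, j.2, hj⟩
      obtain ⟨hn, h1⟩ := Nat.find_spec hP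
      refine ⟨Nat.find hP, hn.le, fun j => ⟨fun hj => ?_, fun hj => ?_⟩⟩
      · have := Nat.find_min hP hj
        by_contra hcon
        exact this ⟨j.2, not_le.mp hcon⟩
      · by_contra hcon
        have := hx.mono ⟨Nat.find hP, hn⟩ j (by rw [Fin.le_def]; exact not_lt.mp hcon)
        linarith
  obtain ⟨k, hkN, hk⟩ := hkex
  set T : Submodule ℚ (Fin N → ℚ) := Submodule.span ℚ ((fun j => cq (x j)) '' {j : Fin N | (j : ℕ) < k}) with hT
  have hTmem : ∀ v, v ∈ T ↔ ∀ b : Fin N, k ≤ (b : ℕ) → ∑ l, (h b l : ℚ) * v l = 0 := by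
    intro v
    constructor
    · intro hv b hb
      induction hv using Submodule.span_induction with
      | mem v hv =>
        obtain ⟨j, hj, rfl⟩ := hv
        have := hdualq b j
        rw [if_neg (by rintro rfl; exact absurd hj (not_lt.mpr hb))] at this
        exact this
      | zero => simp
      | add v w _ _ h1 h2 => simp only [Pi.add_apply, mul_add, Finset.sum_add_distrib, h1, h2, add_zero]
      | smul c v _ h1 =>
        have : ∑ l, (h b l : ℚ) * (c • v) l = c * ∑ l, (h b l : ℚ) * v l := by
          rw [Finset.mul_sum]; exact Finset.sum_congr rfl fun l _ => by simp; ring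
        rw [this, h1, mul_zero]
    · intro hv
      rw [hexp v]
      refine Submodule.sum_mem _ fun b _ => ?_
      by_cases hb : (b : ℕ) < k
      · exact Submodule.smul_mem _ _ (Submodule.subset_span ⟨b, hb, rfl⟩)
      · rw [hv b (not_lt.mp hb)]; simp
  have hyT : ∀ y, nm B y ≤ t → cq y ∈ T := by
    intro y hy
    have hyf : cv y ∈ flag x k := by
      by_contra hcon
      rcases Nat.lt_or_ge k N with hlt | hge
      · have h1 := hx.min ⟨k, hlt⟩ y hcon
        have := (hk ⟨k, hlt⟩).mpr (h1.trans hy)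
        simp at this
      · have : k = N := le_antisymm hkN hge
        rw [this, hx.flag_top] at hcon
        exact hcon trivial
    rw [hTmem]
    intro b hb
    have : ∀ v ∈ flag x k, ∑ l, (h b l : ℝ) * v l = 0 := by
      intro v hv
      induction hv using Submodule.span_induction with
      | mem v hv =>
        obtain ⟨j, hj, rfl⟩ := hv
        have := hdual b j
        rw [if_neg (by rintro rfl; exact absurd hj (not_lt.mpr hb))] at this
        simp only [cv]
        exact_mod_cast this
      | zero => simp
      | add v w _ _ h1 h2 => simp only [Pi.add_apply, mul_add, Finset.sum_add_distrib, h1, h2, add_zero]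
      | smul c v _ h1 =>
        have : ∑ l, (h b l : ℝ) * (c • v) l = c * ∑ l, (h b l : ℝ) * v l := by
          rw [Finset.mul_sum]; exact Finset.sum_congr rfl fun l _ => by simp; ring
        rw [this, h1, mul_zero]
    have h1 := this _ hyf
    simp only [cv] at h1
    have h2 : (∑ l, h b l * y l : ℤ) = 0 := by exact_mod_cast h1
    simp only [cq]
    exact_mod_cast h2
  have hST : S = T := by
    apply le_antisymm
    · refine hS1.trans (Submodule.span_le.mpr ?_)
      rintro _ ⟨y, hy, rfl⟩
      exact hyT y hy
    · refine Submodule.span_le.mpr ?_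
      rintro _ ⟨j, hj, rfl⟩
      exact hS2 _ (lt_of_le_of_lt ((hk j).mp hj) htE)
  have hk0 : 0 < k := by
    by_contra hcon
    apply hS3
    rw [hST, hT]
    have : {j : Fin N | (j : ℕ) < k} = ∅ := by ext j; simp; omega
    rw [this]; simp
  have hkN' : k < N := by
    by_contra hcon
    apply hS4
    rw [hST, eq_top_iff]
    intro v _
    rw [hTmem]
    intro b hb
    have := b.2
    omega
  refine ⟨k, x, h, d, hk0, hkN', hd, hdual, ?_, fun j => hx.pos hB j, fun j hj => (hk j).mp hj, ?_, hbd⟩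
  · rw [hST]; exact hTmem
  · intro j hj
    by_contra hcon
    have h1 := hS2 _ (not_le.mp hcon)
    rw [hST, hTmem] at h1
    have h2 := h1 j hj
    have h3 := hdualq j j
    rw [if_pos rfl] at h3
    exact hdq (h3.symm.trans h2)

/-- evaluation of a tensor -/
def evf {R : Type*} [CommRing R] {k N : ℕ} (T : (Fin k → Fin N) → R) (v : Fin k → Fin N → R) : R :=
  ∑ l : Fin k → Fin N, (∏ a, v a (l a)) * T l

lemma sum_prod_fn {R : Type*} [CommRing R] {k N : ℕ} (f : Fin k → Fin N → R) :
    ∑ l : Fin k → Fin N, ∏ a, f a (l a) = ∏ a, ∑ m, f a m := by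
  rw [Finset.prod_univ_sum, Fintype.piFinset_univ]

lemma ev_det {R : Type*} [CommRing R] {k N : ℕ} (x : Fin k → Fin N → R) (v : Fin k → Fin N → R) :
    evf (fun l => (Matrix.of fun a c => x c (l a)).det) v = (Matrix.of fun a c => ∑ m, v a m * x c m).det := by
  unfold evf
  have h1 : ∀ l : Fin k → Fin N, (Matrix.of fun a c => x c (l a)).det =
      ∑ σ : Equiv.Perm (Fin k), ((Equiv.Perm.sign σ : ℤ) : R) * ∏ a, x (σ a) (l a) := by
    intro l
    rw [← Matrix.det_transpose, Matrix.det_apply']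
    rfl
  have h2 : (Matrix.of fun a c => ∑ m, v a m * x c m).det =
      ∑ σ : Equiv.Perm (Fin k), ((Equiv.Perm.sign σ : ℤ) : R) * ∏ a, ∑ m, v a m * x (σ a) m := by
    rw [← Matrix.det_transpose, Matrix.det_apply']
    rfl
  rw [h2]
  simp_rw [h1, Finset.mul_sum]
  rw [Finset.sum_comm]
  refine Finset.sum_congr rfl fun σ _ => ?_
  rw [← sum_prod_fn, Finset.mul_sum]
  refine Finset.sum_congr rfl fun l _ => ?_
  rw [Finset.prod_mul_distrib]; ring

lemma ev_kron {R : Type*} [CommRing R] {k N : ℕ} (P Q : Matrix (Fin N) (Fin N) R) (hPQ : P * Q = 1)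
    (T : (Fin k → Fin N) → R) (v : Fin k → Fin N → R) :
    evf T v = ∑ i : Fin k → Fin N, (∏ a, ∑ m, v a m * P m (i a)) * evf T (fun a => Q (i a)) := by
  unfold evf
  simp_rw [Finset.mul_sum]
  rw [Finset.sum_comm]
  refine Finset.sum_congr rfl fun l _ => ?_
  have h1 : ∀ a, v a (l a) = ∑ i, (∑ m, v a m * P m i) * Q i (l a) := by
    intro a
    have : (v a ᵥ* P) ᵥ* Q = v a := by rw [Matrix.vecMul_vecMul, hPQ, Matrix.vecMul_one]
    conv_lhs => rw [← this]
    rfl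
  have h2 : ∏ a, v a (l a) = ∑ i : Fin k → Fin N, ∏ a, ((∑ m, v a m * P m (i a)) * Q (i a) (l a)) := by
    rw [sum_prod_fn (fun a i => (∑ m, v a m * P m i) * Q i (l a))]
    exact Finset.prod_congr rfl fun a _ => h1 a
  rw [h2, Finset.sum_mul]
  refine Finset.sum_congr rfl fun i _ => ?_
  rw [Finset.prod_mul_distrib]; ring

/-- evaluation as a multilinear map -/
noncomputable def evM {k N : ℕ} (T : (Fin k → Fin N) → ℚ) : MultilinearMap ℚ (fun _ : Fin k => Fin N → ℚ) ℚ :=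
  ∑ l : Fin k → Fin N, T l • (MultilinearMap.mkPiAlgebra ℚ (Fin k) ℚ).compLinearMap (fun a => LinearMap.proj (l a))

lemma evM_apply {k N : ℕ} (T : (Fin k → Fin N) → ℚ) (v : Fin k → Fin N → ℚ) : evM T v = evf T v := by
  unfold evM evf
  rw [MultilinearMap.sum_apply]
  refine Finset.sum_congr rfl fun l _ => ?_
  simp [mul_comm]

/-- the space of alternating tensors -/
def altV (k N : ℕ) : Submodule ℚ ((Fin k → Fin N) → ℚ) where
  carrier := {T | ∀ (v : Fin k → Fin N → ℚ) (a b : Fin k), v a = v b → a ≠ b → evf T v = 0}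
  add_mem' := by
    intro T T' h h' v a b h1 h2
    have : evf (T + T') v = evf T v + evf T' v := by simp [evf, mul_add, Finset.sum_add_distrib]
    rw [this, h v a b h1 h2, h' v a b h1 h2, add_zero]
  zero_mem' := by intro v a b _ _; simp [evf]
  smul_mem' := by
    intro c T h v a b h1 h2
    have : evf (c • T) v = c * evf T v := by
      simp only [evf, Pi.smul_apply, smul_eq_mul, Finset.mul_sum]
      exact Finset.sum_congr rfl fun l _ => by ring
    rw [this, h v a b h1 h2, mul_zero]

/-- the alternating map of an alternating tensor -/
noncomputable def evA {k N : ℕ} (T : (Fin k → Fin N) → ℚ) (hT : T ∈ altV k N) : (Fin N → ℚ) [⋀^Fin k]→ₗ[ℚ] ℚ :=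
  { evM T with map_eq_zero_of_eq' := fun v a b h1 h2 => (evM_apply T v).trans (hT v a b h1 h2) }

lemma evA_apply {k N : ℕ} (T : (Fin k → Fin N) → ℚ) (hT : T ∈ altV k N) (v : Fin k → Fin N → ℚ) :
    evA T hT v = evf T v := evM_apply T v

lemma ev_single {R : Type*} [CommRing R] {k N : ℕ} (T : (Fin k → Fin N) → R) (l : Fin k → Fin N) :
    evf T (fun a => Pi.single (l a) 1) = T l := by
  unfold evf
  rw [Finset.sum_eq_single l]
  · simp
  · intro l' _ hl
    obtain ⟨a, ha⟩ := Function.ne_iff.mp hl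
    rw [Finset.prod_eq_zero (Finset.mem_univ a), zero_mul]
    simp [ha]
  · simp

lemma ev_cast {R : Type*} [CommRing R] {k N : ℕ} (T : (Fin k → Fin N) → ℤ) (v : Fin k → Fin N → ℤ) :
    evf (fun l => (T l : R)) (fun a m => (v a m : R)) = ((evf T v : ℤ) : R) := by
  simp [evf]

/-- the wedge of the vectors `x c` -/
def wdg {k N : ℕ} (x : Fin k → Fin N → ℤ) : (Fin k → Fin N) → ℤ := fun l => (Matrix.of fun a c => x c (l a)).det

lemma ev_wdg {R : Type*} [CommRing R] {k N : ℕ} (x : Fin k → Fin N → ℤ) (v : Fin k → Fin N → R) :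
    evf (fun l => (wdg x l : R)) v = (Matrix.of fun a c => ∑ m, v a m * (x c m : R)).det := by
  have h1 : (fun l => (wdg x l : R)) = fun l => (Matrix.of fun a c => (x c (l a) : R)).det := by
    ext l
    unfold wdg
    have := RingHom.map_det (Int.castRingHom R) (Matrix.of fun a c => x c (l a))
    simp only [eq_intCast] at this
    rw [this]
    congr 1
  rw [h1, ev_det (fun c m => (x c m : R))]

lemma wdg_mem {k N : ℕ} (x : Fin k → Fin N → ℤ) : cq (wdg x) ∈ altV k N := by
  intro v a b h1 h2
  change evf (fun l => (wdg x l : ℚ)) v = 0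
  rw [ev_wdg]
  apply Matrix.det_zero_of_row_eq h2
  ext c
  simp [h1]

theorem tens_key {k N : ℕ} (hkN : k ≤ N) (x h : Fin N → Fin N → ℤ) (d : ℤ) (hd : d ≠ 0)
    (hdual : ∀ b c, ∑ l, h b l * x c l = if b = c then d else 0)
    (Y : (Fin k → Fin N) → ℤ) (hY : cq Y ∈ altV k N) (hP : ¬ Prp Y (wdg fun c : Fin k => x (Fin.castLE hkN c))) :
    ∃ b : Fin k → Fin N, Function.Injective b ∧ (∃ a, k ≤ (b a : ℕ)) ∧ evf Y (fun a => h (b a)) ≠ 0 := by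
  classical
  by_contra hcon
  push Not at hcon
  apply hP
  have hdq : (d : ℚ) ≠ 0 := by exact_mod_cast hd
  set ω := wdg fun c : Fin k => x (Fin.castLE hkN c) with hω
  have hdualq : ∀ b c, ∑ l, (h b l : ℚ) * x c l = if b = c then (d : ℚ) else 0 := by
    intro b c
    have h3 : ((∑ l, h b l * x c l : ℤ) : ℚ) = ((if b = c then d else 0 : ℤ) : ℚ) := by rw [hdual]
    push_cast at h3; exact h3
  have hli : LinearIndependent ℚ fun b => cq (h b) := by
    rw [Fintype.linearIndependent_iff]
    intro g hg c
    have h1 : ∑ l, (∑ b, g b • cq (h b)) l * (x c l : ℚ) = g c * d := by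
      simp only [Finset.sum_apply, Pi.smul_apply, smul_eq_mul, cq, Finset.sum_mul]
      rw [Finset.sum_comm]
      have : ∀ b, ∑ l, g b * (h b l : ℚ) * x c l = g b * if b = c then (d : ℚ) else 0 := by
        intro b; rw [← hdualq, Finset.mul_sum]; exact Finset.sum_congr rfl fun l _ => by ring
      simp_rw [this]
      simp
    rw [hg] at h1
    simp at h1
    rcases h1 with h1 | h1
    · exact h1
    · exact absurd h1 hd
  let bs := basisOfPiSpaceOfLinearIndependent hli
  have hbs : ∀ b, bs b = cq (h b) := fun b => by
    simp [bs]
  set s : ℤ := evf Y (fun a => h (Fin.castLE hkN a)) with hs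
  have hωh : ∀ b : Fin k → Fin N, evf (cq ω) (fun a => cq (h (b a))) =
      (Matrix.of fun a c : Fin k => if b a = Fin.castLE hkN c then (d : ℚ) else 0).det := by
    intro b
    have := ev_wdg (R := ℚ) (fun c : Fin k => x (Fin.castLE hkN c)) (fun a m => (h (b a) m : ℚ))
    simp only [hdualq] at this
    exact this
  have hωd : evf (cq ω) (fun a => cq (h (Fin.castLE hkN a))) = (d : ℚ) ^ k := by
    rw [hωh]
    have : (Matrix.of fun a c : Fin k => if Fin.castLE hkN a = Fin.castLE hkN c then (d : ℚ) else 0) =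
        Matrix.diagonal fun _ => (d : ℚ) := by
      ext a c
      simp [Matrix.diagonal_apply, Fin.castLE_inj]
    rw [this, Matrix.det_diagonal]; simp
  have hev : ∀ b : Fin k → Fin N, evf (cq Y) (fun a => cq (h (b a))) = ((evf Y fun a => h (b a) : ℤ) : ℚ) :=
    fun b => ev_cast (R := ℚ) Y (fun a => h (b a))
  have key : (d : ℚ) ^ k • evA (cq Y) hY = (s : ℚ) • evA (cq ω) (wdg_mem _) := by
    apply Module.Basis.ext_alternating bs
    intro b hb
    simp only [hbs, AlternatingMap.smul_apply, evA_apply, smul_eq_mul]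
    by_cases hbk : ∃ a, k ≤ (b a : ℕ)
    · have h1 := hcon b hb hbk
      obtain ⟨a, ha⟩ := hbk
      rw [hev, h1, hωh, Matrix.det_eq_zero_of_row_eq_zero a]
      · simp
      · intro c
        simp only [Matrix.of_apply]
        rw [if_neg]
        intro h2
        rw [h2] at ha
        have := c.2
        simp at ha
        omega
    · push Not at hbk
      let π : Fin k → Fin k := fun a => ⟨b a, hbk a⟩
      have hπ : Function.Injective π := by
        intro a a' h1
        apply hb
        have h2 : (π a : ℕ) = π a' := by rw [h1]
        exact Fin.ext h2
      let e : Equiv.Perm (Fin k) := Equiv.ofBijective π (Finite.injective_iff_bijective.mp hπ)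
      have hbe : ∀ a, b a = Fin.castLE hkN (e a) := fun a => by ext; simp [e, π]
      have h1 := AlternatingMap.map_perm (evA (cq Y) hY) (fun a => cq (h (Fin.castLE hkN a))) e
      have h2 := AlternatingMap.map_perm (evA (cq ω) (wdg_mem _)) (fun a => cq (h (Fin.castLE hkN a))) e
      rw [evA_apply, evA_apply] at h1 h2
      have h3 : (fun a => cq (h (b a))) = (fun a => cq (h (Fin.castLE hkN a))) ∘ e := by
        ext a; simp [hbe]
      rw [h3, h1, h2, hωd, hev, ← hs]
      rw [mul_smul_comm, mul_smul_comm, mul_comm]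
  refine ⟨d ^ k, s, pow_ne_zero _ hd, fun l => ?_⟩
  have h1 := congrArg (fun f => f (fun a => (Pi.single (l a) 1 : Fin N → ℚ))) key
  simp only [AlternatingMap.smul_apply, evA_apply, smul_eq_mul, ev_single] at h1
  simp only [cq] at h1
  exact_mod_cast h1

theorem tens_det {k N : ℕ} (hkN : k ≤ N) (x h x' h' : Fin N → Fin N → ℤ) (d d' : ℤ) (hd : d ≠ 0) (hd' : d' ≠ 0)
    (hdual : ∀ b c, ∑ l, h b l * x c l = if b = c then d else 0)
    (hdual' : ∀ b c, ∑ l, h' b l * x' c l = if b = c then d' else 0)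
    (hP : Prp (wdg fun c : Fin k => x' (Fin.castLE hkN c)) (wdg fun c : Fin k => x (Fin.castLE hkN c))) :
    ∀ (c : Fin k) (b : Fin N), k ≤ (b : ℕ) → ∑ l, h' b l * x (Fin.castLE hkN c) l = 0 := by
  classical
  intro c b hb
  obtain ⟨r, s, hr, hrs⟩ := hP
  set ω := wdg fun c : Fin k => x (Fin.castLE hkN c) with hω
  set ω' := wdg fun c : Fin k => x' (Fin.castLE hkN c) with hω'
  have hlin : ∀ v, r * evf ω' v = s * evf ω v := by
    intro v
    simp only [evf, Finset.mul_sum]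
    refine Finset.sum_congr rfl fun l _ => ?_
    linear_combination (∏ a, v a (l a)) * hrs l
  have hs : s ≠ 0 := by
    rintro rfl
    have h1 := hlin (fun a => h' (Fin.castLE hkN a))
    have h2 := ev_wdg (R := ℤ) (fun c : Fin k => x' (Fin.castLE hkN c)) (fun a => h' (Fin.castLE hkN a))
    simp only [Int.cast_id, hdual', Fin.castLE_inj] at h2
    have h3 : (Matrix.of fun a c : Fin k => if a = c then d' else 0) = Matrix.diagonal fun _ => d' := by
      ext a c; simp [Matrix.diagonal_apply]
    rw [h3, Matrix.det_diagonal] at h2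
    have h4 : evf ω' (fun a => h' (Fin.castLE hkN a)) = ∏ _i : Fin k, d' := h2
    rw [h4, zero_mul] at h1
    simp [hr, hd'] at h1
  have h1 := hlin (Function.update (fun a => h (Fin.castLE hkN a)) c (h' b))
  have h2 := ev_wdg (R := ℤ) (fun c : Fin k => x' (Fin.castLE hkN c)) (Function.update (fun a => h (Fin.castLE hkN a)) c (h' b))
  have h3 := ev_wdg (R := ℤ) (fun c : Fin k => x (Fin.castLE hkN c)) (Function.update (fun a => h (Fin.castLE hkN a)) c (h' b))
  simp only [Int.cast_id] at h2 h3
  rw [Matrix.det_eq_zero_of_row_eq_zero c] at h2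
  · have h2' : evf ω' (Function.update (fun a => h (Fin.castLE hkN a)) c (h' b)) = 0 := h2
    have h4 : (Matrix.of fun a c_1 : Fin k => ∑ m, Function.update (fun a => h (Fin.castLE hkN a)) c (h' b) a m * x (Fin.castLE hkN c_1) m)
        = (Matrix.diagonal fun _ => d).updateRow c (fun c' => ∑ m, h' b m * x (Fin.castLE hkN c') m) := by
      ext a c'
      by_cases ha : a = c
      · subst ha; simp
      · simp [ha, hdual, Matrix.diagonal_apply, Fin.castLE_inj]
    rw [h4] at h3
    set u : Fin k → ℤ := fun c' => ∑ m, h' b m * x (Fin.castLE hkN c') m with hu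
    have h5 : d * ((Matrix.diagonal fun _ => d).updateRow c u).det = u c * d ^ k := by
      have h6 := Matrix.det_updateRow_sum (Matrix.diagonal fun _ : Fin k => d) c u
      have h7 : ∑ b, u b • (Matrix.diagonal fun _ : Fin k => d) b = d • u := by
        ext a
        simp [Finset.sum_apply, Matrix.diagonal_apply, mul_comm]
      rw [h7, Matrix.det_updateRow_smul] at h6
      simpa using h6
    have h3' : evf ω (Function.update (fun a => h (Fin.castLE hkN a)) c (h' b)) = ((Matrix.diagonal fun _ => d).updateRow c u).det := h3
    rw [h2', h3', mul_zero] at h1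
    have h8 := mul_eq_zero.mp h1.symm
    rw [h8.resolve_left hs, mul_zero] at h5
    exact (mul_eq_zero.mp h5.symm).resolve_right (pow_ne_zero _ hd)
  · intro c'
    simp only [Matrix.of_apply, Function.update_self, hdual']
    rw [if_neg]
    rintro rfl
    simp at hb
    have := c'.2
    omega

lemma prod_gap {k N : ℕ} (hkN : k ≤ N) (lam : Fin N → ℝ) (hpos : ∀ j, 0 < lam j) (t E : ℝ) (ht : 0 < t) (hE : 1 < E)
    (h1 : ∀ j : Fin N, (j : ℕ) < k → lam j ≤ t) (h2 : ∀ j : Fin N, k ≤ (j : ℕ) → t * E ≤ lam j)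
    (b : Fin k → Fin N) (hb : Function.Injective b) (a0 : Fin k) (ha0 : k ≤ (b a0 : ℕ)) :
    E * ∏ c : Fin k, lam (Fin.castLE hkN c) ≤ ∏ a, lam (b a) := by
  classical
  set R := Finset.univ.image b with hR
  set P := Finset.univ.image (Fin.castLE hkN) with hP
  have e1 : ∏ a, lam (b a) = ∏ j ∈ R, lam j := by
    rw [hR, Finset.prod_image fun x _ y _ h => hb h]
  have e2 : ∏ c : Fin k, lam (Fin.castLE hkN c) = ∏ j ∈ P, lam j := by
    rw [hP, Finset.prod_image fun x _ y _ h => Fin.castLE_injective hkN h]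
  have c1 : R.card = k := by rw [hR, Finset.card_image_of_injective _ hb]; simp
  have c2 : P.card = k := by rw [hP, Finset.card_image_of_injective _ (Fin.castLE_injective hkN)]; simp
  have memP : ∀ j, j ∈ P ↔ (j : ℕ) < k := by
    intro j
    simp only [hP, Finset.mem_image, Finset.mem_univ, true_and]
    constructor
    · rintro ⟨a, rfl⟩; exact a.2
    · intro h; exact ⟨⟨j, h⟩, rfl⟩
  have hc : (R \ P).card = (P \ R).card := by
    have := Finset.card_sdiff_add_card_inter R P
    have := Finset.card_sdiff_add_card_inter P R
    rw [Finset.inter_comm] at this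
    omega
  have hm : 1 ≤ (R \ P).card := by
    apply Finset.card_pos.mpr
    refine ⟨b a0, Finset.mem_sdiff.mpr ⟨Finset.mem_image_of_mem _ (Finset.mem_univ _), ?_⟩⟩
    rw [memP]; omega
  have s1 : ∏ j ∈ P \ R, lam j ≤ t ^ (P \ R).card := by
    rw [← Finset.prod_const]
    exact Finset.prod_le_prod (fun j _ => (hpos j).le) fun j hj => h1 j ((memP j).mp (Finset.mem_sdiff.mp hj).1)
  have s2 : (t * E) ^ (R \ P).card ≤ ∏ j ∈ R \ P, lam j := by
    rw [← Finset.prod_const]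
    refine Finset.prod_le_prod (fun j _ => by positivity) fun j hj => h2 j ?_
    have := mt (memP j).mpr (Finset.mem_sdiff.mp hj).2
    omega
  have s3 : E * ∏ j ∈ P \ R, lam j ≤ ∏ j ∈ R \ P, lam j := by
    refine le_trans ?_ s2
    rw [mul_pow, ← hc] at *
    have : E ≤ E ^ (R \ P).card := le_self_pow₀ hE.le (by omega)
    rw [mul_comm]
    exact mul_le_mul s1 this (by linarith) (by positivity)
  have i1 : ∏ j ∈ R, lam j = (∏ j ∈ R ∩ P, lam j) * ∏ j ∈ R \ P, lam j := (Finset.prod_inter_mul_prod_diff R P lam).symm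
  have i2 : ∏ j ∈ P, lam j = (∏ j ∈ R ∩ P, lam j) * ∏ j ∈ P \ R, lam j := by
    rw [Finset.inter_comm]; exact (Finset.prod_inter_mul_prod_diff P R lam).symm
  rw [e1, e2, i1, i2]
  have : 0 ≤ ∏ j ∈ R ∩ P, lam j := Finset.prod_nonneg fun j _ => (hpos j).le
  calc _ = (∏ j ∈ R ∩ P, lam j) * (E * ∏ j ∈ P \ R, lam j) := by ring
    _ ≤ _ := mul_le_mul_of_nonneg_left s3 this

/-- norm on tensors -/
def gT {k N : ℕ} (B : Matrix (Fin N) (Fin N) ℝ) (Y : (Fin k → Fin N) → ℤ) : ℝ :=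
  ∑ i : Fin k → Fin N, |evf (fun l => (Y l : ℝ)) (fun a => B (i a))|

theorem gap_tens {k N : ℕ} (hkN : k ≤ N) (B : Matrix (Fin N) (Fin N) ℝ) (hB : B.det ≠ 0) (x h : Fin N → Fin N → ℤ)
    (d : ℤ) (hd : d ≠ 0) (hdual : ∀ b c, ∑ l, h b l * x c l = if b = c then d else 0)
    (hpos : ∀ j, 0 < nm B (x j)) (t E C0 : ℝ) (ht : 0 < t) (hE : 1 < E)
    (h1 : ∀ j : Fin N, (j : ℕ) < k → nm B (x j) ≤ t) (h2 : ∀ j : Fin N, k ≤ (j : ℕ) → t * E ≤ nm B (x j))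
    (h3 : ∀ b i, |∑ l, (h b l : ℝ) * B⁻¹ l i| * nm B (x b) ≤ C0) (hC0 : 0 ≤ C0)
    (Y : (Fin k → Fin N) → ℤ) (hY : cq Y ∈ altV k N) (hP : ¬ Prp Y (wdg fun c : Fin k => x (Fin.castLE hkN c))) :
    E * gT B (wdg fun c : Fin k => x (Fin.castLE hkN c)) ≤ (N ^ k * k.factorial * C0 ^ k) * gT B Y := by
  classical
  have hBB : B⁻¹ * B = 1 := Matrix.nonsing_inv_mul _ (isUnit_iff_ne_zero.mpr hB)
  obtain ⟨b, hb, ⟨a0, ha0⟩, hne⟩ := tens_key hkN x h d hd hdual Y hY hP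
  have hg := prod_gap hkN (fun j => nm B (x j)) hpos t E ht hE h1 h2 b hb a0 ha0
  set Λ := ∏ c : Fin k, nm B (x (Fin.castLE hkN c)) with hΛ
  have u1 : gT B (wdg fun c : Fin k => x (Fin.castLE hkN c)) ≤ N ^ k * k.factorial * Λ := by
    unfold gT
    have : ∀ i ∈ (Finset.univ : Finset (Fin k → Fin N)), |evf (fun l => ((wdg fun c : Fin k => x (Fin.castLE hkN c)) l : ℝ)) (fun a => B (i a))| ≤
        k.factorial * Λ := by
      intro i _
      rw [ev_wdg, ← Matrix.det_transpose]
      apply det_le_rows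
      intro c a
      exact le_nm B (x (Fin.castLE hkN c)) (i a)
    refine (Finset.sum_le_card_nsmul _ _ _ this).trans ?_
    simp [mul_assoc]
  have gT0 : 0 ≤ gT B Y := Finset.sum_nonneg fun _ _ => abs_nonneg _
  have u2 : ∏ a, nm B (x (b a)) ≤ C0 ^ k * gT B Y := by
    have v1 : (1 : ℝ) ≤ |evf (fun l => (Y l : ℝ)) (fun a m => (h (b a) m : ℝ))| := by
      rw [ev_cast (R := ℝ) Y (fun a => h (b a))]
      rw [← Int.cast_abs]
      exact_mod_cast Int.one_le_abs hne
    rw [ev_kron B⁻¹ B hBB] at v1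
    have hp0 : 0 ≤ ∏ a, nm B (x (b a)) := Finset.prod_nonneg fun j _ => (hpos _).le
    calc ∏ a, nm B (x (b a)) = (∏ a, nm B (x (b a))) * 1 := by ring
      _ ≤ (∏ a, nm B (x (b a))) * ∑ i : Fin k → Fin N, |(∏ a, ∑ m, (h (b a) m : ℝ) * B⁻¹ m (i a)) * evf (fun l => (Y l : ℝ)) (fun a => B (i a))| :=
          mul_le_mul_of_nonneg_left (v1.trans (Finset.abs_sum_le_sum_abs _ _)) hp0
      _ ≤ C0 ^ k * gT B Y := by
        unfold gT
        rw [Finset.mul_sum, Finset.mul_sum]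
        refine Finset.sum_le_sum fun i _ => ?_
        rw [abs_mul, ← mul_assoc]
        refine mul_le_mul_of_nonneg_right ?_ (abs_nonneg _)
        rw [Finset.abs_prod, ← Finset.prod_mul_distrib]
        have : ∏ _a : Fin k, C0 = C0 ^ k := by simp
        rw [← this]
        refine Finset.prod_le_prod (fun a _ => mul_nonneg (hpos _).le (abs_nonneg _)) fun a _ => ?_
        rw [mul_comm]
        exact h3 _ _
  have hE0 : 0 ≤ E := by linarith
  calc _ ≤ E * (N ^ k * k.factorial * Λ) := mul_le_mul_of_nonneg_left u1 hE0
    _ = (N ^ k * k.factorial) * (E * Λ) := by ring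
    _ ≤ (N ^ k * k.factorial) * (C0 ^ k * gT B Y) := mul_le_mul_of_nonneg_left (hg.trans u2) (by positivity)
    _ = _ := by ring

lemma wdg_ne {k N : ℕ} (hkN : k ≤ N) (x h : Fin N → Fin N → ℤ) (d : ℤ) (hd : d ≠ 0)
    (hdual : ∀ b c, ∑ l, h b l * x c l = if b = c then d else 0) : (wdg fun c : Fin k => x (Fin.castLE hkN c)) ≠ 0 := by
  intro h0
  have h2 := ev_wdg (R := ℤ) (fun c : Fin k => x (Fin.castLE hkN c)) (fun a => h (Fin.castLE hkN a))
  simp only [Int.cast_id, hdual, Fin.castLE_inj] at h2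
  have h3 : (Matrix.of fun a c : Fin k => if a = c then d else 0) = Matrix.diagonal fun _ => d := by
    ext a c; simp [Matrix.diagonal_apply]
  rw [h3, Matrix.det_diagonal, h0] at h2
  simp [evf, hd] at h2
  exact absurd h2.symm (pow_ne_zero _ hd)

lemma Prp.symm' {κ : Type*} {x h : κ → ℤ} (hp : Prp x h) (hx : x ≠ 0) : Prp h x := by
  obtain ⟨r, s, hr, hrs⟩ := hp
  refine ⟨s, r, ?_, fun l => (hrs l).symm⟩
  rintro rfl
  apply hx
  ext l
  have := hrs l
  simpa [hr] using this

lemma S_le {k N : ℕ} (hkN : k ≤ N) (x h x' h' : Fin N → Fin N → ℤ) (d d' : ℤ) (hd : d ≠ 0) (hd' : d' ≠ 0)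
    (hdual : ∀ b c, ∑ l, h b l * x c l = if b = c then d else 0)
    (hdual' : ∀ b c, ∑ l, h' b l * x' c l = if b = c then d' else 0)
    (hP : Prp (wdg fun c : Fin k => x' (Fin.castLE hkN c)) (wdg fun c : Fin k => x (Fin.castLE hkN c)))
    (v : Fin N → ℚ) (hv : ∀ b : Fin N, k ≤ (b : ℕ) → ∑ l, (h b l : ℚ) * v l = 0) :
    ∀ b : Fin N, k ≤ (b : ℕ) → ∑ l, (h' b l : ℚ) * v l = 0 := by
  intro b hb
  have hdq : (d : ℚ) ≠ 0 := by exact_mod_cast hd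
  set H : Matrix (Fin N) (Fin N) ℚ := Matrix.of fun b l => (h b l : ℚ) with hH
  set X : Matrix (Fin N) (Fin N) ℚ := Matrix.of fun l c => (x c l : ℚ) / d with hX
  have e1 : H * X = 1 := by
    ext b c
    rw [Matrix.mul_apply, Matrix.one_apply]
    have h3 : ((∑ l, h b l * x c l : ℤ) : ℚ) = ((if b = c then d else 0 : ℤ) : ℚ) := by rw [hdual]
    push_cast at h3
    have : ∑ l, H b l * X l c = (∑ l, (h b l : ℚ) * x c l) / d := by
      rw [Finset.sum_div]; exact Finset.sum_congr rfl fun l _ => by simp [hH, hX]; ring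
    rw [this, h3]
    split_ifs <;> simp [hd]
  have e2 : X * H = 1 := mul_eq_one_comm.mp e1
  have e3 : v = X *ᵥ (H *ᵥ v) := by rw [Matrix.mulVec_mulVec, e2, Matrix.one_mulVec]
  have e4 : ∀ l, v l = ∑ c, (x c l : ℚ) / d * ∑ m, (h c m : ℚ) * v m := fun l => congrFun e3 l
  calc ∑ l, (h' b l : ℚ) * v l = ∑ l, ∑ c, (h' b l : ℚ) * ((x c l : ℚ) / d * ∑ m, (h c m : ℚ) * v m) := by
        refine Finset.sum_congr rfl fun l _ => ?_
        conv_lhs => rw [e4 l]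
        rw [Finset.mul_sum]
    _ = ∑ c, (∑ l, (h' b l : ℚ) * x c l) * ((∑ m, (h c m : ℚ) * v m) / d) := by
        rw [Finset.sum_comm]
        refine Finset.sum_congr rfl fun c _ => ?_
        rw [Finset.sum_mul]
        exact Finset.sum_congr rfl fun l _ => by ring
    _ = 0 := by
        refine Finset.sum_eq_zero fun c _ => ?_
        by_cases hc : k ≤ (c : ℕ)
        · rw [hv c hc]; simp
        · have := tens_det hkN x h x' h' d d' hd hd' hdual hdual' hP ⟨c, by omega⟩ b hb
          have h3 : ((∑ l, h' b l * x c l : ℤ) : ℚ) = 0 := by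
            exact_mod_cast this
          push_cast at h3
          rw [h3, zero_mul]

lemma gT_eq {k N : ℕ} (A : Fin N → ℝ) (hA : ∀ i, 0 < A i) (R : Matrix (Fin N) (Fin N) ℝ) (Y : (Fin k → Fin N) → ℤ) :
    gT (wm A R) Y = gn (Matrix.of fun (i l : Fin k → Fin N) => ∏ a, R (i a) (l a)) (fun i => ∏ a, A (i a)) Y := by
  unfold gT gn
  refine Finset.sum_congr rfl fun i _ => ?_
  have hp : 0 ≤ ∏ a, A (i a) := Finset.prod_nonneg fun a _ => (hA _).le
  beta_reduce
  conv_rhs => rw [← abs_of_nonneg hp, ← abs_mul]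
  congr 1
  unfold evf
  rw [Finset.mul_sum]
  refine Finset.sum_congr rfl fun l _ => ?_
  simp only [wm, Matrix.diagonal_mul, Matrix.of_apply, Finset.prod_mul_distrib]
  ring

lemma gn_nm {N : ℕ} {ι : Type*} [Fintype ι] (R : Matrix ι (Fin N) ℝ) (A : ι → ℝ) (hA : ∀ i, 0 < A i) (e : Fin N → ι)
    (he : ∀ (i : ι) (v : Fin N → ℝ), A i * |∑ l, R i l * v l| ≤ ∑ a, A (e a) * |∑ l, R (e a) l * v l|) (x : Fin N → ℤ) :
    nm (wm (A ∘ e) (R.submatrix e id)) x ≤ gn R A x ∧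
    gn R A x ≤ (Fintype.card ι * N + 1) * nm (wm (A ∘ e) (R.submatrix e id)) x := by
  have hRv : ∀ i, (wm (A ∘ e) (R.submatrix e id) *ᵥ cv x) i = A (e i) * ∑ l, R (e i) l * (x l : ℝ) := by
    intro i; rw [wm_mulVec]; rfl
  constructor
  · apply nm_le _ _ (gn_nonneg _ hA _)
    intro i
    rw [hRv, abs_mul, abs_of_pos (hA _)]
    exact Finset.single_le_sum (f := fun i => A i * |∑ l, R i l * (x l : ℝ)|)
      (fun i _ => mul_nonneg (hA i).le (abs_nonneg _)) (Finset.mem_univ (e i))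
  · have h6 : ∀ i, A i * |∑ l, R i l * (x l : ℝ)| ≤ N * nm (wm (A ∘ e) (R.submatrix e id)) x := by
      intro i
      refine (he i (cv x)).trans ?_
      calc _ ≤ ∑ a : Fin N, nm (wm (A ∘ e) (R.submatrix e id)) x := by
            refine Finset.sum_le_sum fun a _ => ?_
            have := le_nm (wm (A ∘ e) (R.submatrix e id)) x a
            rwa [hRv, abs_mul, abs_of_pos (hA _)] at this
        _ = _ := by simp
    calc gn R A x ≤ ∑ i : ι, N * nm (wm (A ∘ e) (R.submatrix e id)) x := Finset.sum_le_sum fun i _ => h6 i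
      _ = Fintype.card ι * N * nm (wm (A ∘ e) (R.submatrix e id)) x := by simp; ring
      _ ≤ _ := mul_le_mul_of_nonneg_right (by linarith) (nm_nonneg _ _)


lemma kron_inv {k N : ℕ} {R : Type*} [CommRing R] (P Q : Matrix (Fin N) (Fin N) R) (h : P * Q = 1) :
    (Matrix.of fun (i l : Fin k → Fin N) => ∏ a, P (i a) (l a)) * (Matrix.of fun (i l : Fin k → Fin N) => ∏ a, Q (i a) (l a)) = 1 := by
  ext i l
  rw [Matrix.mul_apply]
  simp only [Matrix.of_apply, ← Finset.prod_mul_distrib]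
  rw [sum_prod_fn (fun a m => P (i a) m * Q m (l a))]
  have : ∀ a, ∑ m, P (i a) m * Q m (l a) = if i a = l a then 1 else 0 := by
    intro a
    rw [← Matrix.mul_apply, h, Matrix.one_apply]
  simp_rw [this]
  rw [Matrix.one_apply]
  split_ifs with hil
  · simp [hil]
  · obtain ⟨a, ha⟩ := Function.ne_iff.mp hil
    exact Finset.prod_eq_zero (Finset.mem_univ a) (by simp [ha])

lemma gap_arith {E Kt Kc g w : ℝ} (a : ℝ) (hKc : 0 < Kc) (hKt : 0 ≤ Kt) (hg : 0 ≤ g) (ha : 0 < a) (hEq : E * Kc = a * a) (hb : Kt * Kc ≤ a)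
    (h : E * w ≤ Kt * g) : a * w ≤ g := by
  have h1 : a * a * w ≤ a * g := by
    calc a * a * w = (E * w) * Kc := by rw [← hEq]; ring
      _ ≤ (Kt * g) * Kc := mul_le_mul_of_nonneg_right h hKc.le
      _ = (Kt * Kc) * g := by ring
      _ ≤ a * g := mul_le_mul_of_nonneg_right hb hg
  have h2 : a * (a * w) ≤ a * g := by linarith
  exact le_of_mul_le_mul_left h2 ha

set_option maxHeartbeats 1000000 in
theorem gap {ι : Type*} [Fintype ι] {N : ℕ} {F : Type*} [Field F] [NumberField F] (τ : F →+* ℝ)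
    (M : Matrix ι (Fin N) F) (G : Matrix (Fin N) ι ℝ) (hG : G * M.map τ = 1) (δ C : ℝ) (hδ : 0 < δ) {α : Type*} (f q : α → ℝ)
    (A : α → ι → ℝ) (S : α → Submodule ℚ (Fin N → ℚ)) (t : α → ℝ) (p : α → Prop) (hU : Unb f p)
    (hp : ∀ y, p y → f y ≤ q y ∧ (∀ i, Real.exp (-(C * q y)) ≤ A y i ∧ A y i ≤ Real.exp (C * q y)) ∧ 0 < t y ∧
      S y ≤ Submodule.span ℚ (cq '' {x | gn (M.map τ) (A y) x ≤ t y}) ∧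
      (∀ x, gn (M.map τ) (A y) x < t y * Real.exp (δ * q y) → cq x ∈ S y) ∧ S y ≠ ⊥ ∧ S y ≠ ⊤)
    (hfin : ∀ y, p y → ∃ B, ∀ y', p y' → S y' = S y → f y' ≤ B) : False := by
  classical
  set Kc : ℝ := Fintype.card ι * N + 1 with hKc
  have hKpos : 0 < Kc := by positivity
  set C0 : ℝ := N.factorial * dK N ^ N with hC0
  have hC00 : 0 ≤ C0 := by rw [hC0, dK]; positivity
  set E : α → ℝ := fun y => Real.exp (δ * q y) / Kc with hE
  let Q : (Fin N → ι) × Fin N → α → (Fin N → Fin N → ℤ) → (Fin N → Fin N → ℤ) → ℤ → Prop := fun ek y x h d =>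
    p y ∧ (((M.submatrix ek.1 id).map τ).det ≠ 0) ∧ d ≠ 0 ∧
      (∀ b c, ∑ l, h b l * x c l = if b = c then d else 0) ∧
      (∀ v, v ∈ S y ↔ ∀ b : Fin N, (ek.2 : ℕ) ≤ (b : ℕ) → ∑ l, (h b l : ℚ) * v l = 0) ∧
      (∀ j, 0 < nm (wm (A y ∘ ek.1) ((M.submatrix ek.1 id).map τ)) (x j)) ∧ 1 < E y ∧
      (∀ j : Fin N, (j : ℕ) < ek.2 → nm (wm (A y ∘ ek.1) ((M.submatrix ek.1 id).map τ)) (x j) ≤ t y) ∧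
      (∀ j : Fin N, (ek.2 : ℕ) ≤ (j : ℕ) → t y * E y ≤ nm (wm (A y ∘ ek.1) ((M.submatrix ek.1 id).map τ)) (x j)) ∧
      ∀ b i, |∑ l, (h b l : ℝ) * (wm (A y ∘ ek.1) ((M.submatrix ek.1 id).map τ))⁻¹ l i| * nm (wm (A y ∘ ek.1) ((M.submatrix ek.1 id).map τ)) (x b) ≤ C0
  obtain ⟨⟨e, k⟩, hek⟩ := hU.pigeon (T := (Fin N → ι) × Fin N) (q := fun ek y => ∃ x h d, Q ek y x h d) (by
    obtain ⟨B0, hB0⟩ := eventually_atTop.mp (ev_exp hδ (Kc + 1))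
    refine ⟨B0, fun y hy0 hy => ?_⟩
    obtain ⟨h1, h2, h3, h4, h5, h6, h7⟩ := hp y hy
    have hApos : ∀ i, 0 < A y i := fun i => (Real.exp_pos _).trans_le (h2 i).1
    obtain ⟨e, he1, he2⟩ := subbasis (M.map τ) G hG (A y) hApos
    have hgn := gn_nm (M.map τ) (A y) hApos e he2
    have hsub : (M.map τ).submatrix e id = (M.submatrix e id).map τ := rfl
    rw [hsub] at hgn he1
    have hEK : E y * Kc = Real.exp (δ * q y) := by rw [hE]; field_simp
    have hE1 : 1 < E y := by
      have := hB0 (q y) (hy0.trans h1)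
      rw [hE]; beta_reduce
      rw [lt_div_iff₀ hKpos]; linarith
    have hdet : (wm (A y ∘ e) ((M.submatrix e id).map τ)).det ≠ 0 := by
      rw [wm_det]
      exact mul_ne_zero (Finset.prod_ne_zero_iff.mpr fun i _ => (hApos _).ne') he1
    obtain ⟨k, x, h, d, g1, g2, g3, g4, g5, g6, g7, g8, g9⟩ := gap_one hdet (S y) (t y) (E y) h3 hE1
      (h4.trans (Submodule.span_mono (Set.image_mono fun x hx => (hgn x).1.trans hx)))
      (fun x hx => h5 x (by
        refine (hgn x).2.trans_lt ?_
        rw [← hEK]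
        calc _ < Kc * (t y * E y) := mul_lt_mul_of_pos_left hx hKpos
          _ = _ := by ring)) h6 h7
    exact ⟨(e, ⟨k, g2⟩), x, h, d, hy, he1, g3, g4, g5, g6, hE1, g7, g8, g9⟩)
  obtain ⟨k, hk⟩ := k
  have hkN : k ≤ N := hk.le
  obtain ⟨_, ⟨_, _, _, _, hRdet, _⟩, _⟩ := hek 0
  beta_reduce at hRdet
  set R : Matrix (Fin N) (Fin N) ℝ := (M.submatrix e id).map τ with hR
  have hRR : R⁻¹ * R = 1 := Matrix.nonsing_inv_mul _ (isUnit_iff_ne_zero.mpr hRdet)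
  set Kt : ℝ := N ^ k * k.factorial * C0 ^ k with hKt
  have hKt0 : 0 ≤ Kt := by positivity
  obtain ⟨B1, hB1⟩ := eventually_atTop.mp (ev_exp (a := δ / 2) (by positivity) (Kt * Kc))
  let P : α × (Fin N → Fin N → ℤ) × (Fin N → Fin N → ℤ) × ℤ → Prop := fun z =>
    B1 ≤ q z.1 ∧ Q (e, ⟨k, hk⟩) z.1 z.2.1 z.2.2.1 z.2.2.2
  have hU2 : Unb (fun z : α × (Fin N → Fin N → ℤ) × (Fin N → Fin N → ℤ) × ℤ => f z.1) P := by
    refine hek.map ⟨B1, fun y hy ⟨x, h, d, hQ⟩ => ⟨(y, x, h, d), ⟨hy.trans (hp y hQ.1).1, hQ⟩, le_refl _⟩⟩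
  have hM' : ∀ i : Fin k → Fin N, ∀ l : Fin k → Fin N, τ (∏ a, M (e (i a)) (l a)) = ∏ a, R (i a) (l a) := by
    intro i l; rw [map_prod]; rfl
  have hMm : (Matrix.of fun (i l : Fin k → Fin N) => ∏ a, M (e (i a)) (l a)).map τ =
      Matrix.of fun (i l : Fin k → Fin N) => ∏ a, R (i a) (l a) := by
    ext i l; exact hM' i l
  refine isol τ (Matrix.of fun (i l : Fin k → Fin N) => ∏ a, M (e (i a)) (l a))
    (Matrix.of fun (i l : Fin k → Fin N) => ∏ a, R⁻¹ (i a) (l a)) (by rw [hMm]; exact kron_inv _ _ hRR) (δ / 2) (k * C) (by positivity)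
    (fun z : α × (Fin N → Fin N → ℤ) × (Fin N → Fin N → ℤ) × ℤ => f z.1) (fun z => q z.1)
    (fun z i => ∏ a, A z.1 (e (i a))) (fun z => wdg fun c : Fin k => z.2.1 (Fin.castLE hkN c)) _ (altV k N) le_rfl P hU2 ?_ ?_
  · rintro ⟨y, x, h, d⟩ ⟨hyB, hy, g2, g3, g4, g5, g6, hE1, g7, g8, g9⟩
    dsimp only at *
    obtain ⟨h1, h2, h3, h4, h5, h6, h7⟩ := hp y hy
    have hApos : ∀ i, 0 < A y i := fun i => (Real.exp_pos _).trans_le (h2 i).1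
    refine ⟨h1, fun i => ⟨?_, ?_⟩, wdg_ne hkN x h d g3 g4, wdg_mem _, fun Y hY hYP => ?_⟩
    · calc Real.exp (-(k * C * q y)) = ∏ _a : Fin k, Real.exp (-(C * q y)) := by
            simp [← Real.exp_nat_mul]; ring
        _ ≤ _ := Finset.prod_le_prod (fun _ _ => (Real.exp_pos _).le) fun a _ => (h2 _).1
    · calc _ ≤ ∏ _a : Fin k, Real.exp (C * q y) := Finset.prod_le_prod (fun a _ => (hApos _).le) fun a _ => (h2 _).2
        _ = Real.exp (k * C * q y) := by simp [← Real.exp_nat_mul]; ring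
    · have hdet : (wm (A y ∘ e) R).det ≠ 0 := by
        rw [wm_det]
        exact mul_ne_zero (Finset.prod_ne_zero_iff.mpr fun i _ => (hApos _).ne') g2
      have hfin := gap_tens hkN (wm (A y ∘ e) R) hdet x h d g3 g4 g6 (t y) (E y) C0 h3 hE1 g7 g8 g9 hC00 Y hY hYP
      have eq1 := gT_eq (k := k) (A y ∘ e) (fun i => hApos _) R
      rw [hMm]
      rw [eq1, eq1] at hfin
      have hEK : E y * Kc = Real.exp (δ / 2 * q y) * Real.exp (δ / 2 * q y) := by
        rw [← Real.exp_add, hE]; beta_reduce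
        rw [div_mul_cancel₀ _ hKpos.ne']; ring_nf
      exact gap_arith _ hKpos hKt0 (gn_nonneg _ (fun i => Finset.prod_pos fun a _ => hApos _) _) (Real.exp_pos _) hEK (hB1 _ hyB) hfin
  · rintro ⟨y, x, h, d⟩ ⟨_, hy, _, g3, g4, g5, _⟩
    obtain ⟨B, hB⟩ := hfin y hy
    refine ⟨B, ?_⟩
    rintro ⟨y', x', h', d'⟩ ⟨_, hy', _, g3', g4', g5', _⟩ hP
    dsimp only at *
    apply hB y' hy'
    have hP' : Prp (wdg fun c : Fin k => x (Fin.castLE hkN c)) (wdg fun c : Fin k => x' (Fin.castLE hkN c)) :=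
      hP.symm' (wdg_ne hkN x' h' d' g3' g4')
    ext v
    rw [g5, g5']
    exact ⟨S_le hkN x' h' x h d' d g3' g3 g4' g4 hP' v, S_le hkN x h x' h' d d' g3 g3' g4 g4' hP v⟩

/-- real and imaginary parts of a complex matrix -/
def ri {N : ℕ} (Φ : Matrix (Fin N) (Fin N) ℂ) : Matrix (Fin N × Bool) (Fin N) ℝ :=
  Matrix.of fun ib l => if ib.2 then (Φ ib.1 l).im else (Φ ib.1 l).re

lemma alg_re {z : ℂ} (hz : IsAlgebraic ℚ z) : IsAlgebraic ℚ z.re ∧ IsAlgebraic ℚ z.im := by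
  have hc : IsAlgebraic ℚ ((starRingEnd ℂ) z) := by
    have := hz.algHom (Complex.conjAe.restrictScalars ℚ).toAlgHom
    exact this
  have hi : IsAlgebraic ℚ Complex.I := by
    refine ⟨Polynomial.X ^ 2 + 1, ?_, by simp⟩
    exact (Polynomial.monic_X_pow_add_C (1 : ℚ) (n := 2) (by norm_num)).ne_zero
  have h2 : IsAlgebraic ℚ (2⁻¹ : ℂ) := by
    have := isAlgebraic_algebraMap (A := ℂ) (2⁻¹ : ℚ)
    simpa using this
  constructor
  · rw [← isAlgebraic_algebraMap_iff (algebraMap ℝ ℂ).injective]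
    have : algebraMap ℝ ℂ z.re = (z + (starRingEnd ℂ) z) * 2⁻¹ := by
      rw [Complex.add_conj]; simp; ring
    rw [this]
    exact (hz.add hc).mul h2
  · rw [← isAlgebraic_algebraMap_iff (algebraMap ℝ ℂ).injective]
    have : algebraMap ℝ ℂ z.im = (z - (starRingEnd ℂ) z) * 2⁻¹ * (-Complex.I) := by
      rw [Complex.sub_conj]
      simp only [Complex.coe_algebraMap]
      push_cast
      linear_combination (z.im : ℂ) * Complex.I_sq
    rw [this]
    exact ((hz.sub hc).mul h2).mul hi.neg

lemma ri_field {N : ℕ} (Φ : Matrix (Fin N) (Fin N) ℂ) (hΦ : ∀ i l, IsAlgebraic ℚ (Φ i l)) :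
    ∃ (F : IntermediateField ℚ ℝ) (M : Matrix (Fin N × Bool) (Fin N) F), FiniteDimensional ℚ F ∧ M.map (algebraMap F ℝ) = ri Φ := by
  classical
  let S : Set ℝ := Set.range fun il : (Fin N × Bool) × Fin N => ri Φ il.1 il.2
  refine ⟨IntermediateField.adjoin ℚ S, Matrix.of fun i l => ⟨ri Φ i l, IntermediateField.subset_adjoin _ _ ⟨(i, l), rfl⟩⟩, ?_, ?_⟩
  · haveI : Finite S := Set.finite_range _
    apply IntermediateField.finiteDimensional_adjoin
    rintro x ⟨⟨⟨i, b⟩, l⟩, rfl⟩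
    rw [← isAlgebraic_iff_isIntegral]
    simp only [ri, Matrix.of_apply]
    cases b
    · simpa using (alg_re (hΦ i l)).1
    · simpa using (alg_re (hΦ i l)).2
  · ext i l; rfl

lemma ri_inv {N : ℕ} (Φ : Matrix (Fin N) (Fin N) ℂ) (hd : Φ.det ≠ 0) : ∃ G : Matrix (Fin N) (Fin N × Bool) ℝ, G * ri Φ = 1 := by
  have h1 : Φ⁻¹ * Φ = 1 := Matrix.nonsing_inv_mul _ (isUnit_iff_ne_zero.mpr hd)
  refine ⟨Matrix.of fun l ib => if ib.2 then -(Φ⁻¹ l ib.1).im else (Φ⁻¹ l ib.1).re, ?_⟩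
  ext l m
  have h2 := congrArg Complex.re (congrFun (congrFun h1 l) m)
  rw [Matrix.mul_apply, Complex.re_sum] at h2
  rw [Matrix.mul_apply, Fintype.sum_prod_type]
  simp only [ri, Matrix.of_apply, Fintype.univ_bool]
  have h3 : ∀ i, ∑ b : Bool, (if b = true then -(Φ⁻¹ l i).im else (Φ⁻¹ l i).re) * (if b = true then (Φ i m).im else (Φ i m).re) =
      (Φ⁻¹ l i * Φ i m).re := by
    intro i
    rw [Fintype.sum_bool, Complex.mul_re]
    simp; ring
  have h4 : ((1 : Matrix (Fin N) (Fin N) ℂ) l m).re = (1 : Matrix (Fin N) (Fin N) ℝ) l m := by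
    rw [Matrix.one_apply, Matrix.one_apply]; split_ifs <;> simp
  rw [← h4, ← h2]
  exact Finset.sum_congr rfl fun i _ => h3 i

/-- the complex form -/
def cf {N : ℕ} (Φ : Matrix (Fin N) (Fin N) ℂ) (i : Fin N) (x : Fin N → ℤ) : ℂ := ∑ l, Φ i l * (x l : ℂ)

lemma ri_gn {N : ℕ} (Φ : Matrix (Fin N) (Fin N) ℂ) (A : Fin N → ℝ) (hA : ∀ i, 0 < A i) (x : Fin N → ℤ) :
    (∀ i, A i * ‖cf Φ i x‖ ≤ gn (ri Φ) (fun ib => A ib.1) x) ∧ gn (ri Φ) (fun ib => A ib.1) x ≤ 2 * ∑ i, A i * ‖cf Φ i x‖ := by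
  have h1 : gn (ri Φ) (fun ib => A ib.1) x = ∑ i, A i * (|(cf Φ i x).im| + |(cf Φ i x).re|) := by
    unfold gn
    rw [Fintype.sum_prod_type]
    refine Finset.sum_congr rfl fun i _ => ?_
    have e1 : (cf Φ i x).im = ∑ l, (Φ i l).im * (x l : ℝ) := by
      rw [cf, Complex.im_sum]; exact Finset.sum_congr rfl fun l _ => by simp [Complex.mul_im]
    have e2 : (cf Φ i x).re = ∑ l, (Φ i l).re * (x l : ℝ) := by
      rw [cf, Complex.re_sum]; exact Finset.sum_congr rfl fun l _ => by simp [Complex.mul_re]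
    rw [Fintype.sum_bool, e1, e2]
    simp [ri, mul_add]
  rw [h1]
  constructor
  · intro i
    refine le_trans ?_ (Finset.single_le_sum (f := fun i => A i * (|(cf Φ i x).im| + |(cf Φ i x).re|))
      (fun i _ => mul_nonneg (hA i).le (by positivity)) (Finset.mem_univ i))
    beta_reduce
    refine mul_le_mul_of_nonneg_left ?_ (hA i).le
    have := Complex.norm_le_abs_re_add_abs_im (cf Φ i x)
    linarith
  · rw [Finset.mul_sum]
    refine Finset.sum_le_sum fun i _ => ?_
    have h2 := Complex.abs_re_le_norm (cf Φ i x)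
    have h3 := Complex.abs_im_le_norm (cf Φ i x)
    have := mul_le_mul_of_nonneg_left (add_le_add h3 h2) (hA i).le
    linarith

lemma not_top {N : ℕ} (Φ : Matrix (Fin N) (Fin N) ℂ) (A : Fin N → ℝ) (hA : ∀ i, 0 < A i) (t : ℝ)
    (h : Submodule.span ℚ (cq '' {x : Fin N → ℤ | gn (ri Φ) (fun ib => A ib.1) x ≤ t}) = ⊤) :
    (∏ i, A i) * ‖Φ.det‖ ≤ N.factorial * t ^ N := by
  classical
  obtain ⟨g, hg1, _, hg3⟩ := Submodule.exists_fun_fin_finrank_span_eq ℚ (cq '' {x : Fin N → ℤ | gn (ri Φ) (fun ib => A ib.1) x ≤ t})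
  have hfr : Module.finrank ℚ (Submodule.span ℚ (cq '' {x : Fin N → ℤ | gn (ri Φ) (fun ib => A ib.1) x ≤ t})) = N := by
    rw [h, finrank_top]; simp
  let g' : Fin N → Fin N → ℚ := fun j => g (Fin.cast hfr.symm j)
  have hg3' : LinearIndependent ℚ g' := hg3.comp _ (Fin.cast_injective _)
  have hex : ∀ j, ∃ x : Fin N → ℤ, gn (ri Φ) (fun ib => A ib.1) x ≤ t ∧ cq x = g' j := fun j => hg1 _
  choose x hx1 hx2 using hex
  have hX : (Matrix.of x).det ≠ 0 := by
    intro h0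
    have h1 : ((Matrix.of x).map (Int.castRingHom ℚ)).det = 0 := by
      rw [← RingHom.mapMatrix_apply, ← RingHom.map_det, h0, map_zero]
    have h2 : (Matrix.of x).map (Int.castRingHom ℚ) = Matrix.of g' := by
      ext j l; rw [Matrix.of_apply, ← hx2]; simp [cq]
    rw [h2] at h1
    have h3 : IsUnit (Matrix.of g') := Matrix.linearIndependent_rows_iff_isUnit.mp hg3'
    rw [Matrix.isUnit_iff_isUnit_det, h1] at h3
    simp at h3
  set Xc : Matrix (Fin N) (Fin N) ℂ := (Matrix.of x).map (Int.castRingHom ℂ) with hXc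
  have hXd : Xc.det = ((Matrix.of x).det : ℤ) := by
    rw [hXc, ← RingHom.mapMatrix_apply, ← RingHom.map_det]; rfl
  have hX1 : 1 ≤ ‖Xc.det‖ := by
    rw [hXd, Complex.norm_intCast, ← Int.cast_abs]
    exact_mod_cast Int.one_le_abs hX
  have hent : ∀ i j, NormedField.toAbsoluteValue ℂ ((Matrix.diagonal (fun i => (A i : ℂ)) * (Φ * Xcᵀ)) i j) ≤ t := by
    intro i j
    rw [Matrix.diagonal_mul, map_mul]
    have e1 : (Φ * Xcᵀ) i j = cf Φ i (x j) := by
      rw [Matrix.mul_apply]; rfl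
    rw [e1]
    have := ((ri_gn Φ A hA (x j)).1 i).trans (hx1 j)
    change ‖(A i : ℂ)‖ * ‖cf Φ i (x j)‖ ≤ t
    rwa [Complex.norm_real, Real.norm_eq_abs, abs_of_pos (hA i)]
  have h5 := Matrix.det_le hent
  rw [Matrix.det_mul, Matrix.det_mul, Matrix.det_transpose, Matrix.det_diagonal] at h5
  have h6 : NormedField.toAbsoluteValue ℂ ((∏ i, (A i : ℂ)) * (Φ.det * Xc.det)) = (∏ i, A i) * (‖Φ.det‖ * ‖Xc.det‖) := by
    rw [map_mul, map_mul]
    change ‖∏ i, (A i : ℂ)‖ * _ = _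
    rw [norm_prod]
    congr 1
    exact Finset.prod_congr rfl fun i _ => by rw [Complex.norm_real, Real.norm_eq_abs, abs_of_pos (hA i)]
  rw [h6] at h5
  simp only [Fintype.card_fin, nsmul_eq_mul] at h5
  refine le_trans ?_ h5
  refine mul_le_mul_of_nonneg_left ?_ (Finset.prod_nonneg fun i _ => (hA i).le)
  exact le_mul_of_one_le_right (norm_nonneg _) hX1

lemma chain_end {N : ℕ} (S : ℕ → Submodule ℚ (Fin N → ℚ)) (hm : ∀ i, S i ≤ S (i + 1)) (h0 : S 0 ≠ ⊥) (hN : S N ≠ ⊤) :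
    ∃ i, i < N ∧ S i = S (i + 1) := by
  by_contra hcon
  push Not at hcon
  have h1 : ∀ i, i ≤ N → i + 1 ≤ Module.finrank ℚ (S i) := by
    intro i
    induction i with
    | zero =>
      intro _
      have := mt Submodule.finrank_eq_zero.mp h0
      omega
    | succ i ih =>
      intro hi
      have := Submodule.finrank_lt_finrank_of_lt (lt_of_le_of_ne (hm i) (hcon i (by omega)))
      have := ih (by omega)
      omega
  have h2 := h1 N le_rfl
  have h3 := Submodule.finrank_le (S N)
  simp at h3
  omega

set_option maxHeartbeats 1000000 in
/-- abstract subspace theorem -/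
theorem sub0 {N : ℕ} (Φ : Matrix (Fin N) (Fin N) ℂ) (hΦ : ∀ i l, IsAlgebraic ℚ (Φ i l)) (hdet : Φ.det ≠ 0)
    {J : Type*} [Finite J] (T : J → (Fin N → ℚ) →ₗ[ℚ] (Fin N → ℚ)) (C2 : ℝ)
    (hT : ∀ j x, ∃ x', T j (cq x) = cq x' ∧ ∀ i, ‖cf Φ i x'‖ ≤ C2 * ‖cf Φ i x‖)
    (δ C C' : ℝ) (hδ : 0 < δ) {α : Type*} (f q : α → ℝ) (A : α → Fin N → ℝ) (h : α → Fin N → ℤ) (p : α → Prop) (hU : Unb f p)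
    (hp : ∀ y, p y → f y ≤ q y ∧ (∀ i, Real.exp (-(C * q y)) ≤ A y i ∧ A y i ≤ Real.exp (C * q y)) ∧
      Real.exp (δ * q y) ≤ ∏ i, A y i ∧ h y ≠ 0 ∧ ∀ i, A y i * ‖cf Φ i (h y)‖ ≤ C') :
    ∃ S : Submodule ℚ (Fin N → ℚ), S ≠ ⊤ ∧ (∀ j, ∀ v ∈ S, T j v ∈ S) ∧ Unb f (fun y => p y ∧ cq (h y) ∈ S) := by
  classical
  by_contra hcon
  push Not at hcon
  obtain ⟨F, M, hFd, hM⟩ := ri_field Φ hΦ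
  haveI : NumberField F := { to_finiteDimensional := hFd }
  obtain ⟨G, hG⟩ := ri_inv Φ hdet
  set δ' : ℝ := δ / (N + 1) ^ 2 with hδ'
  have hδ'0 : 0 < δ' := by positivity
  set C1 : ℝ := 2 * (N * |C'|) + 1 with hC1
  have hC10 : 0 < C1 := by positivity
  let g : α → (Fin N → ℤ) → ℝ := fun y => gn (ri Φ) (fun ib => A y ib.1)
  let t : α → ℕ → ℝ := fun y i => C1 * Real.exp (i * δ' * q y)
  let S : α → ℕ → Submodule ℚ (Fin N → ℚ) := fun y i => Submodule.span ℚ (cq '' {x | g y x ≤ t y i})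
  have htt : ∀ y i, t y (i + 1) = t y i * Real.exp (δ' * q y) := by
    intro y i
    simp only [t]
    rw [mul_assoc C1, ← Real.exp_add]; push_cast; ring_nf
  have hε : 0 < δ - N ^ 2 * δ' := by
    rw [hδ', sub_pos, ← mul_div_assoc, div_lt_iff₀ (by positivity)]
    nlinarith [Nat.cast_nonneg (α := ℝ) N]
  have hΦn : 0 < ‖Φ.det‖ := norm_pos_iff.mpr hdet
  obtain ⟨B1, hB1⟩ := eventually_atTop.mp (ev_exp hδ'0 (2 * (N * |C2|) + 1))
  obtain ⟨B2, hB2⟩ := eventually_atTop.mp (ev_exp hε (N.factorial * C1 ^ N / ‖Φ.det‖ + 1))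
  -- the basic facts for large y
  have key : ∀ y, p y → B1 ≤ f y → B2 ≤ f y → ∃ i, i < N ∧ S y i = S y (i + 1) ∧ S y i ≠ ⊤ ∧ cq (h y) ∈ S y i ∧
      ∀ j, ∀ v ∈ S y i, T j v ∈ S y i := by
    intro y hy hyB1 hyB2
    obtain ⟨h1, h2, h3, h4, h5⟩ := hp y hy
    have hApos : ∀ i, 0 < A y i := fun i => (Real.exp_pos _).trans_le (h2 i).1
    have hE1 := hB1 (q y) (hyB1.trans h1)
    have hE2 := hB2 (q y) (hyB2.trans h1)
    have hE1' : 1 ≤ Real.exp (δ' * q y) := by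
      have : 0 ≤ 2 * (N * |C2|) := by positivity
      linarith
    have ht0 : ∀ i, 0 < t y i := fun i => by positivity
    have hmono : ∀ i, S y i ≤ S y (i + 1) := by
      intro i
      apply Submodule.span_mono
      apply Set.image_mono
      intro x hx
      have hx' : g y x ≤ t y i := hx
      refine le_trans hx' ?_
      rw [htt]
      exact le_mul_of_one_le_right (ht0 i).le hE1'
    have hmem0 : cq (h y) ∈ S y 0 := by
      apply Submodule.subset_span
      refine ⟨h y, ?_, rfl⟩
      change g y (h y) ≤ t y 0
      have e1 : t y 0 = C1 := by simp [t]
      rw [e1]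
      refine ((ri_gn Φ (A y) hApos (h y)).2).trans ?_
      have e2 : ∑ i, A y i * ‖cf Φ i (h y)‖ ≤ ∑ _i : Fin N, |C'| := Finset.sum_le_sum fun i _ => (h5 i).trans (le_abs_self _)
      simp only [Finset.sum_const, Finset.card_univ, Fintype.card_fin, nsmul_eq_mul] at e2
      rw [hC1]; linarith
    have hmem : ∀ i, cq (h y) ∈ S y i := by
      intro i
      induction i with
      | zero => exact hmem0
      | succ i ih => exact hmono i ih
    have hbot : S y 0 ≠ ⊥ := by
      intro h0
      rw [h0, Submodule.mem_bot] at hmem0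
      apply h4
      ext l
      have := congrFun hmem0 l
      simpa [cq] using this
    have htop : S y N ≠ ⊤ := by
      intro h0
      have e1 := not_top Φ (A y) hApos (t y N) h0
      have e2 : t y N ^ N = C1 ^ N * Real.exp (N ^ 2 * δ' * q y) := by
        simp only [t]
        rw [mul_pow, ← Real.exp_nat_mul]; ring_nf
      rw [e2] at e1
      have e3 : Real.exp (δ * q y) = Real.exp ((δ - N ^ 2 * δ') * q y) * Real.exp (N ^ 2 * δ' * q y) := by
        rw [← Real.exp_add]; ring_nf
      have e4 := mul_le_mul_of_nonneg_right h3 hΦn.le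
      have e5 := e4.trans e1
      rw [e3] at e5
      have e6 : Real.exp ((δ - N ^ 2 * δ') * q y) * ‖Φ.det‖ ≤ N.factorial * C1 ^ N := by
        refine le_of_mul_le_mul_right ?_ (Real.exp_pos (N ^ 2 * δ' * q y))
        linarith
      have e7 : N.factorial * C1 ^ N / ‖Φ.det‖ * ‖Φ.det‖ = N.factorial * C1 ^ N := div_mul_cancel₀ _ hΦn.ne'
      have e8 := mul_le_mul_of_nonneg_right hE2 hΦn.le
      linarith [add_mul (N.factorial * C1 ^ N / ‖Φ.det‖) 1 ‖Φ.det‖]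
    obtain ⟨i, hiN, hi⟩ := chain_end (S y) hmono hbot htop
    have hmono' : Monotone (S y) := monotone_nat_of_le_succ hmono
    refine ⟨i, hiN, hi, ?_, hmem i, ?_⟩
    · intro h0
      apply htop
      rw [eq_top_iff, ← h0]
      exact hmono' hiN.le
    · intro j v hv
      have hle : S y i ≤ (S y i).comap (T j) := by
        apply Submodule.span_le.mpr
        rintro _ ⟨x, hx, rfl⟩
        obtain ⟨x', hx', hx'2⟩ := hT j x
        change T j (cq x) ∈ S y i
        rw [hx', hi]
        apply Submodule.subset_span
        refine ⟨x', ?_, rfl⟩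
        change g y x' ≤ t y (i + 1)
        have hx0 : g y x ≤ t y i := hx
        refine ((ri_gn Φ (A y) hApos x').2).trans ?_
        rw [htt]
        have e0 : ∀ i, A y i * ‖cf Φ i x'‖ ≤ A y i * (|C2| * ‖cf Φ i x‖) := fun i =>
          mul_le_mul_of_nonneg_left ((hx'2 i).trans (mul_le_mul_of_nonneg_right (le_abs_self _) (norm_nonneg _))) (hApos i).le
        have e1 : ∑ i, A y i * ‖cf Φ i x'‖ ≤ ∑ _i : Fin N, |C2| * t y i := by
          refine Finset.sum_le_sum fun k _ => (e0 k).trans ?_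
          have e2 := mul_le_mul_of_nonneg_left (((ri_gn Φ (A y) hApos x).1 k).trans hx0) (abs_nonneg C2)
          linarith
        simp only [Finset.sum_const, Finset.card_univ, Fintype.card_fin, nsmul_eq_mul] at e1
        have e3 := mul_le_mul_of_nonneg_left hE1 (ht0 i).le
        have := ht0 i
        linarith
      exact hle hv
  let P : α × ℕ → Prop := fun z => p z.1 ∧ S z.1 z.2 = S z.1 (z.2 + 1) ∧ S z.1 z.2 ≠ ⊤ ∧ cq (h z.1) ∈ S z.1 z.2 ∧
      ∀ j, ∀ v ∈ S z.1 z.2, T j v ∈ S z.1 z.2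
  have hU2 : Unb (fun z : α × ℕ => f z.1) P := by
    refine hU.map ⟨max B1 B2, fun y hy hyp => ?_⟩
    obtain ⟨i, _, hi⟩ := key y hyp ((le_max_left _ _).trans hy) ((le_max_right _ _).trans hy)
    exact ⟨(y, i), ⟨hyp, hi⟩, le_rfl⟩
  refine gap (algebraMap F ℝ) M G (by rw [hM]; exact hG) δ' C hδ'0 (fun z : α × ℕ => f z.1) (fun z => q z.1)
    (fun z ib => A z.1 ib.1) (fun z => S z.1 z.2) (fun z => t z.1 z.2) P hU2 ?_ ?_
  · rintro ⟨y, i⟩ ⟨hy, g1, g2, g3, g4⟩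
    dsimp only at *
    obtain ⟨h1, h2, h3, h4, h5⟩ := hp y hy
    rw [hM]
    refine ⟨h1, fun ib => h2 _, by positivity, le_rfl, ?_, ?_, g2⟩
    · intro x hx
      rw [g1]
      apply Submodule.subset_span
      refine ⟨x, ?_, rfl⟩
      change g y x ≤ t y (i + 1)
      rw [htt]
      exact hx.le
    · intro h0
      rw [h0, Submodule.mem_bot] at g3
      apply h4
      ext l
      have := congrFun g3 l
      simpa [cq] using this
  · rintro ⟨y, i⟩ ⟨hy, g1, g2, g3, g4⟩
    dsimp only at *
    have := hcon (S y i) g2 g4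
    unfold Unb at this
    push Not at this
    obtain ⟨B, hB⟩ := this
    refine ⟨B, ?_⟩
    rintro ⟨y', i'⟩ ⟨hy', _, _, g3', _⟩ hS
    dsimp only at *
    exact (hB y' ⟨hy', hS ▸ g3'⟩).le

lemma unit_prod {L : Type*} [Field L] [NumberField L] (x : 𝓞 L) (hx : IsUnit x) : ∏ v : L →ₐ[ℚ] ℂ, ‖v (x : L)‖ = 1 := by
  have h1 := Algebra.norm_eq_prod_embeddings ℚ ℂ (x : L)
  rw [← norm_prod, ← h1]
  have h2 := (NumberField.isUnit_iff_norm).mp hx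
  rw [RingOfIntegers.coe_norm] at h2
  have h3 : (algebraMap ℚ ℂ) ((Algebra.norm ℚ) (x : L)) = (((Algebra.norm ℚ) (x : L) : ℚ) : ℝ) := by simp
  rw [h3, Complex.norm_real, Real.norm_eq_abs, ← Rat.cast_abs, h2]; simp

/-- two compatible bases -/
lemma two_bases (L : Type*) [Field L] [NumberField L] (σ : Type*) [Fintype σ] :
    ∃ (N : ℕ) (_ : Fin N ≃ (L →ₐ[ℚ] ℂ) × σ) (B : Module.Basis (Fin N) ℚ (σ → L)) (b : Module.Basis (Fin N) ℤ (σ → 𝓞 L)),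
      ∀ l c, B l c = ((b l c : 𝓞 L) : L) := by
  classical
  let κ := Σ _ : σ, Module.Free.ChooseBasisIndex ℤ (𝓞 L)
  have e0 : κ ≃ Fin (Fintype.card κ) := Fintype.equivFin κ
  have hc : Fintype.card κ = Fintype.card ((L →ₐ[ℚ] ℂ) × σ) := by
    rw [Fintype.card_prod, AlgHom.card, Fintype.card_sigma]
    rw [Finset.sum_const, smul_eq_mul, Finset.card_univ, ← Module.finrank_eq_card_chooseBasisIndex, RingOfIntegers.rank, mul_comm]
  have e1 : κ ≃ (L →ₐ[ℚ] ℂ) × σ := Fintype.equivOfCardEq hc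
  refine ⟨Fintype.card κ, e0.symm.trans e1, (Pi.basis fun _ : σ => integralBasis L).reindex e0,
    (Pi.basis fun _ : σ => RingOfIntegers.basis L).reindex e0, ?_⟩
  intro l c
  simp only [Module.Basis.reindex_apply, Pi.basis_apply]
  by_cases h : c = (e0.symm l).1
  · subst h; simp [integralBasis_apply]
  · simp [Pi.single_apply, h]

lemma emb_indep {L : Type*} [Field L] [NumberField L] (g : (L →ₐ[ℚ] ℂ) → ℂ) (h : ∀ z : 𝓞 L, ∑ v : L →ₐ[ℚ] ℂ, g v * v (z : L) = 0) :
    ∀ v, g v = 0 := by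
  let m : (L →ₐ[ℚ] ℂ) → (𝓞 L →* ℂ) := fun v => (v : L →* ℂ).comp (algebraMap (𝓞 L) L : 𝓞 L →* L)
  have hm : Function.Injective m := by
    intro v v' hvv
    have h1 : ∀ z : 𝓞 L, v (z : L) = v' (z : L) := fun z => DFunLike.congr_fun hvv z
    ext x
    obtain ⟨a, b, hb, rfl⟩ := IsFractionRing.div_surjective (A := 𝓞 L) x
    rw [map_div₀, map_div₀]
    exact congrArg₂ _ (h1 a) (h1 b)
  have h2 := (linearIndependent_monoidHom (𝓞 L) ℂ).comp m hm
  rw [Fintype.linearIndependent_iff] at h2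
  apply h2 g
  ext z
  simp only [Finset.sum_apply, Pi.smul_apply, smul_eq_mul, Pi.zero_apply, Function.comp]
  exact h z

/-- coefficients of the linear forms -/
def cl {L σ : Type*} [Field L] [NumberField L] [DecidableEq σ] [DecidableEq (L →ₐ[ℚ] ℂ)] (v0 : L →ₐ[ℚ] ℂ) (f0 : σ) (t : σ → L)
    (i : (L →ₐ[ℚ] ℂ) × σ) : σ → L := if i = (v0, f0) then t else Pi.single i.2 1

set_option maxHeartbeats 1000000 in
theorem subsp {L : Type*} [Field L] [NumberField L] {σ : Type*} [Fintype σ] (v0 : L →ₐ[ℚ] ℂ) (f0 : σ) (t : σ → L) (ht : t f0 ≠ 0)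
    (δ C : ℝ) (hδ : 0 < δ) {α : Type*} (f q : α → ℝ) (y : α → σ → 𝓞 L) (p : α → Prop) (hU : Unb f p)
    (hp : ∀ a, p a → f a ≤ q a ∧ (∀ b, IsUnit (y a b)) ∧
      (∀ (v : L →ₐ[ℚ] ℂ) b, Real.exp (-(C * q a)) ≤ ‖v (y a b : L)‖ ∧ ‖v (y a b : L)‖ ≤ Real.exp (C * q a)) ∧
      ‖v0 (∑ b, t b * (y a b : L))‖ ≤ Real.exp (-(δ * q a)) * ‖v0 (y a f0 : L)‖)
    (hS : ∀ c : σ → L, c ≠ 0 → ¬ Unb f (fun a => p a ∧ ∑ b, c b * (y a b : L) = 0)) : False := by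
  classical
  obtain ⟨N, e, B, b, hBb⟩ := two_bases L σ
  set Φ : Matrix (Fin N) (Fin N) ℂ := Matrix.of fun i l => (e i).1 (∑ c, cl v0 f0 t (e i) c * (b l c : L)) with hΦ
  have hBb' : ∀ x : Fin N → ℤ, ∀ c, (B.equivFun.symm (cq x)) c = ((b.equivFun.symm x c : 𝓞 L) : L) := by
    intro x c
    rw [Module.Basis.equivFun_symm_apply, Module.Basis.equivFun_symm_apply]
    simp only [Finset.sum_apply, Pi.smul_apply, hBb, cq, map_sum]
    refine Finset.sum_congr rfl fun l _ => ?_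
    rw [Rat.smul_def, zsmul_eq_mul]
    simp
  have hBb2 : ∀ X : σ → 𝓞 L, B.equivFun (fun c => (X c : L)) = cq (b.equivFun X) := by
    intro X
    rw [← LinearEquiv.eq_symm_apply]
    ext c
    rw [hBb', LinearEquiv.symm_apply_apply]
  have hcf : ∀ i x, cf Φ i x = (e i).1 (∑ c, cl v0 f0 t (e i) c * (b.equivFun.symm x c : L)) := by
    intro i x
    simp only [cf, hΦ, Matrix.of_apply]
    have : ∀ l, (e i).1 (∑ c, cl v0 f0 t (e i) c * (b l c : L)) * (x l : ℂ) = (e i).1 ((∑ c, cl v0 f0 t (e i) c * (b l c : L)) * (x l : L)) := by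
      intro l; simp
    simp_rw [this]
    rw [← map_sum]
    congr 1
    simp_rw [Finset.sum_mul]
    rw [Finset.sum_comm]
    refine Finset.sum_congr rfl fun c _ => ?_
    rw [Module.Basis.equivFun_symm_apply]
    simp only [Finset.sum_apply, Pi.smul_apply, map_sum, Finset.mul_sum]
    refine Finset.sum_congr rfl fun l _ => ?_
    rw [zsmul_eq_mul]; simp; ring
  have hdet : Φ.det ≠ 0 := by
    have hli : LinearIndependent ℂ Φ.row := by
      rw [Fintype.linearIndependent_iff]
      intro g hg
      have h1 : ∀ x : Fin N → ℤ, ∑ i, g i * cf Φ i x = 0 := by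
        intro x
        have h2 : ∑ l, (∑ i, g i • Φ.row i) l * (x l : ℂ) = ∑ i, g i * cf Φ i x := by
          simp only [Finset.sum_apply, Pi.smul_apply, smul_eq_mul, Finset.sum_mul, cf, Finset.mul_sum, Matrix.row]
          rw [Finset.sum_comm]
          exact Finset.sum_congr rfl fun i _ => Finset.sum_congr rfl fun l _ => by ring
        rw [← h2, hg]; simp
      let g' : (L →ₐ[ℚ] ℂ) × σ → ℂ := fun i => g (e.symm i)
      have h2 : ∀ X : σ → 𝓞 L, ∑ i : (L →ₐ[ℚ] ℂ) × σ, g' i * i.1 (∑ c, cl v0 f0 t i c * (X c : L)) = 0 := by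
        intro X
        have := h1 (b.equivFun X)
        simp only [hcf, LinearEquiv.symm_apply_apply] at this
        rw [← this]
        refine (Equiv.sum_comp e (fun i => g' i * i.1 (∑ c, cl v0 f0 t i c * (X c : L)))).symm.trans ?_
        exact Finset.sum_congr rfl fun i _ => by simp [g']
      have h3 : ∀ c v, ∑ b', g' (v, b') * v (cl v0 f0 t (v, b') c) = 0 := by
        intro c
        apply emb_indep
        intro z
        have := h2 (Pi.single c z)
        rw [← this, Fintype.sum_prod_type]
        refine Finset.sum_congr rfl fun v _ => ?_
        rw [Finset.sum_mul]
        refine Finset.sum_congr rfl fun b' _ => ?_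
        have h4 : ∑ c', cl v0 f0 t (v, b') c' * (((Pi.single c z : σ → 𝓞 L) c' : 𝓞 L) : L) = cl v0 f0 t (v, b') c * (z : L) := by
          rw [Finset.sum_eq_single c]
          · simp
          · intro c' _ hc; simp [hc]
          · simp
        rw [h4, map_mul]; ring
      have h4 : g' (v0, f0) = 0 := by
        have h5 := h3 f0 v0
        rw [Finset.sum_eq_single f0] at h5
        · simp only [cl, if_true] at h5
          exact (mul_eq_zero.mp h5).resolve_right (by simpa using ht)
        · intro b' _ hb
          simp [cl, hb, Pi.single_apply, Ne.symm hb]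
        · simp
      have h5 : ∀ i, g' i = 0 := by
        rintro ⟨v, c⟩
        by_cases hi : (v, c) = (v0, f0)
        · rw [hi, h4]
        have h6 := h3 c v
        rw [Finset.sum_eq_single c] at h6
        · simpa [cl, hi] using h6
        · intro b' _ hb
          by_cases hj : (v, b') = (v0, f0)
          · rw [hj, h4, zero_mul]
          · simp [cl, hj, Pi.single_apply, Ne.symm hb]
        · simp
      intro i
      have := h5 (e i)
      simpa [g'] using this
    have := Matrix.linearIndependent_rows_iff_isUnit.mp hli
    rw [Matrix.isUnit_iff_isUnit_det] at this
    exact this.ne_zero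
  let w := integralBasis L
  let T : Module.Free.ChooseBasisIndex ℤ (𝓞 L) → (Fin N → ℚ) →ₗ[ℚ] (Fin N → ℚ) := fun j =>
    { toFun := fun v => B.equivFun (w j • B.equivFun.symm v)
      map_add' := fun u v => by rw [map_add, smul_add, map_add]
      map_smul' := fun c v => by rw [LinearEquiv.map_smul, smul_comm, LinearEquiv.map_smul]; rfl }
  set C2 : ℝ := ∑ vj : (L →ₐ[ℚ] ℂ) × Module.Free.ChooseBasisIndex ℤ (𝓞 L), ‖vj.1 (w vj.2)‖ with hC2
  have hT : ∀ j x, ∃ x', T j (cq x) = cq x' ∧ ∀ i, ‖cf Φ i x'‖ ≤ C2 * ‖cf Φ i x‖ := by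
    intro j x
    refine ⟨b.equivFun (fun c => RingOfIntegers.basis L j * b.equivFun.symm x c), ?_, ?_⟩
    · rw [← hBb2]
      change B.equivFun (w j • B.equivFun.symm (cq x)) = _
      congr 1
      ext c
      rw [Pi.smul_apply, hBb', smul_eq_mul]
      simp [w, integralBasis_apply]
    · intro i
      rw [hcf, hcf]
      simp only [LinearEquiv.symm_apply_apply]
      have e1 : ∑ c, cl v0 f0 t (e i) c * ((RingOfIntegers.basis L j * b.equivFun.symm x c : 𝓞 L) : L) =
          w j * ∑ c, cl v0 f0 t (e i) c * (b.equivFun.symm x c : L) := by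
        rw [Finset.mul_sum]
        refine Finset.sum_congr rfl fun c _ => ?_
        have : w j = ((RingOfIntegers.basis L j : 𝓞 L) : L) := integralBasis_apply L j
        have h2 : ((RingOfIntegers.basis L j * b.equivFun.symm x c : 𝓞 L) : L) = (RingOfIntegers.basis L j : L) * (b.equivFun.symm x c : L) := map_mul (algebraMap (𝓞 L) L) _ _
        rw [this, h2]; ring
      rw [e1, map_mul, norm_mul]
      refine mul_le_mul_of_nonneg_right ?_ (norm_nonneg _)
      exact Finset.single_le_sum (f := fun vj : (L →ₐ[ℚ] ℂ) × Module.Free.ChooseBasisIndex ℤ (𝓞 L) => ‖vj.1 (w vj.2)‖)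
        (fun _ _ => norm_nonneg _) (Finset.mem_univ ((e i).1, j))
  let wt : α → (L →ₐ[ℚ] ℂ) × σ → ℝ := fun a i => (if i = (v0, f0) then Real.exp (δ * q a) else 1) * ‖i.1 (y a i.2 : L)‖⁻¹
  obtain ⟨B0, hB0⟩ := eventually_atTop.mp (ev_exp hδ 1)
  have hU2 : Unb f (fun a => B0 ≤ f a ∧ p a) := hU.mono ⟨B0, fun a h1 h2 => ⟨h1, h2⟩⟩
  obtain ⟨S, hS1, hS2, hS3⟩ := sub0 Φ (by
      intro i l
      exact (Algebra.IsAlgebraic.isAlgebraic (R := ℚ) (∑ c, cl v0 f0 t (e i) c * (b l c : L))).algHom (e i).1) hdet T C2 hT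
    δ (C + δ) 1 hδ f q (fun a i => wt a (e i)) (fun a => b.equivFun (y a)) (fun a => B0 ≤ f a ∧ p a) hU2 (by
    rintro a ⟨ha0, ha⟩
    obtain ⟨h1, h2, h3, h4⟩ := hp a ha
    have hq := hB0 _ (ha0.trans h1)
    have hpos : ∀ (v : L →ₐ[ℚ] ℂ) b, 0 < ‖v (y a b : L)‖ := fun v b => (Real.exp_pos _).trans_le (h3 v b).1
    have hone : ∀ i : (L →ₐ[ℚ] ℂ) × σ, 1 ≤ (if i = (v0, f0) then Real.exp (δ * q a) else 1) ∧
        (if i = (v0, f0) then Real.exp (δ * q a) else 1) ≤ Real.exp (δ * q a) := by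
      intro i; split_ifs
      · exact ⟨hq, le_rfl⟩
      · exact ⟨le_rfl, hq⟩
    refine ⟨h1, fun i => ⟨?_, ?_⟩, ?_, ?_, fun i => ?_⟩
    · have e1 : Real.exp (-((C + δ) * q a)) ≤ Real.exp (-(C * q a)) := by
        rw [Real.exp_le_exp]
        have := Real.one_le_exp_iff.mp hq
        linarith [add_mul C δ (q a)]
      have e2 : Real.exp (-(C * q a)) ≤ ‖(e i).1 (y a (e i).2 : L)‖⁻¹ := by
        rw [Real.exp_neg]
        exact inv_anti₀ (hpos _ _) (h3 _ _).2
      exact e1.trans (e2.trans (le_mul_of_one_le_left (inv_nonneg.mpr (hpos _ _).le) (hone _).1))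
    · have e2 : ‖(e i).1 (y a (e i).2 : L)‖⁻¹ ≤ Real.exp (C * q a) := by
        have := inv_anti₀ (Real.exp_pos _) (h3 (e i).1 (e i).2).1
        rwa [Real.exp_neg, inv_inv] at this
      have e3 : Real.exp ((C + δ) * q a) = Real.exp (δ * q a) * Real.exp (C * q a) := by rw [← Real.exp_add]; ring_nf
      rw [e3]
      exact mul_le_mul (hone _).2 e2 (inv_nonneg.mpr (hpos _ _).le) (Real.exp_pos _).le
    · rw [Equiv.prod_comp e (wt a)]
      simp only [wt]
      rw [Finset.prod_mul_distrib, Finset.prod_ite_eq' Finset.univ (v0, f0) (fun _ => Real.exp (δ * q a))]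
      rw [Finset.prod_inv_distrib, Fintype.prod_prod_type_right]
      simp only [Finset.mem_univ, if_true]
      rw [Finset.prod_eq_one fun c _ => unit_prod (y a c) (h2 c)]
      simp
    · intro h0
      have := (LinearEquiv.map_eq_zero_iff _).mp h0
      have h5 := (h2 f0).ne_zero
      rw [this] at h5
      exact h5 rfl
    · rw [hcf]
      simp only [LinearEquiv.symm_apply_apply, wt, cl]
      split_ifs with hi
      · rw [hi]
        have := mul_le_mul_of_nonneg_left h4 (Real.exp_pos (δ * q a)).le
        rw [← mul_assoc, ← Real.exp_add, add_neg_cancel, Real.exp_zero, one_mul] at this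
        rw [mul_right_comm, mul_inv_le_iff₀ (hpos _ _), one_mul]
        exact this
      · have e1 : ∑ c, (Pi.single (e i).2 1 : σ → L) c * (y a c : L) = y a (e i).2 := by
          rw [Finset.sum_eq_single (e i).2]
          · simp
          · intro c _ hc; simp [Pi.single_apply, hc]
          · simp
        rw [e1, one_mul, inv_mul_cancel₀ (hpos _ _).ne'])
  let W : Submodule L (σ → L) :=
    { carrier := {X | B.equivFun X ∈ S}
      add_mem' := fun {u v} hu hv => by
        change B.equivFun (u + v) ∈ S
        rw [map_add]; exact S.add_mem hu hv
      zero_mem' := by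
        change B.equivFun 0 ∈ S
        rw [map_zero]; exact S.zero_mem
      smul_mem' := fun z X hX => by
        change B.equivFun (z • X) ∈ S
        have h1 : z • X = ∑ j, w.repr z j • (w j • X) := by
          conv_lhs => rw [← w.sum_repr z]
          rw [Finset.sum_smul]
          exact Finset.sum_congr rfl fun j _ => by rw [smul_assoc]
        rw [h1, map_sum]
        refine S.sum_mem fun j _ => ?_
        rw [map_smul]
        refine S.smul_mem _ ?_
        have := hS2 j _ hX
        change B.equivFun (w j • B.equivFun.symm (B.equivFun X)) ∈ S at this
        rwa [LinearEquiv.symm_apply_apply] at this }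
  have hW : W < ⊤ := by
    rw [lt_top_iff_ne_top]
    intro h0
    apply hS1
    rw [eq_top_iff]
    intro v _
    have : B.equivFun.symm v ∈ W := by rw [h0]; trivial
    change B.equivFun (B.equivFun.symm v) ∈ S at this
    rwa [LinearEquiv.apply_symm_apply] at this
  obtain ⟨φ, hφ0, hφ⟩ := Submodule.exists_le_ker_of_lt_top W hW
  have hφe : ∀ X : σ → L, φ X = ∑ c, φ (Pi.single c 1) * X c := by
    intro X
    conv_lhs => rw [pi_eq_sum_univ' X]
    rw [map_sum]
    refine Finset.sum_congr rfl fun c _ => ?_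
    rw [map_smul, smul_eq_mul, mul_comm]
  refine hS (fun c => φ (Pi.single c 1)) ?_ (hS3.mono ⟨0, fun a _ ha => ⟨ha.1.2, ?_⟩⟩)
  · intro h0
    apply hφ0
    refine LinearMap.ext fun X => ?_
    rw [hφe]
    refine (Finset.sum_eq_zero fun c _ => ?_).trans (by simp)
    have := congrFun h0 c
    simp only [Pi.zero_apply] at this
    rw [this, zero_mul]
  · rw [← hφe (fun c => (y a c : L))]
    apply hφ
    change B.equivFun (fun c => (y a c : L)) ∈ S
    rw [hBb2]
    exact ha.2

lemma gap_split {ι : Type*} [Fintype ι] (a : ι → ℝ) (i0 i1 : ι) (h0 : a i0 = 0) (g : ℝ) (hg : 0 < g)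
    (h1 : (Fintype.card ι + 1) * g ≤ a i1) : ∃ J : Finset ι, i1 ∈ J ∧ i0 ∉ J ∧ ∀ i, i ∉ J → ∀ j ∈ J, a i + g ≤ a j := by
  classical
  have : ∃ k ∈ Finset.range (Fintype.card ι + 1), k ∉ Finset.univ.image (fun i => ⌊a i / g⌋₊) := by
    apply Finset.exists_mem_notMem_of_card_lt_card
    refine Finset.card_image_le.trans_lt ?_
    simp
  obtain ⟨k, hk1, hk2⟩ := this
  simp only [Finset.mem_image, Finset.mem_univ, true_and, not_exists, Finset.mem_range] at hk1 hk2
  have hk0 : 1 ≤ k := Nat.one_le_iff_ne_zero.mpr fun h => hk2 i0 (by simp [h0, h])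
  have hk0' : (1 : ℝ) ≤ k := by exact_mod_cast hk0
  have hk1' : (k : ℝ) + 1 ≤ Fintype.card ι + 1 := by exact_mod_cast hk1
  refine ⟨Finset.univ.filter fun i => k * g ≤ a i, ?_, ?_, ?_⟩
  · simp only [Finset.mem_filter, Finset.mem_univ, true_and]
    nlinarith
  · simp only [Finset.mem_filter, Finset.mem_univ, true_and, h0, not_le]
    nlinarith
  · intro i hi j hj
    simp only [Finset.mem_filter, Finset.mem_univ, true_and, not_le] at hi hj
    have h2 : k ≤ ⌊a j / g⌋₊ := Nat.le_floor ((le_div_iff₀ hg).mpr hj)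
    have h3 : k + 1 ≤ ⌊a j / g⌋₊ := lt_of_le_of_ne h2 (fun h => hk2 j h.symm)
    have h4 := (Nat.le_floor_iff' (by omega)).mp h3
    rw [le_div_iff₀ hg] at h4
    push_cast at h4
    linarith

set_option maxHeartbeats 1000000 in
theorem unit_fin {L : Type*} [Field L] [NumberField L] {ι : Type*} [Fintype ι] (i0 : ι) :
    {u : ι → 𝓞 L | (∀ i, IsUnit (u i)) ∧ u i0 = 1 ∧ ∑ i, u i = 0 ∧
      ∀ s : Finset ι, s.Nonempty → s ≠ Finset.univ → ∑ i ∈ s, u i ≠ 0}.Finite := by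
  classical
  by_contra hinf
  obtain ⟨v1⟩ : Nonempty (L →ₐ[ℚ] ℂ) := ⟨(Classical.arbitrary (L →+* ℂ)).toRatAlgHom⟩
  set P : (ι → 𝓞 L) → Prop := fun u => (∀ i, IsUnit (u i)) ∧ u i0 = 1 ∧ ∑ i, u i = 0 ∧
      ∀ s : Finset ι, s.Nonempty → s ≠ Finset.univ → ∑ i ∈ s, u i ≠ 0 with hP
  set H : (ι → 𝓞 L) → ℝ := fun u => ∑ vi : (L →ₐ[ℚ] ℂ) × ι, ‖vi.1 (u vi.2 : L)‖ with hH
  have hle : ∀ (u : ι → 𝓞 L) (v : L →ₐ[ℚ] ℂ) (i : ι), ‖v (u i : L)‖ ≤ H u := fun u v i =>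
    Finset.single_le_sum (f := fun vi : (L →ₐ[ℚ] ℂ) × ι => ‖vi.1 (u vi.2 : L)‖) (fun _ _ => norm_nonneg _) (Finset.mem_univ (v, i))
  have hH1 : ∀ u, P u → 1 ≤ H u := by
    intro u hu
    have := hle u v1 i0
    rw [hu.2.1] at this
    simpa using this
  set f : (ι → 𝓞 L) → ℝ := fun u => Real.log (H u) with hf
  have hexp : ∀ u, P u → Real.exp (f u) = H u := fun u hu => Real.exp_log (by linarith [hH1 u hu])
  have hU : Unb f P := by
    intro B
    by_contra hcon
    apply hinf
    have hfin := NumberField.Embeddings.finite_of_norm_le L ℂ (Real.exp B)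
    have hfin2 : {x : 𝓞 L | ∀ v : L →ₐ[ℚ] ℂ, ‖v (x : L)‖ ≤ Real.exp B}.Finite := by
      refine (hfin.preimage (f := fun x : 𝓞 L => (x : L)) (RingOfIntegers.coe_injective.injOn)).subset ?_
      intro x hx
      exact ⟨x.2, fun φ => hx φ.toRatAlgHom⟩
    refine (Set.Finite.pi' fun _ : ι => hfin2).subset ?_
    intro u hu i v
    by_contra h1
    refine hcon ⟨u, hu, ?_⟩
    rw [hf, Real.le_log_iff_exp_le (by linarith [hH1 u hu])]
    exact (not_le.mp h1).le.trans (hle u v i)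
  set n : ℝ := (Fintype.card ι : ℝ) with hn
  have hn0 : 0 ≤ n := Nat.cast_nonneg _
  set δ : ℝ := 1 / (4 * (n + 1)) with hδ
  have hδ0 : 0 < δ := by positivity
  set D := Fintype.card (L →ₐ[ℚ] ℂ) with hD
  set M : ℝ := (Fintype.card ((L →ₐ[ℚ] ℂ) × ι) : ℝ) with hM
  have hM0 : 0 < M := by
    have : 0 < Fintype.card ((L →ₐ[ℚ] ℂ) × ι) := Fintype.card_pos_iff.mpr ⟨(v1, i0)⟩
    rw [hM]; exact Nat.cast_pos.mpr this
  have hpos : ∀ u, P u → ∀ (v : L →ₐ[ℚ] ℂ) i, 0 < ‖v (u i : L)‖ := by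
    intro u hu v i
    rw [norm_pos_iff]
    have := (hu.1 i).ne_zero
    simpa using this
  obtain ⟨B1, hB1⟩ := eventually_atTop.mp (ev_exp hδ0 n)
  obtain ⟨⟨v0, J⟩, hU2⟩ := hU.pigeon (T := (L →ₐ[ℚ] ℂ) × Finset ι)
    (q := fun vJ u => P u ∧ B1 ≤ f u ∧ vJ.2.Nonempty ∧ vJ.2 ≠ Finset.univ ∧
      ∀ i, i ∉ vJ.2 → ∀ j ∈ vJ.2, ‖vJ.1 (u i : L)‖ ≤ Real.exp (-(2 * δ * f u)) * ‖vJ.1 (u j : L)‖)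
    ⟨max (max B1 1) (2 * Real.log M), fun u hb hu => by
      have hb1 : B1 ≤ f u := (le_max_left _ _).trans ((le_max_left _ _).trans hb)
      have hb2 : 1 ≤ f u := (le_max_right _ _).trans ((le_max_left _ _).trans hb)
      have hb3 : 2 * Real.log M ≤ f u := (le_max_right _ _).trans hb
      obtain ⟨⟨v, i1⟩, _, hvi⟩ := Finset.exists_le_of_sum_le (s := (Finset.univ : Finset ((L →ₐ[ℚ] ℂ) × ι)))
        (f := fun _ => H u / M) (g := fun vi => ‖vi.1 (u vi.2 : L)‖) ⟨(v1, i0), Finset.mem_univ _⟩ (by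
          rw [Finset.sum_const, nsmul_eq_mul, Finset.card_univ, mul_div_cancel₀ _ hM0.ne'])
      have hvi' : H u / M ≤ ‖v (u i1 : L)‖ := hvi
      have hl := Real.log_le_log (div_pos (by linarith [hH1 u hu]) hM0) hvi'
      rw [Real.log_div (by linarith [hH1 u hu]) hM0.ne'] at hl
      obtain ⟨J, hJ1, hJ0, hJ⟩ := gap_split (fun i => Real.log ‖v (u i : L)‖) i0 i1 (by simp [hu.2.1]) (2 * δ * f u) (by positivity) (by
        have : (n + 1) * (2 * δ * f u) = f u / 2 := by rw [hδ]; field_simp; norm_num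
        rw [← hn, this]
        have : f u = Real.log (H u) := rfl
        linarith)
      refine ⟨(v, J), hu, hb1, ⟨i1, hJ1⟩, fun h => hJ0 (by rw [show J = _ from h]; exact Finset.mem_univ _), fun i hi j hj => ?_⟩
      have h2 := Real.exp_le_exp.mpr (hJ i hi j hj)
      rw [Real.exp_add, Real.exp_log (hpos u hu v i), Real.exp_log (hpos u hu v j)] at h2
      rw [Real.exp_neg, inv_mul_eq_div, le_div_iff₀ (Real.exp_pos _)]
      exact h2⟩
  set Q : (ι → 𝓞 L) → Prop := fun u => P u ∧ B1 ≤ f u ∧ J.Nonempty ∧ J ≠ Finset.univ ∧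
      ∀ i, i ∉ J → ∀ j ∈ J, ‖v0 (u i : L)‖ ≤ Real.exp (-(2 * δ * f u)) * ‖v0 (u j : L)‖ with hQ
  -- minimal representation of the large part
  have hex : ∃ m : ℕ, ∃ S : Finset ι, S ⊆ J ∧ S.card = m ∧ ∃ t : ι → L, Unb f (fun u => Q u ∧ ∑ i ∈ J, (u i : L) = ∑ i ∈ S, t i * (u i : L)) :=
    ⟨_, J, subset_rfl, rfl, fun _ => 1, hU2.mono ⟨0, fun u _ hu => ⟨hu, by simp⟩⟩⟩
  obtain ⟨S, hSJ, hSc, t, hU3⟩ := Nat.find_spec hex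
  have hmin : ∀ b ∈ S, ∀ t' : ι → L, ¬ Unb f (fun u => Q u ∧ ∑ i ∈ J, (u i : L) = ∑ i ∈ S.erase b, t' i * (u i : L)) := by
    intro b hb t' h
    refine Nat.find_min hex (m := (S.erase b).card) ?_ ⟨S.erase b, (Finset.erase_subset _ _).trans hSJ, rfl, t', h⟩
    rw [← hSc]
    exact Finset.card_erase_lt_of_mem hb
  have hcoe : ∀ (u : ι → 𝓞 L) (s : Finset ι), ((∑ i ∈ s, u i : 𝓞 L) : L) = ∑ i ∈ s, (u i : L) := fun u s => map_sum (algebraMap (𝓞 L) L) _ _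
  have hSn : S.Nonempty := by
    rw [Finset.nonempty_iff_ne_empty]
    intro h0
    obtain ⟨u, ⟨hu, hu2⟩, -⟩ := hU3 0
    rw [h0, Finset.sum_empty, ← hcoe] at hu2
    exact hu.1.2.2.2 J hu.2.2.1 hu.2.2.2.1 (RingOfIntegers.coe_injective (hu2.trans (map_zero _).symm))
  obtain ⟨f0, hf0⟩ := hSn
  have ht : t f0 ≠ 0 := by
    intro h0
    refine hmin f0 hf0 t (hU3.mono ⟨0, fun u _ hu => ⟨hu.1, ?_⟩⟩)
    rw [hu.2, ← Finset.add_sum_erase S _ hf0, h0, zero_mul, zero_add]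
  refine subsp (σ := {x // x ∈ S}) v0 ⟨f0, hf0⟩ (fun b => t b.1) ht δ (D + 1) hδ0 f f (fun u b => u b.1) _ hU3 ?_ ?_
  · rintro u ⟨⟨hu, hB, -, -, hJ⟩, hrel⟩
    have hH1' := hH1 u hu
    have hf0' : 0 ≤ f u := Real.log_nonneg hH1'
    refine ⟨le_rfl, fun b => hu.1 b.1, fun v b => ⟨?_, ?_⟩, ?_⟩
    · have h1 := unit_prod (u b.1) (hu.1 b.1)
      rw [← Finset.mul_prod_erase _ _ (Finset.mem_univ v)] at h1
      have h2 : ∏ w ∈ Finset.univ.erase v, ‖w (u b.1 : L)‖ ≤ (H u) ^ D := by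
        refine (Finset.prod_le_prod (fun _ _ => norm_nonneg _) fun w _ => hle u w b.1).trans ?_
        rw [Finset.prod_const]
        exact pow_le_pow_right₀ hH1' (Finset.card_le_univ _)
      have h3 : Real.exp ((D + 1) * f u) = H u ^ D * H u := by
        rw [add_mul, Real.exp_add, one_mul, hexp u hu, Real.exp_nat_mul, hexp u hu]
      rw [Real.exp_neg, h3, inv_le_iff_one_le_mul₀ (by positivity)]
      have h4 : 1 ≤ ‖v (u b.1 : L)‖ * H u ^ D := by
        rw [← h1]
        exact mul_le_mul_of_nonneg_left h2 (norm_nonneg _)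
      calc (1 : ℝ) = 1 * 1 := by ring
        _ ≤ (‖v (u b.1 : L)‖ * H u ^ D) * H u := mul_le_mul h4 hH1' zero_le_one (by positivity)
        _ = _ := by ring
    · refine (hle u v b.1).trans ?_
      rw [← hexp u hu]
      apply Real.exp_le_exp.mpr
      have : 0 ≤ (D : ℝ) * f u := by positivity
      linarith
    · have h1 : ∑ b : {x // x ∈ S}, t b.1 * (u b.1 : L) = - ∑ i ∈ Jᶜ, (u i : L) := by
        rw [Finset.sum_coe_sort S (fun i => t i * (u i : L)), ← hrel, eq_neg_iff_add_eq_zero, Finset.sum_add_sum_compl, ← hcoe, hu.2.2.1]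
        simp
      rw [h1, map_neg, norm_neg, map_sum]
      refine (norm_sum_le _ _).trans ?_
      refine (Finset.sum_le_card_nsmul _ _ (Real.exp (-(2 * δ * f u)) * ‖v0 (u f0 : L)‖) fun i hi => hJ i (Finset.mem_compl.mp hi) f0 (hSJ hf0)).trans ?_
      rw [nsmul_eq_mul, ← mul_assoc]
      refine mul_le_mul_of_nonneg_right ?_ (norm_nonneg _)
      have h2 : ((Jᶜ).card : ℝ) ≤ Real.exp (δ * f u) := by
        refine le_trans ?_ (hB1 _ hB)
        rw [hn]
        exact_mod_cast Finset.card_le_univ _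
      calc _ ≤ Real.exp (δ * f u) * Real.exp (-(2 * δ * f u)) := mul_le_mul_of_nonneg_right h2 (Real.exp_pos _).le
        _ = _ := by rw [← Real.exp_add]; ring_nf
  · intro c hc hU4
    obtain ⟨⟨b, hb⟩, hcb⟩ := Function.ne_iff.mp hc
    let c' : ι → L := fun i => if h : i ∈ S then c ⟨i, h⟩ else 0
    have hcb' : c' b ≠ 0 := by simpa [c', hb] using hcb
    refine hmin b hb (fun i => t i - t b * (c' b)⁻¹ * c' i) (hU4.mono ⟨0, fun u _ hu => ⟨hu.1.1, ?_⟩⟩)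
    have h1 : ∑ i ∈ S, c' i * (u i : L) = 0 := by
      rw [← hu.2, ← Finset.sum_coe_sort S]
      refine Finset.sum_congr rfl fun i _ => ?_
      simp [c']
    have h2 : ∑ i ∈ S, (t i - t b * (c' b)⁻¹ * c' i) * (u i : L) = ∑ i ∈ J, (u i : L) := by
      rw [hu.1.2]
      simp only [sub_mul, Finset.sum_sub_distrib, mul_assoc, ← Finset.mul_sum]
      rw [h1]; simp
    rw [← h2, ← Finset.add_sum_erase S _ hb, mul_assoc, inv_mul_cancel₀ hcb', mul_one, sub_self, zero_mul, zero_add]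

/-- `x` is a unit of the ring of integers. -/
def IsU {L : Type*} [Field L] [NumberField L] (x : L) : Prop := ∃ y : 𝓞 L, IsUnit y ∧ (y : L) = x

lemma IsU.mul {L : Type*} [Field L] [NumberField L] {x y : L} (hx : IsU x) (hy : IsU y) : IsU (x * y) := by
  obtain ⟨a, ha, rfl⟩ := hx
  obtain ⟨b, hb, rfl⟩ := hy
  exact ⟨a * b, ha.mul hb, map_mul _ _ _⟩

lemma IsU.neg {L : Type*} [Field L] [NumberField L] {x : L} (hx : IsU x) : IsU (-x) := by
  obtain ⟨a, ha, rfl⟩ := hx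
  exact ⟨-a, ha.neg, map_neg _ _⟩

lemma IsU.ne_zero {L : Type*} [Field L] [NumberField L] {x : L} (hx : IsU x) : x ≠ 0 := by
  obtain ⟨a, ha, rfl⟩ := hx
  have := ha.ne_zero
  simpa using this

lemma IsU.inv {L : Type*} [Field L] [NumberField L] {x : L} (hx : IsU x) : IsU x⁻¹ := by
  obtain ⟨a, ⟨u, rfl⟩, rfl⟩ := hx
  refine ⟨(u⁻¹ : (𝓞 L)ˣ), Units.isUnit _, ?_⟩
  refine eq_inv_of_mul_eq_one_left ?_
  refine (map_mul (algebraMap (𝓞 L) L) _ _).symm.trans ?_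
  rw [Units.inv_mul, map_one]

lemma IsU.div {L : Type*} [Field L] [NumberField L] {x y : L} (hx : IsU x) (hy : IsU y) : IsU (x / y) := by
  rw [div_eq_mul_inv]; exact hx.mul hy.inv

lemma unit_fin2 (L ι : Type*) [Field L] [NumberField L] [Fintype ι] : ∃ F : Set L, F.Finite ∧ ∀ x : ι → L, (∀ i, IsU (x i)) →
    ∀ s : Finset ι, ∑ i ∈ s, x i = 0 → (∀ t, t ⊂ s → t.Nonempty → ∑ i ∈ t, x i ≠ 0) → ∀ i ∈ s, ∀ j ∈ s, x i / x j ∈ F := by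
  classical
  refine ⟨⋃ s : Finset ι, ⋃ j : {x // x ∈ s}, ⋃ i : {x // x ∈ s}, (fun u : {x // x ∈ s} → 𝓞 L => (u i : L)) ''
    {u | (∀ i, IsUnit (u i)) ∧ u j = 1 ∧ ∑ i, u i = 0 ∧ ∀ t : Finset {x // x ∈ s}, t.Nonempty → t ≠ Finset.univ → ∑ i ∈ t, u i ≠ 0},
    Set.finite_iUnion fun s => Set.finite_iUnion fun j => Set.finite_iUnion fun i => (unit_fin j).image _, ?_⟩
  intro x hx s hs ht i hi j hj
  have h1 : ∀ l : {x // x ∈ s}, IsU (x l / x j) := fun l => (hx l).div (hx j)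
  choose u hu hux using h1
  have hxj := (hx j).ne_zero
  have hinj : ∀ z : 𝓞 L, (z : L) = 0 → z = 0 := fun z hz => RingOfIntegers.coe_injective (hz.trans (map_zero _).symm)
  have hsum : ∀ t : Finset {x // x ∈ s}, ((∑ l ∈ t, u l : 𝓞 L) : L) = (∑ l ∈ t.map (Function.Embedding.subtype _), x l) / x j := by
    intro t
    refine (map_sum (algebraMap (𝓞 L) L) _ _).trans ?_
    rw [Finset.sum_map, Finset.sum_div]
    exact Finset.sum_congr rfl fun l _ => hux l
  simp only [Set.mem_iUnion]
  refine ⟨s, ⟨j, hj⟩, ⟨i, hi⟩, u, ⟨hu, ?_, ?_, ?_⟩, hux _⟩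
  · apply RingOfIntegers.coe_injective
    exact ((hux _).trans (div_self hxj)).trans (map_one (algebraMap (𝓞 L) L)).symm
  · apply hinj
    rw [hsum, Finset.univ_eq_attach, Finset.attach_map_val, hs, zero_div]
  · intro t htn htu h0
    have h2 := hsum t
    rw [h0] at h2
    replace h2 := h2.symm.trans (map_zero (algebraMap (𝓞 L) L))
    rw [div_eq_zero_iff] at h2
    refine ht _ ?_ (htn.map) (h2.resolve_right hxj)
    refine Finset.ssubset_iff_subset_ne.mpr ⟨fun l hl => ?_, fun h => htu ?_⟩
    · obtain ⟨m, _, rfl⟩ := Finset.mem_map.mp hl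
      exact m.2
    · refine Finset.eq_univ_of_forall fun m => ?_
      obtain ⟨m', h3, h4⟩ := Finset.mem_map.mp ((Finset.ext_iff.mp h m.1).mpr m.2)
      rwa [← Subtype.ext h4]

/-- signs -/
def sg : Fin 3 ⊕ Fin 3 → ℤ := Sum.elim (fun _ => 1) (fun _ => -1)

lemma root_fin {L : Type*} [Field L] {F : Set L} (hF : F.Finite) : {r : L | ∃ n : ℤ, n ≠ 0 ∧ |n| ≤ 3 ∧ r ^ n ∈ F}.Finite := by
  have h1 : ∀ n : ℕ, n ≠ 0 → ∀ G : Set L, G.Finite → {r : L | r ^ n ∈ G}.Finite := by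
    classical
    intro n hn G hG
    refine Set.Finite.preimage' hG fun b _ => ((Polynomial.nthRoots n b).toFinset.finite_toSet).subset ?_
    intro r hr
    have : r ^ n = b := hr
    simp [Polynomial.mem_nthRoots (Nat.pos_of_ne_zero hn), this]
  refine (((h1 1 (by norm_num) (F ∪ (·⁻¹) '' F) (hF.union (hF.image _))).union
    (h1 2 (by norm_num) (F ∪ (·⁻¹) '' F) (hF.union (hF.image _)))).union
    (h1 3 (by norm_num) (F ∪ (·⁻¹) '' F) (hF.union (hF.image _)))).subset ?_
  rintro r ⟨n, hn, hn3, hr⟩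
  obtain ⟨h2, h3⟩ := abs_le.mp hn3
  have key : ∀ m : ℕ, (n = m ∨ n = -m) → r ^ m ∈ F ∪ (·⁻¹) '' F := by
    rintro m (rfl | rfl)
    · left; simpa using hr
    · right; exact ⟨_, hr, by simp⟩
  have : n = -3 ∨ n = -2 ∨ n = -1 ∨ n = 1 ∨ n = 2 ∨ n = 3 := by omega
  rcases this with h | h | h | h | h | h
  · right; exact key 3 (by simp [h])
  · left; right; exact key 2 (by simp [h])
  · left; left; exact key 1 (by simp [h])
  · left; left; exact key 1 (by simp [h])
  · left; right; exact key 2 (by simp [h])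
  · right; exact key 3 (by simp [h])

set_option maxHeartbeats 1000000 in
lemma six (L : Type*) [Field L] [NumberField L] : ∃ F : Set L, F.Finite ∧ ∀ a b : Fin 3 → L, (∀ i, IsU (a i)) → (∀ i, IsU (b i)) →
    ∑ i, a i = ∑ i, b i → ∏ i, a i = ∏ i, b i → (∀ i j, a i ≠ b j) → ∀ i j, a i / b j ∈ F := by
  classical
  obtain ⟨F0, hF0, h0⟩ := unit_fin2 L (Fin 3 ⊕ Fin 3)
  set F1 : Set L := (fun ρ : Fin 3 ⊕ Fin 3 → L => -(∏ l, ρ l ^ sg l)⁻¹) '' {ρ | ∀ l, ρ l ∈ F0} with hF1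
  have hF1f : F1.Finite := (Set.Finite.pi' fun _ => hF0).image _
  set F2 := F0 ∪ {r : L | ∃ n : ℤ, n ≠ 0 ∧ |n| ≤ 3 ∧ r ^ n ∈ F1} with hF2
  have hF2f : F2.Finite := hF0.union (root_fin hF1f)
  refine ⟨(fun x => -x) '' F2, hF2f.image _, ?_⟩
  intro a b ha hb hsum hprod hne i j
  set x : Fin 3 ⊕ Fin 3 → L := Sum.elim a (fun i => -b i) with hx
  have hxU : ∀ l, IsU (x l) := by
    rintro (l | l)
    · exact ha l
    · exact (hb l).neg
  have hxs : ∑ l, x l = 0 := by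
    rw [Fintype.sum_sum_type]
    simp [hx, hsum]
  have hx0 := fun l => (hxU l).ne_zero
  have hxp : ∏ l, x l ^ sg l = -1 := by
    have hb0 : ∀ l, b l ≠ 0 := fun l => (hb l).ne_zero
    rw [Fintype.prod_sum_type]
    simp only [hx, sg, Sum.elim_inl, Sum.elim_inr, zpow_one, _root_.zpow_neg]
    rw [hprod, Fin.prod_univ_three, Fin.prod_univ_three]
    have := hb0 0
    have := hb0 1
    have := hb0 2
    field_simp
  have hpair : ∀ s : Finset (Fin 3 ⊕ Fin 3), s.card = 2 → ∑ l ∈ s, x l = 0 → ∑ l ∈ s, sg l = 2 ∨ ∑ l ∈ s, sg l = -2 := by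
    intro s hs hs0
    obtain ⟨l, m, hlm, rfl⟩ := Finset.card_eq_two.mp hs
    rw [Finset.sum_pair hlm] at hs0 ⊢
    rcases l with l | l <;> rcases m with m | m
    · simp [sg]
    · exact absurd (sub_eq_zero.mp (by simpa [hx, ← sub_eq_add_neg] using hs0)) (hne l m)
    · exact absurd (sub_eq_zero.mp (by simpa [hx, ← sub_eq_add_neg, add_comm] using hs0)) (hne m l)
    · simp [sg]
  have htri : ∀ s : Finset (Fin 3 ⊕ Fin 3), s.card = 3 → ∑ l ∈ s, sg l ≠ 0 ∧ |∑ l ∈ s, sg l| ≤ 3 := by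
    intro s hs
    obtain ⟨l, m, n, h1, h2, h3, rfl⟩ := Finset.card_eq_three.mp hs
    rw [Finset.sum_insert (by simp [h1, h2]), Finset.sum_pair h3]
    rcases l with l | l <;> rcases m with m | m <;> rcases n with n | n <;> simp [sg]
  have hcompl : ∀ s : Finset (Fin 3 ⊕ Fin 3), ∑ l ∈ s, x l = 0 → ∑ l ∈ sᶜ, x l = 0 := by
    intro s hs
    have := Finset.sum_add_sum_compl s x
    rwa [hs, zero_add, hxs] at this
  have hcard : ∀ s : Finset (Fin 3 ⊕ Fin 3), s.card + sᶜ.card = 6 := by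
    intro s; rw [Finset.card_add_card_compl]; rfl
  have hcard1 : ∀ s : Finset (Fin 3 ⊕ Fin 3), s.Nonempty → ∑ l ∈ s, x l = 0 → 2 ≤ s.card := by
    intro s hs hs0
    by_contra hc
    have : s.card = 1 := by have := hs.card_pos; omega
    obtain ⟨l, rfl⟩ := Finset.card_eq_one.mp this
    rw [Finset.sum_singleton] at hs0
    exact hx0 l hs0
  have hsgt : ∀ s : Finset (Fin 3 ⊕ Fin 3), ∑ l ∈ s, sg l + ∑ l ∈ sᶜ, sg l = 0 := by
    intro s; rw [Finset.sum_add_sum_compl, Fintype.sum_sum_type]; simp [sg]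
  suffices hmain : ∀ l m, x l / x m ∈ F2 by
    refine ⟨_, hmain (Sum.inl i) (Sum.inr j), ?_⟩
    simp [hx, div_neg]
  -- minimal vanishing set
  obtain ⟨s, hs, hsmin⟩ := Finset.exists_min_image (Finset.univ.filter fun s : Finset (Fin 3 ⊕ Fin 3) => s.Nonempty ∧ ∑ l ∈ s, x l = 0)
    Finset.card ⟨Finset.univ, by simp only [Finset.mem_filter, Finset.mem_univ, true_and]; exact ⟨⟨Sum.inl 0, Finset.mem_univ _⟩, hxs⟩⟩
  simp only [Finset.mem_filter, Finset.mem_univ, true_and, and_imp] at hs hsmin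
  have hsm : ∀ t, t ⊂ s → t.Nonempty → ∑ i ∈ t, x i ≠ 0 := fun t ht htn h => absurd (hsmin t htn h) (not_le.mpr (Finset.card_lt_card ht))
  intro l m
  by_cases hsu : s = Finset.univ
  · exact Or.inl (h0 x hxU s hs.2 hsm l (by simp [hsu]) m (by simp [hsu]))
  have hscn : sᶜ.Nonempty := by rw [Finset.nonempty_iff_ne_empty]; simpa using hsu
  have hc1 := hsmin _ hscn (hcompl s hs.2)
  have hc2 := hcard1 s hs.1 hs.2
  have hc3 := hcard s
  have hn : ∑ l ∈ s, sg l ≠ 0 ∧ |∑ l ∈ s, sg l| ≤ 3 := by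
    by_cases h3 : s.card = 3
    · exact htri s h3
    · rcases hpair s (by omega) hs.2 with h | h <;> rw [h] <;> simp
  have hscm : ∀ t, t ⊂ sᶜ → t.Nonempty → ∑ i ∈ t, x i ≠ 0 := by
    intro t ht htn h
    have e1 := hsmin t htn h
    have e2 := Finset.card_lt_card ht
    have e3 : ∑ i ∈ sᶜ \ t, x i = 0 := by
      have := Finset.sum_sdiff ht.1 (f := x)
      rwa [h, add_zero, hcompl s hs.2] at this
    have e4 : (sᶜ \ t).card = sᶜ.card - t.card := Finset.card_sdiff_of_subset ht.1
    have e5 := hcard1 (sᶜ \ t) (by rw [← Finset.card_pos]; omega) e3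
    have e6 := hpair s (by omega) hs.2
    have e7 := hpair t (by omega) h
    have e8 := hpair _ (by omega) e3
    have e9 := Finset.sum_sdiff ht.1 (f := sg)
    have e10 := hsgt s
    omega
  have hS := h0 x hxU s hs.2 hsm
  have hSc := h0 x hxU sᶜ (hcompl s hs.2) hscm
  have hcross : ∀ l ∈ s, ∀ m ∈ sᶜ, ∃ n : ℤ, n ≠ 0 ∧ |n| ≤ 3 ∧ (x l / x m) ^ n ∈ F1 := by
    intro l hl m hm
    refine ⟨∑ l ∈ s, sg l, hn.1, hn.2, fun k => if k ∈ s then x k / x l else x k / x m, ?_, ?_⟩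
    · intro k
      by_cases hk : k ∈ s
      · simp only [hk, if_true]; exact hS k hk l hl
      · simp only [hk, if_false]; exact hSc k (Finset.mem_compl.mpr hk) m hm
    · have e1 : ∏ k, (if k ∈ s then x k / x l else x k / x m) ^ sg k =
          (∏ k, x k ^ sg k) * ((∏ k ∈ s, (x l) ^ sg k) * ∏ k ∈ sᶜ, (x m) ^ sg k)⁻¹ := by
        rw [← Finset.prod_mul_prod_compl s, ← Finset.prod_mul_prod_compl s (fun k => x k ^ sg k)]
        rw [mul_inv, mul_mul_mul_comm, ← Finset.prod_inv_distrib, ← Finset.prod_inv_distrib, ← Finset.prod_mul_distrib, ← Finset.prod_mul_distrib]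
        congr 1
        · refine Finset.prod_congr rfl fun k hk => ?_
          rw [if_pos hk, div_zpow, div_eq_mul_inv]
        · refine Finset.prod_congr rfl fun k hk => ?_
          rw [if_neg (Finset.mem_compl.mp hk), div_zpow, div_eq_mul_inv]
      have e2 : ∀ (y : L), y ≠ 0 → ∀ s : Finset (Fin 3 ⊕ Fin 3), ∏ k ∈ s, y ^ sg k = y ^ ∑ k ∈ s, sg k := by
        intro y hy s
        induction s using Finset.induction_on with
        | empty => simp
        | insert k s hk ih => rw [Finset.prod_insert hk, Finset.sum_insert hk, zpow_add₀ hy, ih]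
      change -(∏ k, (if k ∈ s then x k / x l else x k / x m) ^ sg k)⁻¹ = _
      rw [e1, hxp, e2 _ (hx0 l), e2 _ (hx0 m), eq_neg_of_add_eq_zero_right (hsgt s), div_zpow, _root_.zpow_neg]
      simp [div_eq_mul_inv]
  by_cases hl : l ∈ s <;> by_cases hm : m ∈ s
  · exact Or.inl (hS l hl m hm)
  · exact Or.inr (hcross l hl m (Finset.mem_compl.mpr hm))
  · obtain ⟨n, h1, h2, h3⟩ := hcross m hm l (Finset.mem_compl.mpr hl)
    refine Or.inr ⟨-n, by simpa using h1, by simpa using h2, ?_⟩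
    rw [_root_.zpow_neg, ← _root_.inv_zpow, inv_div]
    exact h3
  · exact Or.inl (hSc l (Finset.mem_compl.mpr hl) m (Finset.mem_compl.mpr hm))

/-- collinearity of three points in a planar projection -/
def col {E L : Type*} [Field L] (a b : E → L) (i j k : E) : Prop := (a i - a j) * (b i - b k) = (a i - a k) * (b i - b j)

section
variable {E L : Type*} [Field L] {a b : E → L} {i j k l : E}

lemma col.symm (h : col a b i j k) : col b a i j k := by unfold col at *; linear_combination -h
lemma col.sw (h : col a b i j k) : col a b i k j := by unfold col at *; linear_combination -h
lemma col.rot (h : col a b i j k) : col a b j k i := by unfold col at *; linear_combination h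
lemma col.ext (h : col a b i j k) (h2 : col a b i j l) (hij : a i ≠ a j) : col a b i k l := by
  unfold col at *
  refine mul_left_cancel₀ (sub_ne_zero.mpr hij) ?_
  linear_combination (a i - a k) * h2 - (a i - a l) * h
lemma col_self (a b : E → L) (i j : E) : col a b i i j := by unfold col; ring
end

/-- a triple of conjugate vectors with unit quotients of differences -/
structure Val {E L : Type*} [Field L] [NumberField L] (a b c : E → L) : Prop where
  ia : a.Injective
  ib : b.Injective
  ic : c.Injective
  u : ∀ i j, i ≠ j → IsU ((b i - b j) / (a i - a j))
  v : ∀ i j, i ≠ j → IsU ((c i - c j) / (a i - a j))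

/-- a triangle that is nondegenerate in all three projections -/
def Good {E L : Type*} [Field L] (a b c : E → L) (i j k : E) : Prop := ¬ col a b i j k ∧ ¬ col a c i j k ∧ ¬ col b c i j k

section
variable {E L : Type*} [Field L] [NumberField L] {a b c : E → L} {i j k l : E}

lemma Val.swap (h : Val a b c) : Val b a c where
  ia := h.ib
  ib := h.ia
  ic := h.ic
  u := fun i j hij => by rw [← inv_div]; exact (h.u i j hij).inv
  v := fun i j hij => by
    have := (h.v i j hij).div (h.u i j hij)
    rwa [div_div_div_cancel_right₀ (sub_ne_zero.mpr (h.ia.ne hij))] at this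

lemma Val.swap2 (h : Val a b c) : Val a c b := ⟨h.ia, h.ic, h.ib, h.v, h.u⟩

lemma Good.swap (h : Good a b c i j k) : Good b a c i j k := ⟨fun q => h.1 q.symm, h.2.2, h.2.1⟩
lemma Good.swap2 (h : Good a b c i j k) : Good a c b i j k := ⟨h.2.1, h.1, fun q => h.2.2 q.symm⟩
lemma Good.sw (h : Good a b c i j k) : Good a b c i k j := ⟨fun q => h.1 q.sw, fun q => h.2.1 q.sw, fun q => h.2.2 q.sw⟩
lemma Good.rot (h : Good a b c i j k) : Good a b c j k i := ⟨fun q => h.1 q.rot.rot, fun q => h.2.1 q.rot.rot, fun q => h.2.2 q.rot.rot⟩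
lemma Good.ne (h : Good a b c i j k) : i ≠ j := fun e => h.1 (by rw [e]; exact col_self _ _ _ _)
end

set_option maxHeartbeats 1000000 in
lemma tri_fin (E L : Type*) [Field L] [NumberField L] : ∃ F : Set L, F.Finite ∧ ∀ a b c : E → L, Val a b c → ∀ i j k, Good a b c i j k →
    (a i - a j) / (a i - a k) ∈ F := by
  obtain ⟨F, hF, h6⟩ := six L
  refine ⟨(fun p : L × L => (p.2⁻¹ - p.1) / (1 - p.1)) '' (F ×ˢ F), (hF.prod hF).image _, ?_⟩
  intro a b c hv i j k hg
  have hij := hg.ne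
  have hjk := hg.rot.ne
  have hki := hg.rot.rot.ne
  have A1 := sub_ne_zero.mpr (hv.ia.ne hij)
  have A2 := sub_ne_zero.mpr (hv.ia.ne hjk)
  have A3 := sub_ne_zero.mpr (hv.ia.ne hki)
  have U1 := hv.u i j hij
  have U2 := hv.u j k hjk
  have U3 := hv.u k i hki
  have V1 := hv.v i j hij
  have V2 := hv.v j k hjk
  have V3 := hv.v k i hki
  obtain ⟨n1, n2, n3⟩ := hg
  obtain ⟨x1, hx1⟩ : ∃ x, x = (b i - b j) / (a i - a j) := ⟨_, rfl⟩
  obtain ⟨x2, hx2⟩ : ∃ x, x = (b j - b k) / (a j - a k) := ⟨_, rfl⟩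
  obtain ⟨x3, hx3⟩ : ∃ x, x = (b k - b i) / (a k - a i) := ⟨_, rfl⟩
  obtain ⟨y1, hy1⟩ : ∃ x, x = (c i - c j) / (a i - a j) := ⟨_, rfl⟩
  obtain ⟨y2, hy2⟩ : ∃ x, x = (c j - c k) / (a j - a k) := ⟨_, rfl⟩
  obtain ⟨y3, hy3⟩ : ∃ x, x = (c k - c i) / (a k - a i) := ⟨_, rfl⟩
  rw [← hx1] at U1; rw [← hx2] at U2; rw [← hx3] at U3
  rw [← hy1] at V1; rw [← hy2] at V2; rw [← hy3] at V3
  rw [eq_div_iff A1] at hx1 hy1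
  rw [eq_div_iff A2] at hx2 hy2
  rw [eq_div_iff A3] at hx3 hy3
  -- two basic relations
  have hx : x1 * (a i - a j) + x2 * (a j - a k) + x3 * (a k - a i) = 0 := by rw [hx1, hx2, hx3]; ring
  have hy : y1 * (a i - a j) + y2 * (a j - a k) + y3 * (a k - a i) = 0 := by rw [hy1, hy2, hy3]; ring
  have hx12 : x1 ≠ x2 := by
    intro e
    refine n1 ?_
    unfold col
    rw [← e] at hx2
    linear_combination (a i - a j) * (-hx1 - hx2) + (a i - a k) * hx1
  have hx13 : x1 ≠ x3 := by
    intro e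
    refine n1 ?_
    unfold col
    rw [← e] at hx3
    linear_combination (a i - a j) * hx3 + (a i - a k) * hx1
  have hx23 : x2 ≠ x3 := by
    intro e
    refine n1 ?_
    unfold col
    rw [← e] at hx3
    linear_combination (a i - a j) * hx3 - (a i - a k) * (hx2 + hx3)
  have hy12 : y1 ≠ y2 := by
    intro e
    refine n2 ?_
    unfold col
    rw [← e] at hy2
    linear_combination (a i - a j) * (-hy1 - hy2) + (a i - a k) * hy1
  have hy13 : y1 ≠ y3 := by
    intro e
    refine n2 ?_
    unfold col
    rw [← e] at hy3
    linear_combination (a i - a j) * hy3 + (a i - a k) * hy1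
  have hy23 : y2 ≠ y3 := by
    intro e
    refine n2 ?_
    unfold col
    rw [← e] at hy3
    linear_combination (a i - a j) * hy3 - (a i - a k) * (hy2 + hy3)
  have hw : ∀ {i j k : E} {x y x' y' : L}, ¬ col b c i j k → x * (a i - a j) = b i - b j → x' * (a i - a k) = b i - b k →
      y * (a i - a j) = c i - c j → y' * (a i - a k) = c i - c k → x * y' ≠ x' * y := by
    intro i j k x y x' y' hn h1 h2 h3 h4 e
    apply hn
    unfold col
    rw [← h1, ← h2, ← h3, ← h4]
    linear_combination (a i - a j) * (a i - a k) * e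
  have hx1' : x1 * (a j - a i) = b j - b i := by linear_combination -hx1
  have hy1' : y1 * (a j - a i) = c j - c i := by linear_combination -hy1
  have hx2' : x2 * (a k - a j) = b k - b j := by linear_combination -hx2
  have hy2' : y2 * (a k - a j) = c k - c j := by linear_combination -hy2
  have hx3' : x3 * (a i - a k) = b i - b k := by linear_combination -hx3
  have hy3' : y3 * (a i - a k) = c i - c k := by linear_combination -hy3
  have w13 := hw n3 hx1 hx3' hy1 hy3'
  have w21 := hw (fun q => n3 q.rot.rot) hx2 hx1' hy2 hy1'
  have w32 := hw (fun q => n3 q.rot) hx3 hx2' hy3 hy2'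
  have hdet : x2 * y3 + x3 * y1 + x1 * y2 = x3 * y2 + x1 * y3 + x2 * y1 := by
    refine mul_left_cancel₀ A1 ?_
    linear_combination (y2 - y3) * hx - (x2 - x3) * hy
  have h := h6 ![x2 * y3, x3 * y1, x1 * y2] ![x3 * y2, x1 * y3, x2 * y1]
    (by intro i; fin_cases i; exacts [U2.mul V3, U3.mul V1, U1.mul V2])
    (by intro i; fin_cases i; exacts [U3.mul V2, U1.mul V3, U2.mul V1])
    (by simpa [Fin.sum_univ_three] using hdet)
    (by simp [Fin.prod_univ_three]; ring)
    (by
      have z1 := U1.ne_zero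
      have z2 := U2.ne_zero
      have z3 := U3.ne_zero
      have t1 := V1.ne_zero
      have t2 := V2.ne_zero
      have t3 := V3.ne_zero
      intro i j
      fin_cases i <;> fin_cases j
      · exact fun e => w32 e.symm
      · exact fun e => hx12 (mul_right_cancel₀ t3 e).symm
      · exact fun e => hy13 (mul_left_cancel₀ z2 e).symm
      · exact fun e => hy12 (mul_left_cancel₀ z3 e)
      · exact fun e => w13 e.symm
      · exact fun e => hx23 (mul_right_cancel₀ t1 e).symm
      · exact fun e => hx13 (mul_right_cancel₀ t2 e)
      · exact fun e => hy23 (mul_left_cancel₀ z1 e)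
      · exact fun e => w21 e.symm)
  have r1 : x2 * y3 / (x1 * y3) ∈ F := h 0 1
  have r2 : x1 * y2 / (x3 * y2) ∈ F := h 2 0
  rw [mul_div_mul_right _ _ V3.ne_zero] at r1
  rw [mul_div_mul_right _ _ V2.ne_zero] at r2
  refine ⟨(x2 / x1, x1 / x3), ⟨r1, r2⟩, ?_⟩
  change ((x1 / x3)⁻¹ - x2 / x1) / (1 - x2 / x1) = _
  have z1 := U1.ne_zero
  have A3' : a i - a k ≠ 0 := sub_ne_zero.mpr (hv.ia.ne hki.symm)
  rw [inv_div, ← sub_div, one_sub_div z1, div_div_div_cancel_right₀ z1, div_eq_div_iff (sub_ne_zero.mpr hx12) A3']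
  linear_combination -hx

/-- the function recovering the position of the fourth point -/
def g4 {L : Type*} [Field L] (p : L × L × L) : L :=
  ((p.2.1 - 1) / (p.1 * (1 - p.2.2)) * p.1 - p.2.1) / ((p.2.1 - 1) / (p.1 * (1 - p.2.2)) - 1)

lemma k4alg {L : Type*} [Field L] (A1 A2 A3 B1 B2 B3 C1 C2 C3 : L) (hA1 : A1 ≠ 0) (hA3 : A3 ≠ 0) (hB1 : B1 ≠ 0)
    (hB3 : B3 ≠ 0) (hC1 : C1 ≠ 0) (h1 : A1 * B2 = A2 * B1) (h2 : A1 * C3 = A3 * C1) (h3 : B2 * C3 = B3 * C2)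
    (hA12 : A1 ≠ A2) (hA13 : A1 ≠ A3) (hC23 : C2 ≠ C3) (hne : A1 * B3 ≠ A3 * B1) :
    A1 / (A1 - A2) = g4 ((A1 - A3) / (A1 - A2), (B1 - B3) / (B1 - B2), (C1 - C2) / (C1 - C3)) := by
  have d12 := sub_ne_zero.mpr hA12
  have d13 := sub_ne_zero.mpr hA13
  have dne := sub_ne_zero.mpr hne
  obtain rfl : B2 = A2 * B1 / A1 := by rw [eq_div_iff hA1]; linear_combination h1
  obtain rfl : C3 = A3 * C1 / A1 := by rw [eq_div_iff hA1]; linear_combination h2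
  obtain rfl : C2 = A2 * B1 / A1 * (A3 * C1 / A1) / B3 := by rw [eq_div_iff hB3]; linear_combination -h3
  have hk : B1 * A2 - A1 * B3 ≠ 0 := by
    intro h
    apply hC23
    field_simp
    linear_combination h
  have e1 : (A1 - A3) / (A1 - A2) * (1 - (C1 - A2 * B1 / A1 * (A3 * C1 / A1) / B3) / (C1 - A3 * C1 / A1)) =
      A3 * (B1 * A2 - A1 * B3) / (A1 * B3 * (A1 - A2)) := by
    have : C1 - A3 * C1 / A1 = C1 * (A1 - A3) / A1 := by field_simp
    rw [this]
    field_simp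
    ring
  have e0 : B1 - A2 * B1 / A1 = B1 * (A1 - A2) / A1 := by field_simp
  have e2 : (B1 - B3) / (B1 - A2 * B1 / A1) - 1 = (B1 * A2 - A1 * B3) / (B1 * (A1 - A2)) := by
    rw [e0]; field_simp; ring
  have e3 : (B1 * A2 - A1 * B3) / (B1 * (A1 - A2)) / (A3 * (B1 * A2 - A1 * B3) / (A1 * B3 * (A1 - A2))) = A1 * B3 / (A3 * B1) := by
    field_simp
  simp only [g4]
  rw [e1, e2, e3, e0]
  have e4 : A1 * B3 / (A3 * B1) - 1 = (A1 * B3 - A3 * B1) / (A3 * B1) := by field_simp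
  rw [e4]
  field_simp
  ring

lemma three_rel {S : Type*} (R : Fin 3 → S → S → Prop) (hE : ∀ m, Equivalence (R m)) (hn : ∀ m, ∃ p q, ¬ R m p q) :
    (∃ p q, ∀ m, ¬ R m p q) ∨ ∃ j k l, R 0 j k ∧ ¬ R 0 k l ∧ R 1 k l ∧ ¬ R 1 l j ∧ R 2 l j ∧ ¬ R 2 j k := by
  by_contra hcon
  push Not at hcon
  obtain ⟨hc1, hc2⟩ := hcon
  have hc1' : ∀ p q, R 0 p q ∨ R 1 p q ∨ R 2 p q := by
    intro p q
    obtain ⟨m, hm⟩ := hc1 p q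
    fin_cases m
    exacts [Or.inl hm, Or.inr (Or.inl hm), Or.inr (Or.inr hm)]
  have s := fun m {x y} => (hE m).symm (x := x) (y := y)
  have t := fun m {x y z} => (hE m).trans (x := x) (y := y) (z := z)
  obtain ⟨j, l, h0, h1⟩ : ∃ j l, ¬ R 0 j l ∧ ¬ R 1 j l := by
    by_contra hx
    push Not at hx
    obtain ⟨p, q, hpq⟩ := hn 0
    have h1 := hx p q hpq
    obtain ⟨r, hr⟩ : ∃ r, ¬ R 1 r p := by
      by_contra hy
      push Not at hy
      obtain ⟨p', q', h'⟩ := hn 1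
      exact h' (t 1 (hy p') (s 1 (hy q')))
    have h2 : R 0 r p := by by_contra h; exact hr (hx r p h)
    have h3 : R 0 r q := by by_contra h; exact hr (t 1 (hx r q h) (s 1 h1))
    exact hpq (t 0 (s 0 h2) h3)
  have h2 : R 2 j l := by have := hc1' j l; tauto
  obtain ⟨k, hk⟩ : ∃ k, ¬ R 2 k j := by
    by_contra hy
    push Not at hy
    obtain ⟨p', q', h'⟩ := hn 2
    exact h' (t 2 (hy p') (s 2 (hy q')))
  have hkl : ¬ R 2 k l := fun h => hk (t 2 h (s 2 h2))
  rcases hc1' k j with h | h | h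
  · rcases hc1' k l with h' | h' | h'
    · exact h0 (t 0 (s 0 h) h')
    · exact hk (s 2 (hc2 j k l (s 0 h) (fun e => h0 (t 0 (s 0 h) e)) h' (fun e => h1 (s 1 e)) (s 2 h2)))
    · exact hkl h'
  · rcases hc1' k l with h' | h' | h'
    · exact hkl (s 2 (hc2 l k j (s 0 h') (fun e => h0 (t 0 (s 0 e) h')) h h1 h2))
    · exact h1 (t 1 (s 1 h) h')
    · exact hkl h'
  · exact hk h

lemma good_exists {E L : Type*} [Field L] {a b c : E → L} (ha : a.Injective) (hb : b.Injective)
    (hab : ∃ i j k, ¬ col a b i j k) (hac : ∃ i j k, ¬ col a c i j k) (hbc : ∃ i j k, ¬ col b c i j k) :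
    ∃ i j k, Good a b c i j k := by
  obtain ⟨o, -, -, -⟩ := id hab
  have htr : ∀ {x y : E → L}, x.Injective → ∀ {p q r}, q ≠ o → col x y o p q → col x y o q r → col x y o p r :=
    fun hx p q r hq h1 h2 => h1.sw.ext h2 (hx.ne hq.symm)
  have hnt : ∀ {x y : E → L}, x.Injective → (∃ i j k, ¬ col x y i j k) → ∃ p q : {p // p ≠ o}, ¬ col x y o p.1 q.1 := by
    rintro x y hx ⟨i, j, k, hn⟩
    by_contra hcon
    push Not at hcon
    have hall : ∀ p q, col x y o p q := by
      intro p q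
      by_cases hp : p = o
      · rw [hp]; exact col_self _ _ _ _
      by_cases hq : q = o
      · rw [hq]; exact (col_self _ _ _ _).sw
      exact hcon ⟨p, hp⟩ ⟨q, hq⟩
    by_cases hi : o = i
    · rw [hi] at hall; exact hn (hall j k)
    · exact hn ((hall i j).sw.rot.rot.ext (hall i k).sw.rot.rot (hx.ne (Ne.symm hi)))
  have heq : ∀ {x y : E → L}, x.Injective → Equivalence (fun p q : {p // p ≠ o} => col x y o p.1 q.1) := fun {x y} hx =>
    ⟨fun p => (col_self x y p.1 o).rot.rot, fun h => h.sw, fun {p q r} h1 h2 => htr hx q.2 h1 h2⟩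
  have key : ∀ {x y : E → L}, x.Injective → ∀ {j k l}, col x y o j k → ¬ col x y o k l → j ≠ k → ¬ col x y j k l := by
    intro x y hx j k l h1 h2 hjk h3
    exact h2 ((h1.sw.rot.ext h3.sw.rot.rot (hx.ne hjk.symm)).rot.sw)
  rcases three_rel (fun m (p q : {p // p ≠ o}) => (![col a b o p.1 q.1, col a c o p.1 q.1, col b c o p.1 q.1] : Fin 3 → Prop) m)
    (by intro m; fin_cases m; exacts [heq ha, heq ha, heq hb])
    (by intro m; fin_cases m; exacts [hnt ha hab, hnt ha hac, hnt hb hbc]) with ⟨p, q, h⟩ | ⟨j, k, l, h1, h2, h3, h4, h5, h6⟩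
  · exact ⟨o, p, q, h 0, h 1, h 2⟩
  · change col a b o j.1 k.1 at h1
    change ¬ col a b o k.1 l.1 at h2
    change col a c o k.1 l.1 at h3
    change ¬ col a c o l.1 j.1 at h4
    change col b c o l.1 j.1 at h5
    change ¬ col b c o j.1 k.1 at h6
    have hjk : j.1 ≠ k.1 := fun e => h6 (by rw [e]; exact (col_self _ _ _ _).rot.rot)
    have hkl : k.1 ≠ l.1 := fun e => h2 (by rw [e]; exact (col_self _ _ _ _).rot.rot)
    have hlj : l.1 ≠ j.1 := fun e => h4 (by rw [e]; exact (col_self _ _ _ _).rot.rot)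
    exact ⟨j, k, l, key ha h1 h2 hjk, fun q => key ha h3 h4 hkl q.rot, fun q => key hb h5 h6 hlj q.rot.rot⟩

set_option maxHeartbeats 1000000 in
lemma shape_fin (E L : Type*) [Field L] [NumberField L] : ∃ F : Set L, F.Finite ∧ ∀ a b c : E → L, Val a b c →
    (∃ i j k, ¬ col a b i j k) → (∃ i j k, ¬ col a c i j k) → (∃ i j k, ¬ col b c i j k) → ∀ p q r s, (a p - a q) / (a r - a s) ∈ F := by
  obtain ⟨F, hF, hT⟩ := tri_fin E L
  set F1 := F ∪ g4 '' (F ×ˢ F ×ˢ F) with hF1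
  have hF1f : F1.Finite := hF.union ((hF.prod (hF.prod hF)).image _)
  set F2 := insert 0 (insert 1 F) with hF2
  have hF2f : F2.Finite := (hF.insert 1).insert 0
  set F3 := F2 ∪ (fun p : L × L × L => p.1 - p.2.2 * (p.1 - p.2.1)) '' (F2 ×ˢ F2 ×ˢ F1) with hF3
  have hF3f : F3.Finite := hF2f.union ((hF2f.prod (hF2f.prod hF1f)).image _)
  refine ⟨(fun p : L × L × L × L => (p.1 - p.2.1) / (p.2.2.1 - p.2.2.2)) '' (F3 ×ˢ F3 ×ˢ F3 ×ˢ F3),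
    (hF3f.prod (hF3f.prod (hF3f.prod hF3f))).image _, ?_⟩
  intro a b c hv hab hac hbc
  obtain ⟨i, j, k, hg⟩ := good_exists hv.ia hv.ib hab hac hbc
  have hij := hg.ne
  have hd := sub_ne_zero.mpr (hv.ia.ne hij.symm)
  obtain ⟨N, hN⟩ : ∃ N : E → L, ∀ l, N l = (a l - a i) / (a j - a i) := ⟨_, fun _ => rfl⟩
  have hNi : N i ∈ F2 := Or.inl (by rw [hN, sub_self, zero_div])
  have hNj : N j ∈ F2 := Or.inr (Or.inl (by rw [hN, div_self hd]))
  have hNk : N k ∈ F2 := by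
    right; right
    have := hT a b c hv i k j hg.sw
    rwa [← neg_div_neg_eq, neg_sub, neg_sub, ← hN] at this
  -- the degenerate case
  have hH : ∀ {i j k l}, Good a b c i j k → l ≠ i → l ≠ j → l ≠ k → col a b l i j → col a c l i k → col b c l j k →
      (a i - a l) / (a i - a j) ∈ F1 := by
    intro i j k l hg hi hj hk h1 h2 h3
    have n := fun {x : E → L} (hx : x.Injective) {p q : E} (h : p ≠ q) => sub_ne_zero.mpr (hx.ne h)
    have m := fun {x : E → L} (hx : x.Injective) {p q : E} (h : p ≠ q) (e : x p - x l = x q - x l) => hx.ne h (sub_left_injective e)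
    have := k4alg (a i - a l) (a j - a l) (a k - a l) (b i - b l) (b j - b l) (b k - b l) (c i - c l) (c j - c l) (c k - c l)
      (n hv.ia hi.symm) (n hv.ia hk.symm) (n hv.ib hi.symm) (n hv.ib hk.symm) (n hv.ic hi.symm)
      (by unfold col at h1; linear_combination h1) (by unfold col at h2; linear_combination h2) (by unfold col at h3; linear_combination h3)
      (m hv.ia hg.ne) (m hv.ia hg.sw.ne) (m hv.ic hg.rot.ne) (by
        intro e
        have h4 : col a b l i k := by unfold col; linear_combination e
        exact hg.1 (h1.sw.rot.rot.ext h4.sw.rot.rot (hv.ia.ne hi.symm)))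
    simp only [sub_sub_sub_cancel_right] at this
    rw [this]
    exact Or.inr ⟨_, ⟨hT a b c hv i k j hg.sw, hT b a c hv.swap i k j hg.swap.sw, hT c a b hv.swap2.swap i j k hg.swap2.swap⟩, rfl⟩
  have hex : ∀ l, l ≠ i → l ≠ j → l ≠ k → ∃ m n, N m ∈ F2 ∧ N n ∈ F2 ∧ m ≠ n ∧ (a m - a l) / (a m - a n) ∈ F1 := by
    intro l hi hj hk
    by_cases g1 : Good a b c i l j
    · exact ⟨i, j, hNi, hNj, hij, Or.inl (hT a b c hv i l j g1)⟩
    by_cases g2 : Good a b c j l k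
    · exact ⟨j, k, hNj, hNk, hg.rot.ne, Or.inl (hT a b c hv j l k g2)⟩
    by_cases g3 : Good a b c k l i
    · exact ⟨k, i, hNk, hNi, hg.rot.rot.ne, Or.inl (hT a b c hv k l i g3)⟩
    have k1 : col a b i l j ∨ col a c i l j ∨ col b c i l j := by unfold Good at g1; tauto
    have k2 : col a b j l k ∨ col a c j l k ∨ col b c j l k := by unfold Good at g2; tauto
    have k3 : col a b k l i ∨ col a c k l i ∨ col b c k l i := by unfold Good at g3; tauto
    have dup : ∀ {x y : E → L}, x.Injective → ¬ col x y i j k → ¬ (col x y i l j ∧ col x y j l k) ∧ ¬ (col x y j l k ∧ col x y k l i) ∧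
        ¬ (col x y k l i ∧ col x y i l j) := by
      intro x y hx hn
      refine ⟨fun h => hn ?_, fun h => hn ?_, fun h => hn ?_⟩
      · exact (h.1.sw.rot.ext h.2 (hx.ne hj.symm)).sw.rot.rot
      · exact (h.1.sw.rot.ext h.2 (hx.ne hk.symm)).sw.rot
      · exact (h.1.sw.rot.ext h.2 (hx.ne hi.symm)).sw
    obtain ⟨d1, d2, d3⟩ := dup hv.ia hg.1
    obtain ⟨d4, d5, d6⟩ := dup hv.ia hg.2.1
    obtain ⟨d7, d8, d9⟩ := dup hv.ib hg.2.2
    rcases k1 with k1 | k1 | k1 <;> rcases k2 with k2 | k2 | k2 <;> rcases k3 with k3 | k3 | k3 <;> first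
      | exact (d1 ⟨k1, k2⟩).elim
      | exact (d2 ⟨k2, k3⟩).elim
      | exact (d3 ⟨k3, k1⟩).elim
      | exact (d4 ⟨k1, k2⟩).elim
      | exact (d5 ⟨k2, k3⟩).elim
      | exact (d6 ⟨k3, k1⟩).elim
      | exact (d7 ⟨k1, k2⟩).elim
      | exact (d8 ⟨k2, k3⟩).elim
      | exact (d9 ⟨k3, k1⟩).elim
      | skip
    · exact ⟨j, i, hNj, hNi, hij.symm, hH hg.sw.rot.rot hj hi hk k1.rot k2.rot.sw k3.rot⟩
    · exact ⟨i, j, hNi, hNj, hij, hH hg hi hj hk k1.rot.sw k3.rot k2.rot.sw⟩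
    · exact ⟨j, k, hNj, hNk, hg.rot.ne, hH hg.rot hj hk hi k2.rot.sw k1.rot k3.rot.sw⟩
    · exact ⟨i, k, hNi, hNk, hg.sw.ne, hH hg.sw hi hk hj k3.rot k1.rot.sw k2.rot⟩
    · exact ⟨k, j, hNk, hNj, hg.rot.ne.symm, hH hg.sw.rot hk hj hi k2.rot k3.rot.sw k1.rot⟩
    · exact ⟨k, i, hNk, hNi, hg.rot.rot.ne, hH hg.rot.rot hk hi hj k3.rot.sw k2.rot k1.rot.sw⟩
  have hall : ∀ l, N l ∈ F3 := by
    intro l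
    by_cases hi : l = i
    · rw [hi]; exact Or.inl hNi
    by_cases hj : l = j
    · rw [hj]; exact Or.inl hNj
    by_cases hk : l = k
    · rw [hk]; exact Or.inl hNk
    obtain ⟨m, n, hm, hn, hmn, hr⟩ := hex l hi hj hk
    refine Or.inr ⟨(N m, N n, _), ⟨hm, hn, hr⟩, ?_⟩
    change N m - (a m - a l) / (a m - a n) * (N m - N n) = N l
    have := sub_ne_zero.mpr (hv.ia.ne hmn)
    rw [hN, hN, hN]
    field_simp
    ring
  intro p q r s
  refine ⟨(N p, N q, N r, N s), ⟨hall p, hall q, hall r, hall s⟩, ?_⟩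
  change (N p - N q) / (N r - N s) = _
  have e : ∀ x y, N x - N y = (a x - a y) / (a j - a i) := by intro x y; rw [hN, hN, ← sub_div, sub_sub_sub_cancel_right]
  rw [e, e, div_div_div_cancel_right₀ hd]

lemma exists_galois.{u} (K : Type u) [Field K] [NumberField K] : ∃ (L : Type u) (_ : Field L) (_ : NumberField L), IsGalois ℚ L ∧ Nonempty (K →ₐ[ℚ] L) := by
  have h1 : Algebra.IsAlgebraic ℚ (AlgebraicClosure K) := Algebra.IsAlgebraic.trans ℚ K _
  have h2 : IsAlgClosure ℚ (AlgebraicClosure K) := ⟨inferInstance, h1⟩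
  have h3 : Normal ℚ (AlgebraicClosure K) := IsAlgClosure.normal ℚ _
  have h4 : NumberField (IntermediateField.normalClosure ℚ K (AlgebraicClosure K)) := ⟨⟩
  have h6 := normalClosure.normal ℚ K (AlgebraicClosure K)
  have h7 : Normal ℚ (IntermediateField.normalClosure ℚ K (AlgebraicClosure K)) := by
    convert h6
    exact Subsingleton.elim _ _
  have h5 : IsGalois ℚ (IntermediateField.normalClosure ℚ K (AlgebraicClosure K)) := ⟨⟩
  refine ⟨IntermediateField.normalClosure ℚ K (AlgebraicClosure K), inferInstance, h4, ?_, ⟨?_⟩⟩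
  · exact h5
  · exact (algebraMap K (IntermediateField.normalClosure ℚ K (AlgebraicClosure K))).toRatAlgHom

lemma rat_int {L : Type*} [Field L] [NumberField L] {q : ℚ} (h : IsIntegral ℤ (algebraMap ℚ L q)) : ∃ n : ℤ, q = n := by
  rw [isIntegral_algebraMap_iff (algebraMap ℚ L).injective, IsIntegrallyClosed.isIntegral_iff] at h
  obtain ⟨n, hn⟩ := h
  exact ⟨n, hn.symm⟩

lemma IsU.isIntegral {L : Type*} [Field L] [NumberField L] {x : L} (h : IsU x) : IsIntegral ℤ x := by
  obtain ⟨y, -, rfl⟩ := h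
  exact y.isIntegral_coe

lemma rat_unit {L : Type*} [Field L] [NumberField L] {q : ℚ} (h : IsU (algebraMap ℚ L q)) : q = 1 ∨ q = -1 := by
  obtain ⟨n, hn⟩ := rat_int h.isIntegral
  have h' := h.inv
  rw [← map_inv₀] at h'
  obtain ⟨m, hm⟩ := rat_int h'.isIntegral
  have hq : q ≠ 0 := fun e => h.ne_zero (by rw [e, map_zero])
  have hnm : n * m = 1 := by
    have : (n : ℚ) * m = 1 := by rw [← hn, ← hm, mul_inv_cancel₀ hq]
    exact_mod_cast this
  rcases Int.eq_one_or_neg_one_of_mul_eq_one hnm with h | h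
  · left; rw [hn, h]; norm_num
  · right; rw [hn, h]; norm_num

lemma scale_fin {L : Type*} [Field L] [NumberField L] {x y : L} (hx : x ≠ 0) (hy : y ≠ 0) :
    {q : ℚ | q ≠ 0 ∧ IsIntegral ℤ (algebraMap ℚ L q * x) ∧ IsIntegral ℤ (algebraMap ℚ L q⁻¹ * y)}.Finite := by
  set n := Module.finrank ℚ L with hn
  have hn0 : 0 < n := Module.finrank_pos
  have hX : Algebra.norm ℚ x ≠ 0 := Algebra.norm_ne_zero_iff.mpr hx
  have hY : Algebra.norm ℚ y ≠ 0 := Algebra.norm_ne_zero_iff.mpr hy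
  have key : ∀ q ∈ {q : ℚ | q ≠ 0 ∧ IsIntegral ℤ (algebraMap ℚ L q * x) ∧ IsIntegral ℤ (algebraMap ℚ L q⁻¹ * y)},
      ∃ k m : ℤ, q ^ n * Algebra.norm ℚ x = k ∧ (k : ℚ) * m = Algebra.norm ℚ x * Algebra.norm ℚ y := by
    rintro q ⟨h0, h1, h2⟩
    have h1 := Algebra.isIntegral_norm ℚ h1
    have h2 := Algebra.isIntegral_norm ℚ h2
    rw [map_mul, Algebra.norm_algebraMap] at h1 h2
    obtain ⟨k, hk⟩ := IsIntegrallyClosed.isIntegral_iff.mp h1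
    obtain ⟨m, hm⟩ := IsIntegrallyClosed.isIntegral_iff.mp h2
    simp only [algebraMap_int_eq, eq_intCast] at hk hm
    refine ⟨k, m, hk.symm, ?_⟩
    have : q ^ n ≠ 0 := pow_ne_zero _ h0
    rw [hk, hm, inv_pow]
    field_simp
  rcases Set.eq_empty_or_nonempty {q : ℚ | q ≠ 0 ∧ IsIntegral ℤ (algebraMap ℚ L q * x) ∧ IsIntegral ℤ (algebraMap ℚ L q⁻¹ * y)} with he | ⟨q0, hq0⟩
  · rw [he]; exact Set.finite_empty
  obtain ⟨k0, m0, -, hc⟩ := key q0 hq0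
  have hc0 : k0 * m0 ≠ 0 := by
    intro e
    have : (k0 : ℚ) * m0 = 0 := by exact_mod_cast e
    exact mul_ne_zero hX hY (hc.symm.trans this)
  have hfin : {k : ℤ | k ∣ k0 * m0}.Finite := by
    refine (Set.finite_Icc (-|k0 * m0|) |k0 * m0|).subset fun k hk => ?_
    have h := Int.le_of_dvd (abs_pos.mpr hc0) ((abs_dvd_abs k _).mpr hk)
    exact abs_le.mp h
  refine Set.Finite.subset (hfin.biUnion fun k _ => (Polynomial.nthRoots n ((k : ℚ) / Algebra.norm ℚ x)).toFinset.finite_toSet) ?_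
  intro q hq
  obtain ⟨k, m, h1, h2⟩ := key q hq
  refine Set.mem_biUnion (x := k) ⟨m, ?_⟩ ?_
  · have : (k : ℚ) * m = k0 * m0 := h2.trans hc.symm
    exact_mod_cast this.symm
  · rw [Finset.mem_coe, Multiset.mem_toFinset, Polynomial.mem_nthRoots hn0, eq_div_iff hX, h1]

section
variable {K L : Type*} [Field K] [NumberField K] [Field L] [NumberField L]

/-- vector of conjugates -/
def cj (L : Type*) [Field L] [NumberField L] (α : 𝓞 K) : (K →ₐ[ℚ] L) → L := fun i => i (α : K)

lemma const_rat [IsGalois ℚ L] [Nonempty (K →ₐ[ℚ] L)] (x : K) (h : ∀ i j : K →ₐ[ℚ] L, i x = j x) : ∃ q : ℚ, x = algebraMap ℚ K q := by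
  obtain ⟨i⟩ := ‹Nonempty (K →ₐ[ℚ] L)›
  obtain ⟨q, hq⟩ := (IsGalois.mem_range_algebraMap_iff_fixed (F := ℚ) (i x)).mpr fun f => h ((f : L →ₐ[ℚ] L).comp i) i
  refine ⟨q, i.injective ?_⟩
  exact hq.symm.trans (i.commutes q).symm

lemma lin_rat [IsGalois ℚ L] [Nonempty (K →ₐ[ℚ] L)] (x y : K) (s : L) (i0 j0 : K →ₐ[ℚ] L) (h0 : i0 x ≠ j0 x)
    (h : ∀ i j : K →ₐ[ℚ] L, i y - j y = s * (i x - j x)) : ∃ q r : ℚ, s = algebraMap ℚ L q ∧ y = algebraMap ℚ K q * x + algebraMap ℚ K r := by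
  obtain ⟨q, hq⟩ := (IsGalois.mem_range_algebraMap_iff_fixed (F := ℚ) s).mpr fun f => by
    have h1 := congrArg f (h i0 j0)
    have h2 := h ((f : L →ₐ[ℚ] L).comp i0) ((f : L →ₐ[ℚ] L).comp j0)
    change f (i0 y) - f (j0 y) = s * (f (i0 x) - f (j0 x)) at h2
    rw [map_mul, map_sub, map_sub, h2] at h1
    refine (mul_right_cancel₀ ?_ h1).symm
    exact sub_ne_zero.mpr (f.injective.ne h0)
  obtain ⟨r, hr⟩ := const_rat (L := L) (y - algebraMap ℚ K q * x) fun i j => by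
    simp only [map_sub, map_mul, AlgHom.commutes, hq]
    linear_combination h i j
  exact ⟨q, r, hq.symm, by rw [← hr]; ring⟩

lemma poly_cj {α β : 𝓞 K} (h : β ∈ Subring.closure {α}) : ∃ P : Polynomial (𝓞 L), ∀ i : K →ₐ[ℚ] L,
    RingOfIntegers.mapRingHom (i : K →+* L) β = P.eval (RingOfIntegers.mapRingHom (i : K →+* L) α) := by
  have hle : Subring.closure {α} ≤ (Polynomial.eval₂RingHom (Int.castRingHom (𝓞 K)) α).range := by
    rw [Subring.closure_le, Set.singleton_subset_iff]
    exact ⟨Polynomial.X, by simp⟩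
  obtain ⟨P, rfl⟩ := hle h
  refine ⟨P.map (Int.castRingHom (𝓞 L)), fun i => ?_⟩
  rw [Polynomial.coe_eval₂RingHom, Polynomial.hom_eval₂, Polynomial.eval_map]
  congr 1
  exact RingHom.ext_int _ _

lemma cj_inj {α : 𝓞 K} (ho : IsOrder K (Subring.closure {α})) : (cj L α).Injective := by
  intro i j hij
  have hle : Subring.closure {α} ≤ RingHom.eqLocus ((i : K →+* L).comp (algebraMap (𝓞 K) K)) ((j : K →+* L).comp (algebraMap (𝓞 K) K)) := by
    rw [Subring.closure_le, Set.singleton_subset_iff]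
    exact hij
  ext x
  obtain ⟨a, ha, b, hb, -, rfl⟩ := ho x
  rw [map_div₀, map_div₀]
  congr 1
  · exact hle ha
  · exact hle hb

lemma cj_unit {α β : 𝓞 K} (ho : IsOrder K (Subring.closure {α})) (h : Subring.closure {α} = Subring.closure {β}) (i j : K →ₐ[ℚ] L) (hij : i ≠ j) :
    IsU ((cj L β i - cj L β j) / (cj L α i - cj L α j)) := by
  have hn := sub_ne_zero.mpr ((cj_inj (L := L) ho).ne hij)
  obtain ⟨P, hP⟩ := poly_cj (L := L) (α := α) (β := β) (h ▸ Subring.subset_closure rfl)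
  obtain ⟨Q, hQ⟩ := poly_cj (L := L) (α := β) (β := α) (h ▸ Subring.subset_closure rfl)
  obtain ⟨u, hu⟩ := Polynomial.sub_dvd_eval_sub (RingOfIntegers.mapRingHom (i : K →+* L) α) (RingOfIntegers.mapRingHom (j : K →+* L) α) P
  obtain ⟨v, hv⟩ := Polynomial.sub_dvd_eval_sub (RingOfIntegers.mapRingHom (i : K →+* L) β) (RingOfIntegers.mapRingHom (j : K →+* L) β) Q
  rw [← hP, ← hP] at hu
  rw [← hQ, ← hQ] at hv
  have hu' : cj L β i - cj L β j = (cj L α i - cj L α j) * (u : L) := congrArg (algebraMap (𝓞 L) L) hu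
  have hv' : cj L α i - cj L α j = (cj L β i - cj L β j) * (v : L) := congrArg (algebraMap (𝓞 L) L) hv
  have huv : (u : L) * (v : L) = 1 := by
    refine mul_left_cancel₀ hn ?_
    rw [← mul_assoc, ← hu', ← hv', mul_one]
  refine ⟨u, IsUnit.of_mul_eq_one v (RingOfIntegers.coe_injective huv), ?_⟩
  rw [eq_div_iff hn, hu', mul_comm]

lemma cj_dd {α β : 𝓞 K} (h : Subring.closure {α} = Subring.closure {β}) (i j k : K →ₐ[ℚ] L) :
    ∃ e : 𝓞 L, (cj L β j - cj L β i) * (cj L α k - cj L α i) - (cj L β k - cj L β i) * (cj L α j - cj L α i) =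
      (cj L α j - cj L α i) * (cj L α k - cj L α i) * (cj L α j - cj L α k) * (e : L) := by
  obtain ⟨P, hP⟩ := poly_cj (L := L) (α := α) (β := β) (h ▸ Subring.subset_closure rfl)
  set A := fun i : K →ₐ[ℚ] L => RingOfIntegers.mapRingHom (i : K →+* L) α with hA
  obtain ⟨Q, hQ⟩ := Polynomial.X_sub_C_dvd_sub_C_eval (a := A i) (p := P)
  obtain ⟨e, he⟩ := Polynomial.sub_dvd_eval_sub (A j) (A k) Q
  have h1 : ∀ l : K →ₐ[ℚ] L, RingOfIntegers.mapRingHom (l : K →+* L) β - RingOfIntegers.mapRingHom (i : K →+* L) β = (A l - A i) * Q.eval (A l) := by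
    intro l
    have := congrArg (Polynomial.eval (A l)) hQ
    simpa [hP] using this
  have h2 : ∀ l, cj L β l - cj L β i = (cj L α l - cj L α i) * ((Q.eval (A l) : 𝓞 L) : L) := fun l => congrArg (algebraMap (𝓞 L) L) (h1 l)
  have h3 : ((Q.eval (A j) : 𝓞 L) : L) - ((Q.eval (A k) : 𝓞 L) : L) = (cj L α j - cj L α k) * (e : L) := congrArg (algebraMap (𝓞 L) L) he
  refine ⟨e, ?_⟩
  rw [h2, h2]
  linear_combination (cj L α j - cj L α i) * (cj L α k - cj L α i) * h3

lemma not_col [IsGalois ℚ L] [Nonempty (K →ₐ[ℚ] L)] {α β : 𝓞 K} (ho : IsOrder K (Subring.closure {α}))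
    (h : Subring.closure {α} = Subring.closure {β}) (hne : ¬ ZEquiv K α β) : ∃ i j k, ¬ col (cj L α) (cj L β) i j k := by
  by_contra hc
  push Not at hc
  apply hne
  have main : ∃ u : ℤ, (u = 1 ∨ u = -1) ∧ ∃ r : ℚ, (β : K) = (u : K) * (α : K) + algebraMap ℚ K r := by
    by_cases hs : ∃ i j : K →ₐ[ℚ] L, i ≠ j
    · obtain ⟨i, j, hij⟩ := hs
      have hn := sub_ne_zero.mpr ((cj_inj (L := L) ho).ne hij)
      have h1 : ∀ k, cj L β i - cj L β k = (cj L β i - cj L β j) / (cj L α i - cj L α j) * (cj L α i - cj L α k) := by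
        intro k
        have := hc i j k
        unfold col at this
        field_simp
        linear_combination this
      obtain ⟨q, r, hq, hr⟩ := lin_rat (L := L) (α : K) (β : K) ((cj L β i - cj L β j) / (cj L α i - cj L α j)) i j ((cj_inj (L := L) ho).ne hij)
        (fun p q => by
          change cj L β p - cj L β q = _ * (cj L α p - cj L α q)
          linear_combination h1 q - h1 p)
      have hu := cj_unit (L := L) ho h i j hij
      rw [hq] at hu
      rcases rat_unit hu with rfl | rfl
      · exact ⟨1, Or.inl rfl, r, by rw [hr]; simp⟩
      · exact ⟨-1, Or.inr rfl, r, by rw [hr]; simp⟩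
    · push Not at hs
      obtain ⟨r, hr⟩ := const_rat (L := L) ((β : K) - (α : K)) fun i j => by rw [hs i j]
      exact ⟨1, Or.inl rfl, r, by rw [← hr]; simp⟩
  obtain ⟨u, hu, r, hr⟩ := main
  have hig : IsIntegral ℤ (algebraMap ℚ K r) := by
    have e : algebraMap ℚ K r = ((β - (u : 𝓞 K) * α : 𝓞 K) : K) := by
      change _ = algebraMap (𝓞 K) K (β - (u : 𝓞 K) * α)
      rw [map_sub, map_mul, map_intCast]
      linear_combination -hr
    rw [e]; exact RingOfIntegers.isIntegral_coe _
  obtain ⟨n, rfl⟩ := rat_int hig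
  refine ⟨u, n, hu, RingOfIntegers.coe_injective ?_⟩
  change (β : K) = algebraMap (𝓞 K) K ((u : 𝓞 K) * α + (n : 𝓞 K))
  rw [map_add, map_mul, map_intCast, map_intCast, hr, map_intCast]
end

section
variable {K L : Type*} [Field K] [NumberField K] [Field L] [NumberField L]

/-- the facts used about two generators of one order -/
structure Pr (L : Type*) [Field L] [NumberField L] (α β : 𝓞 K) : Prop where
  ho : IsOrder K (Subring.closure {α})
  h : Subring.closure {α} = Subring.closure {β}
  nc : ∃ i j k, ¬ col (cj L α) (cj L β) i j k

lemma shape_lin [IsGalois ℚ L] [Nonempty (K →ₐ[ℚ] L)] {α α' : 𝓞 K} {i j : K →ₐ[ℚ] L} (h1 : cj L α i - cj L α j ≠ 0) (h2 : cj L α' i - cj L α' j ≠ 0)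
    (hs : ∀ p q r s, (cj L α p - cj L α q) / (cj L α r - cj L α s) = (cj L α' p - cj L α' q) / (cj L α' r - cj L α' s)) :
    ∃ q r : ℚ, q ≠ 0 ∧ (α' : K) = algebraMap ℚ K q * (α : K) + algebraMap ℚ K r := by
  obtain ⟨q, r, h3, h4⟩ := lin_rat (L := L) (α : K) (α' : K) ((cj L α' i - cj L α' j) / (cj L α i - cj L α j)) i j (sub_ne_zero.mp h1) fun p q => by
    have := hs p q i j
    change cj L α' p - cj L α' q = _ * (cj L α p - cj L α q)
    field_simp at this ⊢
    linear_combination -this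
  refine ⟨q, r, ?_, h4⟩
  rintro rfl
  rw [map_zero] at h3
  exact div_ne_zero h2 h1 h3

lemma cj_lin {α α' : 𝓞 K} {q r : ℚ} (h : (α' : K) = algebraMap ℚ K q * (α : K) + algebraMap ℚ K r) (i : K →ₐ[ℚ] L) :
    cj L α' i = algebraMap ℚ L q * cj L α i + algebraMap ℚ L r := by
  unfold cj
  rw [h, map_add, map_mul, AlgHom.commutes, AlgHom.commutes]

lemma closure_eq_of_lin {α α' : 𝓞 K} {r : ℚ} (h : (α' : K) = (α : K) + algebraMap ℚ K r) : Subring.closure {α'} = Subring.closure {α} := by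
  have hig : IsIntegral ℤ (algebraMap ℚ K r) := by
    have e : algebraMap ℚ K r = ((α' - α : 𝓞 K) : K) := by
      change _ = algebraMap (𝓞 K) K (α' - α)
      rw [map_sub]
      linear_combination -h
    rw [e]; exact RingOfIntegers.isIntegral_coe _
  obtain ⟨n, rfl⟩ := rat_int hig
  have e : α' = α + (n : 𝓞 K) := RingOfIntegers.coe_injective (by
    change (α' : K) = algebraMap (𝓞 K) K (α + (n : 𝓞 K))
    rw [map_add, map_intCast, h, map_intCast])
  apply le_antisymm
  · rw [Subring.closure_le, Set.singleton_subset_iff, e]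
    exact add_mem (Subring.subset_closure rfl) (intCast_mem _ n)
  · rw [Subring.closure_le, Set.singleton_subset_iff, eq_sub_of_add_eq e.symm]
    exact sub_mem (Subring.subset_closure rfl) (intCast_mem _ n)

lemma dd_alg {F : Type*} [Field F] {q m xi xj xk yi yj yk r t e e0 : F} (hq : q ≠ 0) (hm : m = q ∨ m = -q)
    (h0 : (yj - yi) * (xk - xi) - (yk - yi) * (xj - xi) = (xj - xi) * (xk - xi) * (xj - xk) * e0)
    (hx : (xj - xi) * (xk - xi) * (xj - xk) ≠ 0)
    (h : ((m * yj + t) - (m * yi + t)) * ((q * xk + r) - (q * xi + r)) - ((m * yk + t) - (m * yi + t)) * ((q * xj + r) - (q * xi + r)) =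
      ((q * xj + r) - (q * xi + r)) * ((q * xk + r) - (q * xi + r)) * ((q * xj + r) - (q * xk + r)) * e) :
    q⁻¹ * e0 = e ∨ q⁻¹ * e0 = -e := by
  have h1 : m * q * e0 = q ^ 3 * e := by
    refine mul_left_cancel₀ hx ?_
    linear_combination h - m * q * h0
  rcases hm with rfl | rfl
  · left
    rw [inv_mul_eq_iff_eq_mul₀ hq]
    refine mul_left_cancel₀ (pow_ne_zero 2 hq) ?_
    linear_combination h1
  · right
    rw [inv_mul_eq_iff_eq_mul₀ hq]
    refine mul_left_cancel₀ (pow_ne_zero 2 hq) ?_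
    linear_combination -h1

lemma fibre_fin [IsGalois ℚ L] [Nonempty (K →ₐ[ℚ] L)] {α β : 𝓞 K} (h0 : Pr L α β) (S : Set (Subring (𝓞 K)))
    (hS : ∀ O ∈ S, ∃ α' β' : 𝓞 K, Subring.closure {α'} = O ∧ Pr L α' β' ∧
      (∀ p q r s, (cj L α p - cj L α q) / (cj L α r - cj L α s) = (cj L α' p - cj L α' q) / (cj L α' r - cj L α' s)) ∧
      (∀ p q r s, (cj L β p - cj L β q) / (cj L β r - cj L β s) = (cj L β' p - cj L β' q) / (cj L β' r - cj L β' s))) : S.Finite := by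
  obtain ⟨i, j, k, hn⟩ := h0.nc
  have hij : i ≠ j := by rintro rfl; exact hn (col_self _ _ _ _)
  have hik : i ≠ k := by rintro rfl; exact hn (col_self _ _ _ _).sw
  have hjk : j ≠ k := by rintro rfl; exact hn (col_self _ _ _ _).rot.rot
  have ia := cj_inj (L := L) h0.ho
  have n := fun {p q : K →ₐ[ℚ] L} (h : p ≠ q) => sub_ne_zero.mpr (ia.ne h)
  have ib := cj_inj (L := L) (h0.h ▸ h0.ho)
  obtain ⟨e0, he0⟩ := cj_dd (L := L) h0.h i j k
  have he00 : (e0 : L) ≠ 0 := by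
    intro e
    rw [e, mul_zero] at he0
    exact hn (by unfold col; linear_combination -he0)
  have key : ∀ O ∈ S, ∃ q r : ℚ, ∃ α' : 𝓞 K, Subring.closure {α'} = O ∧ (α' : K) = algebraMap ℚ K q * (α : K) + algebraMap ℚ K r ∧
      q ≠ 0 ∧ IsIntegral ℤ (algebraMap ℚ L q * (cj L α i - cj L α j)) ∧ IsIntegral ℤ (algebraMap ℚ L q⁻¹ * (e0 : L)) := by
    intro O hO
    obtain ⟨α', β', rfl, h1, ha, hb⟩ := hS O hO
    have ia' := cj_inj (L := L) h1.ho
    have ib' := cj_inj (L := L) (h1.h ▸ h1.ho)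
    obtain ⟨q, r, hq, hqr⟩ := shape_lin (n hij) (sub_ne_zero.mpr (ia'.ne hij)) ha
    obtain ⟨m, t, hm, hmt⟩ := shape_lin (sub_ne_zero.mpr (ib.ne hij)) (sub_ne_zero.mpr (ib'.ne hij)) hb
    have hqL : algebraMap ℚ L q ≠ 0 := (map_ne_zero _).mpr hq
    have hmL : algebraMap ℚ L m ≠ 0 := (map_ne_zero _).mpr hm
    have hA := cj_lin (L := L) hqr
    have hB := cj_lin (L := L) hmt
    refine ⟨q, r, α', rfl, hqr, hq, ?_, ?_⟩
    · have e : algebraMap ℚ L q * (cj L α i - cj L α j) =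
          ((RingOfIntegers.mapRingHom (i : K →+* L) α' - RingOfIntegers.mapRingHom (j : K →+* L) α' : 𝓞 L) : L) := by
        change _ = cj L α' i - cj L α' j
        rw [hA, hA]; ring
      rw [e]; exact RingOfIntegers.isIntegral_coe _
    · have hu := (cj_unit (L := L) h1.ho h1.h i j hij).div (cj_unit (L := L) h0.ho h0.h i j hij)
      have e : (cj L β' i - cj L β' j) / (cj L α' i - cj L α' j) / ((cj L β i - cj L β j) / (cj L α i - cj L α j)) = algebraMap ℚ L (m / q) := by
        rw [hA, hA, hB, hB, add_sub_add_right_eq_sub, add_sub_add_right_eq_sub, ← mul_sub, ← mul_sub, map_div₀]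
        have := n hij
        have := sub_ne_zero.mpr (ib.ne hij)
        field_simp
      rw [e] at hu
      have hmq : algebraMap ℚ L m = algebraMap ℚ L q ∨ algebraMap ℚ L m = -algebraMap ℚ L q := by
        rw [← map_neg]
        rcases rat_unit hu with h | h <;> rw [div_eq_iff hq] at h
        · left; rw [h, one_mul]
        · right; rw [h, neg_one_mul]
      obtain ⟨e', he'⟩ := cj_dd (L := L) h1.h i j k
      rw [hA, hA, hA, hB, hB, hB] at he'
      rw [map_inv₀]
      rcases dd_alg hqL hmq he0 (mul_ne_zero (mul_ne_zero (n hij.symm) (n hik.symm)) (n hjk)) he' with h | h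
      · rw [h]; exact RingOfIntegers.isIntegral_coe _
      · rw [h]; exact (RingOfIntegers.isIntegral_coe _).neg
  choose! g r A hcl hlin hg using key
  refine Set.Finite.of_finite_image (f := g) ((scale_fin (n hij) he00).subset ?_) ?_
  · rintro _ ⟨O, hO, rfl⟩
    exact hg O hO
  · intro O hO O' hO' e
    rw [← hcl O hO, ← hcl O' hO']
    refine closure_eq_of_lin (r := r O - r O') ?_
    rw [hlin O hO, hlin O' hO', e, map_sub]
    ring

lemma final [IsGalois ℚ L] [Nonempty (K →ₐ[ℚ] L)] : {O : Subring (𝓞 K) | IsOrder K O ∧ TimesMonogenic K 3 O}.Finite := by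
  obtain ⟨F, hF, hsh⟩ := shape_fin (K →ₐ[ℚ] L) L
  have key : ∀ O ∈ {O : Subring (𝓞 K) | IsOrder K O ∧ TimesMonogenic K 3 O}, ∃ α β : 𝓞 K, Subring.closure {α} = O ∧ Pr L α β ∧
      (∀ p q r s, (cj L α p - cj L α q) / (cj L α r - cj L α s) ∈ F) ∧ (∀ p q r s, (cj L β p - cj L β q) / (cj L β r - cj L β s) ∈ F) := by
    rintro O ⟨ho, f, hne, hcl⟩
    have e : ∀ i j, Subring.closure {f i} = Subring.closure {f j} := fun i j => (hcl i).trans (hcl j).symm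
    have ho' : ∀ i, IsOrder K (Subring.closure {f i}) := fun i => by rw [hcl]; exact ho
    have nc : ∀ i j, i ≠ j → ∃ p q r, ¬ col (cj L (f i)) (cj L (f j)) p q r := fun i j h => not_col (ho' i) (e i j) (hne i j h)
    have hv : Val (cj L (f 0)) (cj L (f 1)) (cj L (f 2)) := ⟨cj_inj (ho' 0), cj_inj (ho' 1), cj_inj (ho' 2), cj_unit (ho' 0) (e 0 1), cj_unit (ho' 0) (e 0 2)⟩
    exact ⟨f 0, f 1, hcl 0, ⟨ho' 0, e 0 1, nc 0 1 (by decide)⟩,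
      hsh _ _ _ hv (nc 0 1 (by decide)) (nc 0 2 (by decide)) (nc 1 2 (by decide)),
      hsh _ _ _ hv.swap (nc 1 0 (by decide)) (nc 1 2 (by decide)) (nc 0 2 (by decide))⟩
  choose! α β hcl hPr ha hb using key
  refine Set.Finite.of_finite_fibers (fun O (x : Bool × (K →ₐ[ℚ] L) × (K →ₐ[ℚ] L) × (K →ₐ[ℚ] L) × (K →ₐ[ℚ] L)) =>
    (cj L (if x.1 then α O else β O) x.2.1 - cj L (if x.1 then α O else β O) x.2.2.1) /
      (cj L (if x.1 then α O else β O) x.2.2.2.1 - cj L (if x.1 then α O else β O) x.2.2.2.2)) ?_ ?_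
  · refine (Set.Finite.pi' (t := fun _ => F) fun _ => hF).subset ?_
    rintro _ ⟨O, hO, rfl⟩ ⟨b, p, q, r, s⟩
    cases b
    · exact hb O hO p q r s
    · exact ha O hO p q r s
  · rintro _ ⟨O, hO, rfl⟩
    refine fibre_fin (hPr O hO) _ fun O' hO' => ⟨α O', β O', hcl O' hO'.1, hPr O' hO'.1, fun p q r s => ?_, fun p q r s => ?_⟩
    · exact (congrFun hO'.2 (true, p, q, r, s)).symm
    · exact (congrFun hO'.2 (false, p, q, r, s)).symm
end
end TM

/-- Let `K` be a number field of degree at least 3. Then there are at most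
finitely many three times monogenic orders in `K`. -/
theorem three_times_monogenic_orders_finite (K : Type*) [Field K] [NumberField K]
    (hd : 3 ≤ Module.finrank ℚ K) :
    {O : Subring (𝓞 K) | IsOrder K O ∧ TimesMonogenic K 3 O}.Finite := by
  obtain ⟨L, _, _, _, _⟩ := TM.exists_galois K
  exact TM.final (L := L)
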